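/- Let m,n be positive integers and d = m+n. For every h ∈ [m+n−1, m+n], there exists a sequence (ν_k)_{k≥1} of a-invariant Borel probability measures on X_d = SL_d(ℝ)/SL_d(ℤ) with lim_{k→∞} h_{ν_k}(a) = h such that the sequence (ν_k) converges in the weak* topology to a measure ν with ν(X_d) = h − (m+n−1). -/

import Mathlib

open MeasureTheory Matrix ENNReal Filter Topology

noncomputable section

/-- The supremum norm of a matrix (the maximum of the absolute values of its entries),
obtained from the sup norm on the corresponding function space. -/
def supNorm {p q : ℕ} (M : Matrix (Fin p) (Fin q) ℝ) : ℝ := ‖(Matrix.of.symm M)‖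

/-- The diagonal element `a_t = diag(e^{t/m} I_m, e^{-t/n} I_n)`. -/
def aMat (m n : ℕ) (t : ℝ) : Matrix (Fin (m + n)) (Fin (m + n)) ℝ :=
  Matrix.reindex finSumFinEquiv finSumFinEquiv
    (Matrix.fromBlocks (Real.exp (t / m) • (1 : Matrix (Fin m) (Fin m) ℝ)) 0 0
      (Real.exp (-(t / n)) • (1 : Matrix (Fin n) (Fin n) ℝ)))

/-- The unipotent element `u_A` with upper-right block `A`. -/
def uMat (m n : ℕ) (A : Fin m → Fin n → ℝ) : Matrix (Fin (m + n)) (Fin (m + n)) ℝ :=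
  Matrix.reindex finSumFinEquiv finSumFinEquiv
    (Matrix.fromBlocks 1 (Matrix.of A) 0 1)

lemma uMat_det (m n : ℕ) (A : Fin m → Fin n → ℝ) : (uMat m n A).det = 1 := by
  simp [uMat, Matrix.det_fromBlocks_zero₂₁]

lemma aMat_det (m n : ℕ) (hm : 0 < m) (hn : 0 < n) (t : ℝ) : (aMat m n t).det = 1 := by
  have hm' : (m : ℝ) ≠ 0 := Nat.cast_ne_zero.mpr hm.ne'
  have hn' : (n : ℝ) ≠ 0 := Nat.cast_ne_zero.mpr hn.ne'
  simp only [aMat, Matrix.det_reindex_self, Matrix.det_fromBlocks_zero₂₁,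
    Matrix.det_smul, Matrix.det_one, Fintype.card_fin, mul_one]
  rw [← Real.exp_nat_mul, ← Real.exp_nat_mul, ← Real.exp_add]
  rw [mul_div_cancel₀ _ hm']
  rw [show (n : ℝ) * -(t / n) = -t by field_simp [mul_comm]]
  simp

/-- `a_t` as an element of `SL_{m+n}(ℝ)`. -/
def aSL (m n : ℕ) (hm : 0 < m) (hn : 0 < n) (t : ℝ) :
    Matrix.SpecialLinearGroup (Fin (m + n)) ℝ :=
  ⟨aMat m n t, aMat_det m n hm hn t⟩

/-- `u_A` as an element of `SL_{m+n}(ℝ)`. -/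
def uSL (m n : ℕ) (A : Fin m → Fin n → ℝ) : Matrix.SpecialLinearGroup (Fin (m + n)) ℝ :=
  ⟨uMat m n A, uMat_det m n A⟩

instance SLtop (d : ℕ) : TopologicalSpace (Matrix.SpecialLinearGroup (Fin d) ℝ) :=
  instTopologicalSpaceSubtype

/-- `SL_d(ℤ)` viewed as a subgroup of `SL_d(ℝ)`. -/
def Gamma (d : ℕ) : Subgroup (Matrix.SpecialLinearGroup (Fin d) ℝ) :=
  (Matrix.SpecialLinearGroup.map (n := Fin d) (Int.castRingHom ℝ)).range

/-- The space of unimodular lattices `X_d = SL_d(ℝ)/SL_d(ℤ)`. -/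
abbrev XSp (d : ℕ) := Matrix.SpecialLinearGroup (Fin d) ℝ ⧸ Gamma d

instance (d : ℕ) : MeasurableSpace (XSp d) := borel _

/-- The first successive minimum `λ₁` of the lattice `g ℤ^d` (with respect to the sup norm):
the infimum of all `r` such that the lattice contains a nonzero vector of norm at most `r`. -/
def lam1M (d : ℕ) (g : Matrix (Fin d) (Fin d) ℝ) : ℝ :=
  sInf {r : ℝ | ∃ v : Fin d → ℤ, v ≠ 0 ∧ ‖g.mulVec (fun i => (v i : ℝ))‖ ≤ r}

/-- The first successive minimum `λ₁` of a unimodular lattice `x ∈ X_d`. -/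
def lam1X (d : ℕ) (x : XSp d) : ℝ :=
  sInf {r : ℝ | ∃ g : Matrix.SpecialLinearGroup (Fin d) ℝ,
    (QuotientGroup.mk g : XSp d) = x ∧
    ∃ v : Fin d → ℤ, v ≠ 0 ∧
      ‖(g : Matrix (Fin d) (Fin d) ℝ).mulVec (fun i => (v i : ℝ))‖ ≤ r}

/-- The lattice `g ℤ^d` as a subset of `ℝ^d`. -/
def latticeSet (d : ℕ) (g : Matrix (Fin d) (Fin d) ℝ) : Set (Fin d → ℝ) :=
  Set.range fun v : Fin d → ℤ => g.mulVec (fun i => (v i : ℝ))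

/-- Shannon entropy of a finite indexed partition with respect to a measure. -/
def partEnt {α : Type*} [MeasurableSpace α] (μ : Measure α) {ι : Type*} [Fintype ι]
    (P : ι → Set α) : ℝ :=
  ∑ i, Real.negMulLog (μ (P i)).toReal

/-- The join `⋁_{j<N} T^{-j} P` of a finite partition, indexed by itineraries. -/
def joinPart {α : Type*} (T : α → α) {k : ℕ} (P : Fin k → Set α) (N : ℕ) :
    (Fin N → Fin k) → Set α :=
  fun ω => ⋂ j : Fin N, T^[(j : ℕ)] ⁻¹' P (ω j)

/-- A finite measurable partition of the space. -/
def IsFinPart {α : Type*} [MeasurableSpace α] {k : ℕ} (P : Fin k → Set α) : Prop :=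
  (∀ i, MeasurableSet (P i)) ∧ Pairwise (Function.onFun Disjoint P) ∧ (⋃ i, P i) = Set.univ

/-- Kolmogorov–Sinai (measure-theoretic) entropy of a transformation `T` with respect to `μ`:
the supremum over finite measurable partitions `P` of `inf_N H_μ(⋁_{j<N} T^{-j}P)/N`. -/
def ksEntropy {α : Type*} [MeasurableSpace α] (T : α → α) (μ : Measure α) : ℝ :=
  ⨆ (k : ℕ) (P : Fin k → Set α) (_ : IsFinPart P),
    ⨅ N : ℕ, partEnt μ (joinPart T P (N + 1)) / (N + 1)

/-- The time-one map `x ↦ a x` on the space of lattices `X_{m+n}`. -/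
def aAct (m n : ℕ) (hm : 0 < m) (hn : 0 < n) : XSp (m + n) → XSp (m + n) :=
  fun x => aSL m n hm hn 1 • x

/-- The (topological) support of a measure: points all of whose open neighborhoods have
positive measure. -/
def μsupport {α : Type*} [TopologicalSpace α] [MeasurableSpace α] (μ : Measure α) : Set α :=
  {x | ∀ U : Set α, IsOpen U → x ∈ U → 0 < μ U}

section PartEnt

/-! ## Part Ent: Shannon entropy of finite-valued maps -/

/-- Gibbs inequality. -/
lemma gibbs_ineq {ι : Type*} (s : Finset ι) (p q : ι → ℝ) (hp : ∀ i ∈ s, 0 ≤ p i)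
    (hq : ∀ i ∈ s, 0 ≤ q i) (hpq : ∀ i ∈ s, q i = 0 → p i = 0)
    (hsum : ∑ i ∈ s, q i ≤ ∑ i ∈ s, p i) :
    ∑ i ∈ s, Real.negMulLog (p i) ≤ ∑ i ∈ s, p i * (- Real.log (q i)) := by
  have key : ∀ i ∈ s, Real.negMulLog (p i) ≤ p i * (- Real.log (q i)) + (q i - p i) := by
    intro i hi
    rcases (hp i hi).eq_or_lt with h0 | hpos
    · rw [← h0]; simp [hq i hi]
    · have hqpos : 0 < q i := lt_of_le_of_ne (hq i hi) (fun h => hpos.ne' (hpq i hi h.symm))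
      have h1 : Real.log (q i / p i) ≤ q i / p i - 1 := Real.log_le_sub_one_of_pos (by positivity)
      rw [Real.log_div hqpos.ne' hpos.ne'] at h1
      have h2 : p i * (Real.log (q i) - Real.log (p i)) ≤ p i * (q i / p i - 1) :=
        mul_le_mul_of_nonneg_left h1 hpos.le
      have h3 : p i * (q i / p i - 1) = q i - p i := by field_simp
      rw [Real.negMulLog]; nlinarith
  calc _ ≤ ∑ i ∈ s, (p i * (- Real.log (q i)) + (q i - p i)) := Finset.sum_le_sum key
    _ = ∑ i ∈ s, p i * (- Real.log (q i)) + (∑ i ∈ s, q i - ∑ i ∈ s, p i) := by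
      rw [Finset.sum_add_distrib, Finset.sum_sub_distrib]
    _ ≤ _ := by linarith

variable {α : Type*} [MeasurableSpace α]

/-- Shannon entropy of a finite-valued map. -/
def Hent (μ : Measure α) {ι : Type*} [Fintype ι] (f : α → ι) : ℝ :=
  ∑ i, Real.negMulLog (μ.real (f ⁻¹' {i}))

def FibM {ι : Type*} (f : α → ι) : Prop := ∀ i, MeasurableSet (f ⁻¹' {i})

lemma FibM.preimage {ι : Type*} [Finite ι] {f : α → ι} (hf : FibM f) (s : Set ι) :
    MeasurableSet (f ⁻¹' s) := by
  have : f ⁻¹' s = ⋃ i ∈ s, f ⁻¹' {i} := by ext x; simp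
  rw [this]
  exact MeasurableSet.biUnion (Set.to_countable s) (fun i _ => hf i)

lemma FibM.comp {ι κ : Type*} [Finite ι] {f : α → ι} (hf : FibM f) (φ : ι → κ) :
    FibM (fun x => φ (f x)) := fun j => by
  have := hf.preimage (φ ⁻¹' {j})
  exact this

lemma FibM.prodMk {ι κ : Type*} {f : α → ι} {g : α → κ} (hf : FibM f) (hg : FibM g) :
    FibM (fun x => (f x, g x)) := fun j => by
  have : (fun x => (f x, g x)) ⁻¹' {j} = f ⁻¹' {j.1} ∩ g ⁻¹' {j.2} := by
    ext x; simp [Prod.ext_iff]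
  rw [this]; exact (hf _).inter (hg _)

lemma sum_real_fib (μ : Measure α) [IsFiniteMeasure μ] {ι : Type*} [Fintype ι] {f : α → ι}
    (hf : FibM f) (s : Set α) (hs : MeasurableSet s) :
    ∑ i, μ.real (f ⁻¹' {i} ∩ s) = μ.real s := by
  classical
  rw [← measureReal_biUnion_finset]
  · congr 1; ext x; simp
  · intro i _ j _ hij
    apply Set.disjoint_left.2
    rintro x ⟨hx, _⟩ ⟨hy, _⟩
    exact hij (hx.symm.trans hy)
  · intro i _; exact (hf i).inter hs

lemma sum_real_fib_univ (μ : Measure α) [IsProbabilityMeasure μ] {ι : Type*} [Fintype ι] {f : α → ι}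
    (hf : FibM f) : ∑ i, μ.real (f ⁻¹' {i}) = 1 := by
  have := sum_real_fib μ hf Set.univ MeasurableSet.univ
  simpa using this

lemma Hent_nonneg (μ : Measure α) [IsProbabilityMeasure μ] {ι : Type*} [Fintype ι] (f : α → ι) :
    0 ≤ Hent μ f :=
  Finset.sum_nonneg fun _ _ => Real.negMulLog_nonneg measureReal_nonneg measureReal_le_one

/-- Gibbs for maps. -/
lemma Hent_le_gibbs (μ : Measure α) [IsProbabilityMeasure μ] {ι : Type*} [Fintype ι] {f : α → ι}
    (hf : FibM f) (q : ι → ℝ) (hq : ∀ i, 0 ≤ q i)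
    (hpq : ∀ i, q i = 0 → μ.real (f ⁻¹' {i}) = 0) (hs : ∑ i, q i ≤ 1) :
    Hent μ f ≤ ∑ i, μ.real (f ⁻¹' {i}) * (- Real.log (q i)) := by
  apply gibbs_ineq _ _ _ (fun _ _ => measureReal_nonneg) (fun i _ => hq i) (fun i _ => hpq i)
  rw [sum_real_fib_univ μ hf]; exact hs

/-- counting bound. -/
lemma Hent_le_count (μ : Measure α) [IsProbabilityMeasure μ] {ι : Type*} [Fintype ι] {f : α → ι}
    (hf : FibM f) (Y : Set α) (S : Finset ι) (hS : S.Nonempty) (hYS : ∀ x ∈ Y, f x ∈ S) :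
    Hent μ f ≤ Real.log 2 + Real.log S.card + μ.real Yᶜ * Real.log (Fintype.card ι) := by
  classical
  obtain ⟨i0, hi0⟩ := hS
  have hcS : (0:ℝ) < S.card := by exact_mod_cast Finset.card_pos.2 ⟨i0, hi0⟩
  have hcι : (0:ℝ) < Fintype.card ι := by exact_mod_cast Fintype.card_pos_iff.2 ⟨i0⟩
  have hcι1 : (1:ℝ) ≤ Fintype.card ι := by exact_mod_cast Fintype.card_pos_iff.2 ⟨i0⟩
  have hcS1 : (1:ℝ) ≤ S.card := by exact_mod_cast Finset.card_pos.2 ⟨i0, hi0⟩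
  set q : ι → ℝ := fun i => (if i ∈ S then (2 * S.card : ℝ)⁻¹ else 0) + (2 * Fintype.card ι : ℝ)⁻¹
    with hqdef
  have hqpos : ∀ i, 0 < q i := by
    intro i; simp only [hqdef]; split_ifs <;> positivity
  have hsum : ∑ i, q i ≤ 1 := by
    simp only [hqdef, Finset.sum_add_distrib, Finset.sum_ite_mem, Finset.univ_inter,
      Finset.sum_const, nsmul_eq_mul, Finset.card_univ]
    apply le_of_eq; field_simp; norm_num
  refine (Hent_le_gibbs μ hf q (fun i => (hqpos i).le) (fun i h => absurd h (hqpos i).ne') hsum).trans ?_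
  have hb : ∀ i, μ.real (f ⁻¹' {i}) * (- Real.log (q i)) ≤
      μ.real (f ⁻¹' {i}) * (Real.log 2 + Real.log S.card) +
        (if i ∈ S then 0 else μ.real (f ⁻¹' {i})) * Real.log (Fintype.card ι) := by
    intro i
    have hl : 0 ≤ Real.log S.card := Real.log_nonneg hcS1
    by_cases hi : i ∈ S
    · simp only [hi, if_true, zero_mul, add_zero]
      apply mul_le_mul_of_nonneg_left _ measureReal_nonneg
      rw [← Real.log_mul (by norm_num) hcS.ne', ← Real.log_inv]
      apply Real.log_le_log (inv_pos.2 (hqpos i))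
      rw [inv_le_comm₀ (hqpos i) (by positivity)]
      simp only [hqdef, hi, if_true]
      have : (0:ℝ) ≤ (2 * Fintype.card ι : ℝ)⁻¹ := by positivity
      linarith
    · simp only [hi, if_false]
      have : - Real.log (q i) ≤ Real.log 2 + Real.log (Fintype.card ι) := by
        rw [← Real.log_mul (by norm_num) hcι.ne', ← Real.log_inv]
        apply Real.log_le_log (inv_pos.2 (hqpos i))
        rw [inv_le_comm₀ (hqpos i) (by positivity)]
        simp [hqdef, hi]
      have h0 : 0 ≤ μ.real (f ⁻¹' {i}) := measureReal_nonneg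
      nlinarith [mul_nonneg h0 hl, mul_le_mul_of_nonneg_left this h0]
  refine (Finset.sum_le_sum fun i _ => hb i).trans ?_
  rw [Finset.sum_add_distrib, ← Finset.sum_mul, ← Finset.sum_mul, sum_real_fib_univ μ hf, one_mul]
  have h3 : ∑ i, (if i ∈ S then 0 else μ.real (f ⁻¹' {i})) ≤ μ.real Yᶜ := by
    have h4 : ∑ i, (if i ∈ S then 0 else μ.real (f ⁻¹' {i})) = μ.real (f ⁻¹' (S : Set ι)ᶜ) := by
      rw [← sum_real_fib μ hf _ (hf.preimage _)]
      apply Finset.sum_congr rfl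
      intro i _
      by_cases hi : i ∈ S
      · simp only [hi, if_true]
        have : f ⁻¹' {i} ∩ f ⁻¹' (S : Set ι)ᶜ = ∅ := by
          ext x; simp only [Set.mem_inter_iff, Set.mem_preimage, Set.mem_singleton_iff,
            Set.mem_compl_iff, Finset.mem_coe, Set.mem_empty_iff_false, iff_false, not_and, not_not]
          rintro rfl; exact hi
        rw [this]; simp
      · simp only [hi, if_false]
        congr 1
        ext x; simp only [Set.mem_inter_iff, Set.mem_preimage, Set.mem_singleton_iff,
            Set.mem_compl_iff, Finset.mem_coe]
        exact ⟨fun h => ⟨h, h ▸ hi⟩, fun h => h.1⟩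
    rw [h4]
    refine measureReal_mono ?_ (measure_ne_top _ _)
    intro x hx hxY
    exact hx (hYS x hxY)
  have := mul_le_mul_of_nonneg_right h3 (Real.log_nonneg hcι1)
  linarith

lemma Hent_le_log_card (μ : Measure α) [IsProbabilityMeasure μ] {ι : Type*} [Fintype ι] [Nonempty ι]
    {f : α → ι} (hf : FibM f) : Hent μ f ≤ Real.log (Fintype.card ι) := by
  have hcι : (0:ℝ) < Fintype.card ι := by exact_mod_cast Fintype.card_pos
  refine (Hent_le_gibbs μ hf (fun _ => (Fintype.card ι : ℝ)⁻¹) (fun i => by positivity)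
    (fun i h => absurd h (by positivity)) ?_).trans ?_
  · simp [Finset.card_univ, hcι.ne']
  · rw [← Finset.sum_mul, sum_real_fib_univ μ hf]; simp

/-- data processing. -/
lemma Hent_comp_le (μ : Measure α) [IsProbabilityMeasure μ] {ι κ : Type*} [Fintype ι] [Fintype κ]
    {f : α → ι} (hf : FibM f) (φ : ι → κ) : Hent μ (fun x => φ (f x)) ≤ Hent μ f := by
  classical
  have hq : ∀ j, μ.real ((fun x => φ (f x)) ⁻¹' {j}) = ∑ i ∈ Finset.univ.filter (fun i => φ i = j), μ.real (f ⁻¹' {i}) := by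
    intro j
    rw [← sum_real_fib μ hf _ ((hf.comp φ) j), Finset.sum_filter]
    apply Finset.sum_congr rfl
    intro i _
    split_ifs with h
    · congr 1; ext x; simp only [Set.mem_inter_iff, Set.mem_preimage, Set.mem_singleton_iff]
      exact ⟨fun h => h.1, fun h' => ⟨h', by rw [h', h]⟩⟩
    · have : f ⁻¹' {i} ∩ (fun x => φ (f x)) ⁻¹' {j} = ∅ := by
        ext x; simp only [Set.mem_inter_iff, Set.mem_preimage, Set.mem_singleton_iff,
          Set.mem_empty_iff_false, iff_false, not_and]
        rintro rfl; exact h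
      rw [this]; simp
  unfold Hent
  have h1 : ∀ j, Real.negMulLog (μ.real ((fun x => φ (f x)) ⁻¹' {j})) ≤
      ∑ i ∈ Finset.univ.filter (fun i => φ i = j), Real.negMulLog (μ.real (f ⁻¹' {i})) := by
    intro j
    rw [Real.negMulLog, neg_mul, ← mul_neg]
    nth_rewrite 1 [hq j]
    rw [Finset.sum_mul]
    apply Finset.sum_le_sum
    intro i hi
    rcases (measureReal_nonneg : 0 ≤ μ.real (f ⁻¹' {i})).eq_or_lt with h0 | hpos
    · rw [← h0]; simp
    · rw [Real.negMulLog, neg_mul, ← mul_neg]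
      apply mul_le_mul_of_nonneg_left _ hpos.le
      apply neg_le_neg
      apply Real.log_le_log hpos
      rw [hq j]
      exact Finset.single_le_sum (f := fun i => μ.real (f ⁻¹' {i})) (fun _ _ => measureReal_nonneg) hi
  refine (Finset.sum_le_sum fun j _ => h1 j).trans (le_of_eq ?_)
  exact Finset.sum_fiberwise Finset.univ φ _

/-- subadditivity. -/
lemma Hent_prod_le (μ : Measure α) [IsProbabilityMeasure μ] {ι κ : Type*} [Fintype ι] [Fintype κ]
    {f : α → ι} {g : α → κ} (hf : FibM f) (hg : FibM g) :
    Hent μ (fun x => (f x, g x)) ≤ Hent μ f + Hent μ g := by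
  classical
  have hfib : ∀ i j, (fun x => (f x, g x)) ⁻¹' {(i, j)} = f ⁻¹' {i} ∩ g ⁻¹' {j} := by
    intro i j; ext x; simp
  refine (Hent_le_gibbs μ (hf.prodMk hg) (fun ij => μ.real (f ⁻¹' {ij.1}) * μ.real (g ⁻¹' {ij.2}))
    (fun i => mul_nonneg measureReal_nonneg measureReal_nonneg) ?_ ?_).trans ?_
  · rintro ⟨i, j⟩ h
    rw [hfib]
    rcases mul_eq_zero.1 h with h | h
    · exact le_antisymm ((measureReal_mono Set.inter_subset_left).trans h.le) measureReal_nonneg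
    · exact le_antisymm ((measureReal_mono Set.inter_subset_right).trans h.le) measureReal_nonneg
  · rw [Fintype.sum_prod_type]
    simp only [← Finset.mul_sum, sum_real_fib_univ μ hg, mul_one, sum_real_fib_univ μ hf, le_refl]
  · have h1 : ∀ ij : ι × κ, μ.real ((fun x => (f x, g x)) ⁻¹' {ij}) *
        (- Real.log (μ.real (f ⁻¹' {ij.1}) * μ.real (g ⁻¹' {ij.2}))) =
        μ.real (f ⁻¹' {ij.1} ∩ g ⁻¹' {ij.2}) * (- Real.log (μ.real (f ⁻¹' {ij.1}))) +
        μ.real (f ⁻¹' {ij.1} ∩ g ⁻¹' {ij.2}) * (- Real.log (μ.real (g ⁻¹' {ij.2}))) := by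
      rintro ⟨i, j⟩
      rw [hfib]
      by_cases h : μ.real (f ⁻¹' {i} ∩ g ⁻¹' {j}) = 0
      · simp [h]
      · have ha : μ.real (f ⁻¹' {i}) ≠ 0 := fun h' => h (le_antisymm
          ((measureReal_mono Set.inter_subset_left).trans h'.le) measureReal_nonneg)
        have hb : μ.real (g ⁻¹' {j}) ≠ 0 := fun h' => h (le_antisymm
          ((measureReal_mono Set.inter_subset_right).trans h'.le) measureReal_nonneg)
        simp only []
        rw [Real.log_mul ha hb]; ring
    rw [Finset.sum_congr rfl (fun ij _ => h1 ij), Finset.sum_add_distrib]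
    apply add_le_add
    · rw [Fintype.sum_prod_type]
      apply le_of_eq
      unfold Hent
      apply Finset.sum_congr rfl
      intro i _
      simp only [← Finset.sum_mul]
      have := sum_real_fib μ hg (f ⁻¹' {i}) (hf i)
      simp only [Set.inter_comm _ (f ⁻¹' {i})] at this
      rw [this, Real.negMulLog]; ring
    · rw [Fintype.sum_prod_type_right]
      apply le_of_eq
      unfold Hent
      apply Finset.sum_congr rfl
      intro i _
      simp only [← Finset.sum_mul]
      rw [sum_real_fib μ hf (g ⁻¹' {i}) (hg i), Real.negMulLog]; ring

/-- itineraries -/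
def itin (T : α → α) {ι : Type*} (f : α → ι) (N : ℕ) : α → (Fin N → ι) :=
  fun x j => f (T^[(j : ℕ)] x)

lemma FibM.pi {ι : Type*} {N : ℕ} {F : α → (Fin N → ι)} (h : ∀ j, FibM (fun x => F x j)) : FibM F := by
  intro ω
  have : F ⁻¹' {ω} = ⋂ j, (fun x => F x j) ⁻¹' {ω j} := by
    ext x; simp [funext_iff]
  rw [this]; exact MeasurableSet.iInter fun j => h j _

lemma FibM.preT {ι : Type*} {f : α → ι} (hf : FibM f) {T : α → α} (hT : Measurable T) :
    FibM (fun x => f (T x)) := fun i => hT (hf i)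

lemma FibM.itin {ι : Type*} {f : α → ι} (hf : FibM f) {T : α → α} (hT : Measurable T) (N : ℕ) :
    FibM (itin T f N) :=
  FibM.pi fun j => hf.preT (hT.iterate j)

lemma Hent_map {β : Type*} [MeasurableSpace β] (μ : Measure α) {ι : Type*} [Fintype ι] {f : β → ι}
    (hf : FibM f) {S : α → β} (hS : Measurable S) : Hent (μ.map S) f = Hent μ (fun x => f (S x)) := by
  unfold Hent
  apply Finset.sum_congr rfl
  intro i _
  rw [map_measureReal_apply hS (hf i)]; rfl

lemma Hent_preT (μ : Measure α) {ι : Type*} [Fintype ι] {f : α → ι}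
    (hf : FibM f) {S : α → α} (hS : MeasurePreserving S μ μ) : Hent μ (fun x => f (S x)) = Hent μ f := by
  rw [← Hent_map μ hf hS.measurable, hS.map_eq]

/-- entropy of itinerary bounded by the sum of the entropies at each time -/
lemma Hent_pi_le (μ : Measure α) [IsProbabilityMeasure μ] {ι : Type*} [Fintype ι] {N : ℕ}
    (F : α → (Fin N → ι)) (h : ∀ j, FibM (fun x => F x j)) :
    Hent μ F ≤ ∑ j, Hent μ (fun x => F x j) := by
  induction N with
  | zero =>
    have : Nonempty (Fin 0 → ι) := ⟨Fin.elim0⟩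
    refine (Hent_le_log_card μ (FibM.pi h)).trans ?_
    simp
  | succ N ih =>
    have h1 : Hent μ F ≤ Hent μ (fun x => (F x 0, fun j : Fin N => F x j.succ)) := by
      have := Hent_comp_le μ (f := fun x => (F x 0, fun j : Fin N => F x j.succ))
        ((h 0).prodMk (FibM.pi fun j => h j.succ)) (fun p => (Fin.cons p.1 p.2 : Fin (N+1) → ι))
      refine le_trans (le_of_eq ?_) this
      congr 1
      funext x
      exact (Fin.cons_self_tail (F x)).symm
    refine h1.trans ((Hent_prod_le μ (h 0) (FibM.pi fun j => h j.succ)).trans ?_)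
    rw [Fin.sum_univ_succ]
    have := ih (fun x j => F x j.succ) (fun j => h j.succ)
    linarith

lemma Hent_itin_add (μ : Measure α) [IsProbabilityMeasure μ] {ι : Type*} [Fintype ι] {f : α → ι}
    (hf : FibM f) {T : α → α} (hT : Measurable T) (a b : ℕ) :
    Hent μ (itin T f (a + b)) ≤ Hent μ (itin T f a) + Hent μ (fun x => itin T f b (T^[a] x)) := by
  have hb := (hf.itin hT b).preT (hT.iterate a)
  have := Hent_comp_le μ (f := fun x => (itin T f a x, itin T f b (T^[a] x)))
    ((hf.itin hT a).prodMk hb) (fun p => Fin.append p.1 p.2)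
  refine le_trans (le_of_eq ?_) (this.trans (Hent_prod_le μ (hf.itin hT a) hb))
  congr 1
  funext x
  funext j
  refine Fin.addCases (fun i => ?_) (fun i => ?_) j
  · simp [itin]
  · simp [itin, ← Function.iterate_add_apply, add_comm]

lemma Hent_itin_subadd (μ : Measure α) [IsProbabilityMeasure μ] {ι : Type*} [Fintype ι] {f : α → ι}
    (hf : FibM f) {T : α → α} (hT : MeasurePreserving T μ μ) :
    Subadditive (fun N => Hent μ (itin T f N)) := by
  intro a b
  have := Hent_itin_add μ hf hT.measurable a b
  rwa [Hent_preT μ (hf.itin hT.measurable b) (hT.iterate a)] at this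

/-- entropy of a map relative to T -/
def hmap (T : α → α) (μ : Measure α) {ι : Type*} [Fintype ι] (f : α → ι) : ℝ :=
  ⨅ N : ℕ, Hent μ (itin T f (N + 1)) / (N + 1)

lemma hmap_bdd (T : α → α) (μ : Measure α) [IsProbabilityMeasure μ] {ι : Type*} [Fintype ι] (f : α → ι) :
    BddBelow (Set.range fun N : ℕ => Hent μ (itin T f (N + 1)) / ((N : ℝ) + 1)) :=
  ⟨0, by rintro _ ⟨N, rfl⟩; exact div_nonneg (Hent_nonneg _ _) (by positivity)⟩

lemma hmap_le (T : α → α) (μ : Measure α) [IsProbabilityMeasure μ] {ι : Type*} [Fintype ι] (f : α → ι)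
    (N : ℕ) (hN : 0 < N) : hmap T μ f ≤ Hent μ (itin T f N) / N := by
  obtain ⟨k, rfl⟩ := Nat.exists_eq_succ_of_ne_zero hN.ne'
  have := ciInf_le (hmap_bdd T μ f) k
  simpa [hmap] using this

lemma le_hmap (T : α → α) (μ : Measure α) {ι : Type*} [Fintype ι] (f : α → ι) (c : ℝ)
    (h : ∀ N : ℕ, 0 < N → c ≤ Hent μ (itin T f N) / N) : c ≤ hmap T μ f := by
  apply le_ciInf
  intro N
  have := h (N + 1) N.succ_pos
  simpa using this

lemma hmap_nonneg (T : α → α) (μ : Measure α) [IsProbabilityMeasure μ] {ι : Type*} [Fintype ι] (f : α → ι) :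
    0 ≤ hmap T μ f := le_hmap _ _ _ _ fun N _ => div_nonneg (Hent_nonneg _ _) (by positivity)

lemma hmap_tendsto (T : α → α) (μ : Measure α) [IsProbabilityMeasure μ] {ι : Type*} [Fintype ι]
    {f : α → ι} (hf : FibM f) (hT : MeasurePreserving T μ μ) :
    Tendsto (fun N : ℕ => Hent μ (itin T f N) / N) atTop (𝓝 (hmap T μ f)) := by
  have hs := Hent_itin_subadd μ hf hT
  have hb : BddBelow (Set.range fun N : ℕ => Hent μ (itin T f N) / (N : ℝ)) :=
    ⟨0, by rintro _ ⟨N, rfl⟩; exact div_nonneg (Hent_nonneg _ _) (by positivity)⟩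
  have ht := hs.tendsto_lim hb
  have : hs.lim = hmap T μ f := by
    apply le_antisymm
    · apply le_hmap
      intro N hN
      exact hs.lim_le_div hb hN.ne'
    · exact ge_of_tendsto ht (by
        filter_upwards [eventually_gt_atTop 0] with N hN
        exact hmap_le T μ f N hN)
  rwa [this] at ht

lemma hmap_comp_le (T : α → α) (μ : Measure α) [IsProbabilityMeasure μ] {ι κ : Type*} [Fintype ι]
    [Fintype κ] {f : α → ι} (hf : FibM f) (hT : MeasurePreserving T μ μ) (φ : ι → κ) :
    hmap T μ (fun x => φ (f x)) ≤ hmap T μ f := by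
  apply le_hmap
  intro N hN
  refine (hmap_le T μ _ N hN).trans ?_
  gcongr
  exact Hent_comp_le μ (hf.itin hT.measurable N) (fun ω j => φ (ω j))

/-! relation with `ksEntropy` -/

lemma partEnt_eq (T : α → α) (μ : Measure α) {k : ℕ} (f : α → Fin k) :
    (⨅ N : ℕ, partEnt μ (joinPart T (fun i => f ⁻¹' {i}) (N + 1)) / (N + 1)) = hmap T μ f := by
  unfold hmap
  congr 1; funext N; congr 1
  unfold partEnt Hent
  apply Finset.sum_congr rfl
  intro ω _
  congr 2
  congr 1
  ext x; simp [joinPart, itin, funext_iff]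

lemma exists_map_of_part {k : ℕ} {P : Fin k → Set α} (hP : IsFinPart P) :
    ∃ f : α → Fin k, FibM f ∧ P = fun i => f ⁻¹' {i} := by
  obtain ⟨hm, hd, hu⟩ := hP
  have hx : ∀ x : α, ∃ i, x ∈ P i := fun x => by
    have : x ∈ ⋃ i, P i := by rw [hu]; trivial
    simpa using this
  choose f hf using hx
  have hPf : P = fun i => f ⁻¹' {i} := by
    funext i; ext x
    constructor
    · intro h
      by_contra hne
      exact Set.disjoint_left.1 (hd hne) (hf x) h
    · rintro rfl; exact hf x
  refine ⟨f, fun i => ?_, hPf⟩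
  have := hm i
  rwa [hPf] at this

lemma part_of_map {k : ℕ} {f : α → Fin k} (hf : FibM f) : IsFinPart (fun i => f ⁻¹' {i}) := by
  refine ⟨hf, ?_, ?_⟩
  · intro i j hij
    apply Set.disjoint_left.2
    intro x hx hy
    exact hij (hx.symm.trans hy)
  · ext x; simp

lemma ks_le (T : α → α) (μ : Measure α) (s : ℝ) (hs : 0 ≤ s)
    (h : ∀ (k : ℕ) (f : α → Fin k), FibM f → hmap T μ f ≤ s) : ksEntropy T μ ≤ s := by
  unfold ksEntropy
  refine Real.iSup_le (fun k => Real.iSup_le (fun P => Real.iSup_le (fun hP => ?_) hs) hs) hs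
  obtain ⟨f, hf, rfl⟩ := exists_map_of_part hP
  rw [partEnt_eq]; exact h k f hf

lemma le_ks (T : α → α) (μ : Measure α) (s : ℝ) (hs : 0 ≤ s)
    (h : ∀ (k : ℕ) (f : α → Fin k), FibM f → hmap T μ f ≤ s) {k : ℕ} {f : α → Fin k} (hf : FibM f) :
    hmap T μ f ≤ ksEntropy T μ := by
  unfold ksEntropy
  have hP : ∀ (k : ℕ) (P : Fin k → Set α) (hP : IsFinPart P),
      (⨅ N : ℕ, partEnt μ (joinPart T P (N + 1)) / (N + 1)) ≤ s := by
    intro k P hP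
    obtain ⟨f, hf, rfl⟩ := exists_map_of_part hP
    rw [partEnt_eq]; exact h k f hf
  refine le_trans ?_ (le_ciSup (f := fun k => ⨆ (P : Fin k → Set α) (_ : IsFinPart P),
    ⨅ N : ℕ, partEnt μ (joinPart T P (N + 1)) / (N + 1)) ⟨s, ?_⟩ k)
  · refine le_trans ?_ (le_ciSup (f := fun P : Fin k → Set α => ⨆ (_ : IsFinPart P),
      ⨅ N : ℕ, partEnt μ (joinPart T P (N + 1)) / (N + 1)) ⟨s, ?_⟩ (fun i => f ⁻¹' {i}))
    · rw [← partEnt_eq]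
      exact le_ciSup (f := fun _ : IsFinPart (fun i => f ⁻¹' {i}) => ⨅ N : ℕ, partEnt μ
        (joinPart T (fun i => f ⁻¹' {i}) (N + 1)) / (N + 1)) ⟨s, by
          rintro _ ⟨h', rfl⟩; exact hP _ _ h'⟩ (part_of_map hf)
    · rintro _ ⟨P, rfl⟩
      exact Real.iSup_le (fun h' => hP _ _ h') hs
  · rintro _ ⟨k, rfl⟩
    exact Real.iSup_le (fun P => Real.iSup_le (fun h' => hP _ _ h') hs) hs

lemma le_ks' (T : α → α) (μ : Measure α) (s : ℝ) (hs : 0 ≤ s)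
    (h : ∀ (k : ℕ) (f : α → Fin k), FibM f → hmap T μ f ≤ s) [IsProbabilityMeasure μ]
    (hT : MeasurePreserving T μ μ) {ι : Type*} [Fintype ι]
    {f : α → ι} (hf : FibM f) : hmap T μ f ≤ ksEntropy T μ := by
  classical
  set e := Fintype.equivFin ι
  have h1 : hmap T μ f ≤ hmap T μ (fun x => e (f x)) := by
    have := hmap_comp_le T μ (f := fun x => e (f x)) (hf.comp e) hT e.symm
    simpa using this
  exact h1.trans (le_ks T μ s hs h (hf.comp e))

end PartEnt

section PartEnt2

/-! ## Part Ent2: mixtures, affinity, averages -/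

variable {α : Type*} [MeasurableSpace α]

lemma Hent_mix_ge {J : Type*} (s : Finset J) (w : J → ℝ) (hw : ∀ j ∈ s, 0 ≤ w j) (hw1 : ∑ j ∈ s, w j = 1)
    (μ : J → Measure α) (lam : Measure α) {ι : Type*} [Fintype ι] {f : α → ι} (hf : FibM f)
    (hl : ∀ S, MeasurableSet S → lam.real S = ∑ j ∈ s, w j * (μ j).real S) :
    ∑ j ∈ s, w j * Hent (μ j) f ≤ Hent lam f := by
  unfold Hent
  simp only [Finset.mul_sum]
  rw [Finset.sum_comm]
  apply Finset.sum_le_sum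
  intro i _
  rw [hl _ (hf i)]
  have := Real.concaveOn_negMulLog.le_map_sum (t := s) (w := w)
    (p := fun j => (μ j).real (f ⁻¹' {i})) hw hw1 (fun j _ => by simp [measureReal_nonneg])
  simpa using this

lemma negMulLog_add_le {x y : ℝ} (hx : 0 ≤ x) (hy : 0 ≤ y) :
    Real.negMulLog (x + y) ≤ Real.negMulLog x + Real.negMulLog y := by
  rcases hx.eq_or_lt with rfl | hx
  · simp
  rcases hy.eq_or_lt with rfl | hy
  · simp
  have h1 := Real.log_le_log hx (by linarith : x ≤ x + y)
  have h2 := Real.log_le_log hy (by linarith : y ≤ x + y)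
  simp only [Real.negMulLog]
  nlinarith

lemma Hent_mix_le (c : ℝ) (hc : c ∈ Set.Icc (0:ℝ) 1) (μ ν lam : Measure α) [IsProbabilityMeasure μ]
    [IsProbabilityMeasure ν] {ι : Type*} [Fintype ι] {f : α → ι} (hf : FibM f)
    (hl : ∀ S, MeasurableSet S → lam.real S = c * μ.real S + (1 - c) * ν.real S) :
    Hent lam f ≤ c * Hent μ f + (1 - c) * Hent ν f + (Real.negMulLog c + Real.negMulLog (1 - c)) := by
  have h0 := hc.1
  have h1 : 0 ≤ 1 - c := by linarith [hc.2]
  have key : ∀ i, Real.negMulLog (lam.real (f ⁻¹' {i})) ≤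
      (c * Real.negMulLog (μ.real (f ⁻¹' {i})) + (1 - c) * Real.negMulLog (ν.real (f ⁻¹' {i}))) +
      (μ.real (f ⁻¹' {i}) * Real.negMulLog c + ν.real (f ⁻¹' {i}) * Real.negMulLog (1 - c)) := by
    intro i
    rw [hl _ (hf i)]
    refine (negMulLog_add_le (mul_nonneg h0 measureReal_nonneg) (mul_nonneg h1 measureReal_nonneg)).trans ?_
    rw [Real.negMulLog_mul, Real.negMulLog_mul]
    linarith
  unfold Hent
  refine (Finset.sum_le_sum fun i _ => key i).trans ?_
  rw [Finset.sum_add_distrib, Finset.sum_add_distrib, Finset.sum_add_distrib, ← Finset.sum_mul,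
    ← Finset.sum_mul, sum_real_fib_univ μ hf, sum_real_fib_univ ν hf, ← Finset.mul_sum, ← Finset.mul_sum]
  linarith

lemma hmap_mix (T : α → α) (c : ℝ) (hc : c ∈ Set.Icc (0:ℝ) 1) (μ ν lam : Measure α) [IsProbabilityMeasure μ]
    [IsProbabilityMeasure ν] [IsProbabilityMeasure lam] (hμ : MeasurePreserving T μ μ)
    (hν : MeasurePreserving T ν ν) (hlam : MeasurePreserving T lam lam)
    (hl : ∀ S, MeasurableSet S → lam.real S = c * μ.real S + (1 - c) * ν.real S)
    {ι : Type*} [Fintype ι] {f : α → ι} (hf : FibM f) :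
    hmap T lam f = c * hmap T μ f + (1 - c) * hmap T ν f := by
  have t1 := hmap_tendsto T μ hf hμ
  have t2 := hmap_tendsto T ν hf hν
  have t3 := hmap_tendsto T lam hf hlam
  have t12 := (t1.const_mul c).add (t2.const_mul (1 - c))
  have hN := fun N => hf.itin hμ.measurable N
  apply le_antisymm
  · have t4 : Tendsto (fun N : ℕ => (Real.negMulLog c + Real.negMulLog (1 - c)) / (N : ℝ)) atTop (𝓝 0) :=
      tendsto_const_div_atTop_nhds_zero_nat _
    have := le_of_tendsto_of_tendsto' t3 (t12.add t4) (fun N => by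
      have := Hent_mix_le c hc μ ν lam (hN N) hl
      calc _ ≤ _ := div_le_div_of_nonneg_right this (Nat.cast_nonneg N)
        _ = _ := by ring)
    simpa using this
  · refine le_of_tendsto_of_tendsto' t12 t3 (fun N => ?_)
    have := Hent_mix_ge (Finset.univ : Finset Bool) (fun b => if b then c else 1 - c)
      (by intro j _; cases j <;> simp [hc.1, hc.2]) (by simp) (fun b => if b then μ else ν) lam (hN N)
      (by intro S hS; rw [hl S hS]; simp)
    simp only [Fintype.sum_bool, if_true] at this
    calc _ = (c * Hent μ (itin T f N) + (1 - c) * Hent ν (itin T f N)) / N := by ring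
      _ ≤ _ := div_le_div_of_nonneg_right (by simpa using this) (Nat.cast_nonneg N)

lemma mul_ks_le (T : α → α) (μ : Measure α) [IsProbabilityMeasure μ] (c S : ℝ) (hc : 0 ≤ c)
    (h : ∀ (k : ℕ) (f : α → Fin k), FibM f → c * hmap T μ f ≤ S) : c * ksEntropy T μ ≤ S := by
  have hS : 0 ≤ S := le_trans (mul_nonneg hc (hmap_nonneg T μ (fun _ : α => (0 : Fin 1))))
    (h 1 (fun _ => 0) (fun i => by
      have : (fun _ : α => (0 : Fin 1)) ⁻¹' {i} = Set.univ := by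
        ext x; simp [Subsingleton.elim i 0]
      rw [this]; exact MeasurableSet.univ))
  rcases hc.eq_or_lt with rfl | hc
  · simpa using hS
  · rw [← le_div_iff₀' hc]
    exact ks_le T μ _ (by positivity) (fun k f hf => by rw [le_div_iff₀' hc]; exact h k f hf)

lemma ks_affine (T : α → α) (c : ℝ) (hc : c ∈ Set.Icc (0:ℝ) 1) (μ ν lam : Measure α) [IsProbabilityMeasure μ]
    [IsProbabilityMeasure ν] [IsProbabilityMeasure lam] (hμ : MeasurePreserving T μ μ)
    (hν : MeasurePreserving T ν ν) (hlam : MeasurePreserving T lam lam)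
    (hl : ∀ S, MeasurableSet S → lam.real S = c * μ.real S + (1 - c) * ν.real S)
    (s : ℝ) (hs : 0 ≤ s)
    (bμ : ∀ (k : ℕ) (f : α → Fin k), FibM f → hmap T μ f ≤ s)
    (bν : ∀ (k : ℕ) (f : α → Fin k), FibM f → hmap T ν f ≤ s) :
    ksEntropy T lam = c * ksEntropy T μ + (1 - c) * ksEntropy T ν := by
  have h0 := hc.1
  have h1 : 0 ≤ 1 - c := by linarith [hc.2]
  have bl : ∀ (k : ℕ) (f : α → Fin k), FibM f → hmap T lam f ≤ s := by
    intro k f hf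
    rw [hmap_mix T c hc μ ν lam hμ hν hlam hl hf]
    nlinarith [bμ k f hf, bν k f hf]
  apply le_antisymm
  · have := mul_ks_le T lam 1 (c * ksEntropy T μ + (1 - c) * ksEntropy T ν) zero_le_one (by
      intro k f hf
      rw [hmap_mix T c hc μ ν lam hμ hν hlam hl hf, one_mul]
      have a1 := le_ks T μ s hs bμ hf
      have a2 := le_ks T ν s hs bν hf
      nlinarith [mul_le_mul_of_nonneg_left a1 h0, mul_le_mul_of_nonneg_left a2 h1])
    simpa using this
  · have := mul_ks_le T μ c (ksEntropy T lam - (1 - c) * ksEntropy T ν) h0 (by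
      intro k f hf
      have := mul_ks_le T ν (1 - c) (ksEntropy T lam - c * hmap T μ f) h1 (by
        intro l g hg
        have hfg := hf.prodMk hg
        have e1 := le_ks' T lam s hs bl hlam hfg
        rw [hmap_mix T c hc μ ν lam hμ hν hlam hl hfg] at e1
        have e2 := hmap_comp_le T μ hfg hμ Prod.fst
        have e3 := hmap_comp_le T ν hfg hν Prod.snd
        have e4 := mul_le_mul_of_nonneg_left e2 h0
        have e5 := mul_le_mul_of_nonneg_left e3 h1
        linarith)
      linarith)
    linarith

/-! averages -/

/-- the orbit average of a measure -/
def avgM (T : α → α) (η : Measure α) (N : ℕ) : Measure α :=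
  (N : ℝ≥0∞)⁻¹ • ∑ j ∈ Finset.range N, η.map (T^[j])

lemma avgM_apply (T : α → α) (hT : Measurable T) (η : Measure α) (N : ℕ) {S : Set α} (hS : MeasurableSet S) :
    avgM T η N S = (N : ℝ≥0∞)⁻¹ * ∑ j ∈ Finset.range N, η ((T^[j]) ⁻¹' S) := by
  simp only [avgM, Measure.smul_apply, Measure.finsetSum_apply, smul_eq_mul]
  congr 1
  apply Finset.sum_congr rfl
  intro j _
  rw [Measure.map_apply (hT.iterate j) hS]

lemma avgM_prob (T : α → α) (hT : Measurable T) (η : Measure α) [IsProbabilityMeasure η] (N : ℕ) (hN : 0 < N) :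
    IsProbabilityMeasure (avgM T η N) := by
  constructor
  rw [avgM_apply T hT η N MeasurableSet.univ]
  simp only [Set.preimage_univ, measure_univ, Finset.sum_const, Finset.card_range, nsmul_eq_mul, mul_one]
  exact ENNReal.inv_mul_cancel (by exact_mod_cast hN.ne') (by simp)

lemma avgM_real (T : α → α) (hT : Measurable T) (η : Measure α) [IsProbabilityMeasure η] (N : ℕ)
    {S : Set α} (hS : MeasurableSet S) :
    (avgM T η N).real S = ∑ j ∈ Finset.range N, (N : ℝ)⁻¹ * (η.map (T^[j])).real S := by
  rw [Measure.real, avgM_apply T hT η N hS, ENNReal.toReal_mul, ENNReal.toReal_sum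
    (fun j _ => measure_ne_top _ _), Finset.mul_sum]
  simp only [ENNReal.toReal_inv, ENNReal.toReal_natCast]
  apply Finset.sum_congr rfl
  intro j _
  rw [map_measureReal_apply (hT.iterate j) hS]; rfl

/-- abstract block lemma -/
lemma block_aux (h : ℕ → ℕ → ℝ) (h0 : ∀ a, h a 0 ≤ 0) (hadd : ∀ a b c, h a (b + c) ≤ h a b + h (a + b) c)
    (hmono : ∀ a b c, b ≤ c → h a b ≤ h a c) (q : ℕ) (hq : 0 < q) (N : ℕ) :
    ∀ a, h a N ≤ ∑ j ∈ (Finset.range N).filter (fun j => j % q = 0), h (a + j) q := by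
  have hpos : ∀ a b, 0 ≤ h a b := by
    intro a b
    have h1 := hmono a 0 b (Nat.zero_le _)
    have h2 := hadd a 0 0
    simp at h2
    linarith
  induction N using Nat.strong_induction_on with
  | _ N ih =>
    intro a
    rcases Nat.eq_zero_or_pos N with rfl | hN
    · simpa using h0 a
    by_cases hNq : N ≤ q
    · refine (hmono a N q hNq).trans ?_
      have := Finset.single_le_sum (f := fun j => h (a + j) q) (s := (Finset.range N).filter (fun j => j % q = 0))
        (fun j _ => hpos _ _) (a := 0) (by simp [hN])
      simpa using this
    · push Not at hNq
      have h1 := hadd a q (N - q)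
      rw [Nat.add_sub_cancel' hNq.le] at h1
      have h2 := ih (N - q) (by omega) (a + q)
      have h3 : (Finset.range N).filter (fun j => j % q = 0) = insert 0
          (((Finset.range (N - q)).filter (fun j => j % q = 0)).map (addRightEmbedding q)) := by
        ext j
        simp only [Finset.mem_filter, Finset.mem_range, Finset.mem_insert, Finset.mem_map,
          addRightEmbedding_apply]
        constructor
        · rintro ⟨hj, hm⟩
          by_cases hj0 : j = 0
          · exact Or.inl hj0
          · right
            have : q ≤ j := Nat.le_of_dvd (Nat.pos_of_ne_zero hj0) (Nat.dvd_of_mod_eq_zero hm)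
            refine ⟨j - q, ⟨by omega, ?_⟩, by omega⟩
            rw [← Nat.mod_eq_sub_mod this]; exact hm
        · rintro (rfl | ⟨i, ⟨hi, hm⟩, rfl⟩)
          · exact ⟨hN, by simp⟩
          · exact ⟨by omega, by simpa using hm⟩
      rw [h3, Finset.sum_insert (by simp; omega), Finset.sum_map]
      simp only [addRightEmbedding_apply, add_zero]
      have h4 : ∀ j, a + (j + q) = a + q + j := fun j => by ring
      simp only [h4]
      linarith

lemma block_sum (h : ℕ → ℕ → ℝ) (h0 : ∀ a, h a 0 ≤ 0) (hadd : ∀ a b c, h a (b + c) ≤ h a b + h (a + b) c)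
    (hmono : ∀ a b c, b ≤ c → h a b ≤ h a c) (lk : ℝ) (hlk : ∀ a b : ℕ, h a b ≤ b * lk) (q : ℕ) (hq : 0 < q) (N : ℕ) :
    q * h 0 N ≤ (q:ℝ)^2 * lk + ∑ j ∈ Finset.range N, h j q := by
  have hpos : ∀ a b, 0 ≤ h a b := by
    intro a b
    have h1 := hmono a 0 b (Nat.zero_le _)
    have h2 := hadd a 0 0
    simp at h2
    linarith
  have hlk0 : 0 ≤ lk := by have := hlk 0 1; have := hpos 0 1; simp at *; linarith
  have key : ∀ r ∈ Finset.range q, h 0 N ≤ q * lk + ∑ j ∈ (Finset.range N).filter (fun j => j % q = r), h j q := by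
    intro r hr
    have hr := Finset.mem_range.1 hr
    have hrq : (r : ℝ) * lk ≤ q * lk := by gcongr
    have hs0 : 0 ≤ ∑ j ∈ (Finset.range N).filter (fun j => j % q = r), h j q :=
      Finset.sum_nonneg fun j _ => hpos _ _
    by_cases hrN : r ≤ N
    · have h1 := hadd 0 r (N - r)
      rw [Nat.add_sub_cancel' hrN, zero_add] at h1
      have h2 := block_aux h h0 hadd hmono q hq (N - r) r
      have h3 : ∑ j ∈ (Finset.range (N - r)).filter (fun j => j % q = 0), h (r + j) q ≤
          ∑ j ∈ (Finset.range N).filter (fun j => j % q = r), h j q := by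
        have e := Finset.sum_map ((Finset.range (N - r)).filter (fun j => j % q = 0)) (addLeftEmbedding r)
          (fun j => h j q)
        simp only [addLeftEmbedding_apply] at e
        rw [← e]
        apply Finset.sum_le_sum_of_subset_of_nonneg
        · intro j
          simp only [Finset.mem_filter, Finset.mem_range, Finset.mem_map, addLeftEmbedding_apply]
          rintro ⟨i, ⟨hi, hm⟩, rfl⟩
          refine ⟨by omega, ?_⟩
          rw [Nat.add_mod, hm, add_zero, Nat.mod_mod, Nat.mod_eq_of_lt hr]
        · intro j _ _; exact hpos _ _
      have := hlk 0 r
      linarith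
    · have h4 := hmono 0 N r (by omega)
      have := hlk 0 r
      linarith
  have := Finset.sum_le_sum key
  rw [Finset.sum_const, Finset.card_range, nsmul_eq_mul, Finset.sum_add_distrib, Finset.sum_const,
    Finset.card_range, nsmul_eq_mul, Finset.sum_fiberwise_of_maps_to (fun j _ => Finset.mem_range.2 (Nat.mod_lt _ hq))] at this
  linarith

lemma misiurewicz (T : α → α) (hT : Measurable T) (η : Measure α) [IsProbabilityMeasure η]
    {ι : Type*} [Fintype ι] [Nonempty ι] {f : α → ι} (hf : FibM f) (q : ℕ) (hq : 0 < q) (N : ℕ) (hN : 0 < N) :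
    Hent η (itin T f N) / N ≤ Hent (avgM T η N) (itin T f q) / q + q * Real.log (Fintype.card ι) / N := by
  have hmix := Hent_mix_ge (Finset.range N) (fun _ => (N:ℝ)⁻¹) (fun _ _ => by positivity)
    (by simp; field_simp) (fun j => η.map (T^[j])) (avgM T η N) (hf.itin hT q)
    (fun S hS => avgM_real T hT η N hS)
  have hb := block_sum (fun a b => Hent η (fun x => itin T f b (T^[a] x))) ?_ ?_ ?_
    (Real.log (Fintype.card ι)) ?_ q hq N
  · have e : ∀ j, Hent (η.map (T^[j])) (itin T f q) = Hent η (fun x => itin T f q (T^[j] x)) :=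
      fun j => Hent_map η (hf.itin hT q) (hT.iterate j)
    simp only [e] at hmix
    rw [← Finset.mul_sum] at hmix
    simp only [Function.iterate_zero, id] at hb
    have hq' : (0:ℝ) < q := by exact_mod_cast hq
    have hN' : (0:ℝ) < N := by exact_mod_cast hN
    have h3 : ∑ j ∈ Finset.range N, Hent η (fun x => itin T f q (T^[j] x)) ≤ N * Hent (avgM T η N) (itin T f q) := by
      rwa [inv_mul_le_iff₀ hN'] at hmix
    have h4 := hb.trans (add_le_add_right h3 _)
    have h5 : Hent (avgM T η N) (itin T f q) / q + q * Real.log (Fintype.card ι) / N =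
      ((q:ℝ)^2 * Real.log (Fintype.card ι) + N * Hent (avgM T η N) (itin T f q)) / (q * N) := by
      field_simp; ring
    rw [h5, le_div_iff₀ (by positivity)]
    calc _ = q * Hent η (itin T f N) := by field_simp
      _ ≤ _ := h4
  · intro a
    have : Nonempty (Fin 0 → ι) := ⟨Fin.elim0⟩
    refine (Hent_le_log_card η ((hf.itin hT 0).preT (hT.iterate a))).trans ?_
    simp
  · intro a b c
    have : IsProbabilityMeasure (η.map (T^[a])) :=
      Measure.isProbabilityMeasure_map (hT.iterate a).aemeasurable
    have := Hent_itin_add (η.map (T^[a])) hf hT b c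
    rw [Hent_map η (hf.itin hT _) (hT.iterate a), Hent_map η (hf.itin hT _) (hT.iterate a),
      Hent_map η ((hf.itin hT _).preT (hT.iterate b)) (hT.iterate a)] at this
    simp only [← Function.iterate_add_apply] at this
    simpa only [add_comm b a] using this
  · intro a b c hbc
    have := Hent_comp_le η ((hf.itin hT c).preT (hT.iterate a)) (fun ω (j : Fin b) => ω (Fin.castLE hbc j))
    exact this
  · intro a b
    refine (Hent_le_log_card η ((hf.itin hT b).preT (hT.iterate a))).trans ?_
    simp

end PartEnt2

section PartU1

/-! ## Part U1: abstract upper bound for entropy via Bowen covers -/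

lemma Hent_le_count' {α : Type*} [MeasurableSpace α] (μ : Measure α) [IsProbabilityMeasure μ]
    {ι : Type*} [Fintype ι] {f : α → ι}
    (hf : FibM f) (Y : Set α) (hY : Y.Nonempty) (S : Finset ι) (hYS : ∀ x ∈ Y, f x ∈ S) (X : ℝ) (hX : (S.card : ℝ) ≤ X)
    (δ : ℝ) (hδ : μ.real Yᶜ ≤ δ) (c : ℝ) (hc : Real.log (Fintype.card ι) ≤ c) :
    Hent μ f ≤ Real.log 2 + Real.log X + δ * c := by
  obtain ⟨x, hx⟩ := hY
  have hne : S.Nonempty := ⟨_, hYS x hx⟩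
  have h1 := Hent_le_count μ hf Y S hne hYS
  have h2 : (0:ℝ) < S.card := by exact_mod_cast Finset.card_pos.2 hne
  have h3 := Real.log_le_log h2 hX
  have : Nonempty ι := ⟨f x⟩
  have h4 : 0 ≤ Real.log (Fintype.card ι) := Real.log_natCast_nonneg _
  have h5 : μ.real Yᶜ * Real.log (Fintype.card ι) ≤ δ * c :=
    mul_le_mul hδ hc h4 (measureReal_nonneg.trans hδ)
  linarith

theorem U1 {α : Type*} [TopologicalSpace α] [MeasurableSpace α] (μ : Measure α)
    [IsProbabilityMeasure μ] (T : α → α) (hT : MeasurePreserving T μ μ)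
    (hreg : ∀ S, MeasurableSet S → ∀ ε > 0, ∃ K ⊆ S, IsCompact K ∧ MeasurableSet K ∧ μ.real (S \ K) ≤ ε)
    (𝒱 : Set (Set (α × α))) (s : ℝ)
    (hsep : ∀ (p : ℕ) (K : Fin p → Set α), (∀ i, IsCompact (K i)) → Pairwise (Function.onFun Disjoint K) →
      ∃ V ∈ 𝒱, ∀ i j, i ≠ j → ∀ x ∈ K i, ∀ y ∈ K j, (x, y) ∉ V)
    (hcov : ∀ V ∈ 𝒱, ∀ δ > 0, ∃ C : ℝ, 1 ≤ C ∧ ∀ L : ℕ, ∃ Y : Set α, μ.real Yᶜ ≤ δ ∧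
      ∃ (p : ℕ) (D : Fin p → Set α), (p : ℝ) ≤ C * Real.exp (s * L) ∧ Y ⊆ ⋃ i, D i ∧
        ∀ i, ∀ x ∈ D i, ∀ x' ∈ D i, ∀ j < L, (T^[j] x, T^[j] x') ∈ V) :
    ∀ (k : ℕ) (f : α → Fin k), FibM f → hmap T μ f ≤ s := by
  classical
  intro k f hf
  have hTm := hT.measurable
  -- main estimate for each M
  have main : ∀ M : ℕ, 0 < M → hmap T μ f ≤ s + 4 / M := by
    intro M hM
    set F := itin T f M with hF
    have hFm : FibM F := hf.itin hTm M
    have hne : Nonempty α := by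
      by_contra h
      rw [not_nonempty_iff] at h
      have := measure_univ (μ := μ)
      rw [Set.univ_eq_empty_iff.2 h] at this
      simp at this
    let ι := Fin M → Fin k
    have hneι : Nonempty ι := ⟨F hne.some⟩
    set c : ℝ := Real.log (Fintype.card (Option ι)) with hc
    have hc0 : 0 ≤ c := Real.log_natCast_nonneg _
    set δ : ℝ := min (1/2) (1 / (2 * (c + 1))) with hδ
    have hδ0 : 0 < δ := by rw [hδ]; positivity
    have hδ1 : δ ≤ 1/2 := min_le_left _ _
    have hδc : δ * c ≤ 1/2 := by
      have : δ ≤ 1 / (2 * (c + 1)) := min_le_right _ _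
      calc δ * c ≤ 1 / (2 * (c + 1)) * (c + 1) := by gcongr; linarith
        _ = 1/2 := by field_simp
    have hcard : (0:ℝ) < Fintype.card ι := by exact_mod_cast Fintype.card_pos
    have hK : ∀ i : ι, ∃ K ⊆ F ⁻¹' {i}, IsCompact K ∧ MeasurableSet K ∧
        μ.real (F ⁻¹' {i} \ K) ≤ δ / Fintype.card ι := fun i => hreg _ (hFm i) _ (by positivity)
    choose K hKs hKc hKm hKμ using hK
    have hKF : ∀ i x, x ∈ K i → F x = i := fun i x hx => hKs i hx
    set Y0 : Set α := ⋃ i, K i with hY0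
    have hY0F : ∀ x, x ∈ Y0 ↔ x ∈ K (F x) := by
      intro x
      simp only [hY0, Set.mem_iUnion]
      exact ⟨fun ⟨i, hi⟩ => by rw [hKF i x hi]; exact hi, fun h => ⟨_, h⟩⟩
    have hY0m : MeasurableSet Y0 := MeasurableSet.iUnion fun i => hKm i
    have hY0μ : μ.real Y0ᶜ ≤ δ := by
      have h1 : Y0ᶜ ⊆ ⋃ i, (F ⁻¹' {i} \ K i) := by
        intro x hx
        simp only [Set.mem_iUnion]
        exact ⟨F x, rfl, fun h => hx ((hY0F x).2 h)⟩
      calc μ.real Y0ᶜ ≤ μ.real (⋃ i, (F ⁻¹' {i} \ K i)) := measureReal_mono h1 (measure_ne_top _ _)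
        _ ≤ ∑ i, μ.real (F ⁻¹' {i} \ K i) := measureReal_iUnion_fintype_le _
        _ ≤ ∑ i : ι, δ / Fintype.card ι := Finset.sum_le_sum fun i _ => hKμ i
        _ = δ := by rw [Finset.sum_const, Finset.card_univ, nsmul_eq_mul]; field_simp
    let F' : α → Option ι := fun x => if x ∈ Y0 then some (F x) else none
    let G : α → Option ι := fun x => if x ∈ Y0 then none else some (F x)
    have hF'm : FibM F' := by
      have : FibM (fun x => (F x, (decide (x ∈ Y0) : Bool))) := hFm.prodMk (by
        intro b
        cases b
        · convert hY0m.compl using 1; ext x; simp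
        · convert hY0m using 1; ext x; simp)
      have h2 := this.comp (fun p => if p.2 then some p.1 else none)
      simpa [F'] using h2
    have hGm : FibM G := by
      have : FibM (fun x => (F x, (decide (x ∈ Y0) : Bool))) := hFm.prodMk (by
        intro b
        cases b
        · convert hY0m.compl using 1; ext x; simp
        · convert hY0m using 1; ext x; simp)
      have h2 := this.comp (fun p => if p.2 then none else some p.1)
      simpa [G] using h2
    have hY0ne : Y0.Nonempty := by
      by_contra h
      rw [Set.not_nonempty_iff_eq_empty] at h
      rw [h] at hY0μ
      simp at hY0μ; linarith
    have hHG : Hent μ G ≤ Real.log 2 + 1/2 := by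
      have := Hent_le_count' μ hGm Y0 hY0ne {none} (by intro x hx; simp [G, hx]) 1 (by simp) δ hY0μ c le_rfl
      simp at this; linarith
    obtain ⟨e⟩ : Nonempty (ι ≃ Fin (Fintype.card ι)) := ⟨Fintype.equivFin ι⟩
    obtain ⟨V, hV, hVs⟩ := hsep (Fintype.card ι) (fun i => K (e.symm i)) (fun i => hKc _) (by
      intro i j hij
      apply Set.disjoint_left.2
      intro x hx hy
      exact hij (e.symm.injective ((hKF _ x hx).symm.trans (hKF _ x hy))))
    have hVs' : ∀ x x', x ∈ Y0 → x' ∈ Y0 → (x, x') ∈ V → F x = F x' := by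
      intro x x' hx hx' hxx
      by_contra hne
      exact hVs (e (F x)) (e (F x')) (fun h => hne (e.injective h)) x (by simpa using (hY0F x).1 hx)
        x' (by simpa using (hY0F x').1 hx') hxx
    obtain ⟨C, hC1, hC⟩ := hcov V hV δ hδ0
    have hl2 : Real.log 2 ≤ 1 := by have := Real.log_two_lt_d9; linarith
    have bound : ∀ N : ℕ, 0 < N → hmap T μ f ≤ s + 3 / M + (1 + Real.log C) / N := by
      intro N hN
      set S := T^[M] with hS
      have hSp : MeasurePreserving S μ μ := hT.iterate M
      have hdiv : ∀ j : Fin (N * M), (j : ℕ) / M < N := fun j => (Nat.div_lt_iff_lt_mul hM).2 j.2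
      have h1 : Hent μ (itin T f (N * M)) ≤ Hent μ (itin S (fun x => (F' x, G x)) N) := by
        have := Hent_comp_le μ ((hF'm.prodMk hGm).itin hSp.measurable N)
          (fun ω (j : Fin (N * M)) => ((ω ⟨j / M, hdiv j⟩).1.getD
            ((ω ⟨j / M, hdiv j⟩).2.getD (F hne.some)))
              ⟨j % M, Nat.mod_lt _ hM⟩)
        refine le_trans (le_of_eq ?_) this
        congr 1
        funext x j
        have e1 : ∀ y, (F' y).getD ((G y).getD (F hne.some)) = F y := by
          intro y
          by_cases hy : y ∈ Y0 <;> simp [F', G, hy]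
        simp only [itin, e1]
        simp only [hF, itin, hS, ← Function.iterate_mul, ← Function.iterate_add_apply]
        congr 2
        rw [Nat.mod_add_div]
      have h2 : Hent μ (itin S (fun x => (F' x, G x)) N) ≤ Hent μ (itin S F' N) + Hent μ (itin S G N) := by
        have := Hent_comp_le μ ((hF'm.itin hSp.measurable N).prodMk (hGm.itin hSp.measurable N))
          (fun p (j : Fin N) => (p.1 j, p.2 j))
        exact le_trans (le_of_eq rfl) (this.trans (Hent_prod_le μ (hF'm.itin hSp.measurable N) (hGm.itin hSp.measurable N)))
      have h3 : Hent μ (itin S G N) ≤ N * Hent μ G := by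
        refine (Hent_pi_le μ (itin S G N) (fun j => hGm.preT (hSp.measurable.iterate j))).trans ?_
        have : ∀ j : Fin N, Hent μ (fun x => itin S G N x j) = Hent μ G := fun j =>
          Hent_preT μ hGm (hSp.iterate j)
        simp [this]
      obtain ⟨Y, hYμ, p, D, hp, hYD, hD⟩ := hC (N * M)
      have hYne : Y.Nonempty := by
        by_contra h
        rw [Set.not_nonempty_iff_eq_empty] at h
        rw [h] at hYμ
        simp at hYμ; linarith
      -- itineraries on D i
      let cc : Fin p → Fin N → ι := fun i j =>
        if h : ∃ x ∈ D i, S^[j] x ∈ Y0 then F (S^[j] h.choose) else F hne.some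
      have hcc : ∀ i, ∀ x ∈ D i, ∀ j : Fin N, S^[j] x ∈ Y0 → F (S^[j] x) = cc i j := by
        intro i x hx j hxj
        have hex : ∃ x ∈ D i, S^[j] x ∈ Y0 := ⟨x, hx, hxj⟩
        have hccj : cc i j = F (S^[j] hex.choose) := dif_pos hex
        rw [hccj]
        obtain ⟨h1, h2⟩ := hex.choose_spec
        apply hVs' _ _ hxj h2
        have hiter : ∀ y, S^[(j : ℕ)] y = T^[M * j] y := fun y => by rw [hS, ← Function.iterate_mul]
        rw [hiter, hiter]
        refine hD i x hx _ h1 _ ?_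
        have := j.2
        calc M * j < M * N := Nat.mul_lt_mul_of_pos_left this hM
          _ = N * M := mul_comm _ _
      let dec : (Fin p × (Fin N → Bool)) → (Fin N → Option ι) := fun q j =>
        if q.2 j then some (cc q.1 j) else none
      let SS : Finset (Fin N → Option ι) := Finset.univ.image dec
      have hSS : ∀ x ∈ Y, itin S F' N x ∈ SS := by
        intro x hx
        obtain ⟨i, hi⟩ := Set.mem_iUnion.1 (hYD hx)
        refine Finset.mem_image.2 ⟨(i, fun j => decide (S^[j] x ∈ Y0)), Finset.mem_univ _, ?_⟩
        funext j
        by_cases h : S^[j] x ∈ Y0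
        · simp [dec, itin, F', h, hcc i x hi j h]
        · simp [dec, itin, F', h]
      have hSSc : (SS.card : ℝ) ≤ C * Real.exp (s * (N * M)) * 2 ^ N := by
        have : SS.card ≤ p * 2 ^ N := by
          refine Finset.card_image_le.trans ?_
          simp
        calc (SS.card : ℝ) ≤ p * 2 ^ N := by exact_mod_cast this
          _ ≤ _ := by
            gcongr
            simpa using hp
      have h4 := Hent_le_count' μ (hF'm.itin hSp.measurable N) Y hYne SS hSS _ hSSc δ hYμ (N * c) (by
        rw [hc]; simp)
      have hCpos : 0 < C := by linarith
      rw [Real.log_mul (by positivity) (by positivity), Real.log_mul (by positivity) (by positivity),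
        Real.log_exp, Real.log_pow] at h4
      have hN' : (0:ℝ) < N := by exact_mod_cast hN
      have hM' : (0:ℝ) < M := by exact_mod_cast hM
      have hM1 : (1:ℝ) ≤ M := by exact_mod_cast hM
      have h5 := hmap_le T μ f (N * M) (Nat.mul_pos hN hM)
      have h6 : Hent μ (itin T f (N * M)) ≤ 1 + Real.log C + s * (N * M) + 3 * N := by
        have a1 : δ * (N * c) ≤ N * (1/2) := by nlinarith
        have a2 : (N : ℝ) * Hent μ G ≤ N * (1 + 1/2) := by gcongr; linarith
        have a3 : (N : ℝ) * Real.log 2 ≤ N * 1 := by gcongr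
        linarith
      have hlC : 0 ≤ Real.log C := Real.log_nonneg hC1
      calc _ ≤ _ := h5
        _ ≤ (1 + Real.log C + s * (N * M) + 3 * N) / ((N * M : ℕ) : ℝ) := by gcongr
        _ = s + 3 / M + (1 + Real.log C) / (N * M) := by push_cast; field_simp; ring
        _ ≤ _ := by
          gcongr
          nlinarith
    have ht : Tendsto (fun N : ℕ => s + 3 / M + (1 + Real.log C) / (N : ℝ)) atTop (𝓝 (s + 3 / M + 0)) :=
      tendsto_const_nhds.add (tendsto_const_div_atTop_nhds_zero_nat _)
    have := ge_of_tendsto ht (by filter_upwards [eventually_gt_atTop 0] with N hN using bound N hN)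
    have hM' : (0:ℝ) < M := by exact_mod_cast hM
    have : (3:ℝ) / M ≤ 4 / M := by gcongr; norm_num
    linarith
  have ht : Tendsto (fun M : ℕ => s + 4 / (M : ℝ)) atTop (𝓝 (s + 0)) :=
    tendsto_const_nhds.add (tendsto_const_div_atTop_nhds_zero_nat _)
  have := ge_of_tendsto ht (by filter_upwards [eventually_gt_atTop 0] with N hN using main N hN)
  linarith

end PartU1

section PartTop

/-! ## Part Top: topology of the space of lattices -/

/-- shorthand for the group -/
abbrev GSp (d : ℕ) := Matrix.SpecialLinearGroup (Fin d) ℝ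

instance instTG (d : ℕ) : IsTopologicalGroup (GSp d) :=
  Matrix.SpecialLinearGroup.topologicalGroup (n := Fin d) (R := ℝ)

lemma GSp_closedEmb (d : ℕ) : IsClosedEmbedding (Subtype.val : GSp d → Matrix (Fin d) (Fin d) ℝ) :=
  Matrix.SpecialLinearGroup.isClosedEmbedding_val (n := Fin d) (R := ℝ)

instance instMSC (d : ℕ) : SecondCountableTopology (Matrix (Fin d) (Fin d) ℝ) :=
  inferInstanceAs (SecondCountableTopology (Fin d → Fin d → ℝ))
instance instMLC (d : ℕ) : LocallyCompactSpace (Matrix (Fin d) (Fin d) ℝ) :=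
  inferInstanceAs (LocallyCompactSpace (Fin d → Fin d → ℝ))
instance instMT2 (d : ℕ) : T2Space (Matrix (Fin d) (Fin d) ℝ) :=
  inferInstanceAs (T2Space (Fin d → Fin d → ℝ))

instance instGSC (d : ℕ) : SecondCountableTopology (GSp d) :=
  (GSp_closedEmb d).isEmbedding.secondCountableTopology
instance instGT2 (d : ℕ) : T2Space (GSp d) := (GSp_closedEmb d).isEmbedding.t2Space
instance instGLC (d : ℕ) : LocallyCompactSpace (GSp d) := (GSp_closedEmb d).locallyCompactSpace

lemma continuous_val (d : ℕ) : Continuous (fun g : GSp d => (g : Matrix (Fin d) (Fin d) ℝ)) :=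
  (GSp_closedEmb d).continuous

lemma Gamma_closed (d : ℕ) : IsClosed (Gamma d : Set (GSp d)) := by
  have : IsClosedEmbedding (Matrix.SpecialLinearGroup.map (n := Fin d) (Int.castRingHom ℝ)) :=
    Topology.IsClosedEmbedding.specialLinearGroup_map (f := Int.castRingHom ℝ) Int.isClosedEmbedding_coe_real
  exact this.isClosed_range

lemma mem_Gamma {d : ℕ} {g : GSp d} (hg : g ∈ Gamma d) : ∃ A : Matrix.SpecialLinearGroup (Fin d) ℤ,
    (g : Matrix (Fin d) (Fin d) ℝ) = (A : Matrix (Fin d) (Fin d) ℤ).map (fun z : ℤ => (z : ℝ)) := by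
  obtain ⟨A, rfl⟩ := hg
  exact ⟨A, rfl⟩

lemma Gamma_disc (d : ℕ) : ∃ U ∈ 𝓝 (1 : GSp d), ∀ g ∈ U, g ∈ Gamma d → g = 1 := by
  refine ⟨{g | ∀ i j, |(g : Matrix (Fin d) (Fin d) ℝ) i j - (1 : Matrix (Fin d) (Fin d) ℝ) i j| < 1}, ?_, ?_⟩
  · apply IsOpen.mem_nhds
    · simp only [Set.ofPred_forall]
      refine isOpen_iInter_of_finite fun i => isOpen_iInter_of_finite fun j => ?_
      refine isOpen_lt ?_ continuous_const
      exact (((continuous_val d).matrix_elem i j).sub continuous_const).abs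
    · intro i j; simp
  · intro g hg hG
    obtain ⟨A, hA⟩ := mem_Gamma hG
    apply Subtype.ext
    ext i j
    have := hg i j
    rw [hA] at this ⊢
    simp only [Matrix.map_apply, SpecialLinearGroup.coe_one] at this ⊢
    by_cases hij : i = j
    · subst hij
      simp only [one_apply_eq] at this ⊢
      have h2 : |((A.1 i i - 1 : ℤ) : ℝ)| < 1 := by push_cast; exact this
      have h3 : |A.1 i i - 1| < 1 := by exact_mod_cast h2
      have h4 := Int.abs_lt_one_iff.1 h3
      have : A.1 i i = 1 := by omega
      show ((A.1 i i : ℤ) : ℝ) = (1 : Matrix (Fin d) (Fin d) ℝ) i i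
      rw [one_apply_eq, this]; simp
    · simp only [one_apply_ne hij, sub_zero] at this ⊢
      have h3 : |A.1 i j| < 1 := by exact_mod_cast this
      show ((A.1 i j : ℤ) : ℝ) = (1 : Matrix (Fin d) (Fin d) ℝ) i j
      rw [one_apply_ne hij, Int.abs_lt_one_iff.1 h3]; simp

instance instXSC (d : ℕ) : SecondCountableTopology (XSp d) := inferInstance
instance instXLC (d : ℕ) : LocallyCompactSpace (XSp d) := inferInstance

instance instXT2 (d : ℕ) : T2Space (XSp d) := by
  rw [t2Space_iff_of_isOpenQuotientMap (QuotientGroup.isOpenQuotientMap_mk (G := GSp d) (N := Gamma d))]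
  have : {q : GSp d × GSp d | (QuotientGroup.mk q.1 : XSp d) = QuotientGroup.mk q.2} =
      (fun q => q.1⁻¹ * q.2) ⁻¹' (Gamma d : Set (GSp d)) := by
    ext q
    simp [QuotientGroup.eq]
  rw [this]
  exact (Gamma_closed d).preimage (by fun_prop)

instance instXBorel (d : ℕ) : BorelSpace (XSp d) := ⟨rfl⟩

instance instXsmul (d : ℕ) : ContinuousSMul (GSp d) (XSp d) := inferInstance

instance instXmet (d : ℕ) : TopologicalSpace.MetrizableSpace (XSp d) :=
  TopologicalSpace.metrizableSpace_of_t3_secondCountable _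

lemma smul_mk {d : ℕ} (g h : GSp d) : g • (QuotientGroup.mk h : XSp d) = QuotientGroup.mk (g * h) := rfl

lemma X_reg {d : ℕ} (μ : Measure (XSp d)) [IsFiniteMeasure μ] (S : Set (XSp d)) (hS : MeasurableSet S)
    (ε : ℝ) (hε : 0 < ε) : ∃ K ⊆ S, IsCompact K ∧ MeasurableSet K ∧ μ.real (S \ K) ≤ ε := by
  letI := TopologicalSpace.metrizableSpaceMetric (XSp d)
  obtain ⟨K, hK, hc, hμ⟩ := hS.exists_isCompact_sdiff_lt (measure_ne_top μ S)
    (ε := ENNReal.ofReal ε) (by simpa using hε)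
  refine ⟨K, hK, hc, hc.measurableSet, ?_⟩
  rw [Measure.real]
  exact ENNReal.toReal_le_of_le_ofReal hε.le hμ.le

/-- relations coming from neighbourhoods of the identity -/
def relN {d : ℕ} (V : Set (GSp d)) : Set (XSp d × XSp d) := {p | ∃ g ∈ V, p.2 = g • p.1}

lemma sep_two {d : ℕ} {K L : Set (XSp d)} (hK : IsCompact K) (hL : IsCompact L) (hKL : Disjoint K L) :
    ∃ V ∈ 𝓝 (1 : GSp d), ∀ x ∈ K, ∀ y ∈ L, (x, y) ∉ relN V := by
  have ho : IsOpen {p : GSp d × XSp d | p.1 • p.2 ∉ L} :=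
    hL.isClosed.isOpen_compl.preimage continuous_smul
  obtain ⟨V, W, hV, -, h1, hKW, hVW⟩ := generalized_tube_lemma (isCompact_singleton (x := (1 : GSp d))) hK ho (by
    rintro ⟨g, x⟩ ⟨hg, hx⟩
    simp only [Set.mem_singleton_iff] at hg
    subst hg
    simp only [Set.mem_ofPred_eq, one_smul]
    exact Set.disjoint_left.1 hKL hx)
  refine ⟨V, hV.mem_nhds (h1 rfl), fun x hx y hy ⟨g, hg, he⟩ => ?_⟩
  have := hVW (Set.mk_mem_prod hg (hKW hx))
  simp only at he
  rw [he] at hy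
  exact this hy

lemma relN_sep {d : ℕ} (p : ℕ) (K : Fin p → Set (XSp d)) (hK : ∀ i, IsCompact (K i))
    (hd : Pairwise (Function.onFun Disjoint K)) :
    ∃ V ∈ {R : Set (XSp d × XSp d) | ∃ V ∈ 𝓝 (1 : GSp d), R = relN V},
      ∀ i j, i ≠ j → ∀ x ∈ K i, ∀ y ∈ K j, (x, y) ∉ V := by
  have h : ∀ ij : Fin p × Fin p, ∃ V ∈ 𝓝 (1 : GSp d), ij.1 ≠ ij.2 → ∀ x ∈ K ij.1, ∀ y ∈ K ij.2, (x, y) ∉ relN V := by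
    rintro ⟨i, j⟩
    by_cases hij : i = j
    · exact ⟨Set.univ, univ_mem, fun h => absurd hij h⟩
    · obtain ⟨V, hV, h⟩ := sep_two (hK i) (hK j) (hd hij)
      exact ⟨V, hV, fun _ => h⟩
  choose V hV h using h
  refine ⟨relN (⋂ ij, V ij), ⟨_, Filter.iInter_mem.2 hV, rfl⟩, fun i j hij x hx y hy ⟨g, hg, he⟩ => ?_⟩
  exact h (i, j) hij x hx y hy ⟨g, Set.mem_iInter.1 hg _, he⟩

lemma inj_rad {d : ℕ} {K : Set (XSp d)} (hK : IsCompact K) :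
    ∃ V ∈ 𝓝 (1 : GSp d), ∀ x ∈ K, ∀ g ∈ V, g • x = x → g = 1 := by
  obtain ⟨U, hU, hUG⟩ := Gamma_disc d
  refine hK.induction_on (p := fun K => ∃ V ∈ 𝓝 (1 : GSp d), ∀ x ∈ K, ∀ g ∈ V, g • x = x → g = 1)
    ⟨Set.univ, univ_mem, by simp⟩ ?_ ?_ ?_
  · rintro s t hst ⟨V, hV, h⟩
    exact ⟨V, hV, fun x hx => h x (hst hx)⟩
  · rintro s t ⟨V, hV, h⟩ ⟨V', hV', h'⟩
    refine ⟨V ∩ V', inter_mem hV hV', ?_⟩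
    rintro x (hx | hx) g hg
    · exact h x hx g hg.1
    · exact h' x hx g hg.2
  · intro x _
    obtain ⟨h, rfl⟩ := QuotientGroup.mk_surjective x
    have hc : ContinuousAt (fun p : GSp d × GSp d => p.2⁻¹ * p.1 * p.2) (1, h) := by fun_prop
    have := hc.preimage_mem_nhds (by simpa using hU)
    obtain ⟨V, hV, W, hW, hVW⟩ := mem_nhds_prod_iff.1 this
    refine ⟨(QuotientGroup.mk '' W : Set (XSp d)), mem_nhdsWithin_of_mem_nhds
      (QuotientGroup.isOpenMap_coe.image_mem_nhds hW), V, hV, ?_⟩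
    rintro _ ⟨w, hw, rfl⟩ g hg he
    rw [smul_mk, QuotientGroup.eq] at he
    have h1 : w⁻¹ * g * w ∈ Gamma d := by
      have := (Gamma d).inv_mem he
      simpa [mul_assoc] using this
    have hm := hVW (Set.mk_mem_prod hg hw)
    rw [Set.mem_preimage] at hm
    have h2 : w⁻¹ * g * w = 1 := hUG _ hm h1
    have : g = w * (w⁻¹ * g * w) * w⁻¹ := by group
    rw [this, h2]; group

/-- small neighbourhoods -/
lemma small_nhds {d : ℕ} (x : XSp d) {V : Set (GSp d)} (hV : V ∈ 𝓝 (1 : GSp d)) :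
    ∃ O ∈ 𝓝 x, ∀ y ∈ O, ∀ y' ∈ O, ∃ g ∈ V, y' = g • y := by
  have hc : ContinuousAt (fun p : GSp d × GSp d => p.2 * p.1⁻¹) (1, 1) := by fun_prop
  have := hc.preimage_mem_nhds (by simpa using hV)
  obtain ⟨W, hW, W', hW', hVW⟩ := mem_nhds_prod_iff.1 this
  obtain ⟨h, rfl⟩ := QuotientGroup.mk_surjective x
  have hn : ((fun g => g * h) '' (W ∩ W')) ∈ 𝓝 h := by
    have := (Homeomorph.mulRight h).isOpenMap.image_mem_nhds (inter_mem hW hW')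
    simpa using this
  refine ⟨(QuotientGroup.mk '' ((fun g => g * h) '' (W ∩ W')) : Set (XSp d)),
    QuotientGroup.isOpenMap_coe.image_mem_nhds hn, ?_⟩
  rintro _ ⟨_, ⟨w, hw, rfl⟩, rfl⟩ _ ⟨_, ⟨w', hw', rfl⟩, rfl⟩
  refine ⟨w' * w⁻¹, hVW (Set.mk_mem_prod hw.1 hw'.2), ?_⟩
  rw [smul_mk]; simp [mul_assoc]

lemma aAct_continuous (m n : ℕ) (hm : 0 < m) (hn : 0 < n) : Continuous (aAct m n hm hn) :=
  continuous_const_smul _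
lemma aAct_measurable (m n : ℕ) (hm : 0 < m) (hn : 0 < n) : Measurable (aAct m n hm hn) :=
  (aAct_continuous m n hm hn).measurable

end PartTop

section PartCoord

/-! ## Part Coord: block coordinates -/

/-- real matrices as functions -/
abbrev Mt (m n : ℕ) := Fin m → Fin n → ℝ

/-- first block of a vector -/
def v1 {m n : ℕ} (w : Fin (m + n) → ℝ) : Fin m → ℝ := fun i => w (Fin.castAdd n i)
/-- second block of a vector -/
def v2 {m n : ℕ} (w : Fin (m + n) → ℝ) : Fin n → ℝ := fun j => w (Fin.natAdd m j)

lemma norm_le_iff12 {m n : ℕ} (w : Fin (m + n) → ℝ) {r : ℝ} (hr : 0 ≤ r) :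
    ‖w‖ ≤ r ↔ ‖v1 w‖ ≤ r ∧ ‖v2 w‖ ≤ r := by
  rw [pi_norm_le_iff_of_nonneg hr, pi_norm_le_iff_of_nonneg hr, pi_norm_le_iff_of_nonneg hr,
    Fin.forall_fin_add]
  rfl

lemma norm_v1_le {m n : ℕ} (w : Fin (m + n) → ℝ) : ‖v1 w‖ ≤ ‖w‖ :=
  ((norm_le_iff12 w (norm_nonneg _)).1 le_rfl).1
lemma norm_v2_le {m n : ℕ} (w : Fin (m + n) → ℝ) : ‖v2 w‖ ≤ ‖w‖ :=
  ((norm_le_iff12 w (norm_nonneg _)).1 le_rfl).2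

lemma ext12 {m n : ℕ} {w w' : Fin (m + n) → ℝ} (h1 : v1 w = v1 w') (h2 : v2 w = v2 w') : w = w' := by
  ext i
  induction i using Fin.addCases with
  | left i => exact congrFun h1 i
  | right i => exact congrFun h2 i

lemma uMat_mul (m n : ℕ) (A B : Mt m n) : uMat m n A * uMat m n B = uMat m n (A + B) := by
  simp only [uMat, reindex_apply, submatrix_mul_equiv, fromBlocks_multiply]
  congr 1
  simp only [Matrix.mul_zero, add_zero, Matrix.one_mul, Matrix.zero_mul, Matrix.mul_one, zero_add]
  rw [add_comm]; rfl

lemma uMat_zero (m n : ℕ) : uMat m n 0 = 1 := by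
  simp [uMat]

lemma aMat_mul (m n : ℕ) (s t : ℝ) : aMat m n s * aMat m n t = aMat m n (s + t) := by
  simp only [aMat, reindex_apply, submatrix_mul_equiv, fromBlocks_multiply]
  congr 1
  simp [smul_smul, ← Real.exp_add, add_div]
  congr 2; ring_nf

lemma aMat_zero (m n : ℕ) : aMat m n 0 = 1 := by
  simp [aMat]

/-- expansion factor -/
def lamE (m n : ℕ) (t : ℝ) : ℝ := Real.exp (t / m + t / n)

lemma lamE_pos (m n : ℕ) (t : ℝ) : 0 < lamE m n t := Real.exp_pos _
lemma lamE_add (m n : ℕ) (s t : ℝ) : lamE m n (s + t) = lamE m n s * lamE m n t := by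
  simp only [lamE, ← Real.exp_add]; congr 1; ring
lemma lamE_zero (m n : ℕ) : lamE m n 0 = 1 := by simp [lamE]
lemma lamE_neg (m n : ℕ) (t : ℝ) : lamE m n (-t) = (lamE m n t)⁻¹ := by
  rw [lamE, lamE, ← Real.exp_neg]; congr 1; ring
lemma lamE_mono (m n : ℕ) {s t : ℝ} (h : s ≤ t) : lamE m n s ≤ lamE m n t := by
  unfold lamE; gcongr
lemma one_le_lamE (m n : ℕ) {t : ℝ} (h : 0 ≤ t) : 1 ≤ lamE m n t := by
  rw [← lamE_zero m n]; exact lamE_mono m n h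

lemma lamE_pow {m n : ℕ} (hm : 0 < m) (hn : 0 < n) (t : ℝ) :
    (lamE m n t) ^ (m * n) = Real.exp ((m + n) * t) := by
  have hm' : (m : ℝ) ≠ 0 := Nat.cast_ne_zero.mpr hm.ne'
  have hn' : (n : ℝ) ≠ 0 := Nat.cast_ne_zero.mpr hn.ne'
  rw [lamE, ← Real.exp_nat_mul]; congr 1; push_cast; field_simp; ring

lemma aMat_uMat (m n : ℕ) (t : ℝ) (A : Mt m n) :
    aMat m n t * uMat m n A = uMat m n (lamE m n t • A) * aMat m n t := by
  simp only [aMat, uMat, reindex_apply, submatrix_mul_equiv, fromBlocks_multiply]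
  congr 1
  simp only [Matrix.mul_zero, add_zero, Matrix.zero_mul, Matrix.mul_one, zero_add, Matrix.one_mul]
  congr 1
  rw [Matrix.smul_mul, Matrix.one_mul, Matrix.mul_smul, Matrix.mul_one]
  ext i j
  simp only [Matrix.smul_apply, of_apply, Pi.smul_apply, smul_eq_mul, lamE]
  rw [← mul_assoc, ← Real.exp_add]
  congr 2; ring

lemma v1_uMat {m n : ℕ} (A : Mt m n) (w : Fin (m + n) → ℝ) (i : Fin m) :
    v1 (uMat m n A *ᵥ w) i = v1 w i + ∑ j, A i j * v2 w j := by
  simp only [v1, v2, uMat, mulVec, dotProduct, Fin.sum_univ_add, reindex_apply, submatrix_apply,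
    finSumFinEquiv_symm_apply_castAdd, finSumFinEquiv_symm_apply_natAdd, fromBlocks_apply₁₁,
    fromBlocks_apply₁₂, of_apply]
  congr 1
  simp [one_apply]

lemma v2_uMat {m n : ℕ} (A : Mt m n) (w : Fin (m + n) → ℝ) :
    v2 (uMat m n A *ᵥ w) = v2 w := by
  ext i
  simp only [v2, uMat, mulVec, dotProduct, Fin.sum_univ_add, reindex_apply, submatrix_apply,
    finSumFinEquiv_symm_apply_castAdd, finSumFinEquiv_symm_apply_natAdd, fromBlocks_apply₂₁,
    fromBlocks_apply₂₂]
  simp [one_apply]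

lemma v1_aMat {m n : ℕ} (t : ℝ) (w : Fin (m + n) → ℝ) :
    v1 (aMat m n t *ᵥ w) = Real.exp (t / m) • v1 w := by
  ext i
  simp only [v1, aMat, mulVec, dotProduct, Fin.sum_univ_add, reindex_apply, submatrix_apply,
    finSumFinEquiv_symm_apply_castAdd, finSumFinEquiv_symm_apply_natAdd, fromBlocks_apply₁₁,
    fromBlocks_apply₁₂]
  simp [one_apply]
  rfl

lemma v2_aMat {m n : ℕ} (t : ℝ) (w : Fin (m + n) → ℝ) :
    v2 (aMat m n t *ᵥ w) = Real.exp (-(t / n)) • v2 w := by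
  ext i
  simp only [v2, aMat, mulVec, dotProduct, Fin.sum_univ_add, reindex_apply, submatrix_apply,
    finSumFinEquiv_symm_apply_castAdd, finSumFinEquiv_symm_apply_natAdd, fromBlocks_apply₂₁,
    fromBlocks_apply₂₂]
  simp [one_apply]
  rfl

/-- bundled parameters -/
lemma uSL_mul (m n : ℕ) (A B : Mt m n) : uSL m n A * uSL m n B = uSL m n (A + B) :=
  Subtype.ext (uMat_mul m n A B)
lemma uSL_zero (m n : ℕ) : uSL m n 0 = 1 := Subtype.ext (uMat_zero m n)
lemma uSL_inv (m n : ℕ) (A : Mt m n) : (uSL m n A)⁻¹ = uSL m n (-A) := by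
  rw [inv_eq_iff_mul_eq_one, uSL_mul, add_neg_cancel, uSL_zero]
lemma aSL_mul (m n : ℕ) (hm : 0 < m) (hn : 0 < n) (s t : ℝ) :
    aSL m n hm hn s * aSL m n hm hn t = aSL m n hm hn (s + t) := Subtype.ext (aMat_mul m n s t)
lemma aSL_zero (m n : ℕ) (hm : 0 < m) (hn : 0 < n) : aSL m n hm hn 0 = 1 := Subtype.ext (aMat_zero m n)
lemma aSL_inv (m n : ℕ) (hm : 0 < m) (hn : 0 < n) (t : ℝ) :
    (aSL m n hm hn t)⁻¹ = aSL m n hm hn (-t) := by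
  rw [inv_eq_iff_mul_eq_one, aSL_mul, add_neg_cancel, aSL_zero]
lemma aSL_uSL (m n : ℕ) (hm : 0 < m) (hn : 0 < n) (t : ℝ) (A : Mt m n) :
    aSL m n hm hn t * uSL m n A = uSL m n (lamE m n t • A) * aSL m n hm hn t :=
  Subtype.ext (aMat_uMat m n t A)

lemma aAct_iter (m n : ℕ) (hm : 0 < m) (hn : 0 < n) (k : ℕ) (x : XSp (m + n)) :
    (aAct m n hm hn)^[k] x = aSL m n hm hn k • x := by
  induction k with
  | zero => simp [aSL_zero]
  | succ k ih =>
    rw [Function.iterate_succ_apply', ih, aAct, smul_smul, aSL_mul]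
    congr 2; push_cast; ring

lemma uSL_continuous (m n : ℕ) : Continuous (uSL m n) := by
  refine Continuous.subtype_mk ?_ _
  refine continuous_matrix fun i j => ?_
  induction i using Fin.addCases with
  | left i =>
    induction j using Fin.addCases with
    | left j => simp [uMat]; exact continuous_const
    | right j => simp [uMat]; fun_prop
  | right i =>
    induction j using Fin.addCases with
    | left j => simp [uMat]; exact continuous_const
    | right j => simp [uMat]; exact continuous_const

/-! ### neighbourhoods -/

/-- entrywise neighbourhoods of the identity -/
def Nb {d : ℕ} (θ : ℝ) : Set (GSp d) :=
  {g | ∀ i j, |(g : Matrix (Fin d) (Fin d) ℝ) i j - (1 : Matrix (Fin d) (Fin d) ℝ) i j| < θ}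

lemma Nb_mem {d : ℕ} {θ : ℝ} (hθ : 0 < θ) : (Nb θ : Set (GSp d)) ∈ 𝓝 (1 : GSp d) := by
  apply IsOpen.mem_nhds
  · simp only [Nb, Set.ofPred_forall]
    refine isOpen_iInter_of_finite fun i => isOpen_iInter_of_finite fun j => ?_
    refine isOpen_lt ?_ continuous_const
    exact (((continuous_val d).matrix_elem i j).sub continuous_const).abs
  · intro i j; simpa using hθ

lemma Nb_basis {d : ℕ} {V : Set (GSp d)} (hV : V ∈ 𝓝 (1 : GSp d)) : ∃ θ > 0, (Nb θ : Set (GSp d)) ⊆ V := by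
  have e : 𝓝 (1 : GSp d) = comap (fun g : GSp d => (g : Matrix (Fin d) (Fin d) ℝ))
      (𝓝 (1 : Matrix (Fin d) (Fin d) ℝ)) :=
    (GSp_closedEmb d).isEmbedding.isInducing.nhds_eq_comap (1 : GSp d)
  rw [e, mem_comap] at hV
  obtain ⟨U, hU, hUV⟩ := hV
  let o : Fin d → Fin d → ℝ := fun i j => (1 : Matrix (Fin d) (Fin d) ℝ) i j
  have hU' : (show Set (Fin d → Fin d → ℝ) from U) ∈ 𝓝 o := hU
  obtain ⟨θ, hθ, h⟩ := Metric.mem_nhds_iff.1 hU'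
  refine ⟨θ, hθ, fun g hg => hUV (h ?_)⟩
  show (fun i j => (g : Matrix (Fin d) (Fin d) ℝ) i j) ∈ Metric.ball o θ
  rw [Metric.mem_ball, dist_pi_lt_iff hθ]
  intro i
  rw [dist_pi_lt_iff hθ]
  intro j
  exact hg i j

lemma Nb_mono {d : ℕ} {θ θ' : ℝ} (h : θ ≤ θ') : (Nb θ : Set (GSp d)) ⊆ Nb θ' :=
  fun _ hg i j => (hg i j).trans_le h

/-- block lower triangular elements -/
def LTri (m n : ℕ) : Set (GSp (m + n)) :=
  {g | ∀ (i : Fin m) (j : Fin n), (g : Matrix (Fin (m+n)) (Fin (m+n)) ℝ) (Fin.castAdd n i) (Fin.natAdd m j) = 0}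

lemma aMat_left {m n : ℕ} (t : ℝ) (i : Fin m) (j : Fin (m + n)) :
    aMat m n t (Fin.castAdd n i) j = if Fin.castAdd n i = j then Real.exp (t / m) else 0 := by
  induction j using Fin.addCases with
  | left j => simp [aMat, one_apply]
  | right j => simp [aMat, Fin.ext_iff]; omega

lemma aMat_right {m n : ℕ} (t : ℝ) (i : Fin n) (j : Fin (m + n)) :
    aMat m n t (Fin.natAdd m i) j = if Fin.natAdd m i = j then Real.exp (-(t / n)) else 0 := by
  induction j using Fin.addCases with
  | left j => simp [aMat, Fin.ext_iff]; omega
  | right j => simp [aMat, one_apply]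

/-- diagonal weights -/
def wt (m n : ℕ) (t : ℝ) (i : Fin (m + n)) : ℝ :=
  Fin.addCases (fun _ => Real.exp (t / m)) (fun _ => Real.exp (-(t / n))) i

lemma aMat_diag (m n : ℕ) (t : ℝ) : aMat m n t = diagonal (wt m n t) := by
  ext i j
  rw [diagonal_apply]
  induction i using Fin.addCases with
  | left i => rw [aMat_left]; simp [wt]
  | right i => rw [aMat_right]; simp [wt]

lemma conj_apply {m n : ℕ} (hm : 0 < m) (hn : 0 < n) (t : ℝ) (g : GSp (m + n)) (i j : Fin (m + n)) :
    ((aSL m n hm hn t * g * (aSL m n hm hn t)⁻¹ : GSp (m + n)) : Matrix (Fin (m+n)) (Fin (m+n)) ℝ) i j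
      = wt m n t i * (g : Matrix (Fin (m+n)) (Fin (m+n)) ℝ) i j * wt m n (-t) j := by
  rw [aSL_inv]
  show (aMat m n t * (g : Matrix (Fin (m+n)) (Fin (m+n)) ℝ) * aMat m n (-t)) i j = _
  rw [aMat_diag, aMat_diag, mul_diagonal, diagonal_mul]

lemma LTri_conj {m n : ℕ} (hm : 0 < m) (hn : 0 < n) {t : ℝ} (ht : 0 ≤ t) {θ : ℝ} (hθ : 0 < θ) {g : GSp (m + n)}
    (hg : g ∈ LTri m n) (hθg : g ∈ (Nb θ : Set (GSp (m + n)))) :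
    aSL m n hm hn t * g * (aSL m n hm hn t)⁻¹ ∈ (Nb θ : Set (GSp (m + n))) := by
  intro i j
  rw [conj_apply]
  have key := hθg i j
  induction i using Fin.addCases with
  | left i =>
    induction j using Fin.addCases with
    | left j =>
      have : Real.exp (t / m) * Real.exp (-t / m) = 1 := by
        rw [← Real.exp_add, neg_div, add_neg_cancel, Real.exp_zero]
      simp only [wt, Fin.addCases_left]
      rw [mul_right_comm, this, one_mul]; exact key
    | right j =>
      rw [hg i j]
      rw [one_apply_ne (by simp [Fin.ext_iff]; omega)]
      simpa using hθ
  | right i =>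
    induction j using Fin.addCases with
    | left j =>
      rw [one_apply_ne (by simp [Fin.ext_iff]; omega)] at key ⊢
      simp only [wt, Fin.addCases_left, Fin.addCases_right]
      rw [sub_zero] at key ⊢
      rw [abs_mul, abs_mul, Real.abs_exp, Real.abs_exp]
      have h1 : Real.exp (-(t / n)) ≤ 1 := by rw [Real.exp_le_one_iff]; have : 0 ≤ t / n := by positivity
                                              linarith
      have h2 : Real.exp (-t / m) ≤ 1 := by rw [Real.exp_le_one_iff, neg_div]; have : 0 ≤ t / m := by positivity
                                            linarith
      refine lt_of_le_of_lt ?_ key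
      have h3 := abs_nonneg ((g : Matrix (Fin (m+n)) (Fin (m+n)) ℝ) (Fin.natAdd m i) (Fin.castAdd n j))
      calc _ ≤ 1 * |(g : Matrix (Fin (m+n)) (Fin (m+n)) ℝ) (Fin.natAdd m i) (Fin.castAdd n j)| * 1 := by gcongr
        _ = _ := by ring
    | right j =>
      have : Real.exp (-(t / n)) * Real.exp (-(-t / n)) = 1 := by
        rw [← Real.exp_add]; simp [neg_div]
      simp only [wt, Fin.addCases_right]
      rw [mul_right_comm, this, one_mul]; exact key

lemma uSL_Nb {m n : ℕ} {θ : ℝ} (hθ : 0 < θ) {A : Mt m n} (hA : ‖A‖ < θ) :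
    uSL m n A ∈ (Nb θ : Set (GSp (m + n))) := by
  intro i j
  show |uMat m n A i j - _| < _
  induction i using Fin.addCases with
  | left i =>
    induction j using Fin.addCases with
    | left j => simpa [uMat, one_apply] using hθ
    | right j =>
      rw [one_apply_ne (by simp [Fin.ext_iff]; omega)]
      simp only [uMat, reindex_apply, submatrix_apply, finSumFinEquiv_symm_apply_castAdd,
        finSumFinEquiv_symm_apply_natAdd, fromBlocks_apply₁₂, of_apply, sub_zero]
      exact ((norm_le_pi_norm (A i) j).trans (norm_le_pi_norm A i)).trans_lt hA
  | right i =>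
    induction j using Fin.addCases with
    | left j =>
      rw [one_apply_ne (by simp [Fin.ext_iff]; omega)]
      simpa [uMat] using hθ
    | right j => simpa [uMat, one_apply] using hθ

lemma decomp {m n : ℕ} {θ : ℝ} (hθ : 0 < θ) : ∃ W ∈ 𝓝 (1 : GSp (m + n)), ∀ g ∈ W, ∃ h ∈ LTri m n,
    h ∈ (Nb θ : Set (GSp (m + n))) ∧ ∃ B : Mt m n, ‖B‖ < θ ∧ g = h * uSL m n B := by
  classical
  let P : GSp (m + n) → Matrix (Fin m) (Fin m) ℝ := fun g =>
    (g : Matrix (Fin (m+n)) (Fin (m+n)) ℝ).submatrix (Fin.castAdd n) (Fin.castAdd n)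
  let Q : GSp (m + n) → Matrix (Fin m) (Fin n) ℝ := fun g =>
    (g : Matrix (Fin (m+n)) (Fin (m+n)) ℝ).submatrix (Fin.castAdd n) (Fin.natAdd m)
  have hP : Continuous P := (continuous_val _).matrix_submatrix _ _
  have hQ : Continuous Q := (continuous_val _).matrix_submatrix _ _
  have hP1 : P 1 = 1 := by
    ext i j; simp [P, one_apply]
  have hQ1 : Q 1 = 0 := by
    ext i j
    show (1 : Matrix (Fin (m+n)) (Fin (m+n)) ℝ) (Fin.castAdd n i) (Fin.natAdd m j) = 0
    rw [one_apply_ne (by simp [Fin.ext_iff]; omega)]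
  let β : GSp (m + n) → Mt m n := fun g => Matrix.of.symm ((P g)⁻¹ * Q g)
  have hdet : ∀ᶠ g in 𝓝 (1 : GSp (m + n)), (P g).det ≠ 0 := by
    have : ContinuousAt (fun g => (P g).det) 1 := hP.matrix_det.continuousAt
    refine this.eventually_ne ?_
    simp [hP1]
  have hβ : ContinuousAt β 1 := by
    have h1 : ContinuousAt (fun g => (P g)⁻¹ * Q g) 1 := by
      suffices h0 : ContinuousAt (fun g => (P g)⁻¹) 1 from
        (show Continuous (fun p : Matrix (Fin m) (Fin m) ℝ × Matrix (Fin m) (Fin n) ℝ => p.1 * p.2) by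
          fun_prop).continuousAt.comp (h0.prodMk hQ.continuousAt)
      have : ContinuousAt (fun M : Matrix (Fin m) (Fin m) ℝ => M⁻¹) (P 1) := by
        refine continuousAt_matrix_inv _ ?_
        simp only [hP1, det_one]
        exact NormedRing.inverse_continuousAt (1 : ℝˣ)
      exact ContinuousAt.comp (f := P) (g := fun M => M⁻¹) this hP.continuousAt
    exact h1
  have hβ1 : β 1 = 0 := by simp only [β, hQ1, Matrix.mul_zero]; rfl
  have e1 : ∀ᶠ g in 𝓝 (1 : GSp (m + n)), ‖β g‖ < θ := by
    have := hβ.norm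
    have := this.eventually_lt (continuousAt_const (y := θ)) (by simpa [hβ1] using hθ)
    exact this
  have e2 : ∀ᶠ g in 𝓝 (1 : GSp (m + n)), g * uSL m n (-(β g)) ∈ (Nb θ : Set (GSp (m + n))) := by
    have hc : ContinuousAt (fun g => g * uSL m n (-(β g))) 1 :=
      continuousAt_id.mul ((uSL_continuous m n).continuousAt.comp hβ.neg)
    refine hc ?_
    simp only [hβ1, neg_zero, uSL_zero, mul_one]
    exact Nb_mem hθ
  refine ⟨_, hdet.and (e1.and e2), ?_⟩
  rintro g ⟨h0, h1, h2⟩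
  refine ⟨g * uSL m n (-(β g)), ?_, h2, β g, h1, ?_⟩
  · intro i j
    show ((g : Matrix (Fin (m+n)) (Fin (m+n)) ℝ) * uMat m n (-(β g))) _ _ = 0
    have h3 : P g * Matrix.of (β g) = Q g := by
      show P g * ((P g)⁻¹ * Q g) = Q g
      rw [← Matrix.mul_assoc, Matrix.mul_nonsing_inv _ (isUnit_iff_ne_zero.2 h0), Matrix.one_mul]
    have h4 := congrFun (congrFun h3 i) j
    simp only [mul_apply, of_apply] at h4
    simp only [mul_apply, Fin.sum_univ_add, uMat, reindex_apply, submatrix_apply, finSumFinEquiv_symm_apply_castAdd,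
        finSumFinEquiv_symm_apply_natAdd, fromBlocks_apply₁₂, fromBlocks_apply₂₂, of_apply, Pi.neg_apply, mul_neg,
        Finset.sum_neg_distrib]
    have h5 : ∑ k, (g : Matrix (Fin (m+n)) (Fin (m+n)) ℝ) (Fin.castAdd n i) (Fin.castAdd n k) * β g k j = Q g i j := h4
    rw [h5]
    simp [one_apply, Q]
  · rw [mul_assoc, uSL_mul, neg_add_cancel, uSL_zero, mul_one]

/-- Bowen estimate -/
lemma bowen_local {m n : ℕ} (hm : 0 < m) (hn : 0 < n) {V : Set (GSp (m + n))} (hV : V ∈ 𝓝 (1 : GSp (m + n))) :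
    ∃ θ > 0, ∀ (x0 : XSp (m + n)) (h h' : GSp (m + n)) (B B' : Mt m n) (L : ℝ),
      h ∈ LTri m n → h' ∈ LTri m n → h ∈ (Nb θ : Set (GSp (m + n))) → h' ∈ (Nb θ : Set (GSp (m + n))) →
      lamE m n L * ‖B' - B‖ < θ → ∀ t, 0 ≤ t → t ≤ L →
      ∃ g ∈ V, aSL m n hm hn t • (h' * uSL m n B') • x0 = g • aSL m n hm hn t • (h * uSL m n B) • x0 := by
  have hc : ContinuousAt (fun p : GSp (m + n) × GSp (m + n) × GSp (m + n) => p.1 * p.2.1 * p.2.2⁻¹) (1, 1, 1) := by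
    fun_prop
  have := hc.preimage_mem_nhds (by simpa using hV)
  obtain ⟨W1, hW1, W', hW', hVW⟩ := mem_nhds_prod_iff.1 this
  obtain ⟨W2, hW2, W3, hW3, hVW'⟩ := mem_nhds_prod_iff.1 hW'
  obtain ⟨θ, hθ, hs⟩ := Nb_basis (inter_mem hW1 (inter_mem hW2 hW3))
  refine ⟨θ, hθ, fun x0 h h' B B' L hL hL' hN hN' hB t ht htL => ?_⟩
  set a := aSL m n hm hn t with ha
  refine ⟨(a * h' * a⁻¹) * uSL m n (lamE m n t • (B' - B)) * (a * h * a⁻¹)⁻¹, ?_, ?_⟩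
  · have k1 := hs (LTri_conj hm hn ht hθ hL' hN')
    have k3 := hs (LTri_conj hm hn ht hθ hL hN)
    have k2 : uSL m n (lamE m n t • (B' - B)) ∈ W1 ∩ (W2 ∩ W3) := by
      refine hs (uSL_Nb hθ ?_)
      rw [norm_smul, Real.norm_of_nonneg (lamE_pos m n t).le]
      refine lt_of_le_of_lt ?_ hB
      gcongr
      exact lamE_mono m n htL
    have k4 := hVW (Set.mk_mem_prod k1.1 (hVW' (Set.mk_mem_prod k2.2.1 k3.2.2)))
    exact k4
  · rw [smul_smul, smul_smul, smul_smul]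
    congr 1
    have e : uSL m n (lamE m n t • (B' - B)) = a * uSL m n (B' - B) * a⁻¹ := by
      rw [ha, aSL_uSL]; group
    have e2 : uSL m n B' = uSL m n (B' - B) * uSL m n B := by rw [uSL_mul]; simp
    rw [e, e2]; group

end PartCoord

section PartCov

/-! ## Part Cov: labellings and Bowen covers -/

/-- `S` is covered by at most `c` pieces on each of which the relation `Q` holds -/
def Lab {α : Type*} (Q : α → α → Prop) (S : Set α) (c : ℝ) : Prop :=
  ∃ (p : ℕ) (D : Fin p → Set α), (p : ℝ) ≤ c ∧ S ⊆ ⋃ i, D i ∧ ∀ i, ∀ x ∈ D i, ∀ x' ∈ D i, x ∈ S → x' ∈ S → Q x x'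

lemma Lab.of' {α κ : Type*} [Fintype κ] {Q : α → α → Prop} {S : Set α} {c : ℝ} (D : κ → Set α)
    (hc : (Fintype.card κ : ℝ) ≤ c) (hS : S ⊆ ⋃ i, D i) (h : ∀ i, ∀ x ∈ D i, ∀ x' ∈ D i, x ∈ S → x' ∈ S → Q x x') : Lab Q S c := by
  refine ⟨Fintype.card κ, fun i => D ((Fintype.equivFin κ).symm i), hc, fun x hx => ?_, fun i => h _⟩
  obtain ⟨i, hi⟩ := Set.mem_iUnion.1 (hS hx)
  exact Set.mem_iUnion.2 ⟨Fintype.equivFin κ i, by simpa using hi⟩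

lemma Lab.of {α κ : Type*} [Fintype κ] {Q : α → α → Prop} {S : Set α} {c : ℝ} (f : α → κ)
    (hc : (Fintype.card κ : ℝ) ≤ c) (h : ∀ x ∈ S, ∀ x' ∈ S, f x = f x' → Q x x') : Lab Q S c :=
  Lab.of' (fun i => f ⁻¹' {i}) hc (fun x _ => Set.mem_iUnion.2 ⟨f x, rfl⟩)
    (fun i x hx x' hx' hS hS' => h x hS x' hS' (by rw [Set.mem_preimage, Set.mem_singleton_iff] at hx hx'; rw [hx, hx']))

lemma Lab.mono {α : Type*} {Q Q' : α → α → Prop} {S S' : Set α} {c c' : ℝ} (h : Lab Q S c)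
    (hQ : ∀ x x', x ∈ S' → x' ∈ S' → Q x x' → Q' x x') (hS : S' ⊆ S) (hc : c ≤ c') : Lab Q' S' c' := by
  obtain ⟨p, f, hp, hf, h⟩ := h
  exact ⟨p, f, hp.trans hc, hS.trans hf, fun i x hx x' hx' hs hs' => hQ _ _ hs hs' (h i x hx x' hx' (hS hs) (hS hs'))⟩

lemma Lab.iUnion {α κ : Type*} [Fintype κ] {Q : α → α → Prop} {S : κ → Set α} {S' : Set α} {c : ℝ}
    (h : ∀ i, Lab Q (S i) c) (hS : S' ⊆ ⋃ i, S i) : Lab Q S' (Fintype.card κ * c) := by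
  choose p D hp hD hQ using h
  refine Lab.of' (κ := Σ i, Fin (p i)) (fun a => D a.1 a.2 ∩ S a.1) ?_ ?_ ?_
  · simp only [Fintype.card_sigma, Fintype.card_fin, Nat.cast_sum]
    calc ∑ i, (p i : ℝ) ≤ ∑ i : κ, c := Finset.sum_le_sum fun i _ => hp i
      _ = _ := by simp
  · intro x hx
    obtain ⟨i, hi⟩ := Set.mem_iUnion.1 (hS hx)
    obtain ⟨j, hj⟩ := Set.mem_iUnion.1 (hD i hi)
    exact Set.mem_iUnion.2 ⟨⟨i, j⟩, hj, hi⟩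
  · rintro ⟨i, j⟩ x hx x' hx' - -
    exact hQ i j x hx.1 x' hx'.1 hx.2 hx'.2

lemma Lab.refine {α : Type*} {Q Q' : α → α → Prop} {S : Set α} {c c' : ℝ} (h : Lab Q S c)
    (hS : ∀ x0 ∈ S, Lab Q' {x ∈ S | Q x0 x} c') (hc' : 0 ≤ c') : Lab Q' S (c * c') := by
  classical
  obtain ⟨p, D, hp, hD, hf⟩ := h
  have : ∀ i : Fin p, Lab Q' (S ∩ D i) c' := by
    intro i
    by_cases hi : (S ∩ D i).Nonempty
    · obtain ⟨x0, hx0⟩ := hi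
      exact (hS x0 hx0.1).mono (fun _ _ _ _ h => h) (fun x hx => ⟨hx.1, hf i x0 hx0.2 x hx.2 hx0.1 hx.1⟩) le_rfl
    · rw [Set.not_nonempty_iff_eq_empty] at hi
      rw [hi]
      exact ⟨0, fun _ => ∅, by simpa using hc', by simp, by simp⟩
  refine (Lab.iUnion this (S' := S) ?_).mono (fun _ _ _ _ h => h) subset_rfl ?_
  · rw [← Set.inter_iUnion]; exact fun x hx => ⟨hx, hD hx⟩
  · simp only [Fintype.card_fin]; gcongr

/-- transport of a labelling along a map -/
lemma Lab.image {α β : Type*} {Q : α → α → Prop} {Q' : β → β → Prop} {S : Set α} {S' : Set β} {c : ℝ} (h : Lab Q S c)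
    (f : β → α) (hf : ∀ x ∈ S', f x ∈ S) (hQ : ∀ x ∈ S', ∀ x' ∈ S', Q (f x) (f x') → Q' x x') : Lab Q' S' c := by
  obtain ⟨p, D, hp, hD, hq⟩ := h
  refine ⟨p, fun i => f ⁻¹' D i, hp, fun x hx => ?_, fun i x hx x' hx' hs hs' => hQ x hs x' hs' (hq i _ hx _ hx' (hf x hs) (hf x' hs'))⟩
  obtain ⟨i, hi⟩ := Set.mem_iUnion.1 (hD (hf x hx))
  exact Set.mem_iUnion.2 ⟨i, hi⟩

lemma grid {m n : ℕ} (S : Set (Mt m n)) (c b : Mt m n) (hS : ∀ x ∈ S, ∀ i j, |x i j - c i j| ≤ b i j) {η : ℝ}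
    (hη : 0 < η) (hb : ∀ i j, 0 ≤ b i j) :
    Lab (fun x x' => ‖x' - x‖ < η) S (∏ i, ∏ j, (2 * b i j / η + 1)) := by
  classical
  have hlt : ∀ x ∈ S, ∀ i j, ⌊(x i j - c i j + b i j) / η⌋₊ < ⌊2 * b i j / η⌋₊ + 1 := by
    intro x hx i j
    refine Nat.lt_succ_of_le (Nat.floor_le_floor ?_)
    have := abs_le.1 (hS x hx i j)
    gcongr; linarith [this.2]
  let D : (∀ i : Fin m, ∀ j : Fin n, Fin (⌊2 * b i j / η⌋₊ + 1)) → Set (Mt m n) := fun w =>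
    {x | ∀ i j, ⌊(x i j - c i j + b i j) / η⌋₊ = (w i j : ℕ)}
  refine Lab.of' D ?_ ?_ ?_
  · simp only [Fintype.card_pi, Fintype.card_fin, Nat.cast_prod]
    refine Finset.prod_le_prod (fun _ _ => Finset.prod_nonneg fun _ _ => by positivity) fun i _ =>
      Finset.prod_le_prod (fun _ _ => by positivity) fun j _ => ?_
    push_cast
    have := Nat.floor_le (a := 2 * b i j / η) (by have := hb i j; positivity)
    linarith
  · intro x hx
    exact Set.mem_iUnion.2 ⟨fun i j => ⟨_, hlt x hx i j⟩, fun i j => rfl⟩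
  · intro w x hx x' hx' hs hs'
    rw [pi_norm_lt_iff hη]; intro i
    rw [pi_norm_lt_iff hη]; intro j
    have e := (hx i j).trans (hx' i j).symm
    have a1 := abs_le.1 (hS x hs i j)
    have a2 := abs_le.1 (hS x' hs' i j)
    have n1 : 0 ≤ (x i j - c i j + b i j) / η := div_nonneg (by linarith [a1.1]) hη.le
    have n2 : 0 ≤ (x' i j - c i j + b i j) / η := div_nonneg (by linarith [a2.1]) hη.le
    have f1 := Nat.floor_le n1
    have f2 := Nat.floor_le n2
    have g1 := Nat.lt_floor_add_one ((x i j - c i j + b i j) / η)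
    have g2 := Nat.lt_floor_add_one ((x' i j - c i j + b i j) / η)
    rw [e] at f1 g1
    rw [le_div_iff₀ hη] at f1 f2
    rw [div_lt_iff₀ hη] at g1 g2
    simp only [Pi.sub_apply, Real.norm_eq_abs]
    rw [abs_lt]; constructor <;> nlinarith

/-- reduction of Bowen covers to covers in the horospherical direction -/
lemma bowen_cover {m n : ℕ} (hm : 0 < m) (hn : 0 < n) {V : Set (GSp (m + n))} (hV : V ∈ 𝓝 (1 : GSp (m + n)))
    {K : Set (XSp (m + n))} (hK : IsCompact K) {θ0 : ℝ} (hθ0 : 0 < θ0) :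
    ∃ θ, 0 < θ ∧ θ ≤ θ0 ∧ ∃ (q : ℕ) (x : Fin q → XSp (m + n)), (∀ i, x i ∈ K) ∧
      ∀ Y ⊆ K, ∀ (L : ℕ) (c : ℝ),
      (∀ i, Lab (fun B B' : Mt m n => lamE m n L * ‖B' - B‖ < θ)
        {B | ‖B‖ < θ ∧ ∃ h ∈ LTri m n, h ∈ (Nb θ : Set (GSp (m + n))) ∧ (h * uSL m n B) • x i ∈ Y} c) →
      Lab (fun y y' => ∀ j ≤ L, ((aAct m n hm hn)^[j] y, (aAct m n hm hn)^[j] y') ∈ relN V) Y (q * c) := by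
  obtain ⟨θ1, hθ1, hbow⟩ := bowen_local hm hn hV
  set θ := min θ0 θ1
  have hθ : 0 < θ := lt_min hθ0 hθ1
  obtain ⟨W, hW, hdec⟩ := decomp (m := m) (n := n) hθ
  have hnh : ∀ x : XSp (m + n), (fun g : GSp (m + n) => g • x) '' W ∈ 𝓝 x := by
    intro x
    obtain ⟨g, rfl⟩ := QuotientGroup.mk_surjective x
    have h1 : (fun w => w * g) '' W ∈ 𝓝 g := by
      have := (Homeomorph.mulRight g).isOpenMap.image_mem_nhds hW
      simpa using this
    have h2 := QuotientGroup.isOpenMap_coe (N := Gamma (m + n)) |>.image_mem_nhds h1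
    rw [Set.image_image] at h2
    exact h2
  obtain ⟨t, htK, ht⟩ := hK.elim_nhds_subcover (fun x => (fun g : GSp (m + n) => g • x) '' W) (fun x _ => hnh x)
  refine ⟨θ, hθ, min_le_left _ _, t.card, fun i => (t.equivFin.symm i : XSp (m + n)), fun i => htK _ (t.equivFin.symm i).2, ?_⟩
  intro Y hY L c hc
  have := Lab.iUnion (Q := fun y y' => ∀ j ≤ L, ((aAct m n hm hn)^[j] y, (aAct m n hm hn)^[j] y') ∈ relN V)
    (S := fun i : Fin t.card => {y ∈ Y | ∃ h ∈ LTri m n, h ∈ (Nb θ : Set (GSp (m + n))) ∧ ∃ B : Mt m n, ‖B‖ < θ ∧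
      y = (h * uSL m n B) • (t.equivFin.symm i : XSp (m + n))}) (S' := Y) (c := c) ?_ ?_
  · simpa using this
  · intro i
    have hex : ∀ y : XSp (m + n), ∃ B : Mt m n, y ∈ {y ∈ Y | ∃ h ∈ LTri m n, h ∈ (Nb θ : Set (GSp (m + n))) ∧ ∃ B : Mt m n, ‖B‖ < θ ∧
      y = (h * uSL m n B) • (t.equivFin.symm i : XSp (m + n))} → (‖B‖ < θ ∧ ∃ h ∈ LTri m n, h ∈ (Nb θ : Set (GSp (m + n))) ∧
      y = (h * uSL m n B) • (t.equivFin.symm i : XSp (m + n))) := by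
      intro y
      by_cases hy : y ∈ {y ∈ Y | ∃ h ∈ LTri m n, h ∈ (Nb θ : Set (GSp (m + n))) ∧ ∃ B : Mt m n, ‖B‖ < θ ∧
          y = (h * uSL m n B) • (t.equivFin.symm i : XSp (m + n))}
      · obtain ⟨_, h, h1, h2, B, h3, h4⟩ := hy
        exact ⟨B, fun _ => ⟨h3, h, h1, h2, h4⟩⟩
      · exact ⟨0, fun h => absurd h hy⟩
    choose b hb using hex
    refine (hc i).image b ?_ ?_
    · intro y hy
      obtain ⟨h1, h, h2, h3, h4⟩ := hb y hy
      exact ⟨h1, h, h2, h3, h4 ▸ hy.1⟩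
    · intro y hy y' hy' hQ j hj
      obtain ⟨-, h, h2, h3, h4⟩ := hb y hy
      obtain ⟨-, h', h2', h3', h4'⟩ := hb y' hy'
      obtain ⟨g, hg, he⟩ := hbow (t.equivFin.symm i : XSp (m + n)) h h' (b y) (b y') L h2 h2'
        (Nb_mono (min_le_right _ _) h3) (Nb_mono (min_le_right _ _) h3') (hQ.trans_le (min_le_right _ _)) j
        (by positivity) (by exact_mod_cast hj)
      refine ⟨g, hg, ?_⟩
      simp only [aAct_iter]
      rw [← h4, ← h4'] at he
      exact he
  · intro y hy
    obtain ⟨x, hx, g, hg, rfl⟩ := Set.mem_iUnion₂.1 (ht (hY hy))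
    obtain ⟨h, h1, h2, B, h3, h4⟩ := hdec g hg
    refine Set.mem_iUnion.2 ⟨t.equivFin ⟨x, hx⟩, hy, h, h1, h2, B, h3, ?_⟩
    simp [h4]

/-- `U1` in terms of labellings -/
lemma U1' {m n : ℕ} (hm : 0 < m) (hn : 0 < n) (μ : Measure (XSp (m + n))) [IsProbabilityMeasure μ]
    (hT : MeasurePreserving (aAct m n hm hn) μ μ) (s : ℝ)
    (hcov : ∀ V ∈ 𝓝 (1 : GSp (m + n)), ∀ δ > 0, ∃ C : ℝ, 1 ≤ C ∧ ∀ L : ℕ, ∃ Y : Set (XSp (m + n)), μ.real Yᶜ ≤ δ ∧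
      Lab (fun y y' => ∀ j ≤ L, ((aAct m n hm hn)^[j] y, (aAct m n hm hn)^[j] y') ∈ relN V) Y (C * Real.exp (s * L))) :
    ∀ (k : ℕ) (f : XSp (m + n) → Fin k), FibM f → hmap (aAct m n hm hn) μ f ≤ s := by
  refine U1 μ _ hT (X_reg μ) {R | ∃ V ∈ 𝓝 (1 : GSp (m + n)), R = relN V} s relN_sep ?_
  rintro _ ⟨V, hV, rfl⟩ δ hδ
  obtain ⟨C, hC, h⟩ := hcov V hV δ hδ
  refine ⟨C, hC, fun L => ?_⟩
  obtain ⟨Y, hY, p, D, hp, hD, hQ⟩ := h L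
  refine ⟨Y, hY, p, fun i => D i ∩ Y, hp, ?_, ?_⟩
  · rw [← Set.iUnion_inter]; exact fun x hx => ⟨hD hx, hx⟩
  · intro i x hx x' hx' j hj
    exact hQ i x hx.1 x' hx'.1 hx.2 hx'.2 j hj.le

lemma U2 {m n : ℕ} (hm : 0 < m) (hn : 0 < n) (μ : Measure (XSp (m + n))) [IsProbabilityMeasure μ]
    (hT : MeasurePreserving (aAct m n hm hn) μ μ) :
    ∀ (k : ℕ) (f : XSp (m + n) → Fin k), FibM f → hmap (aAct m n hm hn) μ f ≤ (m : ℝ) + n := by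
  refine U1' hm hn μ hT _ fun V hV δ hδ => ?_
  obtain ⟨K, -, hK, hKm, hKδ⟩ := X_reg μ Set.univ MeasurableSet.univ δ hδ
  obtain ⟨θ, hθ, -, q, x, -, hx⟩ := bowen_cover hm hn hV hK one_pos
  refine ⟨(q + 1) * 3 ^ (m * n), ?_, fun L => ⟨K, by rwa [Set.compl_eq_univ_sdiff], ?_⟩⟩
  · have : (1 : ℝ) ≤ 3 ^ (m * n) := one_le_pow₀ (by norm_num)
    nlinarith [Nat.cast_nonneg (α := ℝ) q]
  have hl := lamE_pos m n L
  have h1 := one_le_lamE m n (Nat.cast_nonneg (α := ℝ) L)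
  refine (hx K subset_rfl L (3 ^ (m * n) * Real.exp ((m + n) * L)) fun i => ?_).mono (fun _ _ _ _ h => h) subset_rfl ?_
  · refine (grid _ 0 (fun _ _ => θ) (η := θ / lamE m n L) ?_ (by positivity) (fun _ _ => hθ.le)).mono ?_ subset_rfl ?_
    · rintro B ⟨hB, -⟩ i j
      simp only [Pi.zero_apply, sub_zero]
      exact ((norm_le_pi_norm (B i) j).trans (norm_le_pi_norm B i)).trans hB.le
    · intro B B' _ _ h
      rwa [lt_div_iff₀ hl, mul_comm] at h
    · simp only [Finset.prod_const, Finset.card_univ, Fintype.card_fin]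
      rw [← pow_mul, mul_comm n m, ← lamE_pow hm hn, ← mul_pow]
      gcongr
      rw [mul_div_assoc, div_div_cancel₀ hθ.ne']
      linarith
  · have : 0 < 3 ^ (m * n) * Real.exp ((m + n) * L) := by positivity
    nlinarith

end PartCov

section PartLat

/-! ## Part Lat: lattices -/

/-- integer vectors as real vectors -/
def rv {d : ℕ} (v : Fin d → ℤ) : Fin d → ℝ := fun i => (v i : ℝ)

lemma rv_sub {d : ℕ} (v w : Fin d → ℤ) : rv (v - w) = rv v - rv w := by ext i; simp [rv]
lemma rv_eq_zero {d : ℕ} {v : Fin d → ℤ} : rv v = 0 ↔ v = 0 := by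
  constructor
  · intro h; ext i; have := congrFun h i; simpa [rv] using this
  · rintro rfl; ext i; simp [rv]
lemma rv_mulVec {d : ℕ} (A : Matrix (Fin d) (Fin d) ℤ) (v : Fin d → ℤ) :
    rv (A *ᵥ v) = (A.map (fun z : ℤ => (z : ℝ))) *ᵥ rv v := by
  ext i; simp [rv, mulVec, dotProduct]
lemma one_le_norm_rv {d : ℕ} {v : Fin d → ℤ} (hv : v ≠ 0) : 1 ≤ ‖rv v‖ := by
  obtain ⟨i, hi⟩ := Function.ne_iff.1 hv
  refine le_trans ?_ (norm_le_pi_norm _ i)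
  simp only [rv, Real.norm_eq_abs]
  exact_mod_cast Int.one_le_abs hi

/-- the lattice of a point -/
def lat {d : ℕ} (x : XSp d) : Set (Fin d → ℝ) :=
  {w | ∃ g : GSp d, (QuotientGroup.mk g : XSp d) = x ∧ ∃ v : Fin d → ℤ, w = (g : Matrix (Fin d) (Fin d) ℝ) *ᵥ rv v}

lemma mem_lat_mk {d : ℕ} {g : GSp d} {w : Fin d → ℝ} :
    w ∈ lat (QuotientGroup.mk g : XSp d) ↔ ∃ v : Fin d → ℤ, w = (g : Matrix (Fin d) (Fin d) ℝ) *ᵥ rv v := by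
  constructor
  · rintro ⟨g', he, v, rfl⟩
    rw [eq_comm, QuotientGroup.eq] at he
    obtain ⟨A, hA⟩ := mem_Gamma he
    refine ⟨A.1 *ᵥ v, ?_⟩
    rw [rv_mulVec, ← hA, mulVec_mulVec]
    congr 1
    show _ = ((g * (g⁻¹ * g') : GSp d) : Matrix (Fin d) (Fin d) ℝ)
    rw [mul_inv_cancel_left]
  · rintro ⟨v, hv⟩; exact ⟨g, rfl, v, hv⟩

lemma mem_lat_smul {d : ℕ} {h : GSp d} {x : XSp d} {w : Fin d → ℝ} :
    w ∈ lat (h • x) ↔ ∃ w' ∈ lat x, w = (h : Matrix (Fin d) (Fin d) ℝ) *ᵥ w' := by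
  obtain ⟨g, rfl⟩ := QuotientGroup.mk_surjective x
  rw [smul_mk, mem_lat_mk]
  constructor
  · rintro ⟨v, rfl⟩
    exact ⟨_, mem_lat_mk.2 ⟨v, rfl⟩, by rw [mulVec_mulVec]; rfl⟩
  · rintro ⟨w', hw', rfl⟩
    obtain ⟨v, rfl⟩ := mem_lat_mk.1 hw'
    exact ⟨v, by rw [mulVec_mulVec]; rfl⟩

lemma smul_mem_lat {d : ℕ} (h : GSp d) {x : XSp d} {w : Fin d → ℝ} (hw : w ∈ lat x) :
    (h : Matrix (Fin d) (Fin d) ℝ) *ᵥ w ∈ lat (h • x) := mem_lat_smul.2 ⟨w, hw, rfl⟩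

lemma GSp_mulVec_ne {d : ℕ} (h : GSp d) {w : Fin d → ℝ} (hw : w ≠ 0) : (h : Matrix (Fin d) (Fin d) ℝ) *ᵥ w ≠ 0 := by
  intro h0
  apply hw
  have h1 : ((h⁻¹ : GSp d) : Matrix (Fin d) (Fin d) ℝ) * (h : Matrix (Fin d) (Fin d) ℝ) = 1 := by
    have := congrArg (fun g : GSp d => (g : Matrix (Fin d) (Fin d) ℝ)) (inv_mul_cancel h)
    exact this
  rw [← one_mulVec w, ← h1, ← mulVec_mulVec, h0, mulVec_zero]

/-- thick part -/
def Cus {d : ℕ} (ε : ℝ) : Set (XSp d) := {x | ∀ w ∈ lat x, w ≠ 0 → ε ≤ ‖w‖}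

lemma Cus_closed {d : ℕ} (ε : ℝ) : IsClosed (Cus ε : Set (XSp d)) := by
  rw [← isOpen_compl_iff, ← (QuotientGroup.isOpenQuotientMap_mk (G := GSp d) (N := Gamma d)).isQuotientMap.isOpen_preimage]
  have : ((QuotientGroup.mk : GSp d → XSp d) ⁻¹' (Cus ε : Set (XSp d))ᶜ) =
      ⋃ v : {v : Fin d → ℤ // v ≠ 0}, {g : GSp d | ‖(g : Matrix (Fin d) (Fin d) ℝ) *ᵥ rv v.1‖ < ε} := by
    ext g
    simp only [Set.mem_preimage, Set.mem_compl_iff, Set.mem_iUnion]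
    constructor
    · intro h
      simp only [Cus, Set.mem_ofPred_eq] at h
      push Not at h
      obtain ⟨w, hw, hne, hlt⟩ := h
      obtain ⟨v, rfl⟩ := mem_lat_mk.1 hw
      refine ⟨⟨v, ?_⟩, hlt⟩
      rintro rfl
      apply hne
      rw [rv_eq_zero.2 rfl, mulVec_zero]
    · rintro ⟨v, hv⟩ h
      have := h _ (mem_lat_mk.2 ⟨v.1, rfl⟩) (GSp_mulVec_ne g (fun h => v.2 (rv_eq_zero.1 h)))
      have hv' : ‖(g : Matrix (Fin d) (Fin d) ℝ) *ᵥ rv v.1‖ < ε := hv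
      linarith
  rw [this]
  refine isOpen_iUnion fun v => isOpen_lt ?_ continuous_const
  exact ((continuous_val d).matrix_mulVec continuous_const).norm

lemma Cus_mono {d : ℕ} {ε ε' : ℝ} (h : ε ≤ ε') : (Cus ε' : Set (XSp d)) ⊆ Cus ε :=
  fun _ hx w hw hne => h.trans (hx w hw hne)

lemma norm_mulVec_le {d : ℕ} (M : Matrix (Fin d) (Fin d) ℝ) {c : ℝ} (hc : ∀ i j, |M i j| ≤ c) (w : Fin d → ℝ) :
    ‖M *ᵥ w‖ ≤ d * c * ‖w‖ := by
  rcases Nat.eq_zero_or_pos d with hd | hd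
  · subst hd; simp [Subsingleton.elim (M *ᵥ w) 0]
  have hc0 : 0 ≤ c := (abs_nonneg _).trans (hc ⟨0, hd⟩ ⟨0, hd⟩)
  rw [pi_norm_le_iff_of_nonneg (by positivity)]
  intro i
  simp only [mulVec, dotProduct]
  calc ‖∑ j, M i j * w j‖ ≤ ∑ j, ‖M i j * w j‖ := norm_sum_le _ _
    _ ≤ ∑ j : Fin d, c * ‖w‖ := by
      refine Finset.sum_le_sum fun j _ => ?_
      rw [norm_mul]
      gcongr
      · exact hc i j
      · exact norm_le_pi_norm w j
    _ = _ := by simp; ring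

lemma inv_mulVec {d : ℕ} (g : GSp d) (w : Fin d → ℝ) :
    ((g⁻¹ : GSp d) : Matrix (Fin d) (Fin d) ℝ) *ᵥ ((g : Matrix (Fin d) (Fin d) ℝ) *ᵥ w) = w := by
  have h1 : ((g⁻¹ : GSp d) : Matrix (Fin d) (Fin d) ℝ) * (g : Matrix (Fin d) (Fin d) ℝ) = 1 := by
    have := congrArg (fun g : GSp d => (g : Matrix (Fin d) (Fin d) ℝ)) (inv_mul_cancel g)
    exact this
  rw [mulVec_mulVec, h1, one_mulVec]

lemma GSp_bdd_compact {d : ℕ} (R : ℝ) : IsCompact {g : GSp d | ∀ i j, |(g : Matrix (Fin d) (Fin d) ℝ) i j| ≤ R} := by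
  have hc : IsCompact {M : Fin d → Fin d → ℝ | ∀ i j, |M i j| ≤ R} := by
    have : {M : Fin d → Fin d → ℝ | ∀ i j, |M i j| ≤ R} = Set.pi Set.univ fun _ => Set.pi Set.univ fun _ => Set.Icc (-R) R := by
      ext M; simp only [Set.mem_pi, Set.mem_univ, true_imp_iff, Set.mem_Icc, ← abs_le]; rfl
    rw [this]
    exact isCompact_univ_pi fun _ => isCompact_univ_pi fun _ => isCompact_Icc
  exact (GSp_closedEmb d).isCompact_preimage hc

lemma GSp_inv_bdd {d : ℕ} (R : ℝ) : ∃ R', ∀ g : GSp d, (∀ i j, |(g : Matrix (Fin d) (Fin d) ℝ) i j| ≤ R) →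
    ∀ i j, |((g⁻¹ : GSp d) : Matrix (Fin d) (Fin d) ℝ) i j| ≤ R' := by
  have h := fun i j => (GSp_bdd_compact (d := d) R).bddAbove_image
    (f := fun g : GSp d => |((g⁻¹ : GSp d) : Matrix (Fin d) (Fin d) ℝ) i j|)
    (((continuous_val d).comp continuous_inv).matrix_elem i j).abs.continuousOn
  choose R' hR' using h
  refine ⟨∑ i, ∑ j, |R' i j|, fun g hg i j => ?_⟩
  have h1 : |((g⁻¹ : GSp d) : Matrix (Fin d) (Fin d) ℝ) i j| ≤ R' i j := hR' i j ⟨g, hg, rfl⟩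
  refine h1.trans ((le_abs_self _).trans ?_)
  exact (Finset.single_le_sum (f := fun j => |R' i j|) (fun _ _ => abs_nonneg _) (Finset.mem_univ j)).trans
    (Finset.single_le_sum (f := fun i => ∑ j, |R' i j|) (fun _ _ => Finset.sum_nonneg fun _ _ => abs_nonneg _) (Finset.mem_univ i))

/-- compact sets are contained in thick parts -/
lemma compact_sub_Cus {d : ℕ} {K : Set (XSp d)} (hK : IsCompact K) : ∃ ε > 0, K ⊆ Cus ε := by
  refine hK.induction_on (p := fun K => ∃ ε > 0, K ⊆ Cus ε) ⟨1, one_pos, by simp⟩ ?_ ?_ ?_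
  · rintro s t hst ⟨ε, hε, h⟩
    exact ⟨ε, hε, hst.trans h⟩
  · rintro s t ⟨ε, hε, h⟩ ⟨ε', hε', h'⟩
    exact ⟨min ε ε', lt_min hε hε', Set.union_subset (h.trans (Cus_mono (min_le_left _ _))) (h'.trans (Cus_mono (min_le_right _ _)))⟩
  · intro x _
    obtain ⟨g, rfl⟩ := QuotientGroup.mk_surjective x
    set R : ℝ := ‖fun i j => (g⁻¹ : GSp d).1 i j‖ with hR
    let U : Set (GSp d) := {h | ∀ i j, |((h⁻¹ : GSp d) : Matrix (Fin d) (Fin d) ℝ) i j| < R + 1}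
    have hU : IsOpen U := by
      simp only [U, Set.ofPred_forall]
      refine isOpen_iInter_of_finite fun i => isOpen_iInter_of_finite fun j => ?_
      exact isOpen_lt (((continuous_val d).comp continuous_inv).matrix_elem i j).abs continuous_const
    have hg : g ∈ U := by
      intro i j
      have h1 := norm_le_pi_norm (fun i j => (g⁻¹ : GSp d).1 i j) i
      have h2 := norm_le_pi_norm (fun j => (g⁻¹ : GSp d).1 i j) j
      have h3 : ‖(g⁻¹ : GSp d).1 i j‖ ≤ R := h2.trans h1
      rw [Real.norm_eq_abs] at h3
      exact h3.trans_lt (lt_add_one _)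
    have hR0 : 0 ≤ R := norm_nonneg _
    have hd : (0:ℝ) ≤ d := Nat.cast_nonneg d
    refine ⟨_, mem_nhdsWithin_of_mem_nhds (QuotientGroup.isOpenMap_coe.image_mem_nhds (hU.mem_nhds hg)), 1 / ((d + 1) * (R + 1)), by positivity, ?_⟩
    rintro _ ⟨h, hh, rfl⟩ w hw hne
    obtain ⟨v, rfl⟩ := mem_lat_mk.1 hw
    have hv : v ≠ 0 := by
      rintro rfl; apply hne; rw [rv_eq_zero.2 rfl, mulVec_zero]
    have h1 := norm_mulVec_le ((h⁻¹ : GSp d) : Matrix (Fin d) (Fin d) ℝ) (fun i j => (hh i j).le) ((h : Matrix (Fin d) (Fin d) ℝ) *ᵥ rv v)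
    rw [inv_mulVec] at h1
    have h2 := (one_le_norm_rv hv).trans h1
    rw [div_le_iff₀ (by positivity)]
    have := norm_nonneg ((h : Matrix (Fin d) (Fin d) ℝ) *ᵥ rv v)
    nlinarith [mul_nonneg this hR0]

end PartLat

section PartMah

/-! ## Part Mah: Minkowski and Mahler -/

lemma minkowski {d : ℕ} (M : Matrix (Fin d) (Fin d) ℝ) (h0 : M.det ≠ 0) (h1 : |M.det| < 1) :
    ∃ v : Fin d → ℤ, v ≠ 0 ∧ ∀ i, |(M *ᵥ rv v) i| ≤ 1 := by
  set b := Pi.basisFun ℝ (Fin d)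
  have fund := ZSpan.isAddFundamentalDomain' b (volume : Measure (Fin d → ℝ))
  have hvol : volume (ZSpan.fundamentalDomain b) = 1 := by
    rw [ZSpan.volume_fundamentalDomain]
    have : (Matrix.of ⇑b) = (1 : Matrix (Fin d) (Fin d) ℝ) := by
      ext i j; simp [b, one_apply, Pi.single_apply, eq_comm]
    rw [this]; simp
  have : Countable (Submodule.span ℤ (Set.range b)).toAddSubgroup :=
    inferInstanceAs (Countable (Submodule.span ℤ (Set.range b)))
  let s : Set (Fin d → ℝ) := (Matrix.toLin' M) ⁻¹' (Set.pi Set.univ fun _ => Set.Icc (-1) 1)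
  have hs : volume s = ENNReal.ofReal |(M.det)⁻¹| * 2 ^ d := by
    rw [Measure.addHaar_preimage_linearMap _ (by rwa [LinearMap.det_toLin']), LinearMap.det_toLin', volume_pi_pi]
    simp; norm_num
  have key := exists_ne_zero_mem_lattice_of_measure_mul_two_pow_lt_measure (s := s) fund ?_ ?_ ?_
  · obtain ⟨⟨x, hx⟩, hne, hxs⟩ := key
    have hx' := (Module.Basis.mem_span_iff_repr_mem ℤ b x).1 hx
    choose v hv using hx'
    have hxv : x = rv v := by
      ext i
      have := hv i
      simp only [b, Pi.basisFun_repr] at this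
      rw [← this]; simp [rv]
    refine ⟨v, ?_, fun i => ?_⟩
    · rintro rfl
      apply hne
      apply Subtype.ext
      show x = 0
      rw [hxv, rv_eq_zero]
    · have := hxs i (Set.mem_univ _)
      rw [abs_le]
      rw [← hxv]
      exact this
  · intro x hx i _
    have := hx i (Set.mem_univ _)
    rw [map_neg]
    simp only [Pi.neg_apply, Set.mem_Icc] at this ⊢
    constructor <;> linarith [this.1, this.2]
  · exact (convex_pi fun _ _ => convex_Icc _ _).linear_preimage _
  · rw [hvol, hs, one_mul, Module.finrank_fin_fun]
    have : (1 : ℝ≥0∞) < ENNReal.ofReal |(M.det)⁻¹| := by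
      rw [← ENNReal.ofReal_one, ENNReal.ofReal_lt_ofReal_iff_of_nonneg zero_le_one, abs_inv]
      exact (one_lt_inv₀ (abs_pos.2 h0)).2 h1
    calc (2 : ℝ≥0∞) ^ d = 1 * 2 ^ d := (one_mul _).symm
      _ < _ := by
        refine (ENNReal.mul_lt_mul_iff_left ?_ ?_).2 this
        · positivity
        · exact ENNReal.pow_ne_top (by simp)

lemma det_updateRow_one {d : ℕ} (i : Fin d) (φ : Fin d → ℝ) : ((1 : Matrix (Fin d) (Fin d) ℝ).updateRow i φ).det = φ i := by
  rw [← cramer_transpose_apply, transpose_one, cramer_one]; rfl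

lemma mahler1 {d : ℕ} {ε : ℝ} (hε : 0 < ε) : ∃ R : ℝ, 0 < R ∧ ∀ g : GSp d, (QuotientGroup.mk g : XSp d) ∈ Cus ε →
    ∀ φ : Fin d → ℝ, φ ≠ 0 → ∃ v : Fin d → ℤ, ‖(g : Matrix (Fin d) (Fin d) ℝ) *ᵥ rv v‖ ≤ R ∧
      φ ⬝ᵥ ((g : Matrix (Fin d) (Fin d) ℝ) *ᵥ rv v) ≠ 0 := by
  classical
  set R' : ℝ := (2 * d / ε) ^ (d - 1) + 1 with hR'
  have hR'0 : 0 < R' := by positivity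
  refine ⟨R' + ε, by positivity, fun g hg φ hφ => ?_⟩
  obtain ⟨k, hk⟩ := Function.ne_iff.1 hφ
  have hd : 0 < d := Fin.pos k
  have hd' : (0 : ℝ) < d := by exact_mod_cast hd
  haveI : Nonempty (Fin d) := ⟨k⟩
  obtain ⟨i0, -, hi0⟩ := Finset.exists_max_image Finset.univ (fun i => |φ i|) ⟨k, Finset.mem_univ _⟩
  have hpos : 0 < |φ i0| := (abs_pos.2 hk).trans_le (hi0 k (Finset.mem_univ _))
  have hne : φ i0 ≠ 0 := abs_pos.1 hpos
  let ψ : Fin d → ℝ := fun i => φ i / φ i0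
  have hψ1 : ψ i0 = 1 := div_self hne
  have hψ : ∀ i, |ψ i| ≤ 1 := by
    intro i
    simp only [ψ, abs_div]
    exact (div_le_one hpos).2 (hi0 i (Finset.mem_univ _))
  let D : Fin d → ℝ := fun i => if i = i0 then 1 / R' else 2 * d / ε
  let S : Matrix (Fin d) (Fin d) ℝ := (1 : Matrix (Fin d) (Fin d) ℝ).updateRow i0 ψ
  have hdetD : ∏ i, D i = (1 / R') * (2 * d / ε) ^ (d - 1) := by
    rw [← Finset.mul_prod_erase _ _ (Finset.mem_univ i0)]
    congr 1
    · simp [D]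
    · rw [Finset.prod_congr rfl (g := fun _ => 2 * (d : ℝ) / ε)]
      · rw [Finset.prod_const, Finset.card_erase_of_mem (Finset.mem_univ _), Finset.card_univ, Fintype.card_fin]
      · intro i hi
        simp [D, Finset.ne_of_mem_erase hi]
  have hdet : (diagonal D * S * (g : Matrix (Fin d) (Fin d) ℝ)).det = (1 / R') * (2 * d / ε) ^ (d - 1) := by
    rw [det_mul, det_mul, det_diagonal, hdetD, det_updateRow_one, hψ1, g.det_coe]; ring
  have hpos2 : 0 < (1 / R') * (2 * d / ε) ^ (d - 1) := by positivity
  obtain ⟨v, hv0, hv⟩ := minkowski (diagonal D * S * (g : Matrix (Fin d) (Fin d) ℝ)) (by rw [hdet]; exact hpos2.ne') (by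
    rw [hdet, abs_of_pos hpos2, one_div, inv_mul_lt_iff₀ hR'0, hR']; linarith)
  set w := (g : Matrix (Fin d) (Fin d) ℝ) *ᵥ rv v with hw
  have hw0 : w ≠ 0 := GSp_mulVec_ne g (fun h => hv0 (rv_eq_zero.1 h))
  have hwε := hg w (mem_lat_mk.2 ⟨v, rfl⟩) hw0
  have hv' : ∀ i, |D i * (S *ᵥ w) i| ≤ 1 := by
    intro i
    have := hv i
    rw [← mulVec_mulVec, ← mulVec_mulVec, mulVec_diagonal] at this
    exact this
  have hS0 : (S *ᵥ w) i0 = ψ ⬝ᵥ w := by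
    simp [S, mulVec]
  have hSi : ∀ i, i ≠ i0 → (S *ᵥ w) i = w i := by
    intro i hi
    have : (S *ᵥ w) i = ((1 : Matrix (Fin d) (Fin d) ℝ) *ᵥ w) i := by
      simp only [S, mulVec, updateRow_ne hi]
    rw [this, one_mulVec]
  have b0 : |ψ ⬝ᵥ w| ≤ R' := by
    have := hv' i0
    rw [hS0] at this
    simp only [D, if_true, abs_mul, abs_of_pos (one_div_pos.2 hR'0)] at this
    rw [one_div, inv_mul_le_iff₀ hR'0] at this; linarith
  have bi : ∀ i, i ≠ i0 → |w i| ≤ ε / (2 * d) := by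
    intro i hi
    have := hv' i
    rw [hSi i hi] at this
    simp only [D, if_neg hi, abs_mul] at this
    rw [abs_of_pos (by positivity), div_mul_eq_mul_div, div_le_one hε] at this
    rw [le_div_iff₀ (by positivity)]; linarith
  have hsum : |ψ ⬝ᵥ w - w i0| ≤ ε / 2 := by
    have : ψ ⬝ᵥ w - w i0 = ∑ i ∈ Finset.univ.erase i0, ψ i * w i := by
      rw [dotProduct, ← Finset.add_sum_erase _ _ (Finset.mem_univ i0), hψ1]; ring
    rw [this]
    refine (Finset.abs_sum_le_sum_abs _ _).trans ?_
    calc ∑ i ∈ Finset.univ.erase i0, |ψ i * w i| ≤ ∑ i ∈ Finset.univ.erase i0, ε / (2 * d) := by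
          refine Finset.sum_le_sum fun i hi => ?_
          rw [abs_mul]
          calc |ψ i| * |w i| ≤ 1 * (ε / (2 * d)) := by
                gcongr
                · exact hψ i
                · exact bi i (Finset.ne_of_mem_erase hi)
            _ = _ := one_mul _
      _ ≤ ∑ i : Fin d, ε / (2 * d) := by
          refine Finset.sum_le_sum_of_subset_of_nonneg (Finset.erase_subset _ _) fun _ _ _ => by positivity
      _ = ε / 2 := by simp; field_simp
  have small : ε / (2 * d) ≤ ε / 2 := by
    have : (1 : ℝ) ≤ d := by exact_mod_cast hd
    gcongr; linarith
  refine ⟨v, ?_, ?_⟩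
  · rw [pi_norm_le_iff_of_nonneg (by positivity)]
    intro i
    rw [Real.norm_eq_abs]
    by_cases hi : i = i0
    · subst hi
      have a1 := abs_le.1 hsum
      have a2 := abs_le.1 b0
      rw [abs_le]; constructor <;> linarith [a1.1, a1.2, a2.1, a2.2]
    · exact (bi i hi).trans (by linarith)
  · intro hz
    have hz' : ψ ⬝ᵥ w = 0 := by
      have : ψ ⬝ᵥ w = (φ ⬝ᵥ w) / φ i0 := by
        simp only [ψ, dotProduct, Finset.sum_div]
        refine Finset.sum_congr rfl fun i _ => by ring
      rw [this, hz, zero_div]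
    have : ‖w‖ ≤ ε / 2 := by
      rw [pi_norm_le_iff_of_nonneg (by positivity)]
      intro i
      rw [Real.norm_eq_abs]
      by_cases hi : i = i0
      · subst hi
        rw [hz', zero_sub, abs_neg] at hsum; exact hsum
      · exact (bi i hi).trans small
    linarith

lemma mahler2 {d : ℕ} {ε : ℝ} (hε : 0 < ε) : ∃ R : ℝ, 0 < R ∧ ∀ g : GSp d, (QuotientGroup.mk g : XSp d) ∈ Cus ε →
    ∃ N : Matrix (Fin d) (Fin d) ℤ, N.det ≠ 0 ∧
      ∀ i j, |((g : Matrix (Fin d) (Fin d) ℝ) * N.map (fun z : ℤ => (z : ℝ))) i j| ≤ R := by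
  obtain ⟨R, hR, h⟩ := mahler1 (d := d) hε
  refine ⟨R, hR, fun g hg => ?_⟩
  let s : Set (Fin d → ℝ) := {w | ∃ v : Fin d → ℤ, w = (g : Matrix (Fin d) (Fin d) ℝ) *ᵥ rv v ∧ ‖w‖ ≤ R}
  have hspan : Submodule.span ℝ s = ⊤ := by
    by_contra hne
    obtain ⟨f, hf0, hf⟩ := Submodule.exists_le_ker_of_lt_top _ (lt_top_iff_ne_top.2 hne)
    let φ : Fin d → ℝ := fun i => f (Pi.single i 1)
    have hφ : ∀ w, f w = φ ⬝ᵥ w := by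
      intro w
      conv_lhs => rw [← Finset.univ_sum_single w]
      rw [map_sum, dotProduct]
      refine Finset.sum_congr rfl fun i _ => ?_
      have : (Pi.single i (w i) : Fin d → ℝ) = w i • Pi.single i 1 := by
        rw [← Pi.single_smul]; simp
      rw [this, map_smul, smul_eq_mul, mul_comm]
    have hφ0 : φ ≠ 0 := by
      intro h0
      apply hf0
      refine LinearMap.ext fun w => ?_
      simp [hφ, h0]
    obtain ⟨v, hv1, hv2⟩ := h g hg φ hφ0
    apply hv2
    rw [← hφ]
    exact hf (Submodule.subset_span ⟨v, rfl, hv1⟩)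
  obtain ⟨f, hf1, hf2, hf3⟩ := Submodule.exists_fun_fin_finrank_span_eq ℝ s
  have hfr : Module.finrank ℝ (Submodule.span ℝ s) = d := by
    rw [hspan, finrank_top, Module.finrank_fin_fun]
  let f' : Fin d → (Fin d → ℝ) := fun i => f (Fin.cast hfr.symm i)
  have hf' : LinearIndependent ℝ f' := hf3.comp _ (Fin.cast_injective _)
  have hm : ∀ i, f' i ∈ s := fun i => hf1 _
  choose v hv hvR using hm
  refine ⟨(Matrix.of v)ᵀ, ?_, ?_⟩
  · intro h0
    have h1 : (Matrix.of f')ᵀ = (g : Matrix (Fin d) (Fin d) ℝ) * ((Matrix.of v)ᵀ.map (fun z : ℤ => (z : ℝ))) := by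
      ext i j
      simp only [transpose_apply, of_apply, mul_apply, map_apply]
      rw [hv j]; rfl
    have h2 : (Matrix.of f').det ≠ 0 := by
      have := Matrix.linearIndependent_rows_iff_isUnit (A := Matrix.of f') |>.1 hf'
      rw [Matrix.isUnit_iff_isUnit_det] at this
      exact this.ne_zero
    apply h2
    rw [← det_transpose, h1, det_mul]
    have h3 := Int.cast_det (R := ℝ) (Matrix.of v)ᵀ
    rw [h0] at h3
    rw [show ((Matrix.of v)ᵀ.map fun z : ℤ => (z : ℝ)).det = 0 from by rw [← h3]; simp, mul_zero]
  · intro i j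
    have : ((g : Matrix (Fin d) (Fin d) ℝ) * ((Matrix.of v)ᵀ.map (fun z : ℤ => (z : ℝ)))) i j = f' j i := by
      rw [hv j]; simp [mul_apply, mulVec, dotProduct, rv]
    rw [this]
    exact (norm_le_pi_norm (f' j) i).trans (hvR j)

end PartMah

section PartMah2

/-! ## Part Mah2: bounded representatives, compactness, counting -/

abbrev cst {d : ℕ} (N : Matrix (Fin d) (Fin d) ℤ) : Matrix (Fin d) (Fin d) ℝ := (Int.castRingHom ℝ).mapMatrix N

lemma cst_mul {d : ℕ} (A B : Matrix (Fin d) (Fin d) ℤ) : cst (A * B) = cst A * cst B := map_mul _ _ _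

lemma int_reps (d : ℕ) (B : ℤ) : ∃ A : ℝ, 0 ≤ A ∧ ∀ N : Matrix (Fin d) (Fin d) ℤ, N.det ≠ 0 → |N.det| ≤ B →
    ∃ γ Nc : Matrix (Fin d) (Fin d) ℤ, γ.det = 1 ∧ γ * Nc = N ∧ ∀ i j, |((Nc.adjugate i j : ℤ) : ℝ)| ≤ A := by
  classical
  let S : Set (Matrix (Fin d) (Fin d) ℤ) := {N | N.det ≠ 0 ∧ |N.det| ≤ B}
  let key : Matrix (Fin d) (Fin d) ℤ → ℤ × (Fin d → Fin d → ℤ) := fun N => (N.det, fun i j => N i j % N.det)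
  have hfin : (key '' S).Finite := by
    refine Set.Finite.subset (s := (Set.Icc (-B) B) ×ˢ (Set.pi Set.univ fun _ : Fin d => Set.pi Set.univ fun _ : Fin d => Set.Icc 0 B)) ?_ ?_
    · exact (Set.finite_Icc _ _).prod (Set.Finite.pi' fun _ => Set.Finite.pi' fun _ => Set.finite_Icc _ _) |>.subset (by
        rintro ⟨a, b⟩ ⟨h1, h2⟩
        exact ⟨h1, fun i j => h2 i trivial j trivial⟩)
    · rintro _ ⟨N, ⟨h1, h2⟩, rfl⟩
      refine ⟨abs_le.1 h2, fun i _ j _ => ⟨Int.emod_nonneg _ h1, ?_⟩⟩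
      exact (Int.emod_lt_abs _ h1).le.trans h2
  choose! rep hrep1 hrep2 using fun (k : ℤ × (Fin d → Fin d → ℤ)) (hk : k ∈ key '' S) => hk
  have hb : ∀ i j, ∃ A : ℝ, ∀ k ∈ key '' S, |(((rep k).adjugate i j : ℤ) : ℝ)| ≤ A := by
    intro i j
    obtain ⟨A, hA⟩ := (hfin.image fun k => |(((rep k).adjugate i j : ℤ) : ℝ)|).bddAbove
    exact ⟨A, fun k hk => hA ⟨k, hk, rfl⟩⟩
  choose A hA using hb
  refine ⟨∑ i, ∑ j, |A i j|, Finset.sum_nonneg fun _ _ => Finset.sum_nonneg fun _ _ => abs_nonneg _, fun N h1 h2 => ?_⟩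
  have hk : key N ∈ key '' S := ⟨N, ⟨h1, h2⟩, rfl⟩
  set Nc := rep (key N) with hNc
  have e := hrep2 _ hk
  rw [← hNc] at e
  have e1 : Nc.det = N.det := congrArg Prod.fst e
  have e2 : ∀ i j, N.det ∣ N i j - Nc i j := by
    intro i j
    have : Nc i j % Nc.det = N i j % N.det := congrFun (congrFun (congrArg Prod.snd e) i) j
    rw [e1] at this
    exact Int.ModEq.dvd this
  choose E hE using e2
  have hγ : (1 + Matrix.of E * Nc.adjugate) * Nc = N := by
    rw [add_mul, one_mul, Matrix.mul_assoc, adjugate_mul, e1]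
    ext i j
    rw [Matrix.add_apply, Matrix.mul_smul, Matrix.mul_one, Matrix.smul_apply, of_apply, smul_eq_mul, ← hE]; ring
  refine ⟨1 + Matrix.of E * Nc.adjugate, Nc, ?_, hγ, fun i j => ?_⟩
  · have := congrArg Matrix.det hγ
    rw [det_mul, e1] at this
    exact mul_right_cancel₀ h1 (this.trans (one_mul _).symm)
  · refine (hA i j _ hk).trans ((le_abs_self _).trans ?_)
    exact (Finset.single_le_sum (f := fun j => |A i j|) (fun _ _ => abs_nonneg _) (Finset.mem_univ j)).trans
      (Finset.single_le_sum (f := fun i => ∑ j, |A i j|) (fun _ _ => Finset.sum_nonneg fun _ _ => abs_nonneg _) (Finset.mem_univ i))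

lemma mahler3 {d : ℕ} {ε : ℝ} (hε : 0 < ε) : ∃ R : ℝ, 1 ≤ R ∧ ∀ x : XSp d, x ∈ Cus ε →
    ∃ g : GSp d, (QuotientGroup.mk g : XSp d) = x ∧ (∀ i j, |(g : Matrix (Fin d) (Fin d) ℝ) i j| ≤ R) ∧
      ∀ i j, |((g⁻¹ : GSp d) : Matrix (Fin d) (Fin d) ℝ) i j| ≤ R := by
  obtain ⟨R, hR, h⟩ := mahler2 (d := d) hε
  obtain ⟨B, hB⟩ := exists_nat_gt ((d.factorial : ℝ) * R ^ d)
  obtain ⟨A, hA0, hA⟩ := int_reps d B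
  set R1 := d * (R * A) with hR1
  obtain ⟨R2, hR2⟩ := GSp_inv_bdd (d := d) R1
  refine ⟨max 1 (max R1 R2), le_max_left _ _, fun x hx => ?_⟩
  obtain ⟨g, rfl⟩ := QuotientGroup.mk_surjective x
  obtain ⟨N, hN0, hN⟩ := h g hx
  have hdet : ((N.det : ℤ) : ℝ) = ((g : Matrix (Fin d) (Fin d) ℝ) * N.map (fun z : ℤ => (z : ℝ))).det := by
    rw [det_mul, g.det_coe, one_mul]; exact Int.cast_det _
  have hNB : |N.det| ≤ B := by
    have h1 : |((N.det : ℤ) : ℝ)| ≤ (d.factorial : ℝ) * R ^ d := by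
      rw [hdet]
      have := Matrix.det_le (A := (g : Matrix (Fin d) (Fin d) ℝ) * N.map (fun z : ℤ => (z : ℝ))) (abv := AbsoluteValue.abs) (x := R) hN
      simpa using this
    have : |((N.det : ℤ) : ℝ)| ≤ B := h1.trans hB.le
    exact_mod_cast this
  obtain ⟨γ, Nc, hγ, hγN, hadj⟩ := hA N hN0 hNB
  let γ' : Matrix.SpecialLinearGroup (Fin d) ℤ := ⟨γ, hγ⟩
  let γr : GSp d := Matrix.SpecialLinearGroup.map (n := Fin d) (Int.castRingHom ℝ) γ'
  have hγr : γr ∈ Gamma d := ⟨γ', rfl⟩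
  have hmk : (QuotientGroup.mk (g * γr) : XSp d) = QuotientGroup.mk g := by
    rw [eq_comm, QuotientGroup.eq]; simpa using hγr
  have hval : ((g * γr : GSp d) : Matrix (Fin d) (Fin d) ℝ) = (g : Matrix (Fin d) (Fin d) ℝ) * cst γ := rfl
  have hmul : ((g : Matrix (Fin d) (Fin d) ℝ) * cst N) * cst Nc.adjugate = ((N.det : ℤ) : ℝ) • ((g * γr : GSp d) : Matrix (Fin d) (Fin d) ℝ) := by
    have hdd : N.det = Nc.det := by rw [← hγN, det_mul, hγ, one_mul]
    have e1 : cst Nc * cst Nc.adjugate = ((N.det : ℤ) : ℝ) • (1 : Matrix (Fin d) (Fin d) ℝ) := by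
      rw [← cst_mul, mul_adjugate, hdd]
      ext i j
      simp only [cst, RingHom.mapMatrix_apply, map_apply, Matrix.smul_apply, one_apply, smul_eq_mul]
      split_ifs <;> simp
    have e2 : cst N = cst γ * cst Nc := by rw [← cst_mul, hγN]
    have e3 : (g : Matrix (Fin d) (Fin d) ℝ) * cst N * cst Nc.adjugate = (g : Matrix (Fin d) (Fin d) ℝ) * cst γ * (cst Nc * cst Nc.adjugate) := by
      rw [e2]; simp only [Matrix.mul_assoc]
    rw [e3, e1, Matrix.mul_smul, Matrix.mul_one, hval]
  have hbd : ∀ i j, |((g * γr : GSp d) : Matrix (Fin d) (Fin d) ℝ) i j| ≤ R1 := by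
    intro i j
    have h1 := congrFun (congrFun hmul i) j
    rw [Matrix.smul_apply, smul_eq_mul] at h1
    have hD : (1 : ℝ) ≤ |((N.det : ℤ) : ℝ)| := by exact_mod_cast Int.one_le_abs hN0
    calc |((g * γr : GSp d) : Matrix (Fin d) (Fin d) ℝ) i j| ≤ |((N.det : ℤ) : ℝ)| * |((g * γr : GSp d) : Matrix (Fin d) (Fin d) ℝ) i j| :=
          le_mul_of_one_le_left (abs_nonneg _) hD
      _ = |∑ k, ((g : Matrix (Fin d) (Fin d) ℝ) * cst N) i k * cst Nc.adjugate k j| := by rw [← abs_mul, ← h1, mul_apply]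
      _ ≤ ∑ k, |((g : Matrix (Fin d) (Fin d) ℝ) * cst N) i k * cst Nc.adjugate k j| := Finset.abs_sum_le_sum_abs _ _
      _ ≤ ∑ k : Fin d, R * A := by
          refine Finset.sum_le_sum fun k _ => ?_
          rw [abs_mul]
          exact mul_le_mul (hN i k) (hadj k j) (abs_nonneg _) hR.le
      _ = R1 := by simp [hR1]
  exact ⟨g * γr, hmk, fun i j => (hbd i j).trans ((le_max_left _ _).trans (le_max_right _ _)),
    fun i j => (hR2 _ hbd i j).trans ((le_max_right _ _).trans (le_max_right _ _))⟩

lemma Cus_compact {d : ℕ} {ε : ℝ} (hε : 0 < ε) : IsCompact (Cus ε : Set (XSp d)) := by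
  obtain ⟨R, -, h⟩ := mahler3 (d := d) hε
  refine ((GSp_bdd_compact (d := d) R).image (f := (QuotientGroup.mk : GSp d → XSp d)) continuous_quotient_mk').of_isClosed_subset (Cus_closed ε) ?_
  intro x hx
  obtain ⟨g, hg, hb, -⟩ := h x hx
  exact ⟨g, hb, hg⟩

/-- absolute lattice point count at large scale -/
lemma lat_count {d : ℕ} {ε : ℝ} (hε : 0 < ε) : ∃ R : ℝ, 1 ≤ R ∧ ∀ x : XSp d, x ∈ Cus ε → ∀ r ≥ R,
    ∀ Λ : Finset (Fin d → ℝ), (∀ w ∈ Λ, w ∈ lat x ∧ ‖w‖ ≤ r) → (Λ.card : ℝ) ≤ (4 * r) ^ d := by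
  classical
  obtain ⟨R, hR1, h⟩ := mahler3 (d := d) hε
  refine ⟨d * R + 1, by nlinarith [(Nat.cast_nonneg d : (0:ℝ) ≤ d)], fun x hx r hr Λ hΛ => ?_⟩
  have hd0 : (0:ℝ) ≤ d := Nat.cast_nonneg d
  have hr0 : 0 ≤ r := by nlinarith
  obtain ⟨g, rfl, hg, -⟩ := h x hx
  let G : (Fin d → ℝ) →ₗ[ℝ] (Fin d → ℝ) := Matrix.toLin' (g : Matrix (Fin d) (Fin d) ℝ)
  have hGdet : LinearMap.det G = 1 := by rw [LinearMap.det_toLin', g.det_coe]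
  choose! k hk using fun w (hw : w ∈ Λ) => mem_lat_mk.1 (hΛ w hw).1
  let Q : (Fin d → ℤ) → Set (Fin d → ℝ) := fun k => Set.pi Set.univ fun i => Set.Ico (k i : ℝ) (k i + 1)
  have hQm : ∀ k, MeasurableSet (Q k) := fun k => MeasurableSet.univ_pi fun i => measurableSet_Ico
  have hQv : ∀ k, volume (Q k) = 1 := by
    intro k; simp [Q, volume_pi_pi]
  have hvol : ∀ k, volume (G '' Q k) = 1 := by
    intro k
    rw [Measure.addHaar_image_linearMap, hGdet, hQv]; simp
  have hinj : Function.Injective G := by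
    rw [← LinearMap.ker_eq_bot, LinearMap.ker_eq_bot']
    intro w hw
    by_contra hne
    exact GSp_mulVec_ne g hne (by simpa [G] using hw)
  have hdisj : (Λ : Set (Fin d → ℝ)).PairwiseDisjoint fun w => G '' Q (k w) := by
    intro w hw w' hw' hne
    refine (Set.disjoint_image_iff hinj).2 (Set.disjoint_left.2 fun u hu hu' => hne ?_)
    have : k w = k w' := by
      ext i
      have h1 := hu i trivial
      have h2 := hu' i trivial
      have a1 : ⌊u i⌋ = k w i := Int.floor_eq_iff.2 ⟨h1.1, h1.2⟩
      have a2 : ⌊u i⌋ = k w' i := Int.floor_eq_iff.2 ⟨h2.1, h2.2⟩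
      rw [← a1, a2]
    rw [hk w hw, hk w' hw', this]
  have hGc : Continuous G := LinearMap.continuous_of_finiteDimensional G
  have hmeas : ∀ w ∈ Λ, MeasurableSet (G '' Q (k w)) := fun w _ =>
    (hQm _).image_of_continuousOn_injOn hGc.continuousOn hinj.injOn
  have hsub : (⋃ w ∈ Λ, G '' Q (k w)) ⊆ Set.pi Set.univ fun _ => Set.Icc (-(2 * r)) (2 * r) := by
    intro u hu
    simp only [Set.mem_iUnion] at hu
    obtain ⟨w, hw, q, hq, rfl⟩ := hu
    have h1 : G q = w + (g : Matrix (Fin d) (Fin d) ℝ) *ᵥ (q - rv (k w)) := by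
      rw [mulVec_sub, ← hk w hw]; simp [G]
    have h2 : ‖q - rv (k w)‖ ≤ 1 := by
      rw [pi_norm_le_iff_of_nonneg zero_le_one]
      intro i
      have := hq i trivial
      simp only [Set.mem_Ico] at this
      rw [Pi.sub_apply, Real.norm_eq_abs, abs_le]
      simp only [rv]
      constructor <;> linarith [this.1, this.2]
    have h3 : ‖G q‖ ≤ 2 * r := by
      rw [h1]
      refine (norm_add_le _ _).trans ?_
      have := norm_mulVec_le _ hg (q - rv (k w))
      have h4 : d * R * ‖q - rv (k w)‖ ≤ d * R * 1 := by gcongr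
      linarith [(hΛ w hw).2]
    intro i _
    exact abs_le.1 ((norm_le_pi_norm (G q) i).trans h3)
  have key := measure_mono (μ := volume) hsub
  rw [measure_biUnion_finset hdisj hmeas, Finset.sum_congr rfl (fun w _ => hvol (k w)), volume_pi_pi] at key
  simp only [Real.volume_Icc, Finset.sum_const, Finset.prod_const, Finset.card_univ, Fintype.card_fin, nsmul_eq_mul, mul_one] at key
  rw [← ENNReal.ofReal_pow (by linarith), ← ENNReal.ofReal_natCast, ENNReal.ofReal_le_ofReal_iff (by apply pow_nonneg; linarith)] at key
  calc _ ≤ _ := key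
    _ = _ := by ring

end PartMah2

section PartLow

/-! ## Part Low: entropy lower bound -/

lemma uSL_Nb_conv {m n : ℕ} {θ : ℝ} (hθ : 0 < θ) {B : Mt m n} (h : uSL m n B ∈ (Nb θ : Set (GSp (m + n)))) : ‖B‖ < θ := by
  rw [pi_norm_lt_iff hθ]
  intro i
  rw [pi_norm_lt_iff hθ]
  intro j
  have := h (Fin.castAdd n i) (Fin.natAdd m j)
  have e : ((uSL m n B : GSp (m + n)) : Matrix (Fin (m+n)) (Fin (m+n)) ℝ) (Fin.castAdd n i) (Fin.natAdd m j) = B i j := by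
    simp [uSL, uMat]
  have e2 : (1 : Matrix (Fin (m+n)) (Fin (m+n)) ℝ) (Fin.castAdd n i) (Fin.natAdd m j) = 0 := by
    rw [one_apply_ne]; intro h; have := congrArg Fin.val h; simp at this; omega
  rw [e, e2, sub_zero] at this
  exact this

lemma grp_split {G : Type*} [Group G] [TopologicalSpace G] [IsTopologicalGroup G] {V : Set G} (hV : V ∈ 𝓝 (1 : G)) :
    ∃ W ∈ 𝓝 (1 : G), ∀ a ∈ W, ∀ b ∈ W, a⁻¹ * b ∈ V := by
  have hcont : ContinuousAt (fun p : G × G => p.1⁻¹ * p.2) (1, 1) := by fun_prop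
  have h1 := hcont.preimage_mem_nhds (by simpa using hV)
  rw [nhds_prod_eq] at h1
  obtain ⟨W1, hW1, W2, hW2, hW⟩ := mem_prod_iff.1 h1
  exact ⟨W1 ∩ W2, Filter.inter_mem hW1 hW2, fun a ha b hb => hW (Set.mk_mem_prod ha.1 hb.2)⟩

lemma low_nbhd {m n : ℕ} {K : Set (XSp (m + n))} (hK : IsCompact K) {c : ℝ} (hc : 0 < c) :
    ∃ θ > 0, θ ≤ 1 / 2 ∧ ∃ V ∈ 𝓝 (1 : GSp (m + n)), ∀ y ∈ K, ∀ g ∈ V, ∀ B : Mt m n, ‖B‖ < 2 * θ →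
      uSL m n B • y = g • y → ‖B‖ < θ / c := by
  obtain ⟨V0, hV0, hinj⟩ := inj_rad hK
  obtain ⟨W1, hW1, hW⟩ := grp_split hV0
  obtain ⟨θ1, hθ1, hN⟩ := Nb_basis hW1
  set θ := min (1 / 2) (θ1 / 2) with hθ
  have hθ0 : 0 < θ := lt_min (by norm_num) (by positivity)
  have hθc : 0 < θ / c := by positivity
  refine ⟨θ, hθ0, min_le_left _ _, W1 ∩ Nb (θ / c), Filter.inter_mem hW1 (Nb_mem hθc), fun y hy g hg B hB he => ?_⟩
  have hB' : uSL m n B ∈ W1 := hN (uSL_Nb hθ1 (hB.trans_le (by have := min_le_right (1/2 : ℝ) (θ1/2); linarith)))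
  have h2 : g⁻¹ * uSL m n B ∈ V0 := hW _ hg.1 _ hB'
  have h3 : (g⁻¹ * uSL m n B) • y = y := by
    rw [mul_smul, he, inv_smul_smul]
  have h4 := hinj y hy _ h2 h3
  have h5 : uSL m n B = g := by rw [inv_mul_eq_one] at h4; exact h4.symm
  exact uSL_Nb_conv hθc (h5 ▸ hg.2)

lemma iter_uSL {m n : ℕ} (hm : 0 < m) (hn : 0 < n) (j : ℕ) (A A' : Mt m n) (x : XSp (m + n)) :
    (aAct m n hm hn)^[j] (uSL m n A' • x) = uSL m n (lamE m n j • (A' - A)) • (aAct m n hm hn)^[j] (uSL m n A • x) := by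
  rw [aAct_iter, aAct_iter, smul_smul, smul_smul, smul_smul, aSL_uSL, mul_assoc, aSL_uSL, ← mul_assoc, uSL_mul]
  congr 3
  rw [smul_sub]; abel

lemma low_lab {m n : ℕ} (hm : 0 < m) (hn : 0 < n) {K : Set (XSp (m + n))} {V : Set (GSp (m + n))} {θ : ℝ} (hθ : 0 < θ)
    (hV : ∀ y ∈ K, ∀ g ∈ V, ∀ B : Mt m n, ‖B‖ < 2 * θ → uSL m n B • y = g • y → ‖B‖ < θ / lamE m n 1)
    {ι : Type*} [DecidableEq ι] (o : ι) (f : XSp (m + n) → ι)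
    (hf : ∀ y y', f y = f y' → f y ≠ o → y ∈ K ∧ ∃ g ∈ V, y' = g • y) (x0 : XSp (m + n)) {R0 : ℝ} (hR0 : 0 ≤ R0) (ω : ℕ → ι) (N : ℕ) :
    Lab (fun A A' : Mt m n => lamE m n N * ‖A' - A‖ < θ)
      {A | ‖A‖ ≤ R0 ∧ ∀ j < N, f ((aAct m n hm hn)^[j] (uSL m n A • x0)) = ω j}
      ((2 * R0 / θ + 1) ^ (m * n) * ((2 * lamE m n 1 + 1) ^ (m * n)) ^ ((Finset.range N).filter fun j => ω j = o).card) := by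
  induction N with
  | zero =>
    have := grid {A : Mt m n | ‖A‖ ≤ R0} 0 (fun _ _ => R0) (fun x hx i j => by
      have h1 := norm_le_pi_norm x i
      have h2 := norm_le_pi_norm (x i) j
      simp only [Pi.zero_apply, sub_zero]
      exact h2.trans (h1.trans hx)) hθ (fun _ _ => hR0)
    refine this.mono (fun x x' _ _ h => by simpa [lamE_zero] using h) (fun A hA => hA.1) ?_
    simp [← pow_mul, mul_comm]
  | succ N ih =>
    set S := {A : Mt m n | ‖A‖ ≤ R0 ∧ ∀ j < N + 1, f ((aAct m n hm hn)^[j] (uSL m n A • x0)) = ω j} with hS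
    have ih' := ih.mono (S' := S) (Q' := fun A A' : Mt m n => lamE m n N * ‖A' - A‖ < θ) (fun _ _ _ _ h => h)
      (fun A hA => ⟨hA.1, fun j hj => hA.2 j (by omega)⟩) le_rfl
    have hl := lamE_pos m n N
    have hl1 := lamE_pos m n 1
    by_cases hω : ω N = o
    · have hc : ((Finset.range (N + 1)).filter fun j => ω j = o).card = ((Finset.range N).filter fun j => ω j = o).card + 1 := by
        rw [Finset.range_add_one, Finset.filter_insert, if_pos hω, Finset.card_insert_of_notMem (by simp)]
      rw [hc, pow_succ, ← mul_assoc]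
      refine ih'.refine (fun A0 hA0 => ?_) (by positivity)
      have := grid {A : Mt m n | A ∈ S ∧ lamE m n N * ‖A - A0‖ < θ} A0 (fun _ _ => θ / lamE m n N) (fun x hx i j => by
        have h1 := norm_le_pi_norm (x - A0) i
        have h2 := norm_le_pi_norm ((x - A0) i) j
        refine (h2.trans h1).trans ?_
        rw [le_div_iff₀ hl]; linarith [hx.2]) (η := θ / lamE m n (N + 1)) (by have := lamE_pos m n (N + 1); positivity) (fun _ _ => by positivity)
      refine this.mono (fun x x' _ _ h => ?_) (fun _ h => h) ?_
      · rw [lt_div_iff₀ (lamE_pos _ _ _)] at h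
        push_cast; linarith
      · rw [lamE_add]
        simp only [Finset.prod_const, Finset.card_univ, Fintype.card_fin, ← pow_mul]
        rw [mul_comm n m]
        have : 2 * (θ / lamE m n ↑N) / (θ / (lamE m n ↑N * lamE m n 1)) = 2 * lamE m n 1 := by field_simp
        rw [this]
    · have hc : ((Finset.range (N + 1)).filter fun j => ω j = o).card = ((Finset.range N).filter fun j => ω j = o).card := by
        rw [Finset.range_add_one, Finset.filter_insert, if_neg hω]
      rw [hc]
      have : Lab (fun A A' : Mt m n => lamE m n (N + 1 : ℕ) * ‖A' - A‖ < θ) S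
          (((2 * R0 / θ + 1) ^ (m * n) * ((2 * lamE m n 1 + 1) ^ (m * n)) ^ ((Finset.range N).filter fun j => ω j = o).card) * 1) := by
        refine ih'.refine (fun A0 hA0 => ?_) zero_le_one
        refine Lab.of (κ := Unit) (fun _ => ()) (by simp) ?_
        rintro A ⟨hA, hA0'⟩ A' ⟨hA', hA0''⟩ -
        have hfA := hA.2 N (by omega)
        have hfA' := hA'.2 N (by omega)
        obtain ⟨hyK, g, hg, he⟩ := hf _ _ (hfA.trans hfA'.symm) (by rw [hfA]; exact hω)
        rw [iter_uSL hm hn N A A'] at he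
        have hnorm : ‖lamE m n N • (A' - A)‖ = lamE m n N * ‖A' - A‖ := by
          rw [norm_smul, Real.norm_eq_abs, abs_of_pos hl]
        have hlt : ‖lamE m n N • (A' - A)‖ < 2 * θ := by
          rw [hnorm]
          have : ‖A' - A‖ ≤ ‖A' - A0‖ + ‖A - A0‖ := by
            have := norm_sub_le (A' - A0) (A - A0)
            rwa [sub_sub_sub_cancel_right] at this
          nlinarith
        have := hV _ hyK g hg _ hlt he
        rw [hnorm, lt_div_iff₀ hl1] at this
        push_cast
        rw [lamE_add]; linarith
      simpa using this

end PartLow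

section PartLow2

lemma Lab.real_le {α : Type*} [MeasurableSpace α] (ρ : Measure α) [IsFiniteMeasure ρ] {Q : α → α → Prop} {S : Set α} {c κ : ℝ}
    (h : Lab Q S c) (hκ0 : 0 ≤ κ) (hκ : ∀ S' : Set α, (∀ x ∈ S', ∀ x' ∈ S', Q x x') → ρ.real S' ≤ κ) : ρ.real S ≤ c * κ := by
  obtain ⟨p, D, hp, hD, hQ⟩ := h
  have h1 : S ⊆ ⋃ i ∈ (Finset.univ : Finset (Fin p)), (S ∩ D i) := by
    intro x hx
    obtain ⟨i, hi⟩ := Set.mem_iUnion.1 (hD hx)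
    simp only [Set.mem_iUnion]
    exact ⟨i, Finset.mem_univ _, hx, hi⟩
  calc ρ.real S ≤ ρ.real (⋃ i ∈ (Finset.univ : Finset (Fin p)), (S ∩ D i)) := measureReal_mono h1 (measure_ne_top _ _)
    _ ≤ ∑ i : Fin p, ρ.real (S ∩ D i) := measureReal_biUnion_finset_le _ _
    _ ≤ ∑ i : Fin p, κ := Finset.sum_le_sum fun i _ => hκ _ fun x hx x' hx' => hQ i x hx.2 x' hx'.2 hx.1 hx'.1
    _ = p * κ := by simp
    _ ≤ c * κ := by gcongr

lemma Hent_lower {m n : ℕ} (hm : 0 < m) (hn : 0 < n) {K : Set (XSp (m + n))} {V : Set (GSp (m + n))} {θ : ℝ} (hθ : 0 < θ)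
    (hV : ∀ y ∈ K, ∀ g ∈ V, ∀ B : Mt m n, ‖B‖ < 2 * θ → uSL m n B • y = g • y → ‖B‖ < θ / lamE m n 1)
    {ι : Type*} [Fintype ι] [DecidableEq ι] (o : ι) {f : XSp (m + n) → ι} (hfm : FibM f)
    (hf : ∀ y y', f y = f y' → f y ≠ o → y ∈ K ∧ ∃ g ∈ V, y' = g • y) (x0 : XSp (m + n)) {R0 : ℝ} (hR0 : 0 ≤ R0) (N : ℕ) (hN : 0 < N)
    (ρ : Measure (Mt m n)) [IsProbabilityMeasure ρ] (hsupp : ρ {A | ‖A‖ ≤ R0}ᶜ = 0) {C s : ℝ} (hC : 0 < C)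
    (hρ : ∀ S : Set (Mt m n), (∀ A ∈ S, ∀ A' ∈ S, lamE m n N * ‖A' - A‖ < θ) → ρ.real S ≤ C * Real.exp (-(s * N))) :
    s * N - Real.log ((2 * R0 / θ + 1) ^ (m * n) * C) - Real.log ((2 * lamE m n 1 + 1) ^ (m * n)) *
      (N * (avgM (aAct m n hm hn) (ρ.map fun A => uSL m n A • x0) N).real (f ⁻¹' {o})) ≤
      Hent (ρ.map fun A => uSL m n A • x0) (itin (aAct m n hm hn) f N) := by
  classical
  set T := aAct m n hm hn with hTdef
  have hT : Measurable T := aAct_measurable m n hm hn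
  set φ : Mt m n → XSp (m + n) := fun A => uSL m n A • x0 with hφ
  have hφm : Measurable φ := by
    have : Continuous φ := (uSL_continuous m n).smul continuous_const
    exact this.measurable
  set η := ρ.map φ with hη
  have : IsProbabilityMeasure η := Measure.isProbabilityMeasure_map hφm.aemeasurable
  have hl1 := lamE_pos m n 1
  set D0 : ℝ := (2 * lamE m n 1 + 1) ^ (m * n) with hD0
  have hD0p : 0 < D0 := by positivity
  set C0 : ℝ := (2 * R0 / θ + 1) ^ (m * n) with hC0
  have hC0p : 0 < C0 := by positivity
  let z : (Fin N → ι) → ℕ := fun ω => (Finset.univ.filter fun j => ω j = o).card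
  let p : (Fin N → ι) → ℝ := fun ω => η.real (itin T f N ⁻¹' {ω})
  have hit : FibM (itin T f N) := hfm.itin hT N
  have hp : ∀ ω, p ω ≤ C0 * D0 ^ z ω * (C * Real.exp (-(s * N))) := by
    intro ω
    let ω' : ℕ → ι := fun j => if h : j < N then ω ⟨j, h⟩ else o
    have hz : ((Finset.range N).filter fun j => ω' j = o).card = z ω := by
      simp only [z]
      rw [Finset.card_filter, Finset.card_filter, Finset.sum_range]
      refine Finset.sum_congr rfl fun j _ => ?_
      simp [ω']
    have lab := low_lab hm hn hθ hV o f hf x0 hR0 ω' N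
    rw [hz] at lab
    have h1 := lab.real_le ρ (by positivity) hρ
    refine le_trans ?_ h1
    have h2 : p ω = ρ.real (φ ⁻¹' (itin T f N ⁻¹' {ω})) := by
      simp only [p, hη]
      rw [map_measureReal_apply hφm (hit ω)]
    rw [h2]
    have h3 : ρ.real (φ ⁻¹' (itin T f N ⁻¹' {ω})) ≤ ρ.real ((φ ⁻¹' (itin T f N ⁻¹' {ω}) ∩ {A | ‖A‖ ≤ R0}) ∪ {A | ‖A‖ ≤ R0}ᶜ) :=
      measureReal_mono (fun A hA => by by_cases h : ‖A‖ ≤ R0 <;> [left; right] <;> [exact ⟨hA, h⟩; exact h])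
    refine h3.trans ((measureReal_union_le _ _).trans ?_)
    rw [show ρ.real {A | ‖A‖ ≤ R0}ᶜ = 0 by rw [Measure.real, hsupp]; rfl, add_zero]
    refine measureReal_mono ?_
    rintro A ⟨hA, hA0⟩
    refine ⟨hA0, fun j hj => ?_⟩
    have := congrFun (show itin T f N (φ A) = ω from hA) ⟨j, hj⟩
    simp only [ω', hj, dif_pos]
    exact this
  have hp0 : ∀ ω, 0 ≤ p ω := fun ω => measureReal_nonneg
  have hterm : ∀ ω, p ω * (s * N - Real.log (C0 * C)) - Real.log D0 * (p ω * z ω) ≤ Real.negMulLog (p ω) := by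
    intro ω
    rcases (hp0 ω).eq_or_lt with h0 | hpos
    · rw [← h0]; simp
    · have hlog := Real.log_le_log hpos (hp ω)
      have e : C0 * D0 ^ z ω * (C * Real.exp (-(s * N))) = (C0 * C) * D0 ^ z ω * Real.exp (-(s * N)) := by ring
      rw [e, Real.log_mul (by positivity) (by positivity), Real.log_mul (by positivity) (by positivity), Real.log_pow, Real.log_exp] at hlog
      rw [Real.negMulLog]
      nlinarith
  have hsum1 : ∑ ω, p ω = 1 := by
    have h1 : ∑ ω, p ω = η.real (⋃ ω ∈ (Finset.univ : Finset (Fin N → ι)), itin T f N ⁻¹' {ω}) := by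
      rw [measureReal_biUnion_finset ?_ (fun ω _ => hit ω)]
      intro a _ b _ hab
      exact Set.disjoint_left.2 fun x hx hx' => hab (hx.symm.trans hx')
    rw [h1]
    have : (⋃ ω ∈ (Finset.univ : Finset (Fin N → ι)), itin T f N ⁻¹' {ω}) = Set.univ := by ext x; simp
    rw [this]; simp
  have hsum2 : ∑ ω, p ω * z ω = N * (avgM T η N).real (f ⁻¹' {o}) := by
    rw [avgM_real T hT η N (hfm o), Finset.mul_sum, Finset.sum_range]
    have e1 : ∀ j : Fin N, (N : ℝ) * ((N : ℝ)⁻¹ * (η.map T^[(j : ℕ)]).real (f ⁻¹' {o})) = ∑ ω : Fin N → ι, p ω * (if ω j = o then 1 else 0) := by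
      intro j
      rw [mul_inv_cancel_left₀ (by positivity), map_measureReal_apply (hT.iterate j) (hfm o)]
      have : (T^[(j : ℕ)] ⁻¹' (f ⁻¹' {o})) = ⋃ ω ∈ (Finset.univ.filter fun ω : Fin N → ι => ω j = o), itin T f N ⁻¹' {ω} := by
        ext x
        simp only [Set.mem_preimage, Set.mem_singleton_iff, Finset.mem_filter, Finset.mem_univ, true_and, Set.mem_iUnion, exists_prop]
        constructor
        · intro h; exact ⟨itin T f N x, h, rfl⟩
        · rintro ⟨ω, h, rfl⟩; exact h
      rw [this, measureReal_biUnion_finset ?_ (fun ω _ => hit ω)]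
      · simp only [mul_ite, mul_one, mul_zero, Finset.sum_filter]; rfl
      · intro a _ b _ hab
        exact Set.disjoint_left.2 fun x hx hx' => hab (hx.symm.trans hx')
    rw [Finset.sum_congr rfl fun j _ => e1 j, Finset.sum_comm]
    refine Finset.sum_congr rfl fun ω _ => ?_
    rw [← Finset.mul_sum]
    simp [z, Finset.sum_boole]
  have := Finset.sum_le_sum fun ω (_ : ω ∈ (Finset.univ : Finset (Fin N → ι))) => hterm ω
  rw [Finset.sum_sub_distrib, ← Finset.sum_mul, ← Finset.mul_sum, hsum1, hsum2, one_mul] at this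
  exact this

end PartLow2

section PartLow3

/-- null frontier -/
def NFr {α : Type*} [TopologicalSpace α] [MeasurableSpace α] (μ : Measure α) (s : Set α) : Prop := μ (frontier s) = 0

lemma NFr.compl {α : Type*} [TopologicalSpace α] [MeasurableSpace α] {μ : Measure α} {s : Set α} (h : NFr μ s) : NFr μ sᶜ := by
  unfold NFr; rwa [frontier_compl]

lemma NFr.inter {α : Type*} [TopologicalSpace α] [MeasurableSpace α] {μ : Measure α} {s t : Set α} (h : NFr μ s) (h' : NFr μ t) :
    NFr μ (s ∩ t) := by
  refine measure_mono_null (t := frontier s ∪ frontier t) ?_ (measure_union_null h h')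
  exact (frontier_inter_subset s t).trans (Set.union_subset_union Set.inter_subset_left Set.inter_subset_right)

lemma NFr.iInter {α ι : Type*} [TopologicalSpace α] [MeasurableSpace α] {μ : Measure α} [Fintype ι] {s : ι → Set α} (h : ∀ i, NFr μ (s i)) :
    NFr μ (⋂ i, s i) := by
  classical
  have : ∀ F : Finset ι, NFr μ (⋂ i ∈ F, s i) := by
    intro F
    induction F using Finset.induction_on with
    | empty => simp [NFr]
    | insert a F _ ih =>
      rw [Finset.set_biInter_insert]
      exact (h a).inter ih
  simpa using this Finset.univ

lemma NFr.preimage {α : Type*} [TopologicalSpace α] [MeasurableSpace α] [BorelSpace α] {μ : Measure α} {T : α → α} (hT : Continuous T)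
    (hμ : MeasurePreserving T μ μ) {s : Set α} (h : NFr μ s) : NFr μ (T ⁻¹' s) := by
  refine measure_mono_null (hT.frontier_preimage_subset s) ?_
  rw [hμ.measure_preimage isClosed_frontier.measurableSet.nullMeasurableSet]
  exact h

lemma nfr_itin {α ι : Type*} [TopologicalSpace α] [MeasurableSpace α] [BorelSpace α] {μ : Measure α} {T : α → α} (hT : Continuous T)
    (hμ : MeasurePreserving T μ μ) {f : α → ι} (h : ∀ i, NFr μ (f ⁻¹' {i})) (q : ℕ) (ω : Fin q → ι) : NFr μ (itin T f q ⁻¹' {ω}) := by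
  have : itin T f q ⁻¹' {ω} = ⋂ j : Fin q, T^[(j : ℕ)] ⁻¹' (f ⁻¹' {ω j}) := by
    ext x; simp [itin, funext_iff]
  rw [this]
  exact NFr.iInter fun j => (h (ω j)).preimage (hT.iterate j) (hμ.iterate j)

/-- partition into a cusp and small pieces with null frontiers -/
lemma low_part {d : ℕ} (μ : Measure (XSp d)) [IsProbabilityMeasure μ] {K K' : Set (XSp d)} (hK : IsCompact K) (hKK : K ⊆ interior K')
    {V : Set (GSp d)} (hV : V ∈ 𝓝 (1 : GSp d)) : ∃ (k : ℕ) (f : XSp d → Finset (Fin k)), FibM f ∧ (∀ i, NFr μ (f ⁻¹' {i})) ∧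
      (∀ y y', f y = f y' → f y ≠ ∅ → y ∈ K' ∧ ∃ g ∈ V, y' = g • y) ∧ f ⁻¹' {∅} ⊆ Kᶜ := by
  classical
  let _ := TopologicalSpace.metrizableSpaceMetric (XSp d)
  have h1 : ∀ x ∈ K, ∃ B : Set (XSp d), IsOpen B ∧ x ∈ B ∧ NFr μ B ∧ B ⊆ K' ∧ ∀ y ∈ B, ∀ y' ∈ B, ∃ g ∈ V, y' = g • y := by
    intro x hx
    obtain ⟨O, hO, hOV⟩ := small_nhds x hV
    have hO' : O ∩ interior K' ∈ 𝓝 x := Filter.inter_mem hO (isOpen_interior.mem_nhds (hKK hx))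
    obtain ⟨ε, hε, hb⟩ := Metric.mem_nhds_iff.1 hO'
    obtain ⟨r, ⟨hr0, hr⟩, hnull⟩ := exists_null_frontier_thickening μ {x} hε
    refine ⟨Metric.thickening r {x}, Metric.isOpen_thickening, ?_, hnull, ?_, ?_⟩
    · rw [Metric.thickening_singleton]; exact Metric.mem_ball_self hr0
    · rw [Metric.thickening_singleton]
      exact fun y hy => interior_subset (hb (Metric.ball_subset_ball hr.le hy)).2
    · rw [Metric.thickening_singleton]
      exact fun y hy y' hy' => hOV y (hb (Metric.ball_subset_ball hr.le hy)).1 y' (hb (Metric.ball_subset_ball hr.le hy')).1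
  choose! B hBo hBx hBn hBK hBV using h1
  obtain ⟨t, htK, htc⟩ := hK.elim_nhds_subcover B (fun x hx => (hBo x hx).mem_nhds (hBx x hx))
  let e := t.equivFin
  let B' : Fin t.card → Set (XSp d) := fun i => B (e.symm i : XSp d)
  have hmem : ∀ i, ((e.symm i : t) : XSp d) ∈ K := fun i => htK _ (e.symm i).2
  let f : XSp d → Finset (Fin t.card) := fun y => Finset.univ.filter fun i => y ∈ B' i
  have hfib : ∀ a, f ⁻¹' {a} = ⋂ i, (if i ∈ a then B' i else (B' i)ᶜ) := by
    intro a
    ext y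
    simp only [Set.mem_preimage, Set.mem_singleton_iff, Set.mem_iInter, f, Finset.ext_iff, Finset.mem_filter, Finset.mem_univ, true_and]
    refine forall_congr' fun i => ?_
    split_ifs with h <;> simp [h]
  refine ⟨t.card, f, fun a => ?_, fun a => ?_, ?_, ?_⟩
  · rw [hfib]
    refine MeasurableSet.iInter fun i => ?_
    split_ifs
    · exact (hBo _ (hmem i)).measurableSet
    · exact (hBo _ (hmem i)).measurableSet.compl
  · rw [hfib]
    refine NFr.iInter fun i => ?_
    split_ifs
    · exact hBn _ (hmem i)
    · exact (hBn _ (hmem i)).compl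
  · intro y y' he hne
    obtain ⟨i, hi⟩ := Finset.nonempty_of_ne_empty hne
    have hi' : i ∈ f y' := he ▸ hi
    simp only [f, Finset.mem_filter, Finset.mem_univ, true_and] at hi hi'
    exact ⟨hBK _ (hmem i) hi, hBV _ (hmem i) y hi y' hi'⟩
  · intro y hy hyK
    obtain ⟨x, hx, hxy⟩ := Set.mem_iUnion₂.1 (htc hyK)
    have : e ⟨x, hx⟩ ∈ f y := by
      simp only [f, Finset.mem_filter, Finset.mem_univ, true_and, B', Equiv.symm_apply_apply]; exact hxy
    rw [show f y = ∅ from hy] at this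
    simp at this

theorem lowerL {m n : ℕ} (hm : 0 < m) (hn : 0 < n) {I : Type*} (l : Filter I) [l.NeBot] (N : I → ℕ) (hN0 : ∀ i, 0 < N i)
    (hN : Tendsto N l atTop) (x0 : XSp (m + n)) (ρ : I → Measure (Mt m n)) [∀ i, IsProbabilityMeasure (ρ i)] {R0 : ℝ} (hR0 : 0 ≤ R0)
    (hsupp : ∀ i, ρ i {A | ‖A‖ ≤ R0}ᶜ = 0) {C s : ℝ} (hC : 0 < C)
    (hρ : ∀ i, ∀ S : Set (Mt m n), (∀ A ∈ S, ∀ A' ∈ S, lamE m n (N i) * ‖A' - A‖ < 1 / 2) → (ρ i).real S ≤ C * Real.exp (-(s * N i)))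
    (κ : I → ProbabilityMeasure (XSp (m + n)))
    (hκ : ∀ i, (κ i : Measure (XSp (m + n))) = avgM (aAct m n hm hn) ((ρ i).map fun A => uSL m n A • x0) (N i))
    (μ : ProbabilityMeasure (XSp (m + n))) (hlim : Tendsto κ l (𝓝 μ))
    (hμ : MeasurePreserving (aAct m n hm hn) (μ : Measure (XSp (m + n))) μ) : s ≤ ksEntropy (aAct m n hm hn) (μ : Measure (XSp (m + n))) := by
  classical
  set T := aAct m n hm hn with hTdef
  have hTc : Continuous T := aAct_continuous m n hm hn
  have hT : Measurable T := hTc.measurable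
  set L0 := Real.log ((2 * lamE m n 1 + 1) ^ (m * n)) with hL0
  have hl1 := lamE_pos m n 1
  have hL0' : 0 ≤ L0 := Real.log_nonneg (one_le_pow₀ (by linarith))
  refine le_of_forall_pos_le_add fun δ hδ => ?_
  set δ' := δ / (L0 + 1) with hδ'
  have hδ'0 : 0 < δ' := by positivity
  obtain ⟨K, -, hK, hKm, hKμ⟩ := X_reg (μ : Measure (XSp (m + n))) Set.univ MeasurableSet.univ δ' hδ'0
  obtain ⟨K', hK', hKK⟩ := exists_compact_superset hK
  obtain ⟨θ, hθ, hθ2, V, hV, hinj⟩ := low_nbhd (m := m) (n := n) hK' hl1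
  obtain ⟨k, f, hfm, hfn, hfp, hf0⟩ := low_part (μ : Measure (XSp (m + n))) hK hKK hV
  have hcusp : (μ : Measure (XSp (m + n))).real (f ⁻¹' {∅}) ≤ δ' := by
    refine (measureReal_mono (hf0.trans ?_)).trans hKμ
    rw [Set.compl_eq_univ_sdiff]
  have hks := le_ks' T (μ : Measure (XSp (m + n))) (m + n) (by positivity) (U2 hm hn _ hμ) hμ hfm
  refine le_trans ?_ (add_le_add_left hks δ)
  rw [← sub_le_iff_le_add]
  refine le_hmap _ _ _ _ fun q hq => ?_
  set C1 := Real.log ((2 * R0 / θ + 1) ^ (m * n) * C) with hC1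
  -- convergence of masses
  have hmass : ∀ S : Set (XSp (m + n)), NFr (μ : Measure (XSp (m + n))) S →
      Tendsto (fun i => (κ i : Measure (XSp (m + n))).real S) l (𝓝 ((μ : Measure (XSp (m + n))).real S)) := by
    intro S hS
    have := ProbabilityMeasure.tendsto_measure_of_null_frontier_of_tendsto' hlim hS
    exact (ENNReal.tendsto_toReal (measure_ne_top _ _)).comp this
  have hHlim : Tendsto (fun i => Hent (κ i : Measure (XSp (m + n))) (itin T f q)) l (𝓝 (Hent (μ : Measure (XSp (m + n))) (itin T f q))) := by
    unfold Hent
    refine tendsto_finsetSum _ fun ω _ => ?_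
    exact (Real.continuous_negMulLog.tendsto _).comp (hmass _ (nfr_itin hTc hμ hfn q ω))
  have hineq : ∀ i, s - C1 / N i - L0 * (κ i : Measure (XSp (m + n))).real (f ⁻¹' {∅}) ≤
      Hent (κ i : Measure (XSp (m + n))) (itin T f q) / q + q * Real.log (Fintype.card (Finset (Fin k))) / N i := by
    intro i
    have hNi : (0 : ℝ) < N i := by exact_mod_cast hN0 i
    have hφm : Measurable fun A : Mt m n => uSL m n A • x0 :=
      (show Continuous fun A : Mt m n => uSL m n A • x0 from (uSL_continuous m n).smul continuous_const).measurable
    have : IsProbabilityMeasure ((ρ i).map fun A => uSL m n A • x0) := Measure.isProbabilityMeasure_map hφm.aemeasurable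
    have h1 := Hent_lower hm hn hθ hinj ∅ hfm hfp x0 hR0 (N i) (hN0 i) (ρ i) (hsupp i) hC
      (fun S hS => hρ i S fun A hA A' hA' => (hS A hA A' hA').trans_le hθ2)
    have h2 := misiurewicz T hT ((ρ i).map fun A => uSL m n A • x0) hfm q hq (N i) (hN0 i)
    rw [← hκ] at h1 h2
    refine le_trans ?_ h2
    rw [le_div_iff₀ hNi]
    refine le_trans (le_of_eq ?_) h1
    have hcc : C1 / N i * N i = C1 := div_mul_cancel₀ _ hNi.ne'
    linear_combination (-1 : ℝ) * hcc
  have hNr : Tendsto (fun i => (N i : ℝ)) l atTop := tendsto_natCast_atTop_atTop.comp hN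
  have hl := le_of_tendsto_of_tendsto' (((tendsto_const_nhds (x := s)).sub (hNr.const_div_atTop C1)).sub ((hmass _ (hfn ∅)).const_mul L0))
    ((hHlim.div_const (q : ℝ)).add (hNr.const_div_atTop (q * Real.log (Fintype.card (Finset (Fin k)))))) hineq
  rw [sub_zero, add_zero] at hl
  refine le_trans ?_ hl
  have : L0 * (μ : Measure (XSp (m + n))).real (f ⁻¹' {∅}) ≤ δ := by
    calc _ ≤ L0 * δ' := by gcongr
      _ ≤ (L0 + 1) * δ' := by nlinarith
      _ = δ := by rw [hδ']; field_simp
  linarith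

end PartLow3

section PartLim

lemma avgM_integral {α : Type*} [TopologicalSpace α] [MeasurableSpace α] [BorelSpace α] {T : α → α} (hT : Continuous T)
    (η : Measure α) [IsProbabilityMeasure η] (N : ℕ) (f : BoundedContinuousFunction α ℝ) :
    ∫ x, f x ∂(avgM T η N) = (N : ℝ)⁻¹ * ∑ j ∈ Finset.range N, ∫ x, f (T^[j] x) ∂η := by
  have hp : ∀ j, IsProbabilityMeasure (η.map (T^[j])) := fun j =>
    Measure.isProbabilityMeasure_map (hT.iterate j).measurable.aemeasurable
  unfold avgM
  rw [integral_smul_measure, integral_finsetSum_measure (fun j _ => f.integrable _)]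
  simp only [ENNReal.toReal_inv, ENNReal.toReal_natCast, smul_eq_mul]
  congr 1
  refine Finset.sum_congr rfl fun j _ => ?_
  rw [integral_map (hT.iterate j).measurable.aemeasurable f.continuous.measurable.aestronglyMeasurable]

lemma avgM_almost_inv {α : Type*} [TopologicalSpace α] [MeasurableSpace α] [BorelSpace α] {T : α → α} (hT : Continuous T)
    (η : Measure α) [IsProbabilityMeasure η] (N : ℕ) (f : BoundedContinuousFunction α ℝ) :
    |∫ x, f (T x) ∂(avgM T η N) - ∫ x, f x ∂(avgM T η N)| ≤ 2 * ‖f‖ / N := by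
  have h1 := avgM_integral hT η N f
  have h2 := avgM_integral hT η N (f.compContinuous ⟨T, hT⟩)
  simp only [BoundedContinuousFunction.compContinuous_apply, ContinuousMap.coe_mk] at h2
  rw [h1, h2, ← mul_sub, ← Finset.sum_sub_distrib]
  have h3 : ∑ j ∈ Finset.range N, (∫ x, f (T (T^[j] x)) ∂η - ∫ x, f (T^[j] x) ∂η) = ∫ x, f (T^[N] x) ∂η - ∫ x, f (T^[0] x) ∂η := by
    rw [← Finset.sum_range_sub (fun j => ∫ x, f (T^[j] x) ∂η) N]
    refine Finset.sum_congr rfl fun j _ => ?_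
    simp only [Function.iterate_succ_apply']
  rw [h3, abs_mul, abs_inv, Nat.abs_cast, div_eq_inv_mul]
  gcongr
  have hb : ∀ j, |∫ x, f (T^[j] x) ∂η| ≤ ‖f‖ := by
    intro j
    have := norm_integral_le_of_norm_le_const (μ := η) (f := fun x => f (T^[j] x)) (C := ‖f‖) (ae_of_all _ fun x => f.norm_coe_le_norm _)
    simpa using this
  have := abs_sub (∫ x, f (T^[N] x) ∂η) (∫ x, f (T^[0] x) ∂η)
  linarith [hb N, hb 0]

theorem lim_exists {m n : ℕ} (hm : 0 < m) (hn : 0 < n) (η : ℕ → Measure (XSp (m + n))) [∀ i, IsProbabilityMeasure (η i)] (N : ℕ → ℕ)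
    (hN0 : ∀ i, 0 < N i) (hN : Tendsto N atTop atTop)
    (ht : ∀ ε : ℝ≥0∞, 0 < ε → ∃ K : Set (XSp (m + n)), IsCompact K ∧ ∀ i, avgM (aAct m n hm hn) (η i) (N i) Kᶜ ≤ ε) :
    ∃ l : Filter ℕ, l.NeBot ∧ l ≤ atTop ∧ ∃ (κ : ℕ → ProbabilityMeasure (XSp (m + n))) (μ : ProbabilityMeasure (XSp (m + n))),
      (∀ i, (κ i : Measure (XSp (m + n))) = avgM (aAct m n hm hn) (η i) (N i)) ∧ Tendsto κ l (𝓝 μ) ∧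
      MeasurePreserving (aAct m n hm hn) (μ : Measure (XSp (m + n))) μ := by
  set T := aAct m n hm hn with hTdef
  have hTc : Continuous T := aAct_continuous m n hm hn
  let κ : ℕ → ProbabilityMeasure (XSp (m + n)) := fun i => ⟨avgM T (η i) (N i), avgM_prob T hTc.measurable (η i) (N i) (hN0 i)⟩
  have hκ : ∀ i, (κ i : Measure (XSp (m + n))) = avgM T (η i) (N i) := fun i => rfl
  have htight : IsTightMeasureSet {((μ : ProbabilityMeasure (XSp (m + n))) : Measure (XSp (m + n))) | μ ∈ Set.range κ} := by
    rw [isTightMeasureSet_iff_exists_isCompact_measure_compl_le]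
    intro ε hε
    obtain ⟨K, hK, h⟩ := ht ε hε
    refine ⟨K, hK, ?_⟩
    rintro _ ⟨_, ⟨i, rfl⟩, rfl⟩
    exact h i
  have hcomp := isCompact_closure_of_isTightMeasureSet htight
  let l : Ultrafilter ℕ := Ultrafilter.of atTop
  have hl : (l : Filter ℕ) ≤ atTop := Ultrafilter.of_le atTop
  obtain ⟨μ, -, hμ⟩ := hcomp.ultrafilter_le_nhds (l.map κ) (by
    rw [le_principal_iff]
    exact mem_of_superset (Filter.image_mem_map univ_mem) (by rw [Set.image_univ]; exact subset_closure))
  have hlim : Tendsto κ l (𝓝 μ) := hμ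
  refine ⟨l, inferInstance, hl, κ, μ, hκ, hlim, ⟨hTc.measurable, ?_⟩⟩
  have h1 : Tendsto (fun i => (κ i).map hTc.measurable.aemeasurable) l (𝓝 (μ.map hTc.measurable.aemeasurable)) :=
    ProbabilityMeasure.tendsto_map_of_tendsto_of_continuous κ μ hlim hTc
  have h2 : Tendsto (fun i => (κ i).map hTc.measurable.aemeasurable) l (𝓝 μ) := by
    rw [ProbabilityMeasure.tendsto_iff_forall_integral_tendsto] at hlim ⊢
    intro f
    have h3 : Tendsto (fun i => ∫ x, f (T x) ∂(κ i : Measure (XSp (m + n))) - ∫ x, f x ∂(κ i : Measure (XSp (m + n)))) l (𝓝 0) := by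
      refine squeeze_zero_norm (a := fun i => 2 * ‖f‖ / N i) (fun i => ?_) ?_
      · exact avgM_almost_inv hTc (η i) (N i) f
      · exact (tendsto_natCast_atTop_atTop.comp (hN.mono_left hl)).const_div_atTop _
    have h4 := h3.add (hlim f)
    simp only [sub_add_cancel, zero_add] at h4
    refine h4.congr fun i => ?_
    rw [ProbabilityMeasure.toMeasure_map, integral_map hTc.measurable.aemeasurable f.continuous.measurable.aestronglyMeasurable]
  have := tendsto_nhds_unique h1 h2
  have h5 := congrArg (fun ν : ProbabilityMeasure (XSp (m + n)) => (ν : Measure (XSp (m + n)))) this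
  simpa using h5

end PartLim

section PartPv

lemma dyadic_sum {ι : Type*} [DecidableEq ι] (f : ι → ℝ) (m e : ℕ) (he : 1 ≤ e) {K : ℝ} (hK : 0 ≤ K) (k : ℕ) : ∀ (b : ℝ) (Λ : Finset ι), 0 < b →
    (∀ w ∈ Λ, b / 2 ^ k < f w ∧ f w ≤ b) → (∀ r > 0, ((Λ.filter fun w => f w ≤ r).card : ℝ) ≤ K * r ^ (m + e)) →
    ∑ w ∈ Λ, (f w)⁻¹ ^ m ≤ 2 ^ (m + 1) * K * b ^ e := by
  induction k with
  | zero =>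
    intro b Λ hb hf hc
    have : Λ = ∅ := by
      refine Finset.eq_empty_of_forall_notMem fun w hw => ?_
      have := hf w hw
      simp at this; linarith
    subst this
    simp; positivity
  | succ k ih =>
    intro b Λ hb hf hc
    rw [← Finset.sum_filter_add_sum_filter_not Λ (fun w => f w ≤ b / 2)]
    have h1 : ∑ w ∈ Λ.filter (fun w => f w ≤ b / 2), (f w)⁻¹ ^ m ≤ 2 ^ (m + 1) * K * (b / 2) ^ e := by
      refine ih (b / 2) _ (by positivity) ?_ ?_
      · intro w hw
        rw [Finset.mem_filter] at hw
        refine ⟨?_, hw.2⟩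
        have := (hf w hw.1).1
        rwa [pow_succ', ← div_div] at this
      · intro r hr
        refine le_trans ?_ (hc r hr)
        gcongr
        exact Finset.filter_subset _ _
    have h2 : ∑ w ∈ Λ.filter (fun w => ¬ f w ≤ b / 2), (f w)⁻¹ ^ m ≤ K * b ^ (m + e) * (2 / b) ^ m := by
      calc _ ≤ ∑ w ∈ Λ.filter (fun w => ¬ f w ≤ b / 2), (2 / b) ^ m := by
            refine Finset.sum_le_sum fun w hw => ?_
            rw [Finset.mem_filter, not_le] at hw
            have h0 : 0 < f w := lt_trans (by positivity) hw.2
            have : (f w)⁻¹ ≤ 2 / b := by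
              rw [inv_le_comm₀ h0 (by positivity), inv_div]; exact hw.2.le
            gcongr
        _ = ((Λ.filter (fun w => ¬ f w ≤ b / 2)).card : ℝ) * (2 / b) ^ m := by rw [Finset.sum_const, nsmul_eq_mul]
        _ ≤ _ := by
            gcongr
            refine le_trans ?_ (hc b hb)
            refine Nat.cast_le.2 (Finset.card_le_card fun w hw => ?_)
            rw [Finset.mem_filter] at hw ⊢
            exact ⟨hw.1, (hf w hw.1).2⟩
    have h3 : K * b ^ (m + e) * (2 / b) ^ m = 2 ^ m * K * b ^ e := by
      rw [div_pow, pow_add]; field_simp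
    have h4 : (b / 2) ^ e ≤ b ^ e / 2 := by
      rw [div_pow]
      gcongr
      calc (2:ℝ) = 2 ^ 1 := by norm_num
        _ ≤ 2 ^ e := by gcongr; norm_num
    have h5 : 2 ^ (m + 1) * K * (b / 2) ^ e ≤ 2 ^ m * K * b ^ e := by
      calc _ ≤ 2 ^ (m + 1) * K * (b ^ e / 2) := by gcongr
        _ = _ := by ring
    rw [h3] at h2
    calc _ ≤ 2 ^ m * K * b ^ e + 2 ^ m * K * b ^ e := add_le_add (h1.trans h5) h2
      _ = _ := by ring

lemma dyadic_sum' {ι : Type*} [DecidableEq ι] (f : ι → ℝ) (m e : ℕ) (he : 1 ≤ e) {K : ℝ} (hK : 0 ≤ K) {b : ℝ} (hb : 0 < b) (Λ : Finset ι)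
    (hf : ∀ w ∈ Λ, 0 < f w ∧ f w ≤ b) (hc : ∀ r > 0, ((Λ.filter fun w => f w ≤ r).card : ℝ) ≤ K * r ^ (m + e)) :
    ∑ w ∈ Λ, (f w)⁻¹ ^ m ≤ 2 ^ (m + 1) * K * b ^ e := by
  have : ∀ w ∈ Λ, ∃ k : ℕ, b / 2 ^ k < f w := by
    intro w hw
    obtain ⟨k, hk⟩ := pow_unbounded_of_one_lt (b / f w) (one_lt_two (α := ℝ))
    refine ⟨k, ?_⟩
    rw [div_lt_iff₀ (hf w hw).1] at hk
    rw [div_lt_iff₀ (by positivity)]; linarith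
  choose! k hk using this
  refine dyadic_sum f m e he hK (Λ.sup k) b Λ hb (fun w hw => ⟨lt_of_le_of_lt ?_ (hk w hw), (hf w hw).2⟩) hc
  have : k w ≤ Λ.sup k := Finset.le_sup hw
  gcongr
  norm_num

/-- the box -/
def Bx (m n : ℕ) : Set (Mt m n) := Set.pi Set.univ fun _ => Set.pi Set.univ fun _ => Set.Icc (1 / 2) 1

lemma mem_Bx {m n : ℕ} {P : Mt m n} : P ∈ Bx m n ↔ ∀ i j, 1 / 2 ≤ P i j ∧ P i j ≤ 1 := by
  simp only [Bx, Set.mem_pi, Set.mem_univ, true_imp_iff, Set.mem_Icc]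

lemma Bx_meas (m n : ℕ) : MeasurableSet (Bx m n) :=
  MeasurableSet.univ_pi fun _ => MeasurableSet.univ_pi fun _ => measurableSet_Icc

lemma Bx_vol (m n : ℕ) : volume (Bx m n) = ((2 : ℝ≥0∞) ^ (m * n))⁻¹ := by
  simp only [Bx, volume_pi_pi, Real.volume_Icc, Finset.prod_const, Finset.card_univ, Fintype.card_fin]
  rw [← pow_mul, ENNReal.inv_pow, mul_comm]
  congr 1
  rw [show (1 : ℝ) - 1 / 2 = 2⁻¹ by norm_num, ENNReal.ofReal_inv_of_pos (by norm_num)]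
  simp

/-- normalized Lebesgue measure on the box -/
def ρ0 (m n : ℕ) : Measure (Mt m n) := (2 : ℝ≥0∞) ^ (m * n) • volume.restrict (Bx m n)

instance (m n : ℕ) : IsProbabilityMeasure (ρ0 m n) := by
  constructor
  simp only [ρ0, Measure.smul_apply, Measure.restrict_apply_univ, Bx_vol, smul_eq_mul]
  exact ENNReal.mul_inv_cancel (by simp) (by simp)

lemma ρ0_le {m n : ℕ} {S S' : Set (Mt m n)} (h : ∀ P ∈ S, P ∈ Bx m n → P ∈ S') {v : ℝ} (hv0 : 0 ≤ v) (hv : volume S' ≤ ENNReal.ofReal v) :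
    (ρ0 m n).real S ≤ 2 ^ (m * n) * v := by
  refine ENNReal.toReal_le_of_le_ofReal (by positivity) ?_
  rw [ρ0, Measure.smul_apply, Measure.restrict_apply' (Bx_meas m n), smul_eq_mul, ENNReal.ofReal_mul (by positivity),
    ENNReal.ofReal_pow (by norm_num), ENNReal.ofReal_ofNat]
  gcongr
  exact (measure_mono fun P hP => h P hP.1 hP.2).trans hv

lemma ρ0_Bx (m n : ℕ) : ρ0 m n (Bx m n)ᶜ = 0 := by
  rw [ρ0, Measure.smul_apply, Measure.restrict_apply' (Bx_meas m n)]
  simp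

lemma slab_vol {n : ℕ} (w : Fin n → ℝ) (hw : w ≠ 0) (c : ℝ) {α : ℝ} (hα : 0 ≤ α) :
    volume {p : Fin n → ℝ | (∀ j, 1 / 2 ≤ p j ∧ p j ≤ 1) ∧ |c + ∑ j, p j * w j| ≤ α} ≤ ENNReal.ofReal (2 * α / ‖w‖) := by
  classical
  have hne : Nonempty (Fin n) := by
    by_contra h
    rw [not_nonempty_iff] at h
    exact hw (Subsingleton.elim _ _)
  obtain ⟨j, hj⟩ : ∃ j, ‖w j‖ = ‖w‖ := by
    obtain ⟨j, -, hj⟩ := Finset.exists_max_image Finset.univ (fun j => ‖w j‖) Finset.univ_nonempty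
    refine ⟨j, le_antisymm (norm_le_pi_norm w j) ?_⟩
    rw [pi_norm_le_iff_of_nonneg (norm_nonneg _)]
    exact fun i => hj i (Finset.mem_univ i)
  have hpos : 0 < ‖w‖ := norm_pos_iff.2 hw
  set S := {p : Fin n → ℝ | (∀ j, 1 / 2 ≤ p j ∧ p j ≤ 1) ∧ |c + ∑ j, p j * w j| ≤ α}
  let M : Matrix (Fin n) (Fin n) ℝ := updateRow 1 j w
  have hdet : M.det = w j := det_updateRow_one j w
  have himg : (Matrix.toLin' M) '' S ⊆ Set.pi Set.univ fun i => if i = j then Set.Icc (-c - α) (-c + α) else Set.Icc (1/2) 1 := by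
    rintro _ ⟨p, ⟨hp, hpα⟩, rfl⟩ i -
    simp only [toLin'_apply]
    by_cases hi : i = j
    · subst hi
      have : (M *ᵥ p) i = ∑ j, p j * w j := by
        simp [M, mulVec, dotProduct, mul_comm]
      rw [if_pos rfl, this]
      rw [abs_le] at hpα
      exact ⟨by linarith, by linarith⟩
    · have : (M *ᵥ p) i = p i := by
        simp [M, mulVec, dotProduct, hi, updateRow_ne, one_apply]
      rw [if_neg hi, this]
      exact hp i
  have hv := Measure.addHaar_image_linearMap volume (Matrix.toLin' M) S
  rw [LinearMap.det_toLin', hdet] at hv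
  have hbox : volume (Set.pi Set.univ fun i : Fin n => if i = j then Set.Icc (-c - α) (-c + α) else Set.Icc (1/2) 1) ≤ ENNReal.ofReal (2 * α) := by
    rw [volume_pi_pi, ← Finset.mul_prod_erase _ _ (Finset.mem_univ j), if_pos rfl, Real.volume_Icc]
    have : ∏ x ∈ Finset.univ.erase j, volume (if x = j then Set.Icc (-c - α) (-c + α) else Set.Icc (1/2 : ℝ) 1) ≤ 1 := by
      refine Finset.prod_le_one' fun i hi => ?_
      rw [if_neg (Finset.ne_of_mem_erase hi), Real.volume_Icc]
      rw [← ENNReal.ofReal_one]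
      exact ENNReal.ofReal_le_ofReal (by norm_num)
    calc _ ≤ ENNReal.ofReal (-c + α - (-c - α)) * 1 := by gcongr
      _ = _ := by rw [mul_one]; congr 1; ring
  have h1 : ENNReal.ofReal |w j| * volume S ≤ ENNReal.ofReal (2 * α) := by
    rw [← hv]; exact (measure_mono himg).trans hbox
  rw [ENNReal.ofReal_div_of_pos hpos, ← hj, Real.norm_eq_abs]
  rw [Real.norm_eq_abs] at hj
  rw [ENNReal.le_div_iff_mul_le (Or.inl (by simp [hj, hw])) (Or.inl (by simp)), mul_comm]
  exact h1

lemma single_vol {m n : ℕ} (w : Fin (m + n) → ℝ) {α : ℝ} (hα : 0 ≤ α) (hw : (n + 1) * α < ‖w‖) :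
    (ρ0 m n).real {P | ‖v1 (uMat m n P *ᵥ w)‖ ≤ α} ≤ 2 ^ (m * n) * (2 * (n + 1) * α) ^ m * ‖w‖⁻¹ ^ m := by
  have hw0 : 0 < ‖w‖ := lt_of_le_of_lt (by positivity) hw
  by_cases hE : ∃ P ∈ Bx m n, ‖v1 (uMat m n P *ᵥ w)‖ ≤ α
  · obtain ⟨P, hP, hPα⟩ := hE
    rw [mem_Bx] at hP
    have hwle : ‖w‖ ≤ (n + 1) * ‖v2 w‖ := by
      have h1 : ‖w‖ ≤ α + n * ‖v2 w‖ ∨ ‖w‖ ≤ ‖v2 w‖ := by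
        by_contra hcon
        push Not at hcon
        have : ‖w‖ ≤ max (α + n * ‖v2 w‖) ‖v2 w‖ := by
          rw [norm_le_iff12 _ (le_max_of_le_right (norm_nonneg _))]
          refine ⟨?_, le_max_right _ _⟩
          refine le_trans ?_ (le_max_left _ _)
          rw [pi_norm_le_iff_of_nonneg (by positivity)]
          intro i
          have h2 := (norm_le_pi_norm _ i).trans hPα
          rw [v1_uMat] at h2
          have h3 : |∑ j, P i j * v2 w j| ≤ n * ‖v2 w‖ := by
            refine (Finset.abs_sum_le_sum_abs _ _).trans ?_
            calc _ ≤ ∑ j : Fin n, ‖v2 w‖ := by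
                  refine Finset.sum_le_sum fun j _ => ?_
                  rw [abs_mul]
                  have h4 : |P i j| ≤ 1 := abs_le.2 ⟨by linarith [(hP i j).1], (hP i j).2⟩
                  have h5 : |v2 w j| ≤ ‖v2 w‖ := norm_le_pi_norm (v2 w) j
                  calc _ ≤ 1 * |v2 w j| := by gcongr
                    _ ≤ _ := by rw [one_mul]; exact h5
              _ = _ := by simp
          rw [Real.norm_eq_abs] at h2 ⊢
          have h6 := abs_sub (v1 w i + ∑ j, P i j * v2 w j) (∑ j, P i j * v2 w j)
          rw [add_sub_cancel_right] at h6
          linarith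
        rcases le_max_iff.1 this with h | h <;> linarith [hcon.1, hcon.2]
      have h0 := norm_nonneg (v2 w)
      have hn0 : (0:ℝ) ≤ n := by positivity
      rcases h1 with h1 | h1
      · by_contra hcon
        push Not at hcon
        have : (n + 1) * ‖w‖ < (n+1) * ‖w‖ := by
          calc (n + 1) * ‖w‖ ≤ (n + 1) * (α + n * ‖v2 w‖) := by gcongr
            _ = (n + 1) * α + n * ((n + 1) * ‖v2 w‖) := by ring
            _ ≤ (n + 1) * α + n * ‖w‖ := by gcongr
            _ < ‖w‖ + n * ‖w‖ := by gcongr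
            _ = _ := by ring
        exact lt_irrefl _ this
      · nlinarith
    have hv2 : v2 w ≠ 0 := by
      intro h; rw [h, norm_zero, mul_zero] at hwle; linarith
    have hv2' : 0 < ‖v2 w‖ := norm_pos_iff.2 hv2
    have := ρ0_le (m := m) (n := n) (S := {P | ‖v1 (uMat m n P *ᵥ w)‖ ≤ α})
      (S' := Set.pi Set.univ fun i => {p : Fin n → ℝ | (∀ j, 1 / 2 ≤ p j ∧ p j ≤ 1) ∧ |v1 w i + ∑ j, p j * v2 w j| ≤ α})
      (v := (2 * α / ‖v2 w‖) ^ m) ?_ (by positivity) ?_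
    · refine this.trans ?_
      rw [mul_assoc, ← mul_pow]
      gcongr
      rw [← div_eq_mul_inv, div_le_div_iff₀ hv2' hw0]
      calc 2 * α * ‖w‖ ≤ 2 * α * ((n + 1) * ‖v2 w‖) := by gcongr
        _ = _ := by ring
    · intro P hP hPB i _
      refine ⟨mem_Bx.1 hPB i, ?_⟩
      have h2 := (norm_le_pi_norm _ i).trans hP
      rwa [v1_uMat] at h2
    · rw [volume_pi_pi, ENNReal.ofReal_pow (by positivity)]
      calc _ ≤ ∏ i : Fin m, ENNReal.ofReal (2 * α / ‖v2 w‖) := Finset.prod_le_prod' fun i _ => slab_vol _ hv2 _ hα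
        _ = _ := by simp
  · push Not at hE
    have := ρ0_le (m := m) (n := n) (S := {P | ‖v1 (uMat m n P *ᵥ w)‖ ≤ α}) (S' := ∅) (v := 0)
      (fun P hP hPB => absurd hP (not_le.2 (hE P hPB))) le_rfl (by simp)
    refine this.trans ?_
    rw [mul_zero]; positivity

/-- Lemma P -/
theorem lemP {m n : ℕ} (Λ : Finset (Fin (m + n) → ℝ)) {α : ℝ} (hα : 0 ≤ α) (hΛ : ∀ w ∈ Λ, (n + 1) * α < ‖w‖) {b : ℝ} (hb : 0 < b)
    (hΛb : ∀ w ∈ Λ, ‖w‖ ≤ b) {K : ℝ} (hK : 0 ≤ K) {e : ℕ} (he : 1 ≤ e)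
    (hc : ∀ r > 0, ((Λ.filter fun w => ‖w‖ ≤ r).card : ℝ) ≤ K * r ^ (m + e)) :
    (ρ0 m n).real {P | ∃ w ∈ Λ, ‖v1 (uMat m n P *ᵥ w)‖ ≤ α} ≤ 2 ^ (m * n) * (2 * (n + 1) * α) ^ m * (2 ^ (m + 1) * K * b ^ e) := by
  classical
  have h1 : {P | ∃ w ∈ Λ, ‖v1 (uMat m n P *ᵥ w)‖ ≤ α} ⊆ ⋃ w ∈ Λ, {P | ‖v1 (uMat m n P *ᵥ w)‖ ≤ α} := by
    rintro P ⟨w, hw, h⟩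
    exact Set.mem_biUnion hw h
  calc _ ≤ ∑ w ∈ Λ, (ρ0 m n).real {P | ‖v1 (uMat m n P *ᵥ w)‖ ≤ α} :=
        (measureReal_mono h1 (measure_ne_top _ _)).trans (measureReal_biUnion_finset_le _ _)
    _ ≤ ∑ w ∈ Λ, 2 ^ (m * n) * (2 * (n + 1) * α) ^ m * ‖w‖⁻¹ ^ m := Finset.sum_le_sum fun w hw => single_vol w hα (hΛ w hw)
    _ = 2 ^ (m * n) * (2 * (n + 1) * α) ^ m * ∑ w ∈ Λ, ‖w‖⁻¹ ^ m := by rw [Finset.mul_sum]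
    _ ≤ _ := by
      gcongr
      exact dyadic_sum' (fun w => ‖w‖) m e he hK hb Λ
        (fun w hw => ⟨lt_of_le_of_lt (by positivity) (hΛ w hw), hΛb w hw⟩) hc

end PartPv

section PartRep

lemma lat_finite {d : ℕ} (x : XSp d) (r : ℝ) : {w | w ∈ lat x ∧ ‖w‖ ≤ r}.Finite := by
  obtain ⟨ε, hε, hx⟩ := compact_sub_Cus (isCompact_singleton (x := x))
  obtain ⟨R, hR, h⟩ := lat_count (d := d) hε
  by_contra hinf
  obtain ⟨k, hk⟩ := exists_nat_gt ((4 * max r R) ^ d)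
  obtain ⟨Λ, hΛ, hc⟩ := (show {w | w ∈ lat x ∧ ‖w‖ ≤ r}.Infinite from hinf).exists_subset_card_eq k
  have := h x (hx rfl) (max r R) (le_max_right _ _) Λ fun w hw => ⟨(hΛ hw).1, (hΛ hw).2.trans (le_max_left _ _)⟩
  rw [hc] at this
  linarith

lemma esc_vec {m n : ℕ} (hm : 0 < m) (hn : 0 < n) {t ε : ℝ} {P : Mt m n} {y : XSp (m + n)}
    (h : aSL m n hm hn t • uSL m n P • y ∉ Cus ε) : ∃ w ∈ lat y, w ≠ 0 ∧ ‖v1 (uMat m n P *ᵥ w)‖ ≤ ε * Real.exp (-(t / m)) ∧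
      ‖v2 w‖ ≤ ε * Real.exp (t / n) := by
  simp only [Cus, Set.mem_ofPred_eq, not_forall, not_le] at h
  obtain ⟨w', hw', hne, hlt⟩ := h
  obtain ⟨w1, hw1, rfl⟩ := mem_lat_smul.1 hw'
  obtain ⟨w, hw, rfl⟩ := mem_lat_smul.1 hw1
  refine ⟨w, hw, ?_, ?_, ?_⟩
  · rintro rfl; simp at hne
  · have h1 := (norm_v1_le _).trans hlt.le
    rw [show ((aSL m n hm hn t : GSp (m+n)) : Matrix (Fin (m+n)) (Fin (m+n)) ℝ) = aMat m n t from rfl, v1_aMat, norm_smul,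
      Real.norm_eq_abs, abs_of_pos (Real.exp_pos _)] at h1
    rw [Real.exp_neg, ← div_eq_mul_inv, le_div_iff₀ (Real.exp_pos _), mul_comm]
    exact h1
  · have h1 := (norm_v2_le _).trans hlt.le
    rw [show ((aSL m n hm hn t : GSp (m+n)) : Matrix (Fin (m+n)) (Fin (m+n)) ℝ) = aMat m n t from rfl, v2_aMat, norm_smul,
      Real.norm_eq_abs, abs_of_pos (Real.exp_pos _), show ((uSL m n P : GSp (m+n)) : Matrix (Fin (m+n)) (Fin (m+n)) ℝ) = uMat m n P from rfl,
      v2_uMat, Real.exp_neg, inv_mul_le_iff₀ (Real.exp_pos _), mul_comm] at h1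
    exact h1

lemma uMat_row_bd {m n : ℕ} {P : Mt m n} (hP : ∀ i j, |P i j| ≤ 1) (w : Fin (m + n) → ℝ) :
    ‖v1 w‖ ≤ ‖v1 (uMat m n P *ᵥ w)‖ + n * ‖v2 w‖ := by
  rw [pi_norm_le_iff_of_nonneg (by positivity)]
  intro i
  have h2 := norm_le_pi_norm (v1 (uMat m n P *ᵥ w)) i
  rw [v1_uMat] at h2
  have h3 : |∑ j, P i j * v2 w j| ≤ n * ‖v2 w‖ := by
    refine (Finset.abs_sum_le_sum_abs _ _).trans ?_
    calc _ ≤ ∑ j : Fin n, ‖v2 w‖ := by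
          refine Finset.sum_le_sum fun j _ => ?_
          rw [abs_mul]
          have h5 : |v2 w j| ≤ ‖v2 w‖ := norm_le_pi_norm (v2 w) j
          calc _ ≤ 1 * |v2 w j| := by gcongr; exact hP i j
            _ ≤ _ := by rw [one_mul]; exact h5
      _ = _ := by simp
  rw [Real.norm_eq_abs] at h2 ⊢
  have h6 := abs_sub (v1 w i + ∑ j, P i j * v2 w j) (∑ j, P i j * v2 w j)
  rw [add_sub_cancel_right] at h6
  linarith

lemma Bx_abs {m n : ℕ} {P : Mt m n} (hP : P ∈ Bx m n) (i : Fin m) (j : Fin n) : |P i j| ≤ 1 := by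
  have := mem_Bx.1 hP i j
  exact abs_le.2 ⟨by linarith [this.1], this.2⟩

lemma ρ0_mono_Bx {m n : ℕ} {S S' : Set (Mt m n)} (h : ∀ P ∈ S, P ∈ Bx m n → P ∈ S') : (ρ0 m n).real S ≤ (ρ0 m n).real S' := by
  refine ENNReal.toReal_mono (measure_ne_top _ _) ?_
  rw [← measure_inter_conull (show ρ0 m n (Bx m n)ᶜ = 0 from ρ0_Bx m n)]
  exact measure_mono fun P hP => h P hP.1 hP.2

theorem repairV {m n : ℕ} (hm : 0 < m) (hn : 0 < n) : ∃ C : ℝ, 0 < C ∧ ∀ ε > 0, ∀ ε' : ℝ, 0 < ε' → ε' ≤ 1 → ∃ N0 : ℕ,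
    ∀ y ∈ (Cus ε : Set (XSp (m + n))), ∀ N : ℕ, N0 ≤ N →
      (ρ0 m n).real {P | aSL m n hm hn N • uSL m n P • y ∉ Cus ε'} ≤ C * ε' ^ (m + n) := by
  classical
  have hm0 : (m : ℝ) ≠ 0 := by positivity
  have hn0 : (n : ℝ) ≠ 0 := by positivity
  set C2 : ℝ := 2 ^ (m * n) * (2 * (n + 1)) ^ m * (2 ^ (m + 1) * 4 ^ (m + n) * (n + 1) ^ n) with hC2
  have hC2p : 0 < C2 := by positivity
  refine ⟨C2 + 1, by positivity, fun ε hε ε' hε' hε'1 => ?_⟩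
  obtain ⟨R, hR, hcount⟩ := lat_count (d := m + n) hε
  set C1 : ℝ := 2 ^ (m * n) * (2 * (n + 1)) ^ m * (2 ^ (m + 1) * ((4 * R) ^ (m + n) / ε ^ (m + n)) * R ^ n) with hC1
  have hC1p : 0 < C1 := by positivity
  -- smallness
  have hlim : Tendsto (fun N : ℕ => Real.exp (-((N : ℝ) / m))) atTop (𝓝 0) :=
    Real.tendsto_exp_neg_atTop_nhds_zero.comp (tendsto_natCast_atTop_atTop.atTop_div_const (by positivity))
  have hsm : ∀ c > 0, ∀ᶠ N : ℕ in atTop, Real.exp (-((N : ℝ) / m)) < c := fun c hc => hlim.eventually_lt_const hc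
  have hlim2 : Tendsto (fun N : ℕ => C1 * (Real.exp (-((N : ℝ) / m))) ^ m) atTop (𝓝 0) := by
    have := (hlim.pow m).const_mul C1
    rwa [zero_pow hm.ne', mul_zero] at this
  obtain ⟨N0, hN0⟩ := eventually_atTop.1 ((hsm (ε / (n + 1)) (by positivity)).and (hlim2.eventually_lt_const (show 0 < ε' ^ (m + n) by positivity)))
  refine ⟨N0, fun y hy N hN => ?_⟩
  obtain ⟨h1, h2⟩ := hN0 N hN
  set E := Real.exp (-((N : ℝ) / m)) with hE
  have hEp : 0 < E := Real.exp_pos _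
  set α := ε' * E with hα
  have hαp : 0 < α := by positivity
  set Q := ε' * Real.exp ((N : ℝ) / n) with hQ
  have hQp : 0 < Q := by positivity
  have hαQ : α ≤ Q := by
    refine mul_le_mul_of_nonneg_left (Real.exp_le_exp.2 ?_) hε'.le
    have : (0:ℝ) ≤ N / m := by positivity
    have : (0:ℝ) ≤ N / n := by positivity
    linarith
  have hsmall : (n + 1) * α < ε := by
    rw [lt_div_iff₀ (by positivity)] at h1
    calc (n + 1) * α = ε' * (E * (n + 1)) := by rw [hα]; ring
      _ ≤ 1 * (E * (n + 1)) := by gcongr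
      _ < ε := by rw [one_mul]; exact h1
  set b := (n + 1) * Q with hb
  have hbp : 0 < b := by positivity
  let Λ1 := (lat_finite y R).toFinset.filter fun w => w ≠ 0
  let Λ2 := (lat_finite y b).toFinset.filter fun w => R < ‖w‖ ∧ w ≠ 0
  have hΛε : ∀ w ∈ lat y, w ≠ 0 → (n + 1) * α < ‖w‖ := fun w hw hne => hsmall.trans_le (hy w hw hne)
  have hP1 := lemP (m := m) (n := n) Λ1 hαp.le (fun w hw => by
      simp only [Λ1, Finset.mem_filter, Set.Finite.mem_toFinset, Set.mem_ofPred_eq] at hw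
      exact hΛε w hw.1.1 hw.2) (b := R) (by linarith) (fun w hw => by
      simp only [Λ1, Finset.mem_filter, Set.Finite.mem_toFinset, Set.mem_ofPred_eq] at hw
      exact hw.1.2) (K := (4 * R) ^ (m + n) / ε ^ (m + n)) (by positivity) (e := n) hn (by
      intro r hr
      by_cases hrε : r < ε
      · have : (Λ1.filter fun w => ‖w‖ ≤ r) = ∅ := by
          refine Finset.eq_empty_of_forall_notMem fun w hw => ?_
          simp only [Λ1, Finset.mem_filter, Set.Finite.mem_toFinset, Set.mem_ofPred_eq] at hw
          linarith [hy w hw.1.1.1 hw.1.2]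
        rw [this, Finset.card_empty, Nat.cast_zero]; positivity
      · push Not at hrε
        have := hcount y hy R le_rfl (Λ1.filter fun w => ‖w‖ ≤ r) (fun w hw => by
          simp only [Λ1, Finset.mem_filter, Set.Finite.mem_toFinset, Set.mem_ofPred_eq] at hw
          exact hw.1.1)
        refine this.trans ?_
        rw [div_mul_eq_mul_div, le_div_iff₀ (by positivity)]
        gcongr)
  have hP2 := lemP (m := m) (n := n) Λ2 hαp.le (fun w hw => by
      simp only [Λ2, Finset.mem_filter, Set.Finite.mem_toFinset, Set.mem_ofPred_eq] at hw
      exact hΛε w hw.1.1 hw.2.2) hbp (fun w hw => by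
      simp only [Λ2, Finset.mem_filter, Set.Finite.mem_toFinset, Set.mem_ofPred_eq] at hw
      exact hw.1.2) (K := 4 ^ (m + n)) (by positivity) (e := n) hn (by
      intro r hr
      by_cases hrR : r < R
      · have : (Λ2.filter fun w => ‖w‖ ≤ r) = ∅ := by
          refine Finset.eq_empty_of_forall_notMem fun w hw => ?_
          simp only [Λ2, Finset.mem_filter, Set.Finite.mem_toFinset, Set.mem_ofPred_eq] at hw
          linarith [hw.1.2.1, hw.2]
        rw [this, Finset.card_empty, Nat.cast_zero]; positivity
      · push Not at hrR
        have := hcount y hy r hrR (Λ2.filter fun w => ‖w‖ ≤ r) (fun w hw => by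
          simp only [Λ2, Finset.mem_filter, Set.Finite.mem_toFinset, Set.mem_ofPred_eq] at hw
          exact ⟨hw.1.1.1, hw.2⟩)
        rwa [mul_pow] at this)
  have hsub : (ρ0 m n).real {P | aSL m n hm hn N • uSL m n P • y ∉ Cus ε'} ≤
      (ρ0 m n).real ({P | ∃ w ∈ Λ1, ‖v1 (uMat m n P *ᵥ w)‖ ≤ α} ∪ {P | ∃ w ∈ Λ2, ‖v1 (uMat m n P *ᵥ w)‖ ≤ α}) := by
    refine ρ0_mono_Bx fun P hP hPB => ?_
    obtain ⟨w, hw, hne, hw1, hw2⟩ := esc_vec hm hn hP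
    have hwb : ‖w‖ ≤ b := by
      rw [norm_le_iff12 _ hbp.le]
      have h0 : ‖v2 w‖ ≤ Q := hw2
      constructor
      · refine (uMat_row_bd (Bx_abs hPB) w).trans ?_
        calc _ ≤ α + n * Q := by gcongr
          _ ≤ Q + n * Q := by gcongr
          _ = b := by rw [hb]; ring
      · refine h0.trans ?_
        rw [hb]; nlinarith [show (0:ℝ) ≤ n from by positivity]
    by_cases hwR : ‖w‖ ≤ R
    · left
      refine ⟨w, ?_, hw1⟩
      simp only [Λ1, Finset.mem_filter, Set.Finite.mem_toFinset, Set.mem_ofPred_eq]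
      exact ⟨⟨hw, hwR⟩, hne⟩
    · right
      refine ⟨w, ?_, hw1⟩
      simp only [Λ2, Finset.mem_filter, Set.Finite.mem_toFinset, Set.mem_ofPred_eq]
      exact ⟨⟨hw, hwb⟩, not_le.1 hwR, hne⟩
  refine hsub.trans ((measureReal_union_le _ _).trans ?_)
  have hb1 : 2 ^ (m * n) * (2 * (n + 1) * α) ^ m * (2 ^ (m + 1) * ((4 * R) ^ (m + n) / ε ^ (m + n)) * R ^ n) ≤ ε' ^ (m + n) := by
    calc _ = ε' ^ m * (C1 * E ^ m) := by rw [hα, hC1]; simp only [mul_pow, pow_add]; ring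
      _ ≤ 1 * (C1 * E ^ m) := by
          gcongr
          exact pow_le_one₀ hε'.le hε'1
      _ ≤ _ := by rw [one_mul]; exact h2.le
  have hexp : E ^ m * (Real.exp ((N : ℝ) / n)) ^ n = 1 := by
    rw [hE, ← Real.exp_nat_mul, ← Real.exp_nat_mul, ← Real.exp_add, ← Real.exp_zero]
    congr 1; field_simp; ring
  have hb2 : 2 ^ (m * n) * (2 * (n + 1) * α) ^ m * (2 ^ (m + 1) * 4 ^ (m + n) * b ^ n) = C2 * ε' ^ (m + n) := by
    calc _ = C2 * ε' ^ (m + n) * (E ^ m * (Real.exp ((N : ℝ) / n)) ^ n) := by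
          rw [hC2, hα, hb, hQ]
          simp only [mul_pow, pow_add]; ring
      _ = _ := by rw [hexp, mul_one]
  rw [hb2] at hP2
  linarith [hP1.trans hb1]

end PartRep

section PartMeasA

lemma avgM_le {α : Type*} [MeasurableSpace α] (T : α → α) (hT : Measurable T) (η : Measure α) (N : ℕ) (hN : 0 < N) {S : Set α}
    (hS : MeasurableSet S) {e : ℝ≥0∞} (h : ∀ j < N, η (T^[j] ⁻¹' S) ≤ e) : avgM T η N S ≤ e := by
  rw [avgM_apply T hT η N hS]
  calc _ ≤ (N : ℝ≥0∞)⁻¹ * ∑ j ∈ Finset.range N, e := by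
        gcongr with j hj
        exact h j (Finset.mem_range.1 hj)
    _ = e := by
      rw [Finset.sum_const, Finset.card_range, nsmul_eq_mul, ← mul_assoc, ENNReal.inv_mul_cancel (by simpa using hN.ne') (by simp), one_mul]

lemma box_vol {m n : ℕ} (A : Mt m n) (r : Fin n → ℝ) (hr : ∀ j, 0 ≤ r j) :
    volume {B : Mt m n | ∀ i j, |B i j - A i j| ≤ r j} ≤ ENNReal.ofReal ((∏ j, 2 * r j) ^ m) := by
  have : {B : Mt m n | ∀ i j, |B i j - A i j| ≤ r j} =
      Set.pi Set.univ fun i => Set.pi Set.univ fun j => Set.Icc (A i j - r j) (A i j + r j) := by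
    ext B
    simp only [Set.mem_ofPred_eq, Set.mem_pi, Set.mem_univ, true_imp_iff, Set.mem_Icc, abs_le]
    refine forall_congr' fun i => forall_congr' fun j => ?_
    constructor <;> rintro ⟨h1, h2⟩ <;> constructor <;> linarith
  rw [this]
  simp only [volume_pi_pi, Real.volume_Icc]
  refine le_of_eq ?_
  have h2 : ∀ i : Fin m, ∏ j, ENNReal.ofReal (A i j + r j - (A i j - r j)) = ENNReal.ofReal (∏ j, 2 * r j) := by
    intro i
    rw [ENNReal.ofReal_prod_of_nonneg (fun j _ => by have := hr j; positivity)]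
    refine Finset.prod_congr rfl fun j _ => ?_
    congr 1; ring
  rw [Finset.prod_congr rfl fun i _ => h2 i, Finset.prod_const, Finset.card_univ, Fintype.card_fin,
    ENNReal.ofReal_pow (Finset.prod_nonneg fun j _ => by have := hr j; positivity)]

theorem measA {m n : ℕ} (hm : 0 < m) (hn : 0 < n) : ∃ μ : Measure (XSp (m + n)), IsProbabilityMeasure μ ∧
    MeasurePreserving (aAct m n hm hn) μ μ ∧ ksEntropy (aAct m n hm hn) μ = (m : ℝ) + n := by
  obtain ⟨ε, hε, hx0⟩ := compact_sub_Cus (isCompact_singleton (x := (QuotientGroup.mk 1 : XSp (m + n))))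
  set x0 : XSp (m + n) := QuotientGroup.mk 1
  have hx0 : x0 ∈ (Cus ε : Set (XSp (m + n))) := hx0 rfl
  set T := aAct m n hm hn with hTdef
  have hTc : Continuous T := aAct_continuous m n hm hn
  have hφ : Continuous fun A : Mt m n => uSL m n A • x0 := by
    have hx : ∀ x : XSp (m + n), Continuous fun A : Mt m n => uSL m n A • x := fun x => (uSL_continuous m n).smul continuous_const
    exact hx x0
  have hφm := hφ.measurable
  have hp : IsProbabilityMeasure ((ρ0 m n).map fun A => uSL m n A • x0) := Measure.isProbabilityMeasure_map hφm.aemeasurable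
  obtain ⟨C, hC, hrep⟩ := repairV hm hn
  have hBc : IsCompact (Bx m n) := isCompact_univ_pi fun _ => isCompact_univ_pi fun _ => isCompact_Icc
  obtain ⟨l, hl, hla, κ, μ, hκ, hlim, hinv⟩ := lim_exists hm hn (fun _ : ℕ => (ρ0 m n).map fun A => uSL m n A • x0) (fun i => i + 1)
    (fun i => Nat.succ_pos i) (tendsto_add_atTop_nat 1) (by
      intro e he
      obtain ⟨ε', hε'0, hε'1, hε'⟩ : ∃ ε' : ℝ, 0 < ε' ∧ ε' ≤ 1 ∧ ENNReal.ofReal (C * ε' ^ (m + n)) ≤ e := by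
        have h1 : Tendsto (fun t : ℝ => ENNReal.ofReal (C * t ^ (m + n))) (𝓝[>] 0) (𝓝 0) := by
          have : Tendsto (fun t : ℝ => ENNReal.ofReal (C * t ^ (m + n))) (𝓝 0) (𝓝 (ENNReal.ofReal (C * 0 ^ (m + n)))) :=
            (ENNReal.continuous_ofReal.comp (by fun_prop : Continuous fun t : ℝ => C * t ^ (m + n))).tendsto 0
          rw [zero_pow (by omega), mul_zero, ENNReal.ofReal_zero] at this
          exact this.mono_left nhdsWithin_le_nhds
        have h2 := (h1.eventually_lt_const he).and (Ioc_mem_nhdsGT (one_pos (α := ℝ)))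
        obtain ⟨t, ht1, ht2⟩ := h2.exists
        exact ⟨t, ht2.1, ht2.2, ht1.le⟩
      obtain ⟨N0, hN0⟩ := hrep ε hε ε' hε'0 hε'1
      have hKc : IsCompact (Cus ε' ∪ ⋃ j ∈ Finset.range N0, T^[j] '' ((fun A : Mt m n => uSL m n A • x0) '' Bx m n)) := by
        refine (Cus_compact hε'0).union ((Finset.range N0).isCompact_biUnion fun j _ => ?_)
        exact (hBc.image hφ).image (hTc.iterate j)
      refine ⟨_, hKc, fun i => ?_⟩
      refine avgM_le _ hTc.measurable _ _ (Nat.succ_pos i) hKc.measurableSet.compl fun j _ => ?_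
      rw [Measure.map_apply hφm ((hTc.iterate j).measurable hKc.measurableSet.compl)]
      by_cases hj : N0 ≤ j
      · refine le_trans ?_ hε'
        refine le_trans ?_ (ENNReal.ofReal_le_ofReal (hN0 x0 hx0 j hj))
        rw [ofReal_measureReal (measure_ne_top _ _)]
        refine measure_mono fun P hP hcus => hP (Or.inl ?_)
        simp only
        rw [aAct_iter]; exact hcus
      · refine le_of_eq_of_le ?_ (zero_le)
        refine measure_mono_null ?_ (ρ0_Bx m n)
        intro P hP hPB
        refine hP (Or.inr ?_)
        exact Set.mem_biUnion (Finset.mem_coe.2 (Finset.mem_range.2 (not_le.1 hj))) ⟨_, ⟨P, hPB, rfl⟩, rfl⟩)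
  have hp' : IsProbabilityMeasure (μ : Measure (XSp (m + n))) := inferInstance
  refine ⟨μ, hp', hinv, le_antisymm ?_ ?_⟩
  · exact ks_le _ _ _ (by positivity) (U2 hm hn _ hinv)
  · refine lowerL hm hn l (fun i => i + 1) (fun i => Nat.succ_pos i) ((tendsto_add_atTop_nat 1).mono_left hla) x0 (fun _ => ρ0 m n)
      (R0 := 1) zero_le_one ?_ (C := 2 ^ (m * n)) (by positivity) ?_ κ hκ μ hlim hinv
    · intro _
      refine measure_mono_null ?_ (ρ0_Bx m n)
      intro P hP hPB
      refine hP ?_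
      rw [Set.mem_ofPred_eq, pi_norm_le_iff_of_nonneg zero_le_one]
      intro i
      rw [pi_norm_le_iff_of_nonneg zero_le_one]
      exact fun j => Bx_abs hPB i j
    · intro k S hS
      have hlp := lamE_pos m n ((k + 1 : ℕ) : ℝ)
      rcases S.eq_empty_or_nonempty with rfl | ⟨A, hA⟩
      · simp; positivity
      refine (ρ0_le (S' := {B : Mt m n | ∀ i j, |B i j - A i j| ≤ 1 / (2 * lamE m n ((k + 1 : ℕ) : ℝ))})
        (v := Real.exp (-(((m : ℝ) + n) * ((k + 1 : ℕ) : ℝ)))) ?_ (Real.exp_pos _).le ?_)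
      · intro P hP _ i j
        have h1 := hS A hA P hP
        have h2 : |P i j - A i j| ≤ ‖P - A‖ := (norm_le_pi_norm ((P - A) i) j).trans (norm_le_pi_norm (P - A) i)
        refine h2.trans ?_
        rw [le_div_iff₀ (by positivity)]
        linarith
      · refine (box_vol A (fun _ => 1 / (2 * lamE m n ((k + 1 : ℕ) : ℝ))) (fun _ => by positivity)).trans (le_of_eq ?_)
        congr 1
        rw [Finset.prod_const, Finset.card_univ, Fintype.card_fin, ← pow_mul, Real.exp_neg, ← lamE_pow hm hn, mul_comm n m, ← inv_pow]
        congr 1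
        field_simp

end PartMeasA

section PartEx1

lemma sep_extract {X E : Type*} [MeasurableSpace X] [NormedAddCommGroup E] [DecidableEq E] (ρ : Measure X) [IsProbabilityMeasure ρ] {G : Set X}
    (hG : 1 / 2 ≤ ρ.real G) (f : X → E) {η q : ℝ} (hη : 0 < η) (hq : 0 < q) (hcell : ∀ P ∈ G, ρ.real {P' | ‖f P' - f P‖ < η} ≤ q) (k : ℕ) :
    k * q ≤ 1 / 2 → ∃ F : Finset E, F.card = k ∧ (∀ B ∈ F, ∃ P ∈ G, f P = B) ∧ ∀ B ∈ F, ∀ B' ∈ F, B ≠ B' → η ≤ ‖B' - B‖ := by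
  classical
  induction k with
  | zero => intro _; exact ⟨∅, by simp, by simp, by simp⟩
  | succ k ih =>
    intro hk
    push_cast at hk
    obtain ⟨F, hc, hF, hs⟩ := ih (by nlinarith)
    have h1 : ρ.real (⋃ B ∈ F, {P' | ‖f P' - B‖ < η}) ≤ k * q := by
      refine (measureReal_biUnion_finset_le _ _).trans ?_
      calc _ ≤ ∑ B ∈ F, q := Finset.sum_le_sum fun B hB => by
            obtain ⟨P, hP, rfl⟩ := hF B hB
            exact hcell P hP
        _ = _ := by rw [Finset.sum_const, hc, nsmul_eq_mul]
    obtain ⟨P, hPG, hP⟩ : ∃ P ∈ G, P ∉ ⋃ B ∈ F, {P' | ‖f P' - B‖ < η} := by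
      by_contra hcon
      push Not at hcon
      have := measureReal_mono (μ := ρ) (show G ⊆ _ from hcon) (measure_ne_top _ _)
      nlinarith
    have hP' : ∀ B ∈ F, η ≤ ‖f P - B‖ := by
      intro B hB
      by_contra hlt
      exact hP (Set.mem_biUnion hB (not_le.1 hlt))
    have hnot : f P ∉ F := fun h => by
      have := hP' _ h
      rw [sub_self, norm_zero] at this; linarith
    refine ⟨insert (f P) F, ?_, ?_, ?_⟩
    · rw [Finset.card_insert_of_notMem hnot, hc]
    · intro B hB
      rcases Finset.mem_insert.1 hB with rfl | hB
      · exact ⟨P, hPG, rfl⟩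
      · exact hF B hB
    · intro B hB B' hB' hne
      rcases Finset.mem_insert.1 hB with h1 | hB <;> rcases Finset.mem_insert.1 hB' with h2 | hB'
      · exact absurd (h1.trans h2.symm) hne
      · rw [h1, norm_sub_rev]; exact hP' _ hB'
      · rw [h2]; exact hP' _ hB
      · exact hs B hB B' hB' hne

lemma count_int {d : ℕ} (g : GSp d) {R : ℝ} (hR : 1 ≤ R) (hg : ∀ i j, |((g⁻¹ : GSp d) : Matrix (Fin d) (Fin d) ℝ) i j| ≤ R) (k0 : Fin d)
    {r M : ℝ} (hM : 0 ≤ M) (hr : 1 ≤ d * R * r) (Λ : Finset (Fin d → ℤ))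
    (hΛ : ∀ k ∈ Λ, ∃ c : ℝ, |c| ≤ M ∧ ‖(g : Matrix (Fin d) (Fin d) ℝ) *ᵥ (rv k - c • Pi.single k0 1)‖ ≤ r) :
    (Λ.card : ℝ) ≤ (3 * (d * R * r)) ^ (d - 1) * (3 * (d * R * r) + 2 * M) := by
  classical
  set b := d * R * r with hb
  let β : Fin d → ℝ := fun l => if l = k0 then b + M else b
  have hβ0 : ∀ l, 0 ≤ β l := fun l => by simp only [β]; split_ifs <;> linarith
  have hsub : Λ ⊆ Fintype.piFinset fun l => Finset.Icc (-⌊β l⌋) ⌊β l⌋ := by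
    intro k hk
    obtain ⟨c, hc, hn⟩ := hΛ k hk
    rw [Fintype.mem_piFinset]
    intro l
    have h1 : ‖rv k - c • Pi.single k0 1‖ ≤ b := by
      have := norm_mulVec_le _ hg ((g : Matrix (Fin d) (Fin d) ℝ) *ᵥ (rv k - c • Pi.single k0 1))
      rw [inv_mulVec] at this
      refine this.trans ?_
      rw [hb]; gcongr
    have h2 := (norm_le_pi_norm _ l).trans h1
    have h3 : |(k l : ℝ)| ≤ β l := by
      simp only [Pi.sub_apply, Pi.smul_apply, smul_eq_mul, Real.norm_eq_abs, rv] at h2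
      simp only [β]
      by_cases hl : l = k0
      · subst hl
        rw [if_pos rfl]
        rw [Pi.single_eq_same, mul_one] at h2
        have := abs_add_le ((k l : ℝ) - c) c
        rw [sub_add_cancel] at this
        linarith
      · rw [if_neg hl]
        rw [Pi.single_eq_of_ne hl, mul_zero, sub_zero] at h2
        exact h2
    rw [abs_le] at h3
    rw [Finset.mem_Icc]
    constructor
    · rw [neg_le]; refine Int.le_floor.2 ?_; push_cast; linarith
    · exact Int.le_floor.2 h3.2
  have hcard : (Λ.card : ℝ) ≤ ∏ l, (2 * β l + 1) := by
    refine (Nat.cast_le.2 (Finset.card_le_card hsub)).trans ?_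
    rw [Fintype.card_piFinset, Nat.cast_prod]
    refine Finset.prod_le_prod (fun _ _ => by positivity) fun l _ => ?_
    rw [Int.card_Icc]
    have h0 : 0 ≤ ⌊β l⌋ := Int.floor_nonneg.2 (hβ0 l)
    have h1 : (((⌊β l⌋ + 1 - -⌊β l⌋).toNat : ℕ) : ℝ) = 2 * (⌊β l⌋ : ℝ) + 1 := by
      have : (((⌊β l⌋ + 1 - -⌊β l⌋).toNat : ℤ)) = 2 * ⌊β l⌋ + 1 := by rw [Int.toNat_of_nonneg (by omega)]; ring
      exact_mod_cast this
    rw [h1]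
    linarith [Int.floor_le (β l)]
  refine hcard.trans ?_
  rw [← Finset.mul_prod_erase _ _ (Finset.mem_univ k0), mul_comm]
  refine mul_le_mul ?_ ?_ (by linarith [hβ0 k0]) (by positivity)
  · calc _ ≤ ∏ l ∈ Finset.univ.erase k0, (3 * b) := by
          refine Finset.prod_le_prod (fun l _ => by linarith [hβ0 l]) fun l hl => ?_
          simp only [β, if_neg (Finset.ne_of_mem_erase hl)]
          linarith
      _ = _ := by simp
  · simp only [β, if_true]; linarith

end PartEx1

section PartEx2

lemma count_int' {d : ℕ} (g : GSp d) {R : ℝ} (hR : 1 ≤ R) (hg : ∀ i j, |((g⁻¹ : GSp d) : Matrix (Fin d) (Fin d) ℝ) i j| ≤ R) (k0 : Fin d)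
    {r M : ℝ} (hM : 0 ≤ M) (hr : 1 ≤ d * R * r) (W : Finset (Fin d → ℝ))
    (hW : ∀ w ∈ W, w ∈ lat (QuotientGroup.mk g : XSp d) ∧
      ∃ c : ℝ, |c| ≤ M ∧ ‖w - c • ((g : Matrix (Fin d) (Fin d) ℝ) *ᵥ Pi.single k0 1)‖ ≤ r) :
    (W.card : ℝ) ≤ (3 * (d * R * r)) ^ (d - 1) * (3 * (d * R * r) + 2 * M) := by
  classical
  have hex : ∀ w : Fin d → ℝ, ∃ k : Fin d → ℤ, w ∈ W → w = (g : Matrix (Fin d) (Fin d) ℝ) *ᵥ rv k := by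
    intro w
    by_cases hw : w ∈ W
    · obtain ⟨k, hk⟩ := mem_lat_mk.1 (hW w hw).1
      exact ⟨k, fun _ => hk⟩
    · exact ⟨0, fun h => absurd h hw⟩
  choose K hK using hex
  have hinj : Set.InjOn K W := by
    intro w hw w' hw' h
    rw [hK w hw, hK w' hw', h]
  rw [← Finset.card_image_of_injOn hinj]
  refine count_int g hR hg k0 hM hr _ ?_
  intro k hk
  obtain ⟨w, hw, rfl⟩ := Finset.mem_image.1 hk
  obtain ⟨c, hc, hcr⟩ := (hW w hw).2
  refine ⟨c, hc, ?_⟩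
  rw [Matrix.mulVec_sub, Matrix.mulVec_smul, ← hK w hw]
  exact hcr

/-- the parametrization of the strip -/
def Bmap {m n : ℕ} (v : Fin (m + n) → ℝ) (j0 : Fin n) (δ : ℝ) (P : Mt m n) : Mt m n :=
  fun i j => if j = j0 then (-v1 v i - ∑ j ∈ Finset.univ.erase j0, P i j * v2 v j + δ * P i j0) / v2 v j0 else P i j

def Phi {m n : ℕ} (v : Fin (m + n) → ℝ) (j0 : Fin n) (δ : ℝ) (w : Fin (m + n) → ℝ) : Fin (m + n) → ℝ :=
  w - (v2 w j0 / v2 v j0) • v + (v2 w j0 / v2 v j0 * δ) • Pi.single (Fin.natAdd m j0) 1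

lemma v1_Phi {m n : ℕ} (v : Fin (m + n) → ℝ) (j0 : Fin n) (δ : ℝ) (w : Fin (m + n) → ℝ) (i : Fin m) :
    v1 (Phi v j0 δ w) i = v1 w i - v2 w j0 / v2 v j0 * v1 v i := by
  have : Fin.castAdd n i ≠ Fin.natAdd m j0 := by
    intro h
    have := congrArg Fin.val h
    simp at this
    omega
  simp [Phi, v1, Pi.single_eq_of_ne this]

lemma v2_Phi_ne {m n : ℕ} (v : Fin (m + n) → ℝ) (j0 : Fin n) (δ : ℝ) (w : Fin (m + n) → ℝ) (j : Fin n) (hj : j ≠ j0) :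
    v2 (Phi v j0 δ w) j = v2 w j - v2 w j0 / v2 v j0 * v2 v j := by
  have : Fin.natAdd m j ≠ Fin.natAdd m j0 := by
    intro h
    exact hj (Fin.natAdd_injective _ _ h)
  simp [Phi, v2, Pi.single_eq_of_ne this]

lemma v2_Phi_eq {m n : ℕ} (v : Fin (m + n) → ℝ) (j0 : Fin n) (δ : ℝ) (w : Fin (m + n) → ℝ) (hv : v2 v j0 ≠ 0) :
    v2 (Phi v j0 δ w) j0 = v2 w j0 / v2 v j0 * δ := by
  have : v2 (Phi v j0 δ w) j0 = v2 w j0 - v2 w j0 / v2 v j0 * v2 v j0 + v2 w j0 / v2 v j0 * δ := by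
    simp [Phi, v2]
  rw [this]; field_simp; ring

lemma v1_Bmap {m n : ℕ} (v : Fin (m + n) → ℝ) (j0 : Fin n) (δ : ℝ) (P : Mt m n) (w : Fin (m + n) → ℝ) (hv : v2 v j0 ≠ 0) :
    v1 (uMat m n (Bmap v j0 δ P) *ᵥ w) = v1 (uMat m n P *ᵥ Phi v j0 δ w) := by
  ext i
  rw [v1_uMat, v1_uMat, v1_Phi, ← Finset.add_sum_erase _ _ (Finset.mem_univ j0), ← Finset.add_sum_erase _ (fun j => P i j * _) (Finset.mem_univ j0),
    v2_Phi_eq _ _ _ _ hv]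
  have h1 : ∑ j ∈ Finset.univ.erase j0, Bmap v j0 δ P i j * v2 w j = ∑ j ∈ Finset.univ.erase j0, P i j * v2 w j :=
    Finset.sum_congr rfl fun j hj => by simp [Bmap, Finset.ne_of_mem_erase hj]
  have h2 : ∑ j ∈ Finset.univ.erase j0, P i j * v2 (Phi v j0 δ w) j = ∑ j ∈ Finset.univ.erase j0, P i j * v2 w j -
      v2 w j0 / v2 v j0 * ∑ j ∈ Finset.univ.erase j0, P i j * v2 v j := by
    rw [Finset.mul_sum, ← Finset.sum_sub_distrib]
    exact Finset.sum_congr rfl fun j hj => by rw [v2_Phi_ne _ _ _ _ _ (Finset.ne_of_mem_erase hj)]; ring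
  rw [h1, h2]
  have h3 : Bmap v j0 δ P i j0 = (-v1 v i - ∑ j ∈ Finset.univ.erase j0, P i j * v2 v j + δ * P i j0) / v2 v j0 := by simp [Bmap]
  rw [h3]
  field_simp
  ring

lemma Phi_norm {m n : ℕ} (v : Fin (m + n) → ℝ) (j0 : Fin n) (δ : ℝ) (w : Fin (m + n) → ℝ) (hv : v2 v j0 ≠ 0) :
    ‖w - (v2 w j0 / v2 v j0) • v‖ ≤ ‖Phi v j0 δ w‖ := by
  rw [norm_le_iff12 _ (norm_nonneg _)]
  constructor
  · have : v1 (w - (v2 w j0 / v2 v j0) • v) = v1 (Phi v j0 δ w) := by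
      ext i; rw [v1_Phi]; simp [v1]
    rw [this]; exact norm_v1_le _
  · rw [pi_norm_le_iff_of_nonneg (norm_nonneg _)]
    intro j
    by_cases hj : j = j0
    · subst hj
      have : v2 (w - (v2 w j / v2 v j) • v) j = 0 := by
        have : v2 (w - (v2 w j / v2 v j) • v) j = v2 w j - v2 w j / v2 v j * v2 v j := by simp [v2]
        rw [this]; field_simp; ring
      rw [this, norm_zero]; exact norm_nonneg _
    · have : v2 (w - (v2 w j0 / v2 v j0) • v) j = v2 (Phi v j0 δ w) j := by
        rw [v2_Phi_ne _ _ _ _ _ hj]; simp [v2]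
      rw [this]; exact (norm_le_pi_norm _ _).trans (norm_v2_le _)

lemma Phi_c {m n : ℕ} (v : Fin (m + n) → ℝ) (j0 : Fin n) {δ : ℝ} (hδ : 0 < δ) (w : Fin (m + n) → ℝ) (hv : v2 v j0 ≠ 0) :
    |v2 w j0 / v2 v j0| * δ ≤ ‖Phi v j0 δ w‖ := by
  have h := (norm_le_pi_norm (v2 (Phi v j0 δ w)) j0).trans (norm_v2_le _)
  rw [v2_Phi_eq _ _ _ _ hv, norm_mul, Real.norm_eq_abs, Real.norm_eq_abs, abs_of_pos hδ] at h
  exact h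

/-- upper bound for `v2 (Phi w)` -/
lemma Phi_v2_le {m n : ℕ} (v : Fin (m + n) → ℝ) (j0 : Fin n) {δ δ' c0 R Q : ℝ} (hδ : 0 < δ) (hδδ : δ ≤ δ') (hc0 : 0 < c0) (hc1 : c0 ≤ 1)
    (hR : 1 ≤ R) (hvR : ‖v‖ ≤ R) (hv : c0 ≤ |v2 v j0|) (hcase : n = 1 ∨ δ' = 1) (w : Fin (m + n) → ℝ) (hw : ‖v2 w‖ ≤ Q) :
    ‖v2 (Phi v j0 δ w)‖ ≤ 2 * R / c0 * (Q * δ') := by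
  have hQ : 0 ≤ Q := (norm_nonneg _).trans hw
  have hvne : v2 v j0 ≠ 0 := by
    intro h; rw [h, abs_zero] at hv; linarith
  have hc : |v2 w j0 / v2 v j0| ≤ Q / c0 := by
    rw [abs_div]
    exact div_le_div₀ hQ ((norm_le_pi_norm (v2 w) j0).trans hw) hc0 hv
  have hδ' : 0 < δ' := hδ.trans_le hδδ
  rw [pi_norm_le_iff_of_nonneg (by positivity)]
  intro j
  by_cases hj : j = j0
  · subst hj
    rw [v2_Phi_eq _ _ _ _ hvne, norm_mul, Real.norm_eq_abs, Real.norm_eq_abs, abs_of_pos hδ]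
    calc |v2 w j / v2 v j| * δ ≤ Q / c0 * δ' := by gcongr
      _ = 1 / c0 * (Q * δ') := by ring
      _ ≤ _ := by gcongr; linarith
  · rcases hcase with h1 | h1
    · subst h1; exact absurd (Subsingleton.elim _ _) hj
    · rw [v2_Phi_ne _ _ _ _ _ hj, h1]
      have e1 : |v2 w j| ≤ Q := (norm_le_pi_norm (v2 w) j).trans hw
      have e2 : |v2 v j| ≤ R := ((norm_le_pi_norm (v2 v) j).trans (norm_v2_le _)).trans hvR
      calc |v2 w j - v2 w j0 / v2 v j0 * v2 v j| ≤ |v2 w j| + |v2 w j0 / v2 v j0 * v2 v j| := abs_sub _ _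
        _ ≤ Q + Q / c0 * R := by rw [abs_mul]; gcongr
        _ ≤ Q / c0 * R + Q / c0 * R := by
            gcongr
            rw [div_mul_eq_mul_div, le_div_iff₀ hc0]
            gcongr
            linarith
        _ = _ := by ring

end PartEx2

section PartEx3

lemma norm_single_le {d : ℕ} (g : Matrix (Fin d) (Fin d) ℝ) {R : ℝ} (hR : 0 ≤ R) (hg : ∀ i j, |g i j| ≤ R) (k0 : Fin d) :
    ‖g *ᵥ (Pi.single k0 1 : Fin d → ℝ)‖ ≤ R := by
  rw [pi_norm_le_iff_of_nonneg hR]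
  intro i
  rw [Matrix.mulVec_single_one]
  exact hg i k0

lemma exc_const {m n : ℕ} (hn : 0 < n) {D C1 Q δ : ℝ} (hD : 1 ≤ D) (hC1 : 1 ≤ C1) (hQ : 0 < Q) (hδ : 0 < δ) (hδ1 : δ ≤ 1) :
    ∃ (δ' K : ℝ) (e : ℕ), δ ≤ δ' ∧ δ' ≤ 1 ∧ (n = 1 ∨ δ' = 1) ∧ 1 ≤ e ∧ 0 ≤ K ∧
      (∀ r > 0, r ≤ C1 * (Q * δ') → (3 * (D * r)) ^ (m + n - 1) * (3 * (D * r) + 2 * min (Q * D) (r / δ)) ≤ K * r ^ (m + e)) ∧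
      K * (C1 * (Q * δ')) ^ e ≤ (3 * D) ^ (m + n - 1) * (3 * D * C1 + 2 * D) * C1 ^ n * Q ^ n := by
  rcases Nat.lt_or_ge 1 n with h | h
  · refine ⟨1, (3 * D) ^ (m + n - 1) * (3 * D * C1 + 2 * D) * Q, n - 1, hδ1, le_rfl, Or.inr rfl, by omega, by positivity, ?_, ?_⟩
    · intro r hr hrb
      rw [mul_one] at hrb
      have h1 : m + (n - 1) = m + n - 1 := by omega
      rw [h1]
      calc _ ≤ (3 * (D * r)) ^ (m + n - 1) * (3 * (D * (C1 * Q)) + 2 * (Q * D)) := by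
            gcongr; exact min_le_left _ _
        _ = _ := by rw [show 3 * (D * r) = (3 * D) * r by ring, mul_pow]; ring
    · have h1 : n = n - 1 + 1 := by omega
      rw [mul_one]
      calc _ = (3 * D) ^ (m + n - 1) * (3 * D * C1 + 2 * D) * C1 ^ (n - 1) * (Q ^ (n - 1) * Q) := by rw [mul_pow]; ring
        _ = (3 * D) ^ (m + n - 1) * (3 * D * C1 + 2 * D) * C1 ^ (n - 1) * Q ^ n := by rw [← pow_succ, ← h1]
        _ ≤ _ := by gcongr; omega
  · obtain rfl : n = 1 := by omega
    refine ⟨δ, (3 * D) ^ (m + 1 - 1) * (3 * D * C1 + 2 * D) / δ, 1, le_rfl, hδ1, Or.inl rfl, le_rfl, by positivity, ?_, ?_⟩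
    · intro r hr hrb
      have h1 : 3 * (D * r) + 2 * min (Q * D) (r / δ) ≤ (3 * D * C1 + 2 * D) / δ * r := by
        calc _ ≤ 3 * (D * r) + 2 * (r / δ) := by gcongr; exact min_le_right _ _
          _ ≤ 3 * (D * C1 * (r / δ)) + 2 * (D * (r / δ)) := by
              have h2 : r ≤ r / δ := by rw [le_div_iff₀ hδ]; nlinarith
              have h3 : r / δ ≤ D * (r / δ) := le_mul_of_one_le_left (by positivity) hD
              have h4 : D * r ≤ D * C1 * (r / δ) := by
                calc D * r ≤ D * (r / δ) := by gcongr
                  _ ≤ D * C1 * (r / δ) := by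
                    rw [mul_assoc]; gcongr
                    exact le_mul_of_one_le_left (by positivity) hC1
              linarith
          _ = _ := by ring
      calc _ ≤ (3 * (D * r)) ^ (m + 1 - 1) * ((3 * D * C1 + 2 * D) / δ * r) := by gcongr
        _ = _ := by simp only [Nat.add_sub_cancel, pow_succ, mul_pow]; ring
    · rw [pow_one, pow_one, pow_one]
      apply le_of_eq; field_simp

set_option maxHeartbeats 1000000 in
theorem exc_meas {m n : ℕ} (hm : 0 < m) (hn : 0 < n) {R : ℝ} (hR : 1 ≤ R) : ∃ C : ℝ, 0 < C ∧ ∃ ε1 : ℝ, 0 < ε1 ∧ ε1 ≤ 1 ∧ ∀ g : GSp (m + n),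
    (∀ i j, |(g : Matrix (Fin (m + n)) (Fin (m + n)) ℝ) i j| ≤ R) →
    (∀ i j, |((g⁻¹ : GSp (m + n)) : Matrix (Fin (m + n)) (Fin (m + n)) ℝ) i j| ≤ R) → ∀ (k0 : Fin (m + n)) (j0 : Fin n),
    1 / (((m + n : ℕ) : ℝ) * R) ≤ |v2 ((g : Matrix (Fin (m + n)) (Fin (m + n)) ℝ) *ᵥ (Pi.single k0 1 : Fin (m + n) → ℝ)) j0| → ∀ N1 : ℕ, ∀ ε : ℝ, 0 < ε → ε ≤ ε1 →
    (ρ0 m n).real {P | aSL m n hm hn N1 • uSL m n (Bmap ((g : Matrix (Fin (m + n)) (Fin (m + n)) ℝ) *ᵥ (Pi.single k0 1 : Fin (m + n) → ℝ)) j0 (Real.exp (-((N1 : ℝ) / m))) P) •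
      (QuotientGroup.mk g : XSp (m + n)) ∉ Cus ε} ≤ C * ε ^ (m + n) := by
  classical
  have hm0 : (m : ℝ) ≠ 0 := by positivity
  have hn0 : (n : ℝ) ≠ 0 := by positivity
  set D : ℝ := ((m + n : ℕ) : ℝ) * R with hDdef
  have hD : 1 ≤ D := by
    have : (1 : ℝ) ≤ ((m + n : ℕ) : ℝ) := by exact_mod_cast (by omega : 1 ≤ m + n)
    rw [hDdef]; nlinarith
  set C1 : ℝ := 1 + (n + 1) * (2 * R * D) with hC1def
  have hC1 : 1 ≤ C1 := by
    have : 0 ≤ (n + 1) * (2 * R * D) := by positivity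
    linarith
  set C2 : ℝ := (3 * D) ^ (m + n - 1) * (3 * D * C1 + 2 * D) * C1 ^ n with hC2def
  refine ⟨2 ^ (m * n) * (2 * (n + 1)) ^ m * (2 ^ (m + 1) * C2), by positivity, min (1 / 4) (1 / (2 * (n + 1) * D)), by positivity,
    (min_le_left _ _).trans (by norm_num), ?_⟩
  intro g hg hgi k0 j0 hj0 N1 ε hε hεε
  set v := (g : Matrix (Fin (m + n)) (Fin (m + n)) ℝ) *ᵥ (Pi.single k0 1 : Fin (m + n) → ℝ) with hv
  set y : XSp (m + n) := QuotientGroup.mk g with hy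
  have hvR : ‖v‖ ≤ R := norm_single_le _ (by linarith) hg k0
  have hvne : v2 v j0 ≠ 0 := by
    intro h; rw [h, abs_zero] at hj0
    have : 0 < 1 / D := by positivity
    linarith
  set δ := Real.exp (-((N1 : ℝ) / m)) with hδ
  have hδp : 0 < δ := Real.exp_pos _
  have hδ1 : δ ≤ 1 := by rw [hδ, Real.exp_le_one_iff]; have : 0 ≤ (N1 : ℝ) / m := by positivity
                         linarith
  set Q := ε * Real.exp ((N1 : ℝ) / n) with hQ
  have hQp : 0 < Q := by positivity
  have hεQ : ε ≤ Q := by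
    have : 1 ≤ Real.exp ((N1 : ℝ) / n) := Real.one_le_exp (by positivity)
    rw [hQ]; nlinarith
  obtain ⟨δ', K, e, hδδ, hδ'1, hcase, he, hK, hKr, hKb⟩ := exc_const (m := m) hn hD hC1 hQp hδp hδ1
  have hδ'p : 0 < δ' := hδp.trans_le hδδ
  set b := C1 * (Q * δ') with hb
  have hbp : 0 < b := by positivity
  set α := ε * δ with hα
  have hαp : 0 < α := by positivity
  -- lower bound for non-multiples
  have hlow : ∀ w ∈ lat y, (¬ ∃ t : ℤ, w = (t : ℝ) • v) → ∀ c : ℝ, 1 / D ≤ ‖w - c • v‖ := by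
    intro w hw hnm c
    obtain ⟨k, rfl⟩ := mem_lat_mk.1 hw
    obtain ⟨l, hl, hkl⟩ : ∃ l, l ≠ k0 ∧ k l ≠ 0 := by
      by_contra hcon
      push Not at hcon
      refine hnm ⟨k k0, ?_⟩
      rw [hv, ← Matrix.mulVec_smul]
      congr 1
      ext l
      by_cases hl : l = k0
      · subst hl; simp [rv]
      · simp [rv, hcon l hl, hl]
    have h1 := norm_mulVec_le _ hgi ((g : Matrix (Fin (m + n)) (Fin (m + n)) ℝ) *ᵥ (rv k - c • Pi.single k0 1))
    rw [inv_mulVec, Matrix.mulVec_sub, Matrix.mulVec_smul, ← hv, ← hDdef] at h1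
    have h2 := (norm_le_pi_norm (rv k - c • Pi.single k0 1) l).trans h1
    simp only [Pi.sub_apply, Pi.smul_apply, Pi.single_eq_of_ne hl, smul_eq_mul, mul_zero, sub_zero, rv, Real.norm_eq_abs] at h2
    have h3 : (1 : ℝ) ≤ |(k l : ℝ)| := by exact_mod_cast Int.one_le_abs hkl
    rw [div_le_iff₀ (by positivity)]
    linarith
  let W := (lat_finite y (b + Q * D * R)).toFinset.filter fun w => (¬ ∃ t : ℤ, w = (t : ℝ) • v) ∧ ‖v2 w‖ ≤ Q ∧ ‖Phi v j0 δ w‖ ≤ b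
  have hWm : ∀ w ∈ W, w ∈ lat y ∧ (¬ ∃ t : ℤ, w = (t : ℝ) • v) ∧ ‖v2 w‖ ≤ Q ∧ ‖Phi v j0 δ w‖ ≤ b := fun w hw => by
    simp only [W, Finset.mem_filter, Set.Finite.mem_toFinset, Set.mem_ofPred_eq] at hw
    exact ⟨hw.1.1, hw.2⟩
  have hcle : ∀ w : Fin (m + n) → ℝ, ‖v2 w‖ ≤ Q → |v2 w j0 / v2 v j0| ≤ Q * D := by
    intro w hw
    rw [abs_div]
    calc _ ≤ Q / (1 / D) := div_le_div₀ hQp.le ((norm_le_pi_norm (v2 w) j0).trans hw) (by positivity) hj0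
      _ = _ := by field_simp
  have hP := lemP (m := m) (n := n) (W.image (Phi v j0 δ)) hαp.le (fun w' hw' => by
      obtain ⟨w, hw, rfl⟩ := Finset.mem_image.1 hw'
      obtain ⟨h1, h2, h3, h4⟩ := hWm w hw
      refine lt_of_lt_of_le ?_ ((hlow w h1 h2 _).trans (Phi_norm v j0 δ w hvne))
      have h5 := hεε.trans (min_le_right _ _)
      rw [le_div_iff₀ (by positivity)] at h5
      rw [lt_div_iff₀ (by positivity)]
      have : α ≤ ε := by rw [hα]; nlinarith
      calc (n + 1) * α * D ≤ (n + 1) * ε * D := by gcongr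
        _ < 1 := by nlinarith) hbp (fun w' hw' => by
      obtain ⟨w, hw, rfl⟩ := Finset.mem_image.1 hw'
      exact (hWm w hw).2.2.2) hK he (by
      intro r hr
      set r' := min r b with hr'
      have hr'p : 0 < r' := lt_min hr hbp
      have h1 : ((W.image (Phi v j0 δ)).filter fun w => ‖w‖ ≤ r) ⊆ (W.filter fun w => ‖Phi v j0 δ w‖ ≤ r').image (Phi v j0 δ) := by
        intro w' hw'
        obtain ⟨hw', hwr⟩ := Finset.mem_filter.1 hw'
        obtain ⟨w, hw, rfl⟩ := Finset.mem_image.1 hw'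
        exact Finset.mem_image.2 ⟨w, Finset.mem_filter.2 ⟨hw, le_min hwr (hWm w hw).2.2.2⟩, rfl⟩
      have h2 : (((W.image (Phi v j0 δ)).filter fun w => ‖w‖ ≤ r).card : ℝ) ≤ ((W.filter fun w => ‖Phi v j0 δ w‖ ≤ r').card : ℝ) := by
        exact_mod_cast (Finset.card_le_card h1).trans Finset.card_image_le
      refine h2.trans ?_
      have h5 : K * r' ^ (m + e) ≤ K * r ^ (m + e) := by gcongr; exact min_le_left _ _
      refine le_trans ?_ h5
      by_cases hrD : r' < 1 / D
      · have : (W.filter fun w => ‖Phi v j0 δ w‖ ≤ r') = ∅ := by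
          refine Finset.eq_empty_of_forall_notMem fun w hw => ?_
          obtain ⟨hw, hwr⟩ := Finset.mem_filter.1 hw
          obtain ⟨h1, h2, h3, h4⟩ := hWm w hw
          linarith [(hlow w h1 h2 _).trans (Phi_norm v j0 δ w hvne)]
        rw [this, Finset.card_empty, Nat.cast_zero]; positivity
      · push Not at hrD
        refine le_trans ?_ (hKr r' hr'p (min_le_right _ _))
        refine count_int' g hR hgi k0 (M := min (Q * D) (r' / δ)) (by positivity) ?_ _ ?_
        · rw [← hDdef]; rw [div_le_iff₀ (by positivity)] at hrD; linarith
        · intro w hw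
          obtain ⟨hw, hwr⟩ := Finset.mem_filter.1 hw
          obtain ⟨h1, h2, h3, h4⟩ := hWm w hw
          refine ⟨h1, v2 w j0 / v2 v j0, le_min (hcle w h3) ?_, (Phi_norm v j0 δ w hvne).trans hwr⟩
          rw [le_div_iff₀ hδp]
          exact (Phi_c v j0 hδp w hvne).trans hwr)
  refine (ρ0_mono_Bx (S' := {P | ∃ w ∈ W.image (Phi v j0 δ), ‖v1 (uMat m n P *ᵥ w)‖ ≤ α}) ?_).trans (hP.trans ?_)
  · intro P hbad hPB
    obtain ⟨w, hw, hwne, h1, h2⟩ := esc_vec hm hn hbad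
    rw [v1_Bmap _ _ _ _ _ hvne, ← hδ, ← hα] at h1
    rw [← hQ] at h2
    refine ⟨Phi v j0 δ w, Finset.mem_image.2 ⟨w, ?_, rfl⟩, h1⟩
    have hPa : ∀ i j, |P i j| ≤ 1 := fun i j => Bx_abs hPB i j
    have hb1 : ‖Phi v j0 δ w‖ ≤ b := by
      have e1 := Phi_v2_le v j0 (c0 := 1 / D) hδp hδδ (by positivity) (by rw [div_le_one (by positivity)]; exact hD) hR hvR hj0 hcase w h2
      rw [show 2 * R / (1 / D) * (Q * δ') = 2 * R * D * (Q * δ') by field_simp] at e1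
      have e2 := uMat_row_bd hPa (Phi v j0 δ w)
      have e3 : α ≤ Q * δ' := by rw [hα]; gcongr
      have e4 : 0 ≤ 2 * R * D * (Q * δ') := by positivity
      rw [norm_le_iff12 _ hbp.le]
      have e6 : (n : ℝ) * ‖v2 (Phi v j0 δ w)‖ ≤ n * (2 * R * D * (Q * δ')) := by gcongr
      have e7 : b = Q * δ' + n * (2 * R * D * (Q * δ')) + 2 * R * D * (Q * δ') := by rw [hb, hC1def]; ring
      have e8 : 0 ≤ n * (2 * R * D * (Q * δ')) := by positivity
      have e9 : 0 ≤ Q * δ' := by positivity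
      constructor <;> linarith
    have hnm : ¬ ∃ t : ℤ, w = (t : ℝ) • v := by
      rintro ⟨t, rfl⟩
      have ht : t ≠ 0 := by rintro rfl; simp at hwne
      have ht1 : (1 : ℝ) ≤ |(t : ℝ)| := by exact_mod_cast Int.one_le_abs ht
      have e1 := (norm_le_pi_norm (v2 (Phi v j0 δ ((t : ℝ) • v))) j0)
      have hP0 := (mem_Bx.1 hPB ⟨0, hm⟩ j0).1
      have e2 := (norm_le_pi_norm (v1 (uMat m n P *ᵥ Phi v j0 δ ((t : ℝ) • v))) ⟨0, hm⟩).trans h1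
      have e0 : v2 ((t : ℝ) • v) j0 / v2 v j0 = t := by
        have : v2 ((t : ℝ) • v) j0 = t * v2 v j0 := by simp [v2]
        rw [this]; field_simp
      have e3 : v1 (uMat m n P *ᵥ Phi v j0 δ ((t : ℝ) • v)) ⟨0, hm⟩ = P ⟨0, hm⟩ j0 * (t * δ) := by
        rw [v1_uMat, v1_Phi, e0, ← Finset.add_sum_erase _ _ (Finset.mem_univ j0), v2_Phi_eq _ _ _ _ hvne, e0]
        have : ∑ j ∈ Finset.univ.erase j0, P ⟨0, hm⟩ j * v2 (Phi v j0 δ ((t : ℝ) • v)) j = 0 := by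
          refine Finset.sum_eq_zero fun j hj => ?_
          rw [v2_Phi_ne _ _ _ _ _ (Finset.ne_of_mem_erase hj), e0]
          simp [v2]
        rw [this]; simp [v1]
      rw [e3, Real.norm_eq_abs, abs_mul, abs_mul, abs_of_pos hδp, abs_of_nonneg (by linarith : (0:ℝ) ≤ P ⟨0, hm⟩ j0)] at e2
      have e5 := hεε.trans (min_le_left _ _)
      have e6 : 1 / 2 * (1 * δ) ≤ P ⟨0, hm⟩ j0 * (|(t : ℝ)| * δ) := by gcongr
      rw [hα] at e2
      have e7 : ε * δ ≤ 1 / 4 * δ := by gcongr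
      linarith
    simp only [W, Finset.mem_filter, Set.Finite.mem_toFinset, Set.mem_ofPred_eq]
    refine ⟨⟨hw, ?_⟩, hnm, h2, hb1⟩
    calc ‖w‖ = ‖(w - (v2 w j0 / v2 v j0) • v) + (v2 w j0 / v2 v j0) • v‖ := by rw [sub_add_cancel]
      _ ≤ ‖w - (v2 w j0 / v2 v j0) • v‖ + ‖(v2 w j0 / v2 v j0) • v‖ := norm_add_le _ _
      _ ≤ b + Q * D * R := by
          rw [norm_smul, Real.norm_eq_abs]
          refine add_le_add ((Phi_norm v j0 δ w hvne).trans hb1) ?_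
          exact mul_le_mul (hcle w h2) hvR (norm_nonneg _) (by positivity)
  · have e1 : α ^ m * Q ^ n = ε ^ (m + n) := by
      rw [hα, hQ, hδ, mul_pow, mul_pow, ← Real.exp_nat_mul, ← Real.exp_nat_mul, pow_add]
      have : Real.exp ((m : ℝ) * -((N1 : ℝ) / m)) * Real.exp ((n : ℝ) * ((N1 : ℝ) / n)) = 1 := by
        rw [← Real.exp_add, Real.exp_eq_one_iff]; field_simp; ring
      calc _ = ε ^ m * ε ^ n * (Real.exp ((m : ℝ) * -((N1 : ℝ) / m)) * Real.exp ((n : ℝ) * ((N1 : ℝ) / n))) := by ring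
        _ = _ := by rw [this, mul_one]
    calc _ = 2 ^ (m * n) * (2 * (n + 1)) ^ m * 2 ^ (m + 1) * α ^ m * (K * b ^ e) := by rw [mul_pow (2 * ((n : ℝ) + 1)) α m]; ring
      _ ≤ 2 ^ (m * n) * (2 * (n + 1)) ^ m * 2 ^ (m + 1) * α ^ m * (C2 * Q ^ n) := by gcongr
      _ = 2 ^ (m * n) * (2 * (n + 1)) ^ m * (2 ^ (m + 1) * C2) * (α ^ m * Q ^ n) := by ring
      _ = _ := by rw [e1]

end PartEx3

section PartEx4

lemma row_big {d : ℕ} (g : GSp d) {R : ℝ} (hR : 0 < R) (hg : ∀ i j, |((g⁻¹ : GSp d) : Matrix (Fin d) (Fin d) ℝ) i j| ≤ R) (j : Fin d) :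
    ∃ k0, 1 / ((d : ℝ) * R) ≤ |(g : Matrix (Fin d) (Fin d) ℝ) j k0| := by
  by_contra hcon
  push Not at hcon
  have hd : (0 : ℝ) < d := by exact_mod_cast (Fin.pos j)
  have h1 : ((g : Matrix (Fin d) (Fin d) ℝ) * ((g⁻¹ : GSp d) : Matrix (Fin d) (Fin d) ℝ)) j j = 1 := by
    rw [← Matrix.SpecialLinearGroup.coe_mul, mul_inv_cancel, Matrix.SpecialLinearGroup.coe_one, Matrix.one_apply_eq]
  rw [Matrix.mul_apply] at h1
  have h2 : ∑ k, (g : Matrix (Fin d) (Fin d) ℝ) j k * ((g⁻¹ : GSp d) : Matrix (Fin d) (Fin d) ℝ) k j < ∑ k : Fin d, 1 / (d : ℝ) := by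
    refine Finset.sum_lt_sum_of_nonempty ⟨j, Finset.mem_univ _⟩ fun k _ => ?_
    refine (le_abs_self _).trans_lt ?_
    rw [abs_mul]
    calc _ ≤ |(g : Matrix (Fin d) (Fin d) ℝ) j k| * R := by gcongr; exact hg k j
      _ < 1 / (d * R) * R := by gcongr; exact hcon k
      _ = 1 / d := by field_simp
  rw [h1, Finset.sum_const, Finset.card_univ, Fintype.card_fin, nsmul_eq_mul] at h2
  have : (d : ℝ) * (1 / d) = 1 := by field_simp
  linarith

lemma v1_Bmap_self {m n : ℕ} (v : Fin (m + n) → ℝ) (j0 : Fin n) (δ : ℝ) (P : Mt m n) (hv : v2 v j0 ≠ 0) (i : Fin m) :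
    v1 (uMat m n (Bmap v j0 δ P) *ᵥ v) i = δ * P i j0 := by
  rw [v1_uMat, ← Finset.add_sum_erase _ _ (Finset.mem_univ j0)]
  have h1 : ∑ j ∈ Finset.univ.erase j0, Bmap v j0 δ P i j * v2 v j = ∑ j ∈ Finset.univ.erase j0, P i j * v2 v j :=
    Finset.sum_congr rfl fun j hj => by simp [Bmap, Finset.ne_of_mem_erase hj]
  have h3 : Bmap v j0 δ P i j0 = (-v1 v i - ∑ j ∈ Finset.univ.erase j0, P i j * v2 v j + δ * P i j0) / v2 v j0 := by simp [Bmap]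
  rw [h1, h3, div_mul_cancel₀ _ hv]
  ring

lemma entry_le {m n : ℕ} (A : Mt m n) (i : Fin m) (j : Fin n) : |A i j| ≤ ‖A‖ := (norm_le_pi_norm (A i) j).trans (norm_le_pi_norm A i)

lemma norm_Mt_le {m n : ℕ} (A : Mt m n) {r : ℝ} (hr : 0 ≤ r) (h : ∀ i j, |A i j| ≤ r) : ‖A‖ ≤ r := by
  rw [pi_norm_le_iff_of_nonneg hr]
  intro i
  rw [pi_norm_le_iff_of_nonneg hr]
  exact fun j => h i j

set_option maxHeartbeats 1000000 in
theorem excV {m n : ℕ} (hm : 0 < m) (hn : 0 < n) {ε0 : ℝ} (hε0 : 0 < ε0) : ∃ RB : ℝ, 1 ≤ RB ∧ ∃ ε : ℝ, 0 < ε ∧ ε ≤ 1 ∧ ∀ κ > 0, ∃ c > 0,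
    ∀ y ∈ (Cus ε0 : Set (XSp (m + n))), ∀ N1 : ℕ, ∃ F : Finset (Mt m n), c * Real.exp (((m : ℝ) + n - 1) * N1) ≤ F.card + 1 ∧
      (∀ B ∈ F, ‖B‖ ≤ RB ∧ aSL m n hm hn N1 • uSL m n B • y ∈ (Cus ε : Set (XSp (m + n))) ∧
        ∃ v ∈ lat y, v ≠ 0 ∧ ‖uMat m n B *ᵥ v‖ ≤ RB ∧ ‖aMat m n N1 *ᵥ (uMat m n B *ᵥ v)‖ ≤ RB) ∧
      ∀ B ∈ F, ∀ B' ∈ F, B ≠ B' → κ / lamE m n N1 ≤ ‖B' - B‖ := by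
  classical
  have hm0 : (m : ℝ) ≠ 0 := by positivity
  have hn0 : (n : ℝ) ≠ 0 := by positivity
  obtain ⟨R, hR, hmah⟩ := mahler3 (d := m + n) hε0
  obtain ⟨C, hC, ε1, hε1, hε11, hmeas⟩ := exc_meas hm hn hR
  set D : ℝ := ((m + n : ℕ) : ℝ) * R with hDdef
  have hD : 1 ≤ D := by
    have : (1 : ℝ) ≤ ((m + n : ℕ) : ℝ) := by exact_mod_cast (by omega : 1 ≤ m + n)
    rw [hDdef]; nlinarith
  set RB := (R * (n + 1) + 1) * D with hRB
  have hRRB : R ≤ RB := by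
    have h1 : R ≤ R * (n + 1) := le_mul_of_one_le_right (by linarith) (by linarith [n.cast_nonneg (α := ℝ)])
    have h2 : R * (n + 1) + 1 ≤ RB := le_mul_of_one_le_right (by positivity) hD
    linarith
  have hRB1 : 1 ≤ RB := hR.trans hRRB
  set ε := min ε1 (1 / (2 * C)) with hε
  have hεp : 0 < ε := lt_min hε1 (by positivity)
  have hεC : C * ε ^ (m + n) ≤ 1 / 2 := by
    have h1 : ε ^ (m + n) ≤ ε := pow_le_of_le_one hεp.le ((min_le_left _ _).trans hε11) (by omega)
    calc C * ε ^ (m + n) ≤ C * (1 / (2 * C)) := by gcongr; exact h1.trans (min_le_right _ _)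
      _ = 1 / 2 := by field_simp
  refine ⟨RB, hRB1, ε, hεp, (min_le_left _ _).trans hε11, fun κ hκ => ?_⟩
  set q0 : ℝ := 2 ^ (m * n) * ((2 * κ) ^ (m * n) * (n * R) ^ m) with hq0
  have hq0p : 0 < q0 := by positivity
  refine ⟨1 / (2 * q0), by positivity, fun y hy N1 => ?_⟩
  obtain ⟨g, hgy, hg, hgi⟩ := hmah y hy
  set j0 : Fin n := ⟨0, hn⟩
  obtain ⟨k0, hk0⟩ := row_big g (by linarith) hgi (Fin.natAdd m j0)
  set v := (g : Matrix (Fin (m + n)) (Fin (m + n)) ℝ) *ᵥ (Pi.single k0 1 : Fin (m + n) → ℝ) with hv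
  have hvj : 1 / D ≤ |v2 v j0| := by
    rw [hv, Matrix.mulVec_single_one]; exact hk0
  have hvne : v2 v j0 ≠ 0 := by
    intro h; rw [h, abs_zero] at hvj
    have : 0 < 1 / D := by positivity
    linarith
  have hvR : ‖v‖ ≤ R := norm_single_le _ (by linarith) hg k0
  set δ := Real.exp (-((N1 : ℝ) / m)) with hδ
  have hδp : 0 < δ := Real.exp_pos _
  have hδ1 : δ ≤ 1 := by
    rw [hδ, Real.exp_le_one_iff]
    have : 0 ≤ (N1 : ℝ) / m := by positivity
    linarith
  have hbad := hmeas g hg hgi k0 j0 hvj N1 ε hεp (min_le_left _ _)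
  rw [hgy, ← hv, ← hδ] at hbad
  have hφ : Continuous fun P : Mt m n => aSL m n hm hn N1 • uSL m n (Bmap v j0 δ P) • y := by
    have h1 : Continuous fun P : Mt m n => Bmap v j0 δ P := by
      refine continuous_pi fun i => continuous_pi fun j => ?_
      by_cases hj : j = j0
      · simp only [Bmap, if_pos hj]; fun_prop
      · simp only [Bmap, if_neg hj]; fun_prop
    have h2 : ∀ (a : GSp (m + n)) (x : XSp (m + n)), Continuous fun P : Mt m n => a • uSL m n (Bmap v j0 δ P) • x := fun a x =>
      (((uSL_continuous m n).comp h1).smul continuous_const).const_smul a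
    exact h2 _ y
  set G : Set (Mt m n) := {P | aSL m n hm hn N1 • uSL m n (Bmap v j0 δ P) • y ∈ Cus ε} ∩ Bx m n with hG
  have hGm : MeasurableSet {P : Mt m n | aSL m n hm hn N1 • uSL m n (Bmap v j0 δ P) • y ∈ Cus ε} := ((Cus_closed ε).preimage hφ).measurableSet
  have hG2 : 1 / 2 ≤ (ρ0 m n).real G := by
    have h1 : (ρ0 m n).real {P | aSL m n hm hn N1 • uSL m n (Bmap v j0 δ P) • y ∈ Cus ε}ᶜ ≤ 1 / 2 := hbad.trans hεC
    rw [probReal_compl_eq_one_sub hGm] at h1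
    have h2 : (ρ0 m n).real {P | aSL m n hm hn N1 • uSL m n (Bmap v j0 δ P) • y ∈ Cus ε} ≤ (ρ0 m n).real G :=
      ρ0_mono_Bx fun P hP hB => ⟨hP, hB⟩
    linarith
  have hl := lamE_pos m n (N1 : ℝ)
  set η := κ / lamE m n N1 with hη
  have hηp : 0 < η := by positivity
  set q := q0 * Real.exp (-(((m : ℝ) + n - 1) * N1)) with hq
  have hqp : 0 < q := by positivity
  have hcell : ∀ P ∈ G, (ρ0 m n).real {P' | ‖Bmap v j0 δ P' - Bmap v j0 δ P‖ < η} ≤ q := by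
    intro P _
    have h1 := ρ0_le (m := m) (n := n) (S := {P' | ‖Bmap v j0 δ P' - Bmap v j0 δ P‖ < η})
      (S' := {P' | ∀ i j, |P' i j - P i j| ≤ (fun j => if j = j0 then n * R * η / δ else η) j})
      (v := (∏ j, 2 * (fun j => if j = j0 then n * R * η / δ else η) j) ^ m) ?_ ?_ ?_
    · refine h1.trans (le_of_eq ?_)
      rw [hq, hq0, mul_assoc (2 ^ (m * n) : ℝ)]
      congr 1
      rw [← Finset.mul_prod_erase _ _ (Finset.mem_univ j0)]
      have h2 : ∏ j ∈ Finset.univ.erase j0, 2 * (fun j => if j = j0 then n * R * η / δ else η) j = (2 * η) ^ (n - 1) := by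
        rw [Finset.prod_congr rfl (g := fun _ => 2 * η) fun j hj => by simp only [if_neg (Finset.ne_of_mem_erase hj)]]
        simp
      rw [h2]
      simp only [if_true]
      have h3 : 2 * (n * R * η / δ) * (2 * η) ^ (n - 1) = (2 * η) ^ n * (n * R) / δ := by
        have : n = n - 1 + 1 := by omega
        conv_rhs => rw [this, pow_succ]
        push_cast [← this]
        ring
      rw [h3, div_pow, mul_pow, ← pow_mul, mul_comm n m, hη, ← mul_div_assoc, div_pow, lamE_pow hm hn, hδ, ← Real.exp_nat_mul]
      have h4 : Real.exp ((m : ℝ) * -((N1 : ℝ) / m)) = Real.exp (-N1) := by congr 1; field_simp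
      have h5 : Real.exp (-(((m : ℝ) + n - 1) * N1)) = Real.exp (-(((m : ℝ) + n) * N1)) / Real.exp (-N1) := by
        rw [← Real.exp_sub]; congr 1; ring
      rw [h4, h5, Real.exp_neg (((m : ℝ) + n) * N1)]
      ring
    · intro P' hP' _ i j
      have hlt : ‖Bmap v j0 δ P' - Bmap v j0 δ P‖ < η := hP'
      simp only
      split_ifs with hj
      · rw [hj]
        have h2 : δ * (P' i j0 - P i j0) = ∑ k, (Bmap v j0 δ P' - Bmap v j0 δ P) i k * v2 v k := by
          have e1 := v1_Bmap_self v j0 δ P' hvne i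
          have e2 := v1_Bmap_self v j0 δ P hvne i
          rw [v1_uMat] at e1 e2
          rw [mul_sub, ← e1, ← e2, add_sub_add_left_eq_sub, ← Finset.sum_sub_distrib]
          exact Finset.sum_congr rfl fun k _ => by simp only [Pi.sub_apply]; ring
        rw [le_div_iff₀ hδp]
        calc |P' i j0 - P i j0| * δ = |δ * (P' i j0 - P i j0)| := by rw [abs_mul, abs_of_pos hδp, mul_comm]
          _ ≤ ∑ k, |(Bmap v j0 δ P' - Bmap v j0 δ P) i k * v2 v k| := by rw [h2]; exact Finset.abs_sum_le_sum_abs _ _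
          _ ≤ ∑ k : Fin n, η * R := by
              refine Finset.sum_le_sum fun k _ => ?_
              rw [abs_mul]
              exact mul_le_mul ((entry_le _ i k).trans hlt.le) (((norm_le_pi_norm (v2 v) k).trans (norm_v2_le _)).trans hvR) (abs_nonneg _) hηp.le
          _ = _ := by simp; ring
      · have h2 := (entry_le (Bmap v j0 δ P' - Bmap v j0 δ P) i j).trans hlt.le
        simp only [Pi.sub_apply, Bmap, if_neg hj] at h2
        exact h2
    · refine pow_nonneg (Finset.prod_nonneg fun j _ => ?_) _
      simp only; split_ifs <;> positivity
    · exact box_vol P _ fun j => by split_ifs <;> positivity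
  obtain ⟨F, hFc, hF, hsep⟩ := sep_extract (ρ0 m n) hG2 (Bmap v j0 δ) hηp hqp hcell ⌊1 / (2 * q)⌋₊ (by
    calc (⌊1 / (2 * q)⌋₊ : ℝ) * q ≤ 1 / (2 * q) * q := by gcongr; exact Nat.floor_le (by positivity)
      _ = 1 / 2 := by field_simp)
  refine ⟨F, ?_, ?_, hsep⟩
  · rw [hFc]
    refine le_trans (le_of_eq ?_) (Nat.lt_floor_add_one (1 / (2 * q))).le
    rw [hq, Real.exp_neg]; field_simp
  · intro B hB
    obtain ⟨P, ⟨hP, hPB⟩, rfl⟩ := hF B hB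
    have hPa : ∀ i j, |P i j| ≤ 1 := fun i j => Bx_abs hPB i j
    have hvy : v ∈ lat y := by
      rw [← hgy]
      refine mem_lat_mk.2 ⟨Pi.single k0 1, ?_⟩
      rw [hv]; congr 1
      ext l
      by_cases hl : l = k0
      · subst hl; simp [rv]
      · simp [rv, hl]
    have hv1 : ‖v1 (uMat m n (Bmap v j0 δ P) *ᵥ v)‖ ≤ δ := by
      rw [pi_norm_le_iff_of_nonneg hδp.le]
      intro i
      rw [v1_Bmap_self _ _ _ _ hvne, norm_mul, Real.norm_eq_abs, Real.norm_eq_abs, abs_of_pos hδp]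
      exact mul_le_of_le_one_right hδp.le (hPa i j0)
    have hv2 : ‖v2 (uMat m n (Bmap v j0 δ P) *ᵥ v)‖ ≤ R := by
      rw [v2_uMat]; exact (norm_v2_le _).trans hvR
    refine ⟨?_, hP, v, hvy, ?_, ?_, ?_⟩
    · refine norm_Mt_le _ (by linarith) fun i j => ?_
      by_cases hj : j = j0
      · simp only [Bmap, if_pos hj]
        rw [abs_div, div_le_iff₀ (by positivity)]
        have e1 : |v1 v i| ≤ R := ((norm_le_pi_norm (v1 v) i).trans (norm_v1_le _)).trans hvR
        have e2 : |∑ j ∈ Finset.univ.erase j0, P i j * v2 v j| ≤ n * R := by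
          calc _ ≤ ∑ j ∈ Finset.univ.erase j0, |P i j * v2 v j| := Finset.abs_sum_le_sum_abs _ _
            _ ≤ ∑ j : Fin n, |P i j * v2 v j| := Finset.sum_le_sum_of_subset_of_nonneg (Finset.erase_subset _ _) fun _ _ _ => abs_nonneg _
            _ ≤ ∑ j : Fin n, R := Finset.sum_le_sum fun j _ => by
                rw [abs_mul]
                calc _ ≤ 1 * R := mul_le_mul (hPa i j) (((norm_le_pi_norm (v2 v) j).trans (norm_v2_le _)).trans hvR) (abs_nonneg _) zero_le_one
                  _ = R := one_mul _
            _ = _ := by simp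
        have e3 : |δ * P i j0| ≤ 1 := by
          rw [abs_mul, abs_of_pos hδp]
          calc _ ≤ 1 * 1 := mul_le_mul hδ1 (hPa i j0) (abs_nonneg _) zero_le_one
            _ = 1 := one_mul _
        have e4 : R * (n + 1) + 1 ≤ RB * |v2 v j0| := by
          rw [hRB, mul_assoc]
          refine le_mul_of_one_le_right (by positivity) ?_
          rw [div_le_iff₀ (by positivity)] at hvj
          linarith
        refine le_trans ?_ e4
        have e5 := abs_add_le (-v1 v i - ∑ j ∈ Finset.univ.erase j0, P i j * v2 v j) (δ * P i j0)
        have e6 := abs_sub (-v1 v i) (∑ j ∈ Finset.univ.erase j0, P i j * v2 v j)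
        rw [abs_neg] at e6
        linarith
      · simp only [Bmap, if_neg hj]; exact (hPa i j).trans hRB1
    · intro h0
      apply hvne; rw [h0]; rfl
    · rw [norm_le_iff12 _ (by linarith)]
      exact ⟨by linarith, by linarith⟩
    · rw [norm_le_iff12 _ (by linarith), v1_aMat, v2_aMat, norm_smul, norm_smul, Real.norm_eq_abs, Real.norm_eq_abs, abs_of_pos (Real.exp_pos _),
        abs_of_pos (Real.exp_pos _)]
      constructor
      · calc _ ≤ Real.exp ((N1 : ℝ) / m) * δ := by gcongr
          _ = 1 := by rw [hδ, ← Real.exp_add, add_neg_cancel, Real.exp_zero]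
          _ ≤ RB := hRB1
      · calc _ ≤ 1 * R := by
              refine mul_le_mul ?_ hv2 (norm_nonneg _) zero_le_one
              rw [Real.exp_le_one_iff]
              have : 0 ≤ (N1 : ℝ) / n := by positivity
              linarith
          _ ≤ RB := by linarith

end PartEx4

section PartTr1

lemma norm_uMat_le {m n : ℕ} (D : Mt m n) (w : Fin (m + n) → ℝ) : ‖uMat m n D *ᵥ w‖ ≤ (1 + n * ‖D‖) * ‖w‖ := by
  rw [norm_le_iff12 _ (by positivity)]
  constructor
  · rw [pi_norm_le_iff_of_nonneg (by positivity)]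
    intro i
    rw [v1_uMat, add_mul, one_mul]
    refine (norm_add_le _ _).trans (add_le_add ((norm_le_pi_norm (v1 w) i).trans (norm_v1_le w)) ?_)
    calc ‖∑ j, D i j * v2 w j‖ ≤ ∑ j, ‖D i j * v2 w j‖ := norm_sum_le _ _
      _ ≤ ∑ j : Fin n, ‖D‖ * ‖w‖ := by
        refine Finset.sum_le_sum fun j _ => ?_
        rw [norm_mul]
        exact mul_le_mul (entry_le D i j) ((norm_le_pi_norm (v2 w) j).trans (norm_v2_le w)) (norm_nonneg _) (norm_nonneg _)
      _ = _ := by simp; ring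
  · rw [v2_uMat]
    refine (norm_v2_le w).trans (le_mul_of_one_le_left (norm_nonneg _) ?_)
    have : (0 : ℝ) ≤ n * ‖D‖ := by positivity
    linarith

lemma uSL_Cus {m n : ℕ} {ε R : ℝ} {A : Mt m n} (hA : ‖A‖ ≤ R) {x : XSp (m + n)} (hx : x ∈ (Cus ε : Set (XSp (m + n)))) :
    uSL m n A • x ∈ (Cus (ε / (1 + n * R)) : Set (XSp (m + n))) := by
  intro w hw hne
  obtain ⟨w', hw', rfl⟩ := mem_lat_smul.1 hw
  have hR : 0 ≤ R := (norm_nonneg _).trans hA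
  have hne' : w' ≠ 0 := by rintro rfl; exact hne (mulVec_zero _)
  have h1 := hx w' hw' hne'
  have h2 := norm_uMat_le (-A) (uMat m n A *ᵥ w')
  rw [mulVec_mulVec, uMat_mul, neg_add_cancel, uMat_zero, one_mulVec, norm_neg] at h2
  rw [div_le_iff₀ (by positivity)]
  refine h1.trans (h2.trans ?_)
  rw [mul_comm]
  show ‖uMat m n A *ᵥ w'‖ * (1 + n * ‖A‖) ≤ ‖uMat m n A *ᵥ w'‖ * (1 + n * R)
  gcongr

/-- excursion set -/
def Exc (m n : ℕ) (N1 : ℕ) (R : ℝ) : Set (XSp (m + n)) :=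
  {x | ∃ v ∈ lat x, v ≠ 0 ∧ ‖v‖ ≤ R ∧ ‖aMat m n N1 *ᵥ v‖ ≤ R}

lemma repair_exists {m n : ℕ} (hm : 0 < m) (hn : 0 < n) : ∃ ε0 : ℝ, 0 < ε0 ∧ ∀ ε > 0, ∃ N2 : ℕ,
    ∀ y ∈ (Cus ε : Set (XSp (m + n))), ∃ P : Mt m n, ‖P‖ ≤ 1 ∧ aSL m n hm hn N2 • uSL m n P • y ∈ (Cus ε0 : Set (XSp (m + n))) := by
  obtain ⟨C, hC, h⟩ := repairV hm hn
  obtain ⟨ε0, h0, h1, h2⟩ : ∃ t : ℝ, 0 < t ∧ t ≤ 1 ∧ C * t ^ (m + n) < 1 := by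
    have h1 : Tendsto (fun t : ℝ => C * t ^ (m + n)) (𝓝[>] 0) (𝓝 0) := by
      have : Tendsto (fun t : ℝ => C * t ^ (m + n)) (𝓝 0) (𝓝 (C * 0 ^ (m + n))) :=
        (by fun_prop : Continuous fun t : ℝ => C * t ^ (m + n)).tendsto 0
      rw [zero_pow (by omega), mul_zero] at this
      exact this.mono_left nhdsWithin_le_nhds
    have h2 := (h1.eventually_lt_const one_pos).and (Ioc_mem_nhdsGT (one_pos (α := ℝ)))
    obtain ⟨t, ht1, ht2⟩ := h2.exists
    exact ⟨t, ht2.1, ht2.2, ht1⟩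
  refine ⟨ε0, h0, fun ε hε => ?_⟩
  obtain ⟨N0, hN0⟩ := h ε hε ε0 h0 h1
  refine ⟨N0, fun y hy => ?_⟩
  have h3 := (hN0 y hy N0 le_rfl).trans_lt h2
  by_contra hcon
  push Not at hcon
  have h4 : (ρ0 m n) {P | aSL m n hm hn N0 • uSL m n P • y ∉ (Cus ε0 : Set (XSp (m + n)))}ᶜ = 0 := by
    refine measure_mono_null ?_ (ρ0_Bx m n)
    intro P hP hPB
    refine hP (hcon P (norm_Mt_le P zero_le_one fun i j => Bx_abs hPB i j))
  rw [measureReal_def, measure_of_measure_compl_eq_zero h4, measure_univ] at h3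
  simp at h3

set_option maxHeartbeats 1000000 in
theorem treeV {m n : ℕ} (hm : 0 < m) (hn : 0 < n) : ∃ RA R ε' : ℝ, 0 < RA ∧ 0 < R ∧ 0 < ε' ∧ ∃ N2 : ℕ, ∃ c : ℝ, 0 < c ∧ ∃ N10 : ℕ,
    ∃ z : XSp (m + n), ∀ N1 : ℕ, N10 ≤ N1 → 1 ≤ c * Real.exp (((m : ℝ) + n - 1) * N1) ∧ ∀ p : ℕ, ∃ F : Finset (Mt m n),
      (c * Real.exp (((m : ℝ) + n - 1) * N1)) ^ p ≤ F.card ∧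
      (∀ A ∈ F, ‖A‖ ≤ RA ∧ ∀ i < p, aSL m n hm hn ((i * (N1 + N2) : ℕ) : ℝ) • uSL m n A • z ∈ (Cus ε' : Set (XSp (m + n))) ∩ Exc m n N1 R) ∧
      ∀ A ∈ F, ∀ A' ∈ F, A ≠ A' → 1 / lamE m n ((p * (N1 + N2) : ℕ) : ℝ) ≤ ‖A' - A‖ := by
  classical
  obtain ⟨ε0, hε0, hrep⟩ := repair_exists hm hn
  obtain ⟨RB, hRB, ε, hε, hε1, hexc⟩ := excV hm hn hε0
  obtain ⟨N2, hN2⟩ := hrep ε hε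
  set RA := 2 * (RB + 1) with hRA
  have hRA0 : 0 < RA := by positivity
  obtain ⟨c, hc, hF⟩ := hexc (3 + 2 * RA) (by positivity)
  obtain ⟨z, hz⟩ : ∃ z : XSp (m + n), z ∈ (Cus ε0 : Set (XSp (m + n))) := by
    obtain ⟨ε1, hε1, hx⟩ := compact_sub_Cus (isCompact_singleton (x := (QuotientGroup.mk 1 : XSp (m + n))))
    obtain ⟨N, hN⟩ := hrep ε1 hε1
    obtain ⟨P, -, hP⟩ := hN _ (hx rfl)
    exact ⟨_, hP⟩
  have hm1 : (1 : ℝ) ≤ m := by exact_mod_cast hm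
  have hn1 : (1 : ℝ) ≤ n := by exact_mod_cast hn
  have hev : ∀ᶠ N1 : ℕ in atTop, 2 ≤ c * Real.exp (((m : ℝ) + n - 1) * N1) ∧ 2 ≤ lamE m n N1 := by
    refine Filter.Eventually.and ?_ ?_
    · refine Tendsto.eventually_ge_atTop ?_ 2
      refine Tendsto.const_mul_atTop hc (Real.tendsto_exp_atTop.comp ?_)
      exact tendsto_natCast_atTop_atTop.const_mul_atTop (by linarith)
    · refine Tendsto.eventually_ge_atTop ?_ 2
      refine Real.tendsto_exp_atTop.comp ?_
      have : (fun N1 : ℕ => (N1 : ℝ) / m + N1 / n) = fun N1 : ℕ => (1 / m + 1 / n : ℝ) * N1 := by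
        ext; ring
      rw [this]
      exact tendsto_natCast_atTop_atTop.const_mul_atTop (by positivity)
  obtain ⟨N10, hN10⟩ := eventually_atTop.1 hev
  refine ⟨RA, (1 + n * (1 + RA)) * RB, ε0 / (1 + n * RA), hRA0, by positivity, by positivity, N2, c / 2, by positivity, N10, z, fun N1 hN1 => ?_⟩
  obtain ⟨hM2, hl2⟩ := hN10 N1 hN1
  have hMM : 1 ≤ c / 2 * Real.exp (((m : ℝ) + n - 1) * N1) := by linarith
  refine ⟨hMM, fun p => ?_⟩
  set M := c / 2 * Real.exp (((m : ℝ) + n - 1) * N1) with hM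
  set N := N1 + N2 with hN
  set r1 := 1 / lamE m n N1 with hr1
  set r := 1 / lamE m n N with hr
  have hl1 := lamE_pos m n (N1 : ℝ)
  have hl1N := lamE_pos m n (N : ℝ)
  have hl2N := lamE_pos m n (N2 : ℝ)
  have hlN : lamE m n (N : ℝ) = lamE m n N1 * lamE m n N2 := by
    rw [← lamE_add, hN]; push_cast; rfl
  have hl21 : 1 ≤ lamE m n (N2 : ℝ) := one_le_lamE m n (by positivity)
  have hr10 : 0 < r1 := by positivity
  have hr0 : 0 < r := by positivity
  have hrr1 : r ≤ r1 := by
    rw [hr, hr1, hlN]; exact one_div_le_one_div_of_le hl1 (le_mul_of_one_le_right hl1.le hl21)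
  have hr1h : r1 ≤ 1 / 2 := by rw [hr1]; exact one_div_le_one_div_of_le (by norm_num) hl2
  clear_value RA
  suffices H : ∀ y ∈ (Cus ε0 : Set (XSp (m + n))), ∃ F : Finset (Mt m n), M ^ p ≤ F.card ∧
      (∀ A ∈ F, ‖A‖ ≤ RA ∧ ∀ i < p, aSL m n hm hn ((i * N : ℕ) : ℝ) • uSL m n A • y ∈ (Cus (ε0 / (1 + n * RA)) : Set (XSp (m + n))) ∩ Exc m n N1 ((1 + n * (1 + RA)) * RB)) ∧
      ∀ A ∈ F, ∀ A' ∈ F, A ≠ A' → 1 / lamE m n ((p * N : ℕ) : ℝ) ≤ ‖A' - A‖ from H z hz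
  induction p with
  | zero =>
    intro y hy
    refine ⟨{0}, by simp, ?_, ?_⟩
    · intro A hA
      rw [Finset.mem_singleton] at hA
      subst hA
      exact ⟨by simpa using hRA0.le, fun i hi => absurd hi (Nat.not_lt_zero _)⟩
    · intro A hA A' hA' hne
      rw [Finset.mem_singleton] at hA hA'
      exact absurd (hA.trans hA'.symm) hne
  | succ p ih =>
    intro y hy
    obtain ⟨F1, hF1c, hF1, hF1s⟩ := hF y hy N1
    have hP : ∀ B : Mt m n, ∃ P : Mt m n, ∃ F' : Finset (Mt m n), B ∈ F1 → ‖P‖ ≤ 1 ∧ M ^ p ≤ F'.card ∧ 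
        (∀ A' ∈ F', ‖A'‖ ≤ RA ∧ ∀ i < p, aSL m n hm hn ((i * N : ℕ) : ℝ) • uSL m n A' • (aSL m n hm hn N • uSL m n (B + r1 • P) • y) ∈ (Cus (ε0 / (1 + n * RA)) : Set (XSp (m + n))) ∩ Exc m n N1 ((1 + n * (1 + RA)) * RB)) ∧
        ∀ A ∈ F', ∀ A' ∈ F', A ≠ A' → 1 / lamE m n ((p * N : ℕ) : ℝ) ≤ ‖A' - A‖ := by
      intro B
      by_cases hB : B ∈ F1
      · obtain ⟨-, hBy, -⟩ := hF1 B hB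
        obtain ⟨P, hP1, hP2⟩ := hN2 _ hBy
        have he : aSL m n hm hn N2 • uSL m n P • aSL m n hm hn N1 • uSL m n B • y = aSL m n hm hn N • uSL m n (B + r1 • P) • y := by
          have h1 : uSL m n P * aSL m n hm hn N1 = aSL m n hm hn N1 * uSL m n (r1 • P) := by
            rw [aSL_uSL, smul_smul, hr1, mul_one_div_cancel hl1.ne', one_smul]
          have h2 : aSL m n hm hn (N : ℝ) = aSL m n hm hn N2 * aSL m n hm hn N1 := by
            rw [aSL_mul, hN]; congr 1; push_cast; ring
          rw [smul_smul (uSL m n P), h1, h2, add_comm B, ← uSL_mul]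
          simp only [mul_smul]
        rw [he] at hP2
        obtain ⟨F', h1, h2, h3⟩ := ih _ hP2
        exact ⟨P, F', fun _ => ⟨hP1, h1, h2, h3⟩⟩
      · exact ⟨0, ∅, fun h => absurd h hB⟩
    choose P F' hPF using hP
    have hsum : ∀ B B' : Mt m n, ∀ A A' : Mt m n, ‖(B' + r1 • P B' + r • A') - (B + r1 • P B + r • A)‖ ≥ ‖B' - B‖ - r1 * (‖P B'‖ + ‖P B‖) - r * (‖A'‖ + ‖A‖) := by
      intro B B' A A'
      have e : B' - B = ((B' + r1 • P B' + r • A') - (B + r1 • P B + r • A)) - (r1 • (P B' - P B) + r • (A' - A)) := by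
        simp only [smul_sub]; abel
      have h1 := norm_sub_le ((B' + r1 • P B' + r • A') - (B + r1 • P B + r • A)) (r1 • (P B' - P B) + r • (A' - A))
      rw [← e] at h1
      have h2 := norm_add_le (r1 • (P B' - P B)) (r • (A' - A))
      rw [norm_smul, norm_smul, Real.norm_of_nonneg hr10.le, Real.norm_of_nonneg hr0.le] at h2
      have h3 : r1 * ‖P B' - P B‖ ≤ r1 * (‖P B'‖ + ‖P B‖) := mul_le_mul_of_nonneg_left (norm_sub_le _ _) hr10.le
      have h4 : r * ‖A' - A‖ ≤ r * (‖A'‖ + ‖A‖) := mul_le_mul_of_nonneg_left (norm_sub_le _ _) hr0.le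
      linarith
    have hsepB : ∀ B ∈ F1, ∀ B' ∈ F1, B ≠ B' → ∀ A ∈ F' B, ∀ A' ∈ F' B', r1 ≤ ‖(B' + r1 • P B' + r • A') - (B + r1 • P B + r • A)‖ := by
      intro B hB B' hB' hne A hA A' hA'
      have h1 := hsum B B' A A'
      have h2 := hF1s B hB B' hB' hne
      have hp1 := (hPF B hB).1
      have hp2 := (hPF B' hB').1
      have ha1 := ((hPF B hB).2.2.1 A hA).1
      have ha2 := ((hPF B' hB').2.2.1 A' hA').1
      have h3 : r1 * (‖P B'‖ + ‖P B‖) ≤ r1 * 2 := mul_le_mul_of_nonneg_left (by linarith) hr10.le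
      have h4 : r * (‖A'‖ + ‖A‖) ≤ r1 * (2 * RA) := mul_le_mul hrr1 (by linarith) (by positivity) hr10.le
      have h5 : (3 + 2 * RA) / lamE m n N1 = (3 + 2 * RA) * r1 := by rw [hr1]; ring
      rw [h5] at h2
      linarith
    have hinj : ∀ B : Mt m n, Function.Injective fun A' : Mt m n => B + r1 • P B + r • A' := by
      intro B A A' h
      have h1 : r • A = r • A' := add_left_cancel h
      exact smul_right_injective _ hr0.ne' h1
    have hscale : r1 ≥ 1 / lamE m n (((p + 1) * N : ℕ) : ℝ) := by
      rw [hr1]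
      refine one_div_le_one_div_of_le hl1 (lamE_mono m n ?_)
      have : N1 ≤ (p + 1) * N := by rw [hN]; nlinarith
      exact_mod_cast this
    refine ⟨F1.biUnion fun B => (F' B).image fun A' => B + r1 • P B + r • A', ?_, ?_, ?_⟩
    · rw [Finset.card_biUnion]
      · push_cast
        have h1 : ∑ B ∈ F1, M ^ p ≤ ∑ B ∈ F1, (((F' B).image fun A' => B + r1 • P B + r • A').card : ℝ) := by
          refine Finset.sum_le_sum fun B hB => ?_
          rw [Finset.card_image_of_injective _ (hinj B)]
          exact (hPF B hB).2.1
        refine le_trans ?_ h1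
        rw [Finset.sum_const, nsmul_eq_mul, pow_succ, mul_comm]
        refine mul_le_mul_of_nonneg_right ?_ (by positivity)
        have : c * Real.exp (((m : ℝ) + n - 1) * N1) = 2 * M := by rw [hM]; ring
        linarith
      · intro B hB B' hB' hne
        rw [Function.onFun, Finset.disjoint_left]
        intro A hA hA'
        rw [Finset.mem_image] at hA hA'
        obtain ⟨a, ha, e⟩ := hA
        obtain ⟨a', ha', e'⟩ := hA'
        have := hsepB B hB B' hB' hne a ha a' ha'
        rw [e, e', sub_self, norm_zero] at this
        linarith
    · intro A hA
      rw [Finset.mem_biUnion] at hA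
      obtain ⟨B, hB, hA⟩ := hA
      rw [Finset.mem_image] at hA
      obtain ⟨A', hA', rfl⟩ := hA
      obtain ⟨hp1, -, h2, -⟩ := hPF B hB
      obtain ⟨h21, h22⟩ := h2 A' hA'
      obtain ⟨hB1, -, v, hv, hv0, hvR, hvR'⟩ := hF1 B hB
      have hnA : ‖B + r1 • P B + r • A'‖ ≤ RA := by
        have h1 := norm_add_le (B + r1 • P B) (r • A')
        have h3 := norm_add_le B (r1 • P B)
        rw [norm_smul, Real.norm_of_nonneg hr0.le] at h1
        rw [norm_smul, Real.norm_of_nonneg hr10.le] at h3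
        have h4 : r * ‖A'‖ ≤ 1 / 2 * RA := mul_le_mul (hrr1.trans hr1h) h21 (norm_nonneg _) (by norm_num)
        have h5 : r1 * ‖P B‖ ≤ 1 / 2 * 1 := mul_le_mul hr1h hp1 (norm_nonneg _) (by norm_num)
        linarith
      refine ⟨hnA, fun i hi => ?_⟩
      rcases Nat.eq_zero_or_pos i with rfl | hi0
      · rw [Nat.zero_mul, Nat.cast_zero, aSL_zero, one_smul]
        refine ⟨uSL_Cus hnA hy, ?_⟩
        set D := P B + (1 / lamE m n N2) • A' with hD
        have hDn : ‖D‖ ≤ 1 + RA := by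
          have h1 := norm_add_le (P B) ((1 / lamE m n N2) • A')
          rw [norm_smul, Real.norm_of_nonneg (by positivity)] at h1
          have h4 : 1 / lamE m n N2 * ‖A'‖ ≤ 1 * RA := mul_le_mul (by rw [div_le_one hl2N]; exact hl21) h21 (norm_nonneg _) (by norm_num)
          linarith
        have hAD : B + r1 • P B + r • A' = r1 • D + B := by
          rw [hD, smul_add, smul_smul, hr, hr1, hlN]
          have : 1 / lamE m n N1 * (1 / lamE m n N2) = 1 / (lamE m n N1 * lamE m n N2) := by rw [div_mul_div_comm, one_mul]
          rw [this]; abel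
        rw [hAD]
        have e1 : uMat m n (r1 • D + B) *ᵥ v = uMat m n (r1 • D) *ᵥ (uMat m n B *ᵥ v) := by rw [mulVec_mulVec, uMat_mul]
        refine ⟨uMat m n (r1 • D + B) *ᵥ v, smul_mem_lat (uSL m n (r1 • D + B)) hv, GSp_mulVec_ne (uSL m n (r1 • D + B)) hv0, ?_, ?_⟩
        · rw [e1]
          refine (norm_uMat_le _ _).trans (mul_le_mul ?_ hvR (norm_nonneg _) (by positivity))
          have : ‖r1 • D‖ ≤ 1 + RA := by
            rw [norm_smul, Real.norm_of_nonneg hr10.le]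
            calc r1 * ‖D‖ ≤ 1 * (1 + RA) := mul_le_mul (by linarith) hDn (norm_nonneg _) (by norm_num)
              _ = _ := one_mul _
          have := mul_le_mul_of_nonneg_left this (show (0 : ℝ) ≤ n by positivity)
          linarith
        · have e2 : aMat m n N1 *ᵥ (uMat m n (r1 • D + B) *ᵥ v) = uMat m n D *ᵥ (aMat m n N1 *ᵥ (uMat m n B *ᵥ v)) := by
            rw [e1, mulVec_mulVec (M := aMat m n N1) (N := uMat m n (r1 • D)), aMat_uMat, smul_smul, hr1, mul_one_div_cancel hl1.ne', one_smul, ← mulVec_mulVec]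
          rw [e2]
          refine (norm_uMat_le _ _).trans (mul_le_mul ?_ hvR' (norm_nonneg _) (by positivity))
          have := mul_le_mul_of_nonneg_left hDn (show (0 : ℝ) ≤ n by positivity)
          linarith
      · have h3 := h22 (i - 1) (by omega)
        have e : aSL m n hm hn ((i * N : ℕ) : ℝ) • uSL m n (B + r1 • P B + r • A') • y =
          aSL m n hm hn (((i - 1) * N : ℕ) : ℝ) • uSL m n A' • (aSL m n hm hn N • uSL m n (B + r1 • P B) • y) := by
          have h1 : uSL m n A' * aSL m n hm hn N = aSL m n hm hn N * uSL m n (r • A') := by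
            rw [aSL_uSL, smul_smul, hr, mul_one_div_cancel hl1N.ne', one_smul]
          have h2 : aSL m n hm hn ((i * N : ℕ) : ℝ) = aSL m n hm hn (((i - 1) * N : ℕ) : ℝ) * aSL m n hm hn N := by
            rw [aSL_mul]; congr 1
            rw [← Nat.cast_add]; congr 1
            obtain ⟨k, rfl⟩ : ∃ k, i = k + 1 := ⟨i - 1, by omega⟩
            simp; ring
          rw [smul_smul (uSL m n A'), h1, h2, add_comm _ (r • A'), ← uSL_mul]
          simp only [mul_smul]
        rw [e]
        exact h3
    · intro A hA A' hA' hne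
      rw [Finset.mem_biUnion] at hA hA'
      obtain ⟨B, hB, hA⟩ := hA
      obtain ⟨B', hB', hA'⟩ := hA'
      rw [Finset.mem_image] at hA hA'
      obtain ⟨a, ha, rfl⟩ := hA
      obtain ⟨a', ha', rfl⟩ := hA'
      by_cases hBB : B = B'
      · subst hBB
        have hne' : a ≠ a' := by rintro rfl; exact hne rfl
        have h1 := (hPF B hB).2.2.2 a ha a' ha' hne'
        rw [add_sub_add_left_eq_sub, ← smul_sub, norm_smul, Real.norm_of_nonneg hr0.le]
        refine le_trans (le_of_eq ?_) (mul_le_mul_of_nonneg_left h1 hr0.le)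
        rw [hr, div_mul_div_comm, one_mul, ← lamE_add]
        congr 2
        push_cast; ring
      · exact hscale.trans (hsepB B hB B' hB' hBB a ha a' ha')

end PartTr1

section PartTr2

lemma unif_compl {α : Type*} [MeasurableSpace α] [MeasurableSingletonClass α] (F : Finset α) :
    ProbabilityTheory.uniformOn (F : Set α) (F : Set α)ᶜ = 0 := by
  rw [ProbabilityTheory.uniformOn, ProbabilityTheory.cond_apply F.measurableSet, Set.inter_compl_self, measure_empty, mul_zero]

lemma unif_single {α : Type*} [MeasurableSpace α] [MeasurableSingletonClass α] (F : Finset α) (S : Set α)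
    (hS : ∀ a ∈ F, ∀ b ∈ F, a ∈ S → b ∈ S → a = b) :
    (ProbabilityTheory.uniformOn (F : Set α)).real S ≤ (F.card : ℝ)⁻¹ := by
  rw [ProbabilityTheory.uniformOn, measureReal_def, ProbabilityTheory.cond_apply F.measurableSet, ENNReal.toReal_mul, Measure.count_apply_finset,
    ENNReal.toReal_inv, ENNReal.toReal_natCast]
  refine mul_le_of_le_one_right (by positivity) ?_
  have hsub : ((F : Set α) ∩ S).Subsingleton := fun a ha b hb => hS a ha.1 b hb.1 ha.2 hb.2
  rcases hsub.eq_empty_or_singleton with h | ⟨a, h⟩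
  · rw [h]; simp
  · rw [h]; simp

lemma sum_mod (g : ℕ → ℝ) (N k : ℕ) : ∑ j ∈ Finset.range (k * N), g (j % N) = k * ∑ t ∈ Finset.range N, g t := by
  induction k with
  | zero => simp
  | succ k ih =>
    rw [Nat.succ_mul, Finset.sum_range_add, ih]
    have : ∑ x ∈ Finset.range N, g ((k * N + x) % N) = ∑ t ∈ Finset.range N, g t := by
      refine Finset.sum_congr rfl fun t ht => ?_
      rw [mul_comm k N, Nat.mul_add_mod, Nat.mod_eq_of_lt (Finset.mem_range.1 ht)]
    rw [this]; push_cast; ring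

/-- excursions leave thick parts -/
lemma exc_out {m n : ℕ} (hm : 0 < m) (hn : 0 < n) {N1 : ℕ} {R δ : ℝ} {j1 : ℕ} (hj : R * Real.exp (-((j1 : ℝ) / (m + n))) < δ)
    {x : XSp (m + n)} (hx : x ∈ Exc m n N1 R) {j : ℕ} (h1 : j1 ≤ j) (h2 : j + j1 ≤ N1) :
    (aAct m n hm hn)^[j] x ∉ (Cus δ : Set (XSp (m + n))) := by
  obtain ⟨v, hv, hv0, hvR, hvR'⟩ := hx
  rw [aAct_iter]
  intro hc
  have hm0 : (0 : ℝ) < m := by exact_mod_cast hm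
  have hn0 : (0 : ℝ) < n := by exact_mod_cast hn
  have h3 : δ ≤ ‖aMat m n j *ᵥ v‖ := hc _ (smul_mem_lat (aSL m n hm hn j) hv) (GSp_mulVec_ne (aSL m n hm hn j) hv0)
  have hR : 0 ≤ R := (norm_nonneg _).trans hvR
  have h4 : ‖aMat m n j *ᵥ v‖ ≤ R * Real.exp (-((j1 : ℝ) / (m + n))) := by
    have hj1 : (j1 : ℝ) ≤ j := by exact_mod_cast h1
    have hj2 : (j : ℝ) + j1 ≤ N1 := by exact_mod_cast h2
    rw [norm_le_iff12 _ (by positivity)]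
    constructor
    · rw [v1_aMat, norm_smul, Real.norm_of_nonneg (Real.exp_pos _).le]
      have h5 := (norm_v1_le _).trans hvR'
      rw [v1_aMat, norm_smul, Real.norm_of_nonneg (Real.exp_pos _).le] at h5
      have h6 : Real.exp ((j : ℝ) / m) = Real.exp ((N1 : ℝ) / m) * Real.exp (-((N1 - j) / m)) := by
        rw [← Real.exp_add]; congr 1; ring
      rw [h6, mul_assoc, mul_comm (Real.exp (-((N1 - j : ℝ) / m))), ← mul_assoc]
      refine mul_le_mul h5 (Real.exp_le_exp.2 (neg_le_neg ?_)) (Real.exp_pos _).le hR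
      refine div_le_div₀ (by linarith) (by linarith) hm0 (by linarith)
    · rw [v2_aMat, norm_smul, Real.norm_of_nonneg (Real.exp_pos _).le, mul_comm]
      refine mul_le_mul ((norm_v2_le _).trans hvR) (Real.exp_le_exp.2 (neg_le_neg ?_)) (Real.exp_pos _).le hR
      refine div_le_div₀ (by linarith) (by linarith) hn0 (by linarith)
  linarith

set_option maxHeartbeats 1000000 in
theorem measB_aux {m n : ℕ} (hm : 0 < m) (hn : 0 < n) {RA R ε' M : ℝ} (hRA : 0 < RA) (hε' : 0 < ε') (hM : 1 ≤ M) (z : XSp (m + n))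
    (N1 N2 : ℕ) (hN0 : 0 < N1 + N2)
    (hF : ∀ p : ℕ, ∃ F : Finset (Mt m n), M ^ p ≤ F.card ∧
      (∀ A ∈ F, ‖A‖ ≤ RA ∧ ∀ i < p, aSL m n hm hn ((i * (N1 + N2) : ℕ) : ℝ) • uSL m n A • z ∈ (Cus ε' : Set (XSp (m + n))) ∩ Exc m n N1 R) ∧
      ∀ A ∈ F, ∀ A' ∈ F, A ≠ A' → 1 / lamE m n ((p * (N1 + N2) : ℕ) : ℝ) ≤ ‖A' - A‖) :
    ∃ μ : Measure (XSp (m + n)), IsProbabilityMeasure μ ∧ MeasurePreserving (aAct m n hm hn) μ μ ∧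
      Real.log M / (N1 + N2 : ℕ) ≤ ksEntropy (aAct m n hm hn) μ ∧
      (∀ f : XSp (m + n) → ℝ, Continuous f → ∀ Mf : ℝ, (∀ x, |f x| ≤ Mf) → ∀ δ : ℝ, (∀ x, x ∉ (Cus δ : Set (XSp (m + n))) → f x = 0) →
        ∀ j1 : ℕ, R * Real.exp (-((j1 : ℝ) / (m + n))) < δ → |∫ x, f x ∂μ| ≤ Mf * ((N2 + 2 * j1 : ℕ) / (N1 + N2 : ℕ))) ∧
      (∀ p : ℕ, 1 ≤ p → μ (⋃ j ∈ Finset.range (N1 + N2), (aAct m n hm hn)^[j] '' 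
        {x | ∀ i < p, (aAct m n hm hn)^[i * (N1 + N2)] x ∈ closure ((Cus ε' : Set (XSp (m + n))) ∩ Exc m n N1 R)})ᶜ = 0) := by
  classical
  set T := aAct m n hm hn with hTdef
  have hTc : Continuous T := aAct_continuous m n hm hn
  set N := N1 + N2 with hN
  set W0 := (Cus ε' : Set (XSp (m + n))) ∩ Exc m n N1 R with hW0
  choose F hFc hF1 hFs using hF
  have hFne : ∀ p, (F p).Nonempty := by
    intro p
    rw [← Finset.card_pos]
    have : (0 : ℝ) < (F p).card := lt_of_lt_of_le (by positivity) (hFc p)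
    exact_mod_cast this
  have hφ : Continuous fun A : Mt m n => uSL m n A • z := by
    have hx : ∀ x : XSp (m + n), Continuous fun A : Mt m n => uSL m n A • x := fun x => (uSL_continuous m n).smul continuous_const
    exact hx z
  have hφm := hφ.measurable
  let ρ : ℕ → Measure (Mt m n) := fun i => ProbabilityTheory.uniformOn (F (i + 1) : Set (Mt m n))
  have hρp : ∀ i, IsProbabilityMeasure (ρ i) := fun i => ProbabilityTheory.isProbabilityMeasure_uniformOn (F (i + 1)).finite_toSet (hFne (i + 1))
  have hρF : ∀ i, ∀ᵐ A ∂(ρ i), A ∈ F (i + 1) := by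
    intro i
    exact unif_compl (F (i + 1))
  have hp : ∀ i, IsProbabilityMeasure ((ρ i).map fun A => uSL m n A • z) := fun i => Measure.isProbabilityMeasure_map hφm.aemeasurable
  have hη : ∀ i, ∀ᵐ x ∂((ρ i).map fun A => uSL m n A • z), ∀ q < i + 1, T^[q * N] x ∈ closure W0 := by
    intro i
    rw [ae_all_iff]
    intro q
    rw [ae_map_iff hφm.aemeasurable]
    · filter_upwards [hρF i] with A hA hq
      rw [aAct_iter]
      exact subset_closure ((hF1 (i + 1) A hA).2 q hq)
    · by_cases hq : q < i + 1
      · simp only [hq, true_imp_iff]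
        exact (hTc.iterate (q * N)).measurable isClosed_closure.measurableSet
      · simp only [hq, false_imp_iff]
        exact MeasurableSet.univ
  have hη' : ∀ i, ∀ j < (i + 1) * N, ∀ᵐ x ∂((ρ i).map fun A => uSL m n A • z), ∃ y, y ∈ closure W0 ∧ T^[j % N] y = T^[j] x ∧
      ∀ q, q + j / N < i + 1 → T^[q * N] y ∈ closure W0 := by
    intro i j hj
    filter_upwards [hη i] with x hx
    have hjN : j / N < i + 1 := Nat.div_lt_of_lt_mul (by rwa [mul_comm])
    refine ⟨T^[j / N * N] x, hx _ hjN, ?_, fun q hq => ?_⟩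
    · rw [← Function.iterate_add_apply, Nat.mod_add_div']
    · rw [← Function.iterate_add_apply, ← add_mul]; exact hx _ hq
  have hWC : closure W0 ⊆ Cus ε' := closure_minimal Set.inter_subset_left (Cus_closed ε')
  have hKc : IsCompact (⋃ j ∈ Finset.range N, T^[j] '' (Cus ε' : Set (XSp (m + n)))) :=
    (Finset.range N).isCompact_biUnion fun j _ => (Cus_compact hε').image (hTc.iterate j)
  have hNi : ∀ i : ℕ, 0 < (i + 1) * N := fun i => Nat.mul_pos (Nat.succ_pos i) hN0
  have hNt : Tendsto (fun i : ℕ => (i + 1) * N) atTop atTop := by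
    refine tendsto_atTop_mono (fun i => ?_) (tendsto_add_atTop_nat 1)
    exact Nat.le_mul_of_pos_right _ hN0
  obtain ⟨l, hl, hla, κ, μ, hκ, hlim, hinv⟩ := lim_exists hm hn (fun i : ℕ => (ρ i).map fun A => uSL m n A • z) (fun i => (i + 1) * N)
    hNi hNt (by
      intro e he
      refine ⟨_, hKc, fun i => ?_⟩
      refine avgM_le _ hTc.measurable _ _ (hNi i) hKc.measurableSet.compl fun j hj => ?_
      refine le_of_eq_of_le ?_ (zero_le)
      have : ∀ᵐ x ∂((ρ i).map fun A => uSL m n A • z), x ∉ T^[j] ⁻¹' (⋃ j ∈ Finset.range N, T^[j] '' (Cus ε' : Set (XSp (m + n))))ᶜ := by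
        filter_upwards [hη' i j hj] with x hx hx2
        obtain ⟨y, hy, hyx, -⟩ := hx
        refine hx2 (Set.mem_biUnion (Finset.mem_coe.2 (Finset.mem_range.2 (Nat.mod_lt j hN0))) ⟨y, hWC hy, hyx⟩)
      exact measure_eq_zero_iff_ae_notMem.2 this)
  have hp' : IsProbabilityMeasure (μ : Measure (XSp (m + n))) := inferInstance
  refine ⟨μ, hp', hinv, ?_, ?_, ?_⟩
  · refine lowerL hm hn l (fun i => (i + 1) * N) hNi (hNt.mono_left hla) z ρ
      (R0 := RA) hRA.le ?_ (C := 1) one_pos ?_ κ hκ μ hlim hinv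
    · intro i
      refine measure_mono_null ?_ (unif_compl (F (i + 1)))
      intro A hA hAF
      exact hA (hF1 _ A hAF).1
    · intro i S hS
      refine (unif_single (F (i + 1)) S ?_).trans ?_
      · intro A hA A' hA' h1 h2
        by_contra hne
        have h3 := hFs (i + 1) A hA A' hA' hne
        have h4 := hS A h1 A' h2
        rw [div_le_iff₀ (lamE_pos _ _ _), mul_comm] at h3
        linarith
      · rw [one_mul, Real.exp_neg]
        refine inv_anti₀ (Real.exp_pos _) (le_trans (le_of_eq ?_) (hFc (i + 1)))
        rw [← Real.exp_log (show 0 < M by linarith), ← Real.exp_nat_mul]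
        congr 1
        rw [Real.log_exp]
        have : (N : ℝ) ≠ 0 := by positivity
        push_cast
        field_simp
  · intro f hf Mf hMf δ hfδ j1 hj1
    have hMf0 : 0 ≤ Mf := (abs_nonneg _).trans (hMf z)
    let fb : BoundedContinuousFunction (XSp (m + n)) ℝ := BoundedContinuousFunction.ofNormedAddCommGroup f hf Mf hMf
    have h1 := (ProbabilityMeasure.tendsto_iff_forall_integral_tendsto.1 hlim fb).abs
    refine le_of_tendsto h1 (Eventually.of_forall fun i => ?_)
    rw [hκ i, avgM_integral hTc, abs_mul, abs_inv, Nat.abs_cast]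
    let g : ℕ → ℝ := fun t => if j1 ≤ t ∧ t + j1 ≤ N1 then 0 else Mf
    have h2 : ∀ j ∈ Finset.range ((i + 1) * N), |∫ x, fb (T^[j] x) ∂((ρ i).map fun A => uSL m n A • z)| ≤ g (j % N) := by
      intro j hj
      rw [Finset.mem_range] at hj
      by_cases hjj : j1 ≤ j % N ∧ j % N + j1 ≤ N1
      · simp only [g, if_pos hjj]
        rw [integral_map (f := fun x => fb (T^[j] x)) hφm.aemeasurable (fb.continuous.comp (hTc.iterate j)).measurable.aestronglyMeasurable]
        rw [integral_eq_zero_of_ae]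
        · simp
        · filter_upwards [hρF i] with A hA
          have hjN : j / N < i + 1 := Nat.div_lt_of_lt_mul (by rwa [mul_comm])
          have h3 := ((hF1 (i + 1) A hA).2 (j / N) hjN).2
          have h4 := exc_out hm hn hj1 h3 hjj.1 hjj.2
          rw [← aAct_iter, ← Function.iterate_add_apply, Nat.mod_add_div'] at h4
          exact hfδ _ h4
      · simp only [g, if_neg hjj]
        have := norm_integral_le_of_norm_le_const (μ := (ρ i).map fun A => uSL m n A • z) (f := fun x => fb (T^[j] x)) (C := Mf) (ae_of_all _ fun x => hMf _)
        simpa using this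
    have h3 := (Finset.abs_sum_le_sum_abs (fun j => ∫ x, fb (T^[j] x) ∂((ρ i).map fun A => uSL m n A • z)) (Finset.range ((i + 1) * N))).trans (Finset.sum_le_sum h2)
    rw [sum_mod g N (i + 1)] at h3
    have h4 : ∑ t ∈ Finset.range N, g t ≤ (N2 + 2 * j1 : ℕ) * Mf := by
      have h5 : ∑ t ∈ Finset.range N, g t = ((Finset.range N).filter fun t => ¬ (j1 ≤ t ∧ t + j1 ≤ N1)).card * Mf := by
        rw [Finset.card_eq_sum_ones, Nat.cast_sum, Finset.sum_mul, Finset.sum_filter]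
        refine Finset.sum_congr rfl fun t _ => ?_
        simp only [g]
        split_ifs <;> simp
      rw [h5]
      refine mul_le_mul_of_nonneg_right ?_ hMf0
      have h6 : ((Finset.range N).filter fun t => ¬ (j1 ≤ t ∧ t + j1 ≤ N1)) ⊆ Finset.range j1 ∪ Finset.Ico (N1 + 1 - j1) N := by
        intro t ht
        simp only [Finset.mem_filter, Finset.mem_range, Finset.mem_union, Finset.mem_Ico] at ht ⊢
        omega
      have h7 := (Finset.card_le_card h6).trans (Finset.card_union_le _ _)
      rw [Finset.card_range, Nat.card_Ico] at h7
      have : ((Finset.range N).filter fun t => ¬ (j1 ≤ t ∧ t + j1 ≤ N1)).card ≤ N2 + 2 * j1 := by omega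
      exact_mod_cast this
    have hNp : (0 : ℝ) < N := by exact_mod_cast hN0
    refine (mul_le_mul_of_nonneg_left h3 (by positivity)).trans ?_
    refine (mul_le_mul_of_nonneg_left (mul_le_mul_of_nonneg_left h4 (by positivity)) (by positivity)).trans (le_of_eq ?_)
    push_cast
    field_simp
  · intro p hp1
    set E := {x | ∀ i < p, T^[i * N] x ∈ closure W0} with hE
    have hEcl : IsClosed E := by
      have : E = ⋂ i ∈ Finset.range p, T^[i * N] ⁻¹' closure W0 := by
        ext x; simp [hE]
      rw [this]
      exact isClosed_biInter fun i _ => isClosed_closure.preimage (hTc.iterate _)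
    have hEc : IsCompact E := by
      refine (Cus_compact hε').of_isClosed_subset hEcl fun x hx => hWC ?_
      have := hx 0 hp1
      simpa using this
    have hYc : IsCompact (⋃ j ∈ Finset.range N, T^[j] '' E) :=
      (Finset.range N).isCompact_biUnion fun j _ => hEc.image (hTc.iterate j)
    have h1 := ProbabilityMeasure.le_liminf_measure_open_of_tendsto hlim hYc.isClosed.isOpen_compl
    refine le_antisymm (h1.trans ?_) (zero_le)
    have hb : ∀ i, (κ i : Measure (XSp (m + n))) (⋃ j ∈ Finset.range N, T^[j] '' E)ᶜ ≤ ENNReal.ofReal (p / (i + 1 : ℕ)) := by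
      intro i
      rw [hκ i, ← ofReal_measureReal (by have := avgM_prob T hTc.measurable ((ρ i).map fun A => uSL m n A • z) ((i + 1) * N) (hNi i); exact measure_ne_top _ _)]
      refine ENNReal.ofReal_le_ofReal ?_
      rw [avgM_real T hTc.measurable _ _ hYc.measurableSet.compl, ← Finset.mul_sum]
      have h2 : ∀ j ∈ Finset.range ((i + 1) * N), (((ρ i).map fun A => uSL m n A • z).map T^[j]).real (⋃ j ∈ Finset.range N, T^[j] '' E)ᶜ ≤ if j + p * N < (i + 1) * N then 0 else 1 := by
        intro j hj
        rw [Finset.mem_range] at hj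
        rw [measureReal_def, Measure.map_apply (hTc.iterate j).measurable hYc.measurableSet.compl]
        split_ifs with hjp
        · rw [ENNReal.toReal_eq_zero_iff _ |>.2 (Or.inl ?_)]
          have : ∀ᵐ x ∂((ρ i).map fun A => uSL m n A • z), x ∉ T^[j] ⁻¹' (⋃ j ∈ Finset.range N, T^[j] '' E)ᶜ := by
            filter_upwards [hη' i j hj] with x hx hx2
            obtain ⟨y, hy, hyx, hyy⟩ := hx
            refine hx2 (Set.mem_biUnion (Finset.mem_coe.2 (Finset.mem_range.2 (Nat.mod_lt j hN0))) ⟨y, fun q hq => hyy q ?_, hyx⟩)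
            have h5 : j / N + p < i + 1 := by
              rw [← Nat.add_mul_div_right _ _ hN0]
              refine Nat.div_lt_of_lt_mul ?_
              rw [mul_comm N (i + 1)]
              exact hjp
            omega
          exact measure_eq_zero_iff_ae_notMem.2 this
        · exact measureReal_le_one
      refine (mul_le_mul_of_nonneg_left (Finset.sum_le_sum h2) (by positivity)).trans ?_
      have h3 : ∑ j ∈ Finset.range ((i + 1) * N), (if j + p * N < (i + 1) * N then (0 : ℝ) else 1) ≤ p * N := by
        rw [Finset.sum_ite, Finset.sum_const_zero, zero_add, Finset.sum_const, nsmul_eq_mul, mul_one]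
        have h6 : ((Finset.range ((i + 1) * N)).filter fun j => ¬ (j + p * N < (i + 1) * N)) ⊆ Finset.Ico ((i + 1) * N - p * N) ((i + 1) * N) := by
          intro t ht
          simp only [Finset.mem_filter, Finset.mem_range, Finset.mem_Ico] at ht ⊢
          omega
        have h7 := Finset.card_le_card h6
        rw [Nat.card_Ico] at h7
        have : ((Finset.range ((i + 1) * N)).filter fun j => ¬ (j + p * N < (i + 1) * N)).card ≤ p * N := by omega
        exact_mod_cast this
      refine (mul_le_mul_of_nonneg_left h3 (by positivity)).trans (le_of_eq ?_)
      have hNp : (0 : ℝ) < N := by exact_mod_cast hN0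
      push_cast
      field_simp
    have h2 : Tendsto (fun i : ℕ => ENNReal.ofReal ((p : ℝ) / (i + 1 : ℕ))) l (𝓝 0) := by
      rw [← ENNReal.ofReal_zero]
      refine (ENNReal.continuous_ofReal.tendsto 0).comp (Tendsto.mono_left ?_ hla)
      exact tendsto_const_nhds.div_atTop (tendsto_natCast_atTop_atTop.comp (tendsto_add_atTop_nat 1))
    rw [← h2.liminf_eq]
    exact liminf_le_liminf (Eventually.of_forall hb)

end PartTr2

section PartUp1

lemma strip_one {m n : ℕ} (hn : 0 < n) {ε β η : ℝ} (hε : 0 < ε) (hβ : 0 ≤ β) (hη : 0 < η) (v : Fin (m + n) → ℝ) (hv : ε ≤ ‖v2 v‖) :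
    Lab (fun B B' : Mt m n => ‖B' - B‖ ≤ n * η) {B | ‖B‖ ≤ 1 ∧ ‖v1 (uMat m n B *ᵥ v)‖ ≤ β}
      (((2 * (β / ε) / η + 1) * (2 * 1 / η + 1) ^ (n - 1)) ^ m) := by
  classical
  have hne : Nonempty (Fin n) := ⟨⟨0, hn⟩⟩
  obtain ⟨j0, hj0⟩ := Finite.exists_max (fun j : Fin n => |v2 v j|)
  have hj0' : ‖v2 v‖ ≤ |v2 v j0| := by
    rw [pi_norm_le_iff_of_nonneg (abs_nonneg _)]; exact hj0
  have hvp : 0 < |v2 v j0| := by linarith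
  have hv0 : v2 v j0 ≠ 0 := abs_pos.1 hvp
  let P : Mt m n → Mt m n := fun B i j => if j = j0 then v1 (uMat m n B *ᵥ v) i / v2 v j0 else B i j
  have hg := grid (P '' {B | ‖B‖ ≤ 1 ∧ ‖v1 (uMat m n B *ᵥ v)‖ ≤ β}) 0 (fun _ j => if j = j0 then β / ε else 1) (by
    rintro _ ⟨B, ⟨hB, hB2⟩, rfl⟩ i j
    simp only [P, Pi.zero_apply, sub_zero]
    split_ifs with h
    · rw [abs_div]
      exact div_le_div₀ hβ ((norm_le_pi_norm _ i).trans hB2) hε (by linarith)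
    · exact (entry_le B i j).trans hB) hη (by
    intro i j
    split_ifs <;> positivity)
  have hprod : (∏ i : Fin m, ∏ j : Fin n, (2 * (if j = j0 then β / ε else 1) / η + 1)) = ((2 * (β / ε) / η + 1) * (2 * 1 / η + 1) ^ (n - 1)) ^ m := by
    rw [Finset.prod_const, Finset.card_univ, Fintype.card_fin]
    congr 1
    rw [← Finset.mul_prod_erase _ _ (Finset.mem_univ j0), if_pos rfl]
    congr 1
    rw [Finset.prod_congr rfl (g := fun _ => 2 * 1 / η + 1), Finset.prod_const, Finset.card_erase_of_mem (Finset.mem_univ _), Finset.card_univ, Fintype.card_fin]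
    intro j hj
    rw [if_neg (Finset.ne_of_mem_erase hj)]
  rw [hprod] at hg
  refine hg.image P (fun B hB => ⟨B, hB, rfl⟩) ?_
  intro B hB B' hB' hlt
  refine norm_Mt_le _ (by positivity) fun i j => ?_
  have hent : ∀ i j, |P B' i j - P B i j| ≤ η := fun i j => (entry_le (P B' - P B) i j).trans hlt.le
  have hoff : ∀ j, j ≠ j0 → |B' i j - B i j| ≤ η := by
    intro j hj
    have := hent i j
    simp only [P, if_neg hj] at this
    exact this
  have hn1 : (1 : ℝ) ≤ n := by exact_mod_cast hn
  by_cases hj : j = j0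
  · subst hj
    have h1 := hent i j
    simp only [P, if_true] at h1
    rw [← sub_div, v1_uMat, v1_uMat, add_sub_add_left_eq_sub, ← Finset.sum_sub_distrib, abs_div, div_le_iff₀ hvp,
      ← Finset.add_sum_erase _ _ (Finset.mem_univ j)] at h1
    have h2 : |∑ x ∈ Finset.univ.erase j, (B' i x * v2 v x - B i x * v2 v x)| ≤ ((n : ℝ) - 1) * (η * |v2 v j|) := by
      refine (Finset.abs_sum_le_sum_abs _ _).trans ?_
      refine (Finset.sum_le_sum (g := fun _ => η * |v2 v j|) fun x hx => ?_).trans (le_of_eq ?_)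
      · rw [← sub_mul, abs_mul]
        exact mul_le_mul (hoff x (Finset.ne_of_mem_erase hx)) (hj0 x) (abs_nonneg _) hη.le
      · rw [Finset.sum_const, Finset.card_erase_of_mem (Finset.mem_univ _), Finset.card_univ, Fintype.card_fin, nsmul_eq_mul,
          Nat.cast_sub hn, Nat.cast_one]
    have h3 : |B' i j * v2 v j - B i j * v2 v j| ≤ η * |v2 v j| + ((n : ℝ) - 1) * (η * |v2 v j|) := by
      have := abs_sub (B' i j * v2 v j - B i j * v2 v j + ∑ x ∈ Finset.univ.erase j, (B' i x * v2 v x - B i x * v2 v x)) (∑ x ∈ Finset.univ.erase j, (B' i x * v2 v x - B i x * v2 v x))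
      rw [add_sub_cancel_right] at this
      linarith
    rw [← sub_mul, abs_mul] at h3
    show |B' i j - B i j| ≤ n * η
    refine le_of_mul_le_mul_right ?_ hvp
    linarith
  · refine (hoff j hj).trans ?_
    nlinarith

lemma strip_count {m n : ℕ} (hm : 0 < m) (hn : 0 < n) {ε R : ℝ} (hε : 0 < ε) (hR : 0 < R) (N1 N2 : ℕ) :
    ((2 * (R * Real.exp (-((N1 : ℝ) / m)) / ε) / (1 / ((n + 1) * lamE m n (N1 + N2 : ℕ))) + 1) * (2 * 1 / (1 / ((n + 1) * lamE m n (N1 + N2 : ℕ))) + 1) ^ (n - 1)) ^ m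
      ≤ ((2 * R / ε * (n + 1) + 1) * (3 * (n + 1)) ^ (n - 1)) ^ m * Real.exp (((m : ℝ) + n - 1) * N1 + (m + n) * N2) := by
  have hm0 : (m : ℝ) ≠ 0 := by positivity
  have hn0 : (n : ℝ) ≠ 0 := by positivity
  set l := lamE m n (N1 + N2 : ℕ) with hl
  have hl1 : 1 ≤ l := one_le_lamE m n (by positivity)
  have hl0 : 0 < l := by linarith
  set e := Real.exp (-((N1 : ℝ) / m)) with he
  have hel : 1 ≤ e * l := by
    rw [he, hl, lamE, ← Real.exp_add, ← Real.exp_zero]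
    refine Real.exp_le_exp.2 ?_
    push_cast
    have : -((N1 : ℝ) / m) + (((N1 : ℝ) + N2) / m + (N1 + N2) / n) = N2 / m + (N1 + N2) / n := by ring
    rw [this]; positivity
  have h1 : 2 * (R * e / ε) / (1 / ((n + 1) * l)) + 1 ≤ (2 * R / ε * (n + 1) + 1) * (e * l) := by
    have : 2 * (R * e / ε) / (1 / ((n + 1) * l)) = (2 * R / ε * (n + 1)) * (e * l) := by field_simp
    rw [this, add_mul, one_mul]
    linarith
  have h2 : 2 * 1 / (1 / ((n + 1) * l)) + 1 ≤ 3 * (n + 1) * l := by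
    have : 2 * 1 / (1 / (((n : ℝ) + 1) * l)) = 2 * (n + 1) * l := by field_simp
    rw [this]
    nlinarith [show (0 : ℝ) ≤ n from by positivity]
  have h3 : Real.exp (((m : ℝ) + n - 1) * N1 + (m + n) * N2) = (e * l * l ^ (n - 1)) ^ m := by
    rw [mul_assoc, ← pow_succ', Nat.sub_add_cancel hn, he, hl, lamE, ← Real.exp_nat_mul, ← Real.exp_add, ← Real.exp_nat_mul]
    congr 1
    push_cast
    field_simp
    ring
  rw [h3, ← mul_pow]
  refine pow_le_pow_left₀ (by positivity) ?_ m
  calc _ ≤ ((2 * R / ε * (n + 1) + 1) * (e * l)) * (3 * (n + 1) * l) ^ (n - 1) := 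
        mul_le_mul h1 (pow_le_pow_left₀ (by positivity) h2 _) (by positivity) (by positivity)
    _ = _ := by simp only [mul_pow]; ring

theorem strip_lab {m n : ℕ} (hm : 0 < m) (hn : 0 < n) {ε R : ℝ} (hε : 0 < ε) (hR : 0 < R) : ∃ C : ℝ, 1 ≤ C ∧ ∃ N10 : ℕ, ∀ N1 : ℕ, N10 ≤ N1 → ∀ N2 : ℕ,
    ∀ x : XSp (m + n), Lab (fun B B' : Mt m n => lamE m n (N1 + N2 : ℕ) * ‖B' - B‖ < 1)
      {B | ‖B‖ ≤ 1 ∧ uSL m n B • x ∈ (Cus ε : Set (XSp (m + n))) ∩ Exc m n N1 R} (C * Real.exp (((m : ℝ) + n - 1) * N1 + (m + n) * N2)) := by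
  classical
  have hm0 : (0 : ℝ) < m := by exact_mod_cast hm
  obtain ⟨R0, hR0, hcount⟩ := lat_count (d := m + n) (ε := ε / (1 + n * 1)) (by positivity)
  set r := max R0 ((1 + n * 1) * R) with hr
  have hr1 : 1 ≤ r := hR0.trans (le_max_left _ _)
  set K := ((2 * R / ε * (n + 1) + 1) * (3 * ((n : ℝ) + 1)) ^ (n - 1)) ^ m with hK
  have hnn : (0 : ℝ) ≤ n := by positivity
  have hK1 : 1 ≤ K := by
    refine one_le_pow₀ (one_le_mul_of_one_le_of_one_le ?_ (one_le_pow₀ (by linarith)))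
    have : 0 ≤ 2 * R / ε * (n + 1) := by positivity
    linarith
  obtain ⟨N10, hN10⟩ : ∃ N10 : ℕ, ∀ N1 : ℕ, N10 ≤ N1 → R * Real.exp (-((N1 : ℝ) / m)) < ε := by
    have : Tendsto (fun N1 : ℕ => R * Real.exp (-((N1 : ℝ) / m))) atTop (𝓝 (R * 0)) := by
      refine Tendsto.const_mul R (Real.tendsto_exp_neg_atTop_nhds_zero.comp ?_)
      exact tendsto_natCast_atTop_atTop.atTop_div_const hm0
    rw [mul_zero] at this
    exact eventually_atTop.1 (this.eventually_lt_const hε)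
  refine ⟨(4 * r) ^ (m + n) * K, ?_, N10, fun N1 hN1 N2 x => ?_⟩
  · exact one_le_mul_of_one_le_of_one_le (one_le_pow₀ (by linarith)) hK1
  have hsm := hN10 N1 hN1
  set β := R * Real.exp (-((N1 : ℝ) / m)) with hβ
  have hl0 := lamE_pos m n (N1 + N2 : ℕ)
  set S := {B : Mt m n | ‖B‖ ≤ 1 ∧ uSL m n B • x ∈ (Cus ε : Set (XSp (m + n))) ∩ Exc m n N1 R} with hS
  by_cases hSe : S.Nonempty
  swap
  · rw [Set.not_nonempty_iff_eq_empty] at hSe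
    rw [hSe]
    exact ⟨0, Fin.elim0, by push_cast; positivity, by simp, fun i => i.elim0⟩
  obtain ⟨B0, hB0, hB0x, -⟩ := hSe
  have hx : x ∈ (Cus (ε / (1 + n * 1)) : Set (XSp (m + n))) := by
    have := uSL_Cus (R := 1) (A := -B0) (by rw [norm_neg]; exact hB0) hB0x
    rwa [smul_smul, uSL_mul, neg_add_cancel, uSL_zero, one_smul] at this
  have hfin := lat_finite x r
  set Λ := hfin.toFinset with hΛ
  have hΛc := hcount x hx r (le_max_left _ _) Λ (fun w hw => by rw [hΛ, Set.Finite.mem_toFinset] at hw; exact hw)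
  have key := Lab.iUnion (κ := Λ) (Q := fun B B' : Mt m n => lamE m n (N1 + N2 : ℕ) * ‖B' - B‖ < 1)
    (S := fun v => {B : Mt m n | ε ≤ ‖v2 (v : Fin (m + n) → ℝ)‖ ∧ ‖B‖ ≤ 1 ∧ ‖v1 (uMat m n B *ᵥ (v : Fin (m + n) → ℝ))‖ ≤ β}) (S' := S)
    (c := K * Real.exp (((m : ℝ) + n - 1) * N1 + (m + n) * N2)) ?_ ?_
  · refine key.mono (fun _ _ _ _ h => h) subset_rfl ?_
    rw [Fintype.card_coe, mul_assoc]
    exact mul_le_mul_of_nonneg_right hΛc (by positivity)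
  · rintro ⟨v, hv⟩
    by_cases hve : ε ≤ ‖v2 v‖
    · refine (strip_one hn hε (by positivity : 0 ≤ β) (η := 1 / ((n + 1) * lamE m n (N1 + N2 : ℕ))) (by positivity) v hve).mono ?_ (fun B hB => hB.2) (strip_count hm hn hε hR N1 N2)
      intro B B' _ _ h
      calc lamE m n (N1 + N2 : ℕ) * ‖B' - B‖ ≤ lamE m n (N1 + N2 : ℕ) * (n * (1 / ((n + 1) * lamE m n (N1 + N2 : ℕ)))) := mul_le_mul_of_nonneg_left h hl0.le
        _ = n / (n + 1) := by field_simp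
        _ < 1 := by rw [div_lt_one (by positivity)]; linarith
    · refine ⟨0, Fin.elim0, by push_cast; positivity, fun B hB => absurd hB.1 hve, fun i => i.elim0⟩
  · rintro B ⟨hB, hBC, w, hw, hw0, hwR, hwR'⟩
    obtain ⟨v, hv, rfl⟩ := mem_lat_smul.1 hw
    change ‖uMat m n B *ᵥ v‖ ≤ R at hwR
    change ‖aMat m n N1 *ᵥ (uMat m n B *ᵥ v)‖ ≤ R at hwR'
    have hε2 : ε ≤ ‖uMat m n B *ᵥ v‖ := hBC _ hw hw0
    have h1 : ‖v1 (uMat m n B *ᵥ v)‖ ≤ β := by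
      have h2 := (norm_v1_le _).trans hwR'
      rw [v1_aMat, norm_smul, Real.norm_of_nonneg (Real.exp_pos _).le] at h2
      rw [hβ, Real.exp_neg, ← div_eq_mul_inv, le_div_iff₀ (Real.exp_pos _), mul_comm]
      exact h2
    have h2 : ε ≤ ‖v2 v‖ := by
      by_contra hcon
      push Not at hcon
      have h3 : ‖uMat m n B *ᵥ v‖ ≤ max β ‖v2 v‖ := by
        rw [norm_le_iff12 _ (by positivity), v2_uMat]
        exact ⟨h1.trans (le_max_left _ _), le_max_right _ _⟩
      have := max_lt hsm hcon
      linarith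
    have h4 : ‖v‖ ≤ r := by
      have h5 := norm_uMat_le (-B) (uMat m n B *ᵥ v)
      rw [mulVec_mulVec, uMat_mul, neg_add_cancel, uMat_zero, one_mulVec, norm_neg] at h5
      refine (h5.trans (mul_le_mul (b := 1 + (n : ℝ) * 1) ?_ hwR (norm_nonneg _) (by positivity))).trans (le_max_right _ _)
      gcongr
    exact Set.mem_iUnion.2 ⟨⟨v, by rw [hΛ, Set.Finite.mem_toFinset]; exact ⟨hv, h4⟩⟩, h2, hB, h1⟩

end PartUp1

section PartUp2

lemma Nb_entry {d : ℕ} {g : GSp d} (hg : g ∈ (Nb 1 : Set (GSp d))) (i j : Fin d) : |(g : Matrix (Fin d) (Fin d) ℝ) i j| ≤ 2 := by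
  have h1 := (hg i j).le
  have h2 : |(1 : Matrix (Fin d) (Fin d) ℝ) i j| ≤ 1 := by
    rw [Matrix.one_apply]; split_ifs <;> simp
  have h3 := abs_add_le ((g : Matrix (Fin d) (Fin d) ℝ) i j - (1 : Matrix (Fin d) (Fin d) ℝ) i j) ((1 : Matrix (Fin d) (Fin d) ℝ) i j)
  rw [sub_add_cancel] at h3
  linarith

lemma perturb {m n : ℕ} (hm : 0 < m) (hn : 0 < n) : ∃ K : ℝ, 1 ≤ K ∧ ∀ (ε R : ℝ), 0 ≤ R → ∀ (N1 : ℕ) (h : GSp (m + n)) (x : XSp (m + n)),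
    h ∈ (Nb 1 : Set (GSp (m + n))) → aSL m n hm hn N1 * h * (aSL m n hm hn N1)⁻¹ ∈ (Nb 1 : Set (GSp (m + n))) →
    h • x ∈ (Cus ε : Set (XSp (m + n))) ∩ Exc m n N1 R → x ∈ (Cus (ε / K) : Set (XSp (m + n))) ∩ Exc m n N1 (K * R) := by
  obtain ⟨R', hR'⟩ := GSp_inv_bdd (d := m + n) 2
  have hd : (1 : ℝ) ≤ ((m + n : ℕ) : ℝ) := by exact_mod_cast (by omega : 1 ≤ m + n)
  set D : ℝ := ((m + n : ℕ) : ℝ) with hD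
  have hK1 : D * 2 ≤ D * (2 + |R'|) := mul_le_mul_of_nonneg_left (by linarith [abs_nonneg R']) (by linarith)
  have hK2 : D * R' ≤ D * (2 + |R'|) := mul_le_mul_of_nonneg_left (by linarith [le_abs_self R']) (by linarith)
  have hK0 : 1 ≤ D * (2 + |R'|) := by linarith
  refine ⟨D * (2 + |R'|), hK0, ?_⟩
  intro ε R hR N1 h x hh hh' ⟨hC, w, hw, hw0, hwR, hwR'⟩
  refine ⟨fun v hv hv0 => ?_, ?_⟩
  · have h1 := hC _ (smul_mem_lat h hv) (GSp_mulVec_ne h hv0)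
    have h2 := norm_mulVec_le _ (Nb_entry hh) v
    rw [div_le_iff₀ (by linarith), mul_comm]
    exact h1.trans (h2.trans (mul_le_mul_of_nonneg_right hK1 (norm_nonneg _)))
  · obtain ⟨v, hv, rfl⟩ := mem_lat_smul.1 hw
    have hbd : ∀ g : GSp (m + n), g ∈ (Nb 1 : Set (GSp (m + n))) → ∀ u : Fin (m + n) → ℝ, ‖(g : Matrix (Fin (m + n)) (Fin (m + n)) ℝ) *ᵥ u‖ ≤ R →
        ‖u‖ ≤ D * (2 + |R'|) * R := by
      intro g hg u hu
      have h1 := norm_mulVec_le _ (hR' g (Nb_entry hg)) ((g : Matrix (Fin (m + n)) (Fin (m + n)) ℝ) *ᵥ u)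
      rw [inv_mulVec] at h1
      refine h1.trans ((mul_le_mul_of_nonneg_right hK2 (norm_nonneg _)).trans (mul_le_mul_of_nonneg_left hu (by linarith)))
    refine ⟨v, hv, ?_, hbd h hh v hwR, hbd _ hh' _ ?_⟩
    · rintro rfl; exact hw0 (mulVec_zero _)
    · have e1 : aSL m n hm hn N1 * h = (aSL m n hm hn N1 * h * (aSL m n hm hn N1)⁻¹) * aSL m n hm hn N1 := by group
      have e2 : ((aSL m n hm hn N1 * h * (aSL m n hm hn N1)⁻¹ : GSp (m + n)) : Matrix (Fin (m + n)) (Fin (m + n)) ℝ) *ᵥ (aMat m n N1 *ᵥ v)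
          = aMat m n N1 *ᵥ ((h : Matrix (Fin (m + n)) (Fin (m + n)) ℝ) *ᵥ v) := by
        rw [mulVec_mulVec, mulVec_mulVec]
        congr 1
        exact (congrArg (fun g : GSp (m + n) => (g : Matrix (Fin (m + n)) (Fin (m + n)) ℝ)) e1).symm
      rw [e2]; exact hwR'

lemma perturb_closure {m n : ℕ} (hm : 0 < m) (hn : 0 < n) {K ε R : ℝ} {N1 : ℕ}
    (hp : ∀ (h : GSp (m + n)) (x : XSp (m + n)),
    h ∈ (Nb 1 : Set (GSp (m + n))) → aSL m n hm hn N1 * h * (aSL m n hm hn N1)⁻¹ ∈ (Nb 1 : Set (GSp (m + n))) →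
    h • x ∈ (Cus ε : Set (XSp (m + n))) ∩ Exc m n N1 R → x ∈ (Cus (ε / K) : Set (XSp (m + n))) ∩ Exc m n N1 (K * R)) :
    closure ((Cus ε : Set (XSp (m + n))) ∩ Exc m n N1 R) ⊆ (Cus (ε / K) : Set (XSp (m + n))) ∩ Exc m n N1 (K * R) := by
  intro x hx
  have hV : {g : GSp (m + n) | g ∈ (Nb 1 : Set (GSp (m + n))) ∧ aSL m n hm hn N1 * g * (aSL m n hm hn N1)⁻¹ ∈ (Nb 1 : Set (GSp (m + n)))} ∈ 𝓝 (1 : GSp (m + n)) := by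
    refine Filter.inter_mem (Nb_mem one_pos) ?_
    have hc : Continuous fun g : GSp (m + n) => aSL m n hm hn N1 * g * (aSL m n hm hn N1)⁻¹ := by fun_prop
    have ht := hc.tendsto 1
    rw [mul_one, mul_inv_cancel] at ht
    exact ht (Nb_mem one_pos)
  obtain ⟨O, hO, hOg⟩ := small_nhds x hV
  obtain ⟨y, hyO, hyS⟩ := mem_closure_iff_nhds.1 hx O hO
  obtain ⟨g, ⟨hg1, hg2⟩, rfl⟩ := hOg x (mem_of_mem_nhds hO) y hyO
  exact hp g x hg1 hg2 hyS

theorem orbit_lab {m n : ℕ} (hm : 0 < m) (hn : 0 < n) (N : ℕ) (G : Set (XSp (m + n))) {M : ℝ} (hM : 0 ≤ M)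
    (hC : ∀ x : XSp (m + n), Lab (fun B B' : Mt m n => lamE m n N * ‖B' - B‖ < 1) {B | ‖B‖ ≤ 1 ∧ uSL m n B • x ∈ G} M) (x : XSp (m + n)) (k : ℕ) :
    Lab (fun B B' : Mt m n => lamE m n (k * N : ℕ) * ‖B' - B‖ < 1)
      {B | ‖B‖ ≤ 1 ∧ ∀ i < k, (aAct m n hm hn)^[i * N] (uSL m n B • x) ∈ G} (3 ^ (m * n) * M ^ k) := by
  induction k with
  | zero =>
    have hg := grid {B : Mt m n | ‖B‖ ≤ 1} 0 (fun _ _ => 1) (by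
      intro B hB i j
      rw [show (0 : Mt m n) i j = 0 from rfl, sub_zero]
      exact (entry_le B i j).trans hB) one_pos (fun _ _ => zero_le_one)
    refine hg.mono ?_ (fun B hB => hB.1) (le_of_eq ?_)
    · intro B B' _ _ h
      rw [zero_mul, Nat.cast_zero, lamE_zero, one_mul]; exact h
    · simp only [Finset.prod_const, Finset.card_univ, Fintype.card_fin]
      rw [pow_zero, mul_one, ← pow_mul, mul_comm n m]; norm_num
  | succ k ih =>
    rw [pow_succ, ← mul_assoc]
    have hl := lamE_pos m n (k * N : ℕ)
    refine Lab.refine (ih.mono (fun _ _ _ _ h => h) (fun B hB => ⟨hB.1, fun i hi => hB.2 i (by omega)⟩) le_rfl) ?_ hM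
    intro B0 hB0
    refine (hC ((aAct m n hm hn)^[k * N] (uSL m n B0 • x))).image (fun B => lamE m n (k * N : ℕ) • (B - B0)) ?_ ?_
    · rintro B ⟨⟨hB1, hB2⟩, hB3⟩
      refine ⟨?_, ?_⟩
      · rw [norm_smul, Real.norm_of_nonneg hl.le]; exact hB3.le
      · rw [← iter_uSL]; exact hB2 k (by omega)
    · intro B _ B' _ h
      rw [← smul_sub, sub_sub_sub_cancel_right, norm_smul, Real.norm_of_nonneg hl.le] at h
      rw [show (((k + 1) * N : ℕ) : ℝ) = (N : ℝ) + (k * N : ℕ) by push_cast; ring, lamE_add, mul_assoc]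
      exact h

theorem orbit_lab2 {m n : ℕ} (hm : 0 < m) (hn : 0 < n) (N : ℕ) (G : Set (XSp (m + n))) {M θ : ℝ} (hM : 0 ≤ M) (hθ : 0 < θ)
    (hC : ∀ x : XSp (m + n), Lab (fun B B' : Mt m n => lamE m n N * ‖B' - B‖ < 1) {B | ‖B‖ ≤ 1 ∧ uSL m n B • x ∈ G} M) (x : XSp (m + n)) (k : ℕ) :
    Lab (fun B B' : Mt m n => lamE m n (k * N : ℕ) * ‖B' - B‖ < θ)
      {B | ‖B‖ ≤ 1 ∧ ∀ i < k, (aAct m n hm hn)^[i * N] (uSL m n B • x) ∈ G} (3 ^ (m * n) * M ^ k * (2 / θ + 1) ^ (m * n)) := by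
  have hl := lamE_pos m n (k * N : ℕ)
  refine Lab.refine (orbit_lab hm hn N G hM hC x k) ?_ (by positivity)
  intro B0 hB0
  have hg := grid {B : Mt m n | lamE m n (k * N : ℕ) * ‖B - B0‖ < 1} B0 (fun _ _ => 1 / lamE m n (k * N : ℕ)) (by
      intro B hB i j
      refine (entry_le (B - B0) i j).trans ?_
      rw [le_div_iff₀ hl, mul_comm]; exact hB.le) (η := θ / lamE m n (k * N : ℕ)) (by positivity) (fun _ _ => by positivity)
  refine hg.mono ?_ (fun B hB => hB.2) (le_of_eq ?_)
  · intro B B' _ _ h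
    rw [lt_div_iff₀ hl, mul_comm] at h; exact h
  · simp only [Finset.prod_const, Finset.card_univ, Fintype.card_fin]
    rw [← pow_mul, mul_comm n m]
    congr 1
    field_simp

theorem upB {m n : ℕ} (hm : 0 < m) (hn : 0 < n) {ε R : ℝ} (hε : 0 < ε) (hR : 0 < R) : ∃ C : ℝ, 1 ≤ C ∧ ∃ N10 : ℕ, ∀ N1 : ℕ, N10 ≤ N1 → ∀ N2 : ℕ,
    0 < N1 + N2 → ∀ μ : Measure (XSp (m + n)), IsProbabilityMeasure μ → MeasurePreserving (aAct m n hm hn) μ μ →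
    (∀ p : ℕ, 1 ≤ p → μ (⋃ j ∈ Finset.range (N1 + N2), (aAct m n hm hn)^[j] ''
       {x | ∀ i < p, (aAct m n hm hn)^[i * (N1 + N2)] x ∈ closure ((Cus ε : Set (XSp (m + n))) ∩ Exc m n N1 R)})ᶜ = 0) →
    ksEntropy (aAct m n hm hn) μ ≤ Real.log (C * Real.exp (((m : ℝ) + n - 1) * N1 + (m + n) * N2)) / (N1 + N2 : ℕ) := by
  obtain ⟨K, hK1, hK⟩ := perturb hm hn
  have hK0 : 0 < K := by linarith
  obtain ⟨C, hC1, N10, hC⟩ := strip_lab hm hn (ε := ε / K / K) (R := K * (K * R)) (by positivity) (by positivity)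
  refine ⟨C, hC1, N10, fun N1 hN1 N2 hN μ hμ hT hsup => ?_⟩
  set N := N1 + N2 with hNdef
  set M := C * Real.exp (((m : ℝ) + n - 1) * N1 + (m + n) * N2) with hM
  have hm1 : (1 : ℝ) ≤ m := by exact_mod_cast hm
  have hM1 : 1 ≤ M := by
    refine one_le_mul_of_one_le_of_one_le hC1 (Real.one_le_exp ?_)
    have : 0 ≤ ((m : ℝ) + n - 1) := by
      have : (0 : ℝ) ≤ n := by positivity
      linarith
    positivity
  have hM0 : 0 < M := by linarith
  have hN0 : (0 : ℝ) < N := by exact_mod_cast hN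
  set s := Real.log M / N with hs
  have hs0 : 0 ≤ s := div_nonneg (Real.log_nonneg hM1) hN0.le
  have hMp : ∀ p : ℕ, M ^ p = Real.exp (s * (p * N : ℕ)) := by
    intro p
    rw [hs, show Real.log M / N * (p * N : ℕ) = p * Real.log M by push_cast; field_simp, Real.exp_nat_mul, Real.exp_log hM0]
  set G := (Cus (ε / K / K) : Set (XSp (m + n))) ∩ Exc m n N1 (K * (K * R)) with hG
  have hlab := hC N1 hN1 N2
  have hcl := perturb_closure hm hn (K := K) (ε := ε) (R := R) (N1 := N1) (fun h x => hK ε R hR.le N1 h x)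
  refine ks_le _ μ s hs0 (U1' hm hn μ hT s ?_)
  intro V hV δ hδ
  obtain ⟨θ, hθ, hθ1, q, xs, hxs, hbow⟩ := bowen_cover hm hn hV (Cus_compact hε) one_pos
  set c0 : ℝ := 3 ^ (m * n) * (2 / θ + 1) ^ (m * n) with hc0
  have hc00 : 0 ≤ c0 := by positivity
  refine ⟨max 1 (N * (q * (c0 * Real.exp (s * (2 * N))))), le_max_left _ _, fun L => ?_⟩
  set p := L / N + 2 with hp
  have hp1 : 1 ≤ p := Nat.le_add_left 1 (L / N + 1)
  have hpN : L + N ≤ p * N ∧ p * N ≤ L + 2 * N := by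
    have h1 := Nat.div_add_mod L N
    have h2 := Nat.mod_lt L hN
    have h3 : p * N = N * (L / N) + 2 * N := by rw [hp]; ring
    omega
  set E : Set (XSp (m + n)) := {x | ∀ i < p, (aAct m n hm hn)^[i * N] x ∈ closure ((Cus ε : Set (XSp (m + n))) ∩ Exc m n N1 R)} with hE
  refine ⟨⋃ j ∈ Finset.range N, (aAct m n hm hn)^[j] '' E, ?_, ?_⟩
  · rw [Measure.real, hsup p hp1]; simpa using hδ.le
  have hEK : E ⊆ (Cus ε : Set (XSp (m + n))) := by
    intro x hx
    have := hx 0 hp1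
    rw [zero_mul, Function.iterate_zero, id] at this
    exact closure_minimal Set.inter_subset_left (Cus_closed ε) this
  have hEL := hbow E hEK (p * N) (c0 * M ^ p) (fun i => by
    refine (orbit_lab2 hm hn N G hM0.le hθ hlab (xs i) p).mono (fun _ _ _ _ h => h) ?_ (le_of_eq (by rw [hc0]; ring))
    rintro B ⟨hB, h, hhL, hhN, hhE⟩
    refine ⟨hB.le.trans hθ1, fun i' hi' => ?_⟩
    have h1 := hcl (hhE i' hi')
    rw [aAct_iter, mul_smul, smul_smul] at h1
    rw [aAct_iter]
    have e1 : aSL m n hm hn (i' * N : ℕ) * h = (aSL m n hm hn (i' * N : ℕ) * h * (aSL m n hm hn (i' * N : ℕ))⁻¹) * aSL m n hm hn (i' * N : ℕ) := by group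
    rw [e1, mul_smul] at h1
    refine hK _ _ (by positivity) N1 _ _ (Nb_mono hθ1 (LTri_conj hm hn (by positivity) hθ hhL hhN)) ?_ h1
    have e2 : aSL m n hm hn N1 * (aSL m n hm hn (i' * N : ℕ) * h * (aSL m n hm hn (i' * N : ℕ))⁻¹) * (aSL m n hm hn N1)⁻¹
      = aSL m n hm hn (N1 + (i' * N : ℕ)) * h * (aSL m n hm hn (N1 + (i' * N : ℕ)))⁻¹ := by
      rw [← aSL_mul]; group
    rw [e2]
    exact Nb_mono hθ1 (LTri_conj hm hn (by positivity) hθ hhL hhN))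
  have hY := Lab.iUnion (κ := Fin N) (S := fun j => (aAct m n hm hn)^[(j : ℕ)] '' E) (S' := ⋃ j ∈ Finset.range N, (aAct m n hm hn)^[j] '' E)
    (Q := fun y y' => ∀ j ≤ L, ((aAct m n hm hn)^[j] y, (aAct m n hm hn)^[j] y') ∈ relN V) (c := q * (c0 * M ^ p)) ?_ ?_
  · refine hY.mono (fun _ _ _ _ h => h) subset_rfl ?_
    refine le_trans ?_ (mul_le_mul_of_nonneg_right (le_max_right _ _) (Real.exp_pos _).le)
    rw [Fintype.card_fin]
    have : M ^ p ≤ Real.exp (s * (2 * N) + s * L) := by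
      rw [hMp, ← mul_add]
      refine Real.exp_le_exp.2 (mul_le_mul_of_nonneg_left ?_ hs0)
      have : ((p * N : ℕ) : ℝ) ≤ ((L + 2 * N : ℕ) : ℝ) := by exact_mod_cast hpN.2
      push_cast at this ⊢
      linarith
    calc (N : ℝ) * (q * (c0 * M ^ p)) ≤ N * (q * (c0 * Real.exp (s * (2 * N) + s * L))) := by gcongr
      _ = _ := by rw [Real.exp_add]; ring
  · intro j
    have hch : ∀ y, ∃ x, y ∈ (aAct m n hm hn)^[(j : ℕ)] '' E → x ∈ E ∧ (aAct m n hm hn)^[(j : ℕ)] x = y := by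
      intro y
      by_cases hy : y ∈ (aAct m n hm hn)^[(j : ℕ)] '' E
      · obtain ⟨x, hx⟩ := hy; exact ⟨x, fun _ => hx⟩
      · exact ⟨y, fun h => absurd h hy⟩
    choose f hf using hch
    refine hEL.image f (fun y hy => (hf y hy).1) ?_
    intro y hy y' hy' hQ j' hj'
    have h1 := hQ (j' + j) (by have := j.2; omega)
    rw [Function.iterate_add_apply, Function.iterate_add_apply, (hf y hy).2, (hf y' hy').2] at h1
    exact h1
  · intro y hy
    simp only [Set.mem_iUnion] at hy ⊢
    obtain ⟨j, hj, hy⟩ := hy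
    exact ⟨⟨j, Finset.mem_range.1 hj⟩, hy⟩

end PartUp2

lemma lim_log {c a b : ℝ} (hc : 0 < c) (N0 N2 : ℕ) (hN0 : 0 < N0) :
    Tendsto (fun k : ℕ => Real.log (c * Real.exp (a * (k + N0 : ℕ) + b)) / ((k + N0) + N2 : ℕ)) atTop (𝓝 a) := by
  have h1 : ∀ k : ℕ, Real.log (c * Real.exp (a * (k + N0 : ℕ) + b)) / ((k + N0) + N2 : ℕ) = a + (Real.log c + b - a * N2) / ((k + (N0 + N2) : ℕ) : ℝ) := by
    intro k
    have hN0' : (0 : ℝ) < N0 := by exact_mod_cast hN0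
    have : (0 : ℝ) < (k : ℝ) + N0 + N2 := by positivity
    rw [Real.log_mul hc.ne' (Real.exp_pos _).ne', Real.log_exp]
    push_cast
    rw [← add_assoc (k : ℝ)]
    field_simp
    ring
  simp_rw [h1]
  have h2 : Tendsto (fun k : ℕ => (Real.log c + b - a * N2) / ((k + (N0 + N2) : ℕ) : ℝ)) atTop (𝓝 0) :=
    (tendsto_const_div_atTop_nhds_zero_nat _).comp (tendsto_add_atTop_nat (N0 + N2))
  simpa using h2.const_add a

theorem measB {m n : ℕ} (hm : 0 < m) (hn : 0 < n) : ∃ μ : ℕ → Measure (XSp (m + n)), (∀ k, IsProbabilityMeasure (μ k)) ∧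
    (∀ k, MeasurePreserving (aAct m n hm hn) (μ k) (μ k)) ∧
    Tendsto (fun k => ksEntropy (aAct m n hm hn) (μ k)) atTop (𝓝 ((m : ℝ) + n - 1)) ∧
    ∀ f : XSp (m + n) → ℝ, Continuous f → HasCompactSupport f → Tendsto (fun k => ∫ x, f x ∂(μ k)) atTop (𝓝 0) := by
  obtain ⟨RA, R, ε', hRA, hR, hε', N2, c, hc, N10, z, htree⟩ := treeV hm hn
  obtain ⟨C, hC1, N10', hup⟩ := upB hm hn hε' hR
  set N0 := max N10 N10' + 1 with hN0
  have hN0p : 0 < N0 := Nat.succ_pos _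
  have hex := fun k : ℕ => measB_aux hm hn hRA hε' (htree (k + N0) (by omega)).1 z (k + N0) N2 (by omega) (htree (k + N0) (by omega)).2
  choose μ hμ hT hlow hintg hsup using hex
  have hdn : (0 : ℝ) < (m : ℝ) + n := by
    have : (0 : ℝ) < m := by exact_mod_cast hm
    positivity
  refine ⟨μ, hμ, hT, ?_, ?_⟩
  · refine tendsto_of_tendsto_of_tendsto_of_le_of_le (lim_log (a := (m : ℝ) + n - 1) (b := 0) hc N0 N2 hN0p)
      (lim_log (a := (m : ℝ) + n - 1) (b := ((m : ℝ) + n) * N2) (lt_of_lt_of_le one_pos hC1) N0 N2 hN0p) ?_ ?_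
    · intro k
      have := hlow k
      simpa only [add_zero] using this
    · intro k
      exact hup (k + N0) (by omega) N2 (by omega) (μ k) (hμ k) (hT k) (hsup k)
  · intro f hf hfc
    obtain ⟨δ, hδ, hsub⟩ := compact_sub_Cus hfc
    obtain ⟨Mf, hMf⟩ := hf.bounded_above_of_compact_support hfc
    obtain ⟨j1, hj1⟩ : ∃ j1 : ℕ, R * Real.exp (-((j1 : ℝ) / (m + n))) < δ := by
      have : Tendsto (fun j : ℕ => R * Real.exp (-((j : ℝ) / (m + n)))) atTop (𝓝 (R * 0)) := by
        refine Tendsto.const_mul R (Real.tendsto_exp_neg_atTop_nhds_zero.comp ?_)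
        exact tendsto_natCast_atTop_atTop.atTop_div_const hdn
      rw [mul_zero] at this
      exact (this.eventually_lt_const hδ).exists
    refine squeeze_zero_norm (a := fun k : ℕ => Mf * (((N2 + 2 * j1 : ℕ) : ℝ) / ((k + (N0 + N2) : ℕ) : ℝ))) (fun k => ?_) ?_
    · have := hintg k f hf Mf hMf δ (fun x hx => by
        by_contra h0
        exact hx (hsub (subset_tsupport f h0))) j1 hj1
      rw [add_assoc k N0 N2] at this
      exact this
    · rw [← mul_zero Mf]
      exact Tendsto.const_mul Mf ((tendsto_const_div_atTop_nhds_zero_nat _).comp (tendsto_add_atTop_nat (N0 + N2)))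

lemma mix_real {α : Type*} [MeasurableSpace α] {c : ℝ} (hc : c ∈ Set.Icc (0 : ℝ) 1) (μ ν : Measure α) [IsProbabilityMeasure μ] [IsProbabilityMeasure ν] (S : Set α) :
    (ENNReal.ofReal c • μ + ENNReal.ofReal (1 - c) • ν).real S = c * μ.real S + (1 - c) * ν.real S := by
  have h1 : (0 : ℝ) ≤ 1 - c := by linarith [hc.2]
  simp only [Measure.real, Measure.add_apply, Measure.smul_apply, smul_eq_mul]
  rw [ENNReal.toReal_add (by finiteness) (by finiteness), ENNReal.toReal_mul, ENNReal.toReal_mul, ENNReal.toReal_ofReal hc.1, ENNReal.toReal_ofReal h1]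

/-- **Corollary.** For any `h ∈ [m+n-1, m+n]` there is a sequence of `a`-invariant probability
measures `(ν_k)` on `X_{m+n}` with `h_{ν_k}(a) → h`, converging weak* to a measure `ν` with
`ν(X_{m+n}) = h - (m+n-1)`. -/
theorem cor_main (m n : ℕ) (hm : 0 < m) (hn : 0 < n) (h : ℝ)
    (hh : h ∈ Set.Icc ((m : ℝ) + n - 1) ((m : ℝ) + n)) :
    ∃ ν : ℕ → Measure (XSp (m + n)), ∃ νlim : Measure (XSp (m + n)),
      (∀ k, IsProbabilityMeasure (ν k)) ∧
      (∀ k, MeasurePreserving (aAct m n hm hn) (ν k) (ν k)) ∧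
      Tendsto (fun k => ksEntropy (aAct m n hm hn) (ν k)) atTop (𝓝 h) ∧
      IsFiniteMeasure νlim ∧
      (∀ f : XSp (m + n) → ℝ, Continuous f → HasCompactSupport f →
        Tendsto (fun k => ∫ x, f x ∂(ν k)) atTop (𝓝 (∫ x, f x ∂νlim))) ∧
      νlim Set.univ = ENNReal.ofReal (h - ((m : ℝ) + n - 1)) := by
  obtain ⟨μA, hA, hAT, hAe⟩ := measA hm hn
  obtain ⟨μB, hB, hBT, hBe, hBi⟩ := measB hm hn
  set c : ℝ := h - ((m : ℝ) + n - 1) with hc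
  have hcI : c ∈ Set.Icc (0 : ℝ) 1 := ⟨by linarith [hh.1], by linarith [hh.2]⟩
  have hc1 : (0 : ℝ) ≤ 1 - c := by linarith [hcI.2]
  have hP : ∀ k, IsProbabilityMeasure (ENNReal.ofReal c • μA + ENNReal.ofReal (1 - c) • μB k) := by
    intro k
    refine ⟨?_⟩
    simp only [Measure.add_apply, Measure.smul_apply, smul_eq_mul, measure_univ, mul_one]
    rw [← ENNReal.ofReal_add hcI.1 hc1, add_sub_cancel, ENNReal.ofReal_one]
  have hTk : ∀ k, MeasurePreserving (aAct m n hm hn) (ENNReal.ofReal c • μA + ENNReal.ofReal (1 - c) • μB k) (ENNReal.ofReal c • μA + ENNReal.ofReal (1 - c) • μB k) := by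
    intro k
    refine ⟨hAT.measurable, ?_⟩
    rw [Measure.map_add _ _ hAT.measurable, Measure.map_smul, Measure.map_smul, hAT.map_eq, (hBT k).map_eq]
  have hmn : (0 : ℝ) ≤ (m : ℝ) + n := by positivity
  refine ⟨fun k => ENNReal.ofReal c • μA + ENNReal.ofReal (1 - c) • μB k, ENNReal.ofReal c • μA, hP, hTk, ?_, ?_, ?_, ?_⟩
  · have he : ∀ k, ksEntropy (aAct m n hm hn) (ENNReal.ofReal c • μA + ENNReal.ofReal (1 - c) • μB k) = c * ((m : ℝ) + n) + (1 - c) * ksEntropy (aAct m n hm hn) (μB k) := by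
      intro k
      have hPk := hP k
      have hBk := hB k
      rw [ks_affine (aAct m n hm hn) c hcI μA (μB k) _ hAT (hBT k) (hTk k) (fun S _ => mix_real hcI μA (μB k) S) ((m : ℝ) + n) hmn
        (U2 hm hn μA hAT) (U2 hm hn (μB k) (hBT k)), hAe]
    simp_rw [he]
    have h1 := (hBe.const_mul (1 - c)).const_add (c * ((m : ℝ) + n))
    rw [show c * ((m : ℝ) + n) + (1 - c) * ((m : ℝ) + n - 1) = h by rw [hc]; ring] at h1
    exact h1
  · exact ⟨by rw [Measure.smul_apply, measure_univ, smul_eq_mul, mul_one]; exact ENNReal.ofReal_lt_top⟩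
  · intro f hf hfc
    have hi : ∀ μ : Measure (XSp (m + n)), IsProbabilityMeasure μ → Integrable f μ := by
      intro μ hμ
      obtain ⟨Mf, hMf⟩ := hf.bounded_above_of_compact_support hfc
      exact Integrable.of_bound hf.aestronglyMeasurable Mf (Eventually.of_forall hMf)
    have he : ∀ k, ∫ x, f x ∂(ENNReal.ofReal c • μA + ENNReal.ofReal (1 - c) • μB k) = ∫ x, f x ∂(ENNReal.ofReal c • μA) + (1 - c) * ∫ x, f x ∂(μB k) := by
      intro k
      rw [integral_add_measure ((hi μA hA).smul_measure (by finiteness)) ((hi (μB k) (hB k)).smul_measure (by finiteness)), integral_smul_measure (μ := μB k), ENNReal.toReal_ofReal hc1, smul_eq_mul]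
    simp_rw [he]
    simpa using ((hBi f hf hfc).const_mul (1 - c)).const_add (∫ x, f x ∂(ENNReal.ofReal c • μA))
  · rw [Measure.smul_apply, measure_univ, smul_eq_mul, mul_one]
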